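/- Let U ⊆ ℂ^m be a domain (nonempty connected open set), let Ω ⊆ ℂ^n be a pseudoconvex open set, let φ be a smooth real-valued function on U × Ω, let η be a smooth real-valued function on Ω, and let δ > 0. Assume Ξ_{δ,η}(e^{−φ}) ≥ 0 at every point of U × Ω. For t ∈ U let K_t denote the diagonal Bergman kernel of H²(Ω, φ(t,·)) (with respect to Lebesgue measure). Then for every holomorphic map F : U → Ω, the function U ∋ t ↦ log K_t(F(t)) is plurisubharmonic or identically −∞. -/

import Mathlib

open MeasureTheory Set
open scoped ENNReal ComplexOrder

noncomputable section

/-- The squared weighted `L²` norm `∫_Ω ‖f‖² e^{−φ} dμ`. -/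
def bergNormSq {n : ℕ} (Ω : Set (Fin n → ℂ)) (φ : (Fin n → ℂ) → ℝ)
    (μ : Measure (Fin n → ℂ)) (f : (Fin n → ℂ) → ℂ) : ℝ≥0∞ :=
  ∫⁻ z in Ω, ENNReal.ofReal (‖f z‖ ^ 2 * Real.exp (-(φ z))) ∂μ

/-- The diagonal Bergman kernel of the weighted Bergman space `H²(Ω,μ,φ)`. -/
def bergKernel {n : ℕ} (Ω : Set (Fin n → ℂ)) (φ : (Fin n → ℂ) → ℝ)
    (μ : Measure (Fin n → ℂ)) (z : Fin n → ℂ) : ℝ≥0∞ :=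
  ⨆ (f : (Fin n → ℂ) → ℂ) (_ : DifferentiableOn ℂ f Ω)
    (_ : bergNormSq Ω φ μ f ≠ 0) (_ : bergNormSq Ω φ μ f ≠ ⊤),
    ENNReal.ofReal (‖f z‖ ^ 2) / bergNormSq Ω φ μ f

/-- Extended logarithm `ℝ≥0∞ → EReal`, with `elog 0 = ⊥`. -/
def elog (x : ℝ≥0∞) : EReal :=
  if x = 0 then ⊥ else if x = ⊤ then ⊤ else ((Real.log x.toReal : ℝ) : EReal)

/-- Directional Wirtinger derivative `∂_v f` at `x`. -/
def wder {E : Type*} [NormedAddCommGroup E] [NormedSpace ℂ E]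
    (f : E → ℂ) (v x : E) : ℂ :=
  (1 / 2 : ℂ) * (fderiv ℝ f x v - Complex.I * fderiv ℝ f x (Complex.I • v))

/-- Directional conjugate Wirtinger derivative `∂̄_v f` at `x`. -/
def wderBar {E : Type*} [NormedAddCommGroup E] [NormedSpace ℂ E]
    (f : E → ℂ) (v x : E) : ℂ :=
  (1 / 2 : ℂ) * (fderiv ℝ f x v + Complex.I * fderiv ℝ f x (Complex.I • v))

/-- The complex Hessian (Levi form) of `u` is positive semidefinite on `W`. -/
def LeviPSD {E : Type*} [NormedAddCommGroup E] [NormedSpace ℂ E]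
    (W : Set E) (u : E → ℝ) : Prop :=
  ∀ x ∈ W, ∀ v : E, 0 ≤ (wder (fun y => wderBar (fun q => (u q : ℂ)) v y) v x).re

/-- Pseudoconvexity of an open set via a smooth psh exhaustion function. -/
def Pseudoconvex {n : ℕ} (Ω : Set (Fin n → ℂ)) : Prop :=
  IsOpen Ω ∧ ∃ u : (Fin n → ℂ) → ℝ, ContDiffOn ℝ (⊤ : ℕ∞) u Ω ∧ LeviPSD Ω u ∧
    ∀ c : ℝ, IsCompact {z ∈ Ω | u z ≤ c}

/-- Plurisubharmonicity (with values in `EReal`): upper semicontinuity plus the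
sub-mean-value inequality on complex lines, expressed via continuous majorants. -/
def PshOn {E : Type*} [NormedAddCommGroup E] [NormedSpace ℂ E]
    (D : Set E) (u : E → EReal) : Prop :=
  UpperSemicontinuousOn u D ∧
  ∀ a ∈ D, ∀ w : E, ∀ r : ℝ, 0 < r →
    (∀ τ : ℂ, ‖τ‖ ≤ r → a + τ • w ∈ D) →
    ∀ g : ℝ → ℝ, Continuous g →
      (∀ θ : ℝ, u (a + (((r : ℂ) * Complex.exp (θ * Complex.I)) • w)) ≤ ((g θ : ℝ) : EReal)) →
      u a ≤ (((1 / (2 * Real.pi)) * ∫ θ in (0:ℝ)..(2 * Real.pi), g θ : ℝ) : EReal)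

/-- The twisted curvature positivity condition `Ξ_{δ,η}(e^{−φ}) ≥ 0` on `U × Ω`. -/
def XiNonneg {m n : ℕ} (U : Set (Fin m → ℂ)) (Ω : Set (Fin n → ℂ))
    (φ : (Fin m → ℂ) × (Fin n → ℂ) → ℝ) (η : (Fin n → ℂ) → ℝ) (δ : ℝ) : Prop :=
  ∀ p ∈ U ×ˢ Ω, ∀ vt : Fin m → ℂ, ∀ vz : Fin n → ℂ,
    0 ≤ (wder (fun y => wderBar (fun q => (φ q : ℂ))
            ((vt, 0) : (Fin m → ℂ) × (Fin n → ℂ)) y) ((vt, 0)) p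
      + wder (fun y => wderBar (fun q => (φ q : ℂ))
            (((0 : Fin m → ℂ), vz)) y) ((vt, 0)) p
      + wder (fun y => wderBar (fun q => (φ q : ℂ))
            ((vt, 0)) y) (((0 : Fin m → ℂ), vz)) p
      + ((δ / (1 + δ) : ℝ) : ℂ) *
        (wder (fun y => wderBar (fun q => (φ q : ℂ))
            (((0 : Fin m → ℂ), vz)) y) (((0 : Fin m → ℂ), vz)) p
          + 2 * wder (fun y => wderBar (fun w => (η w : ℂ)) vz y) vz p.2
          - ((1 + δ : ℝ) : ℂ) * (Complex.normSq (wder (fun w => (η w : ℂ)) vz p.2) : ℂ))).re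

open Filter Topology
open scoped ComplexConjugate ContDiff

section WCalc
variable {E : Type*} [NormedAddCommGroup E] [NormedSpace ℂ E]

lemma wder_congr {f g : E → ℂ} {x : E} (h : f =ᶠ[𝓝 x] g) (v : E) : wder f v x = wder g v x := by
  simp only [wder, h.fderiv_eq]

lemma wderBar_congr {f g : E → ℂ} {x : E} (h : f =ᶠ[𝓝 x] g) (v : E) :
    wderBar f v x = wderBar g v x := by
  simp only [wderBar, h.fderiv_eq]

lemma wder_congr_ev {f g : E → ℂ} {x : E} (h : f =ᶠ[𝓝 x] g) (v : E) :
    (fun y => wder f v y) =ᶠ[𝓝 x] (fun y => wder g v y) := by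
  filter_upwards [h.eventuallyEq_nhds] with y hy using wder_congr hy v

lemma wderBar_congr_ev {f g : E → ℂ} {x : E} (h : f =ᶠ[𝓝 x] g) (v : E) :
    (fun y => wderBar f v y) =ᶠ[𝓝 x] (fun y => wderBar g v y) := by
  filter_upwards [h.eventuallyEq_nhds] with y hy using wderBar_congr hy v

lemma wder_add {f g : E → ℂ} {x : E} (hf : DifferentiableAt ℝ f x) (hg : DifferentiableAt ℝ g x)
    (v : E) : wder (fun y => f y + g y) v x = wder f v x + wder g v x := by
  simp only [wder, fderiv_fun_add hf hg, add_apply]; ring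

lemma wderBar_add {f g : E → ℂ} {x : E} (hf : DifferentiableAt ℝ f x)
    (hg : DifferentiableAt ℝ g x)
    (v : E) : wderBar (fun y => f y + g y) v x = wderBar f v x + wderBar g v x := by
  simp only [wderBar, fderiv_fun_add hf hg, add_apply]; ring

lemma wder_neg {f : E → ℂ} {x : E} (v : E) : wder (fun y => - f y) v x = - wder f v x := by
  simp only [wder, fderiv_fun_neg, neg_apply]; ring

lemma wderBar_neg {f : E → ℂ} {x : E} (v : E) :
    wderBar (fun y => - f y) v x = - wderBar f v x := by
  simp only [wderBar, fderiv_fun_neg, neg_apply]; ring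

lemma wder_sub {f g : E → ℂ} {x : E} (hf : DifferentiableAt ℝ f x) (hg : DifferentiableAt ℝ g x)
    (v : E) : wder (fun y => f y - g y) v x = wder f v x - wder g v x := by
  simp only [wder, fderiv_fun_sub hf hg, sub_apply]; ring

lemma wderBar_sub {f g : E → ℂ} {x : E} (hf : DifferentiableAt ℝ f x)
    (hg : DifferentiableAt ℝ g x)
    (v : E) : wderBar (fun y => f y - g y) v x = wderBar f v x - wderBar g v x := by
  simp only [wderBar, fderiv_fun_sub hf hg, sub_apply]; ring

lemma wder_mul {f g : E → ℂ} {x : E} (hf : DifferentiableAt ℝ f x) (hg : DifferentiableAt ℝ g x)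
    (v : E) : wder (fun y => f y * g y) v x = wder f v x * g x + f x * wder g v x := by
  simp only [wder, fderiv_fun_mul hf hg, add_apply,
    smul_apply, smul_eq_mul]; ring

lemma wderBar_mul {f g : E → ℂ} {x : E} (hf : DifferentiableAt ℝ f x)
    (hg : DifferentiableAt ℝ g x)
    (v : E) : wderBar (fun y => f y * g y) v x = wderBar f v x * g x + f x * wderBar g v x := by
  simp only [wderBar, fderiv_fun_mul hf hg, add_apply,
    smul_apply, smul_eq_mul]; ring

lemma wder_sum {ι : Type*} (s : Finset ι) {f : ι → E → ℂ} {x : E}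
    (hf : ∀ i ∈ s, DifferentiableAt ℝ (f i) x) (v : E) :
    wder (fun y => ∑ i ∈ s, f i y) v x = ∑ i ∈ s, wder (f i) v x := by
  simp only [wder, fderiv_fun_sum hf, sum_apply, Finset.mul_sum,
    ← Finset.sum_sub_distrib]

lemma wderBar_sum {ι : Type*} (s : Finset ι) {f : ι → E → ℂ} {x : E}
    (hf : ∀ i ∈ s, DifferentiableAt ℝ (f i) x) (v : E) :
    wderBar (fun y => ∑ i ∈ s, f i y) v x = ∑ i ∈ s, wderBar (f i) v x := by
  simp only [wderBar, fderiv_fun_sum hf, sum_apply, Finset.mul_sum,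
    ← Finset.sum_add_distrib]

lemma wder_const (c : ℂ) (v x : E) : wder (fun _ => c) v x = 0 := by
  simp [wder]

lemma wderBar_const (c : ℂ) (v x : E) : wderBar (fun _ => c) v x = 0 := by
  simp [wderBar]

lemma wder_const_mul {f : E → ℂ} {x : E} (hf : DifferentiableAt ℝ f x) (c : ℂ)
    (v : E) : wder (fun y => c * f y) v x = c * wder f v x := by
  rw [wder_mul (differentiableAt_const _) hf, wder_const]; ring

lemma wderBar_const_mul {f : E → ℂ} {x : E} (hf : DifferentiableAt ℝ f x) (c : ℂ)
    (v : E) : wderBar (fun y => c * f y) v x = c * wderBar f v x := by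
  rw [wderBar_mul (differentiableAt_const _) hf, wderBar_const]; ring

lemma fderiv_conj_apply {f : E → ℂ} {x : E} (hf : DifferentiableAt ℝ f x) (v : E) :
    fderiv ℝ (fun y => conj (f y)) x v = conj (fderiv ℝ f x v) := by
  have : HasFDerivAt (fun y => conj (f y)) ((Complex.conjCLE : ℂ →L[ℝ] ℂ).comp (fderiv ℝ f x)) x :=
    (Complex.conjCLE.toContinuousLinearMap.hasFDerivAt (x := f x)).comp x hf.hasFDerivAt
  rw [this.fderiv]; simp

lemma wder_conj {f : E → ℂ} {x : E} (hf : DifferentiableAt ℝ f x) (v : E) :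
    wder (fun y => conj (f y)) v x = conj (wderBar f v x) := by
  simp only [wder, wderBar, fderiv_conj_apply hf]
  simp [Complex.conj_ofNat]; ring

lemma wderBar_conj {f : E → ℂ} {x : E} (hf : DifferentiableAt ℝ f x) (v : E) :
    wderBar (fun y => conj (f y)) v x = conj (wder f v x) := by
  simp only [wder, wderBar, fderiv_conj_apply hf]
  simp [Complex.conj_ofNat]

lemma diff_ofReal {r : E → ℝ} {x : E} (hr : DifferentiableAt ℝ r x) :
    DifferentiableAt ℝ (fun y => (r y : ℂ)) x :=
  (Complex.ofRealCLM.hasFDerivAt (x := r x)).differentiableAt.comp x hr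

lemma wderBar_ofReal {r : E → ℝ} {x : E} (hr : DifferentiableAt ℝ r x) (v : E) :
    wderBar (fun y => (r y : ℂ)) v x = conj (wder (fun y => (r y : ℂ)) v x) := by
  rw [← wderBar_conj (diff_ofReal hr)]; simp

lemma fderiv_ofReal_apply {r : E → ℝ} {x : E} (hr : DifferentiableAt ℝ r x) (v : E) :
    fderiv ℝ (fun y => (r y : ℂ)) x v = ((fderiv ℝ r x v : ℝ) : ℂ) := by
  have : HasFDerivAt (fun y => (r y : ℂ)) (Complex.ofRealCLM.comp (fderiv ℝ r x)) x :=
    (Complex.ofRealCLM.hasFDerivAt (x := r x)).comp x hr.hasFDerivAt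
  rw [this.fderiv]; simp

lemma wder_chain {h : ℝ → ℝ} {h' : ℝ} {r : E → ℝ} {x : E} (hr : DifferentiableAt ℝ r x)
    (hh : HasDerivAt h h' (r x)) (v : E) :
    wder (fun y => ((h (r y) : ℝ) : ℂ)) v x = (h' : ℂ) * wder (fun y => (r y : ℂ)) v x := by
  have h1 : HasFDerivAt (fun y => h (r y)) (h' • fderiv ℝ r x) x :=
    hh.comp_hasFDerivAt x hr.hasFDerivAt
  simp only [wder, fderiv_ofReal_apply hr, fderiv_ofReal_apply h1.differentiableAt, h1.fderiv]
  simp; ring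

lemma wderBar_chain {h : ℝ → ℝ} {h' : ℝ} {r : E → ℝ} {x : E} (hr : DifferentiableAt ℝ r x)
    (hh : HasDerivAt h h' (r x)) (v : E) :
    wderBar (fun y => ((h (r y) : ℝ) : ℂ)) v x = (h' : ℂ) * wderBar (fun y => (r y : ℂ)) v x := by
  have h1 : HasFDerivAt (fun y => h (r y)) (h' • fderiv ℝ r x) x :=
    hh.comp_hasFDerivAt x hr.hasFDerivAt
  rw [wderBar_ofReal h1.differentiableAt, wder_chain hr hh, wderBar_ofReal hr]
  simp

lemma wder_smul (f : E → ℂ) (c : ℂ) (v x : E) : wder f (c • v) x = c * wder f v x := by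
  have key : ∀ a b : ℝ, fderiv ℝ f x (((a : ℂ) + b * Complex.I) • v)
      = a * fderiv ℝ f x v + b * fderiv ℝ f x (Complex.I • v) := by
    intro a b
    rw [add_smul, mul_smul, map_add]
    have e1 : ((a : ℂ) • v) = a • v := by simp
    have e2 : ((b : ℂ) • (Complex.I • v)) = b • (Complex.I • v) := by
      exact (Complex.coe_smul b (Complex.I • v))
    rw [e1, e2, map_smul, map_smul]; simp
  have h1 := key c.re c.im
  have h2 := key (-c.im) c.re
  rw [Complex.re_add_im] at h1
  have e3 : ((-c.im : ℝ) : ℂ) + (c.re : ℝ) * Complex.I = Complex.I * c := by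
    conv_rhs => rw [← Complex.re_add_im c]
    push_cast
    linear_combination (-(c.im : ℂ)) * Complex.I_mul_I
  rw [e3, mul_smul] at h2
  simp only [wder, h1, h2]
  conv_rhs => rw [← Complex.re_add_im c]
  push_cast
  linear_combination (- (c.im : ℂ) * fderiv ℝ f x (Complex.I • v) /2 ) * (-Complex.I_mul_I)

lemma wderBar_smul (f : E → ℂ) (c : ℂ) (v x : E) :
    wderBar f (c • v) x = conj c * wderBar f v x := by
  have key : ∀ a b : ℝ, fderiv ℝ f x (((a : ℂ) + b * Complex.I) • v)
      = a * fderiv ℝ f x v + b * fderiv ℝ f x (Complex.I • v) := by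
    intro a b
    rw [add_smul, mul_smul, map_add]
    have e1 : ((a : ℂ) • v) = a • v := by simp
    have e2 : ((b : ℂ) • (Complex.I • v)) = b • (Complex.I • v) := by
      exact (Complex.coe_smul b (Complex.I • v))
    rw [e1, e2, map_smul, map_smul]; simp
  have h1 := key c.re c.im
  have h2 := key (-c.im) c.re
  rw [Complex.re_add_im] at h1
  have e3 : ((-c.im : ℝ) : ℂ) + (c.re : ℝ) * Complex.I = Complex.I * c := by
    conv_rhs => rw [← Complex.re_add_im c]
    push_cast
    linear_combination (-(c.im : ℂ)) * Complex.I_mul_I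
  rw [e3, mul_smul] at h2
  have e4 : conj c = (c.re : ℂ) - c.im * Complex.I := by
    apply Complex.ext <;> simp
  simp only [wderBar, h1, h2, e4]
  push_cast
  linear_combination ((c.im : ℂ) * fderiv ℝ f x (Complex.I • v) /2 ) * (Complex.I_mul_I)

lemma wder_add_dir (f : E → ℂ) (v w x : E) : wder f (v + w) x = wder f v x + wder f w x := by
  simp only [wder, smul_add, map_add]; ring

lemma wderBar_add_dir (f : E → ℂ) (v w x : E) :
    wderBar f (v + w) x = wderBar f v x + wderBar f w x := by
  simp only [wderBar, smul_add, map_add]; ring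

lemma wderBar_holo {f : E → ℂ} {x : E} (hf : DifferentiableAt ℂ f x) (v : E) :
    wderBar f v x = 0 := by
  have := hf.hasFDerivAt.restrictScalars ℝ
  simp only [wderBar, this.fderiv, ContinuousLinearMap.coe_restrictScalars', map_smul, smul_eq_mul]
  rw [← mul_assoc, Complex.I_mul_I]; ring

lemma cd_wder {f : E → ℂ} {x : E} (hf : ContDiffAt ℝ ∞ f x) (v : E) :
    ContDiffAt ℝ ∞ (fun y => wder f v y) x := by
  have h1 : ContDiffAt ℝ ∞ (fderiv ℝ f) x := hf.fderiv_right (m := ∞) (by simp)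
  unfold wder
  exact contDiffAt_const.mul ((h1.clm_apply contDiffAt_const).sub
    (contDiffAt_const.mul (h1.clm_apply contDiffAt_const)))

lemma cd_wderBar {f : E → ℂ} {x : E} (hf : ContDiffAt ℝ ∞ f x) (v : E) :
    ContDiffAt ℝ ∞ (fun y => wderBar f v y) x := by
  have h1 : ContDiffAt ℝ ∞ (fderiv ℝ f) x := hf.fderiv_right (m := ∞) (by simp)
  unfold wderBar
  exact contDiffAt_const.mul ((h1.clm_apply contDiffAt_const).add
    (contDiffAt_const.mul (h1.clm_apply contDiffAt_const)))

lemma ContDiffAt.dR {F : Type*} [NormedAddCommGroup F] [NormedSpace ℝ F] {f : E → F} {x : E}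
    (hf : ContDiffAt ℝ ∞ f x) : DifferentiableAt ℝ f x :=
  hf.differentiableAt (by simp)

lemma fderiv_fderiv_comm {f : E → ℂ} {x : E} (hf : ContDiffAt ℝ ∞ f x) (v w : E) :
    fderiv ℝ (fun y => fderiv ℝ f y v) x w = fderiv ℝ (fun y => fderiv ℝ f y w) x v := by
  have h1 : DifferentiableAt ℝ (fderiv ℝ f) x :=
    (hf.fderiv_right (m := ∞) (by simp)).differentiableAt (by simp)
  have hs : IsSymmSndFDerivAt ℝ f x := hf.isSymmSndFDerivAt (by
    rw [minSmoothness_of_isRCLikeNormedField]; exact ENat.LEInfty.out)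
  have e : ∀ v w, fderiv ℝ (fun y => fderiv ℝ f y v) x w = fderiv ℝ (fderiv ℝ f) x w v := by
    intro v w
    rw [fderiv_clm_apply h1 (differentiableAt_const v)]
    simp
  rw [e, e]; exact hs w v

lemma fderiv_lin {f : E → ℂ} {x : E} (hf : ContDiffAt ℝ ∞ f x) (a b c : ℂ) (v w u : E) :
    fderiv ℝ (fun y => a * (b * fderiv ℝ f y v + c * fderiv ℝ f y w)) x u
      = a * (b * fderiv ℝ (fun y => fderiv ℝ f y v) x u
        + c * fderiv ℝ (fun y => fderiv ℝ f y w) x u) := by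
  have h1 : ∀ v, DifferentiableAt ℝ (fun y => fderiv ℝ f y v) x := fun v =>
    ((hf.fderiv_right (m := ∞) (by simp)).clm_apply contDiffAt_const).differentiableAt (by simp)
  have h2 : DifferentiableAt ℝ (fun y => b * fderiv ℝ f y v + c * fderiv ℝ f y w) x :=
    ((h1 v).const_mul b).fun_add ((h1 w).const_mul c)
  rw [fderiv_const_mul h2,
    fderiv_fun_add ((h1 v).const_mul b) ((h1 w).const_mul c), fderiv_const_mul (h1 v),
    fderiv_const_mul (h1 w)]
  simp [mul_add]

lemma wder_wderBar_comm {f : E → ℂ} {x : E} (hf : ContDiffAt ℝ ∞ f x) (v w : E) :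
    wder (fun y => wderBar f v y) w x = wderBar (fun y => wder f w y) v x := by
  have e1 : ∀ y, wderBar f v y = (1/2:ℂ) * (1 * fderiv ℝ f y v
      + Complex.I * fderiv ℝ f y (Complex.I • v)) := by intro y; simp [wderBar]
  have e2 : ∀ y, wder f w y = (1/2:ℂ) * (1 * fderiv ℝ f y w
      + (-Complex.I) * fderiv ℝ f y (Complex.I • w)) := by intro y; simp [wder]; ring
  simp only [e1, e2]
  rw [wder, wderBar]
  simp only [fderiv_lin hf]
  rw [fderiv_fderiv_comm hf v w, fderiv_fderiv_comm hf v (Complex.I • w),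
    fderiv_fderiv_comm hf (Complex.I • v) w, fderiv_fderiv_comm hf (Complex.I • v) (Complex.I • w)]
  ring

lemma wderBar_comm {f : E → ℂ} {x : E} (hf : ContDiffAt ℝ ∞ f x) (v w : E) :
    wderBar (fun y => wderBar f v y) w x = wderBar (fun y => wderBar f w y) v x := by
  have e1 : ∀ v y, wderBar f v y = (1/2:ℂ) * (1 * fderiv ℝ f y v
      + Complex.I * fderiv ℝ f y (Complex.I • v)) := by intro v y; simp [wderBar]
  simp only [e1]
  rw [wderBar, wderBar]
  simp only [fderiv_lin hf]
  rw [fderiv_fderiv_comm hf v w, fderiv_fderiv_comm hf v (Complex.I • w),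
    fderiv_fderiv_comm hf (Complex.I • v) w, fderiv_fderiv_comm hf (Complex.I • v) (Complex.I • w)]
  ring

lemma wder_eq_zero_of_notMem {f : E → ℂ} {x : E} (hx : x ∉ tsupport f) (v : E) :
    wder f v x = 0 := by
  have : f =ᶠ[𝓝 x] fun _ => 0 := notMem_tsupport_iff_eventuallyEq.mp hx
  rw [wder_congr this, wder_const]

lemma wderBar_eq_zero_of_notMem {f : E → ℂ} {x : E} (hx : x ∉ tsupport f) (v : E) :
    wderBar f v x = 0 := by
  have : f =ᶠ[𝓝 x] fun _ => 0 := notMem_tsupport_iff_eventuallyEq.mp hx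
  rw [wderBar_congr this, wderBar_const]

lemma tsupport_wder (f : E → ℂ) (v : E) : tsupport (fun y => wder f v y) ⊆ tsupport f :=
  closure_minimal (fun x hx => by
    by_contra h; exact hx (wder_eq_zero_of_notMem h v)) (isClosed_tsupport f)

lemma tsupport_wderBar (f : E → ℂ) (v : E) : tsupport (fun y => wderBar f v y) ⊆ tsupport f :=
  closure_minimal (fun x hx => by
    by_contra h; exact hx (wderBar_eq_zero_of_notMem h v)) (isClosed_tsupport f)

lemma HasCompactSupport.wder {f : E → ℂ} (hf : HasCompactSupport f) (v : E) :
    HasCompactSupport (fun y => wder f v y) :=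
  hf.mono' (subset_trans (subset_tsupport _) (tsupport_wder f v))

lemma HasCompactSupport.wderBar {f : E → ℂ} (hf : HasCompactSupport f) (v : E) :
    HasCompactSupport (fun y => wderBar f v y) :=
  hf.mono' (subset_trans (subset_tsupport _) (tsupport_wderBar f v))

lemma wder_slice {E' : Type*} [NormedAddCommGroup E'] [NormedSpace ℂ E'] {f : E' × E → ℂ}
    {t : E'} {z : E} (hf : DifferentiableAt ℝ f (t, z)) (v : E) :
    wder (fun y => f (t, y)) v z = wder f (0, v) (t, z) := by
  have h : HasFDerivAt (fun y => f (t, y))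
      ((fderiv ℝ f (t, z)).comp (ContinuousLinearMap.inr ℝ E' E)) z :=
    HasFDerivAt.comp z hf.hasFDerivAt (hasFDerivAt_prodMk_right t z)
  simp only [wder, h.fderiv]
  simp

lemma wderBar_slice {E' : Type*} [NormedAddCommGroup E'] [NormedSpace ℂ E'] {f : E' × E → ℂ}
    {t : E'} {z : E} (hf : DifferentiableAt ℝ f (t, z)) (v : E) :
    wderBar (fun y => f (t, y)) v z = wderBar f (0, v) (t, z) := by
  have h : HasFDerivAt (fun y => f (t, y))
      ((fderiv ℝ f (t, z)).comp (ContinuousLinearMap.inr ℝ E' E)) z :=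
    HasFDerivAt.comp z hf.hasFDerivAt (hasFDerivAt_prodMk_right t z)
  simp only [wderBar, h.fderiv]
  simp

lemma ContDiffAt.toC {r : E → ℝ} {x : E} (hr : ContDiffAt ℝ ∞ r x) :
    ContDiffAt ℝ ∞ (fun y => (r y : ℂ)) x :=
  Complex.ofRealCLM.contDiff.contDiffAt.comp x hr

lemma cd_conj {f : E → ℂ} {x : E} (hr : ContDiffAt ℝ ∞ f x) :
    ContDiffAt ℝ ∞ (fun y => conj (f y)) x :=
  (Complex.conjCLE.toContinuousLinearMap.contDiff.contDiffAt (x := f x)).comp x hr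

end WCalc

/-- Test functions on `D`. -/
structure Tst {n : ℕ} (D : Set (Fin n → ℂ)) (ζ : (Fin n → ℂ) → ℂ) : Prop where
  smooth : ContDiff ℝ ∞ ζ
  cpt : HasCompactSupport ζ
  sub : tsupport ζ ⊆ D

/-- Pointwise smoothness on a set. -/
def SmAt {n : ℕ} (D : Set (Fin n → ℂ)) (G : (Fin n → ℂ) → ℂ) : Prop :=
  ∀ x ∈ D, ContDiffAt ℝ ∞ G x

/-- Pointwise smoothness on a set, real version. -/
def SmR {n : ℕ} (D : Set (Fin n → ℂ)) (G : (Fin n → ℂ) → ℝ) : Prop :=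
  ∀ x ∈ D, ContDiffAt ℝ ∞ G x

/-- basis vectors -/
def ee {n : ℕ} (j : Fin n) : Fin n → ℂ := Pi.single j 1

section TestFn
variable {n : ℕ} {D : Set (Fin n → ℂ)} {ζ ξ G H : (Fin n → ℂ) → ℂ} {p r : (Fin n → ℂ) → ℝ}

lemma SmR.toC (h : SmR D p) : SmAt D (fun x => (p x : ℂ)) := fun x hx => (h x hx).toC
lemma SmR.add (h : SmR D p) (h' : SmR D r) : SmR D (fun x => p x + r x) :=
  fun x hx => (h x hx).add (h' x hx)
lemma SmR.mul (h : SmR D p) (h' : SmR D r) : SmR D (fun x => p x * r x) :=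
  fun x hx => (h x hx).mul (h' x hx)
lemma SmR.neg (h : SmR D p) : SmR D (fun x => - p x) :=
  fun x hx => (h x hx).neg
lemma SmR.const (c : ℝ) : SmR D (fun _ => c) := fun _ _ => contDiffAt_const
lemma SmR.exp (h : SmR D p) : SmR D (fun x => Real.exp (p x)) :=
  fun x hx => (Real.contDiff_exp.contDiffAt).comp x (h x hx)
lemma SmAt.mul (h : SmAt D G) (h' : SmAt D H) : SmAt D (fun x => G x * H x) :=
  fun x hx => (h x hx).mul (h' x hx)
lemma SmAt.add (h : SmAt D G) (h' : SmAt D H) : SmAt D (fun x => G x + H x) :=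
  fun x hx => (h x hx).add (h' x hx)
lemma SmAt.sub (h : SmAt D G) (h' : SmAt D H) : SmAt D (fun x => G x - H x) :=
  fun x hx => (h x hx).sub (h' x hx)
lemma SmAt.neg (h : SmAt D G) : SmAt D (fun x => - G x) :=
  fun x hx => (h x hx).neg
lemma SmAt.const (c : ℂ) : SmAt D (fun _ => c) := fun _ _ => contDiffAt_const
lemma SmAt.conj (h : SmAt D G) : SmAt D (fun x => conj (G x)) := fun x hx => cd_conj (h x hx)
lemma SmAt.wder (h : SmAt D G) (v : Fin n → ℂ) : SmAt D (fun x => wder G v x) :=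
  fun x hx => cd_wder (h x hx) v
lemma SmAt.wderBar (h : SmAt D G) (v : Fin n → ℂ) : SmAt D (fun x => wderBar G v x) :=
  fun x hx => cd_wderBar (h x hx) v
lemma SmAt.sum {ι : Type*} (s : Finset ι) {f : ι → (Fin n → ℂ) → ℂ}
    (h : ∀ i ∈ s, SmAt D (f i)) : SmAt D (fun x => ∑ i ∈ s, f i x) :=
  fun x hx => ContDiffAt.sum (fun i hi => h i hi x hx)
lemma SmAt.d (h : SmAt D G) {x : Fin n → ℂ} (hx : x ∈ D) : DifferentiableAt ℝ G x :=
  (h x hx).dR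
lemma SmR.d (h : SmR D p) {x : Fin n → ℂ} (hx : x ∈ D) : DifferentiableAt ℝ p x :=
  (h x hx).dR

lemma Tst.sm (h : Tst D ζ) : SmAt D ζ := fun _ _ => h.smooth.contDiffAt
lemma Tst.dd (h : Tst D ζ) (x : Fin n → ℂ) : DifferentiableAt ℝ ζ x :=
  h.smooth.contDiffAt.dR

lemma Tst.mono {D' : Set (Fin n → ℂ)} (h : Tst D ζ) (hD : D ⊆ D') : Tst D' ζ :=
  ⟨h.smooth, h.cpt, h.sub.trans hD⟩

lemma Tst.zero_off (h : Tst D ζ) {x : Fin n → ℂ} (hx : x ∉ D) : ζ x = 0 :=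
  image_eq_zero_of_notMem_tsupport (fun hh => hx (h.sub hh))

lemma Tst.gmul (h : Tst D ζ) (hG : SmAt D G) : Tst D (fun x => G x * ζ x) := by
  have hs : tsupport (fun x => G x * ζ x) ⊆ tsupport ζ := by
    apply closure_mono; intro x hx hz; exact hx (by simp [hz])
  refine ⟨?_, h.cpt.mono' (subset_trans (subset_tsupport _) hs), hs.trans h.sub⟩
  rw [contDiff_iff_contDiffAt]
  intro x
  by_cases hx : x ∈ tsupport ζ
  · exact (hG x (h.sub hx)).mul h.smooth.contDiffAt
  · have : (fun x => G x * ζ x) =ᶠ[𝓝 x] fun _ => 0 := by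
      filter_upwards [notMem_tsupport_iff_eventuallyEq.mp hx] with y hy
      simp [hy]
    exact contDiffAt_const.congr_of_eventuallyEq this

lemma Tst.wder (h : Tst D ζ) (v : Fin n → ℂ) : Tst D (fun x => wder ζ v x) :=
  ⟨contDiff_iff_contDiffAt.mpr (fun _ => cd_wder h.smooth.contDiffAt v), h.cpt.wder v,
    (tsupport_wder ζ v).trans h.sub⟩

lemma Tst.wderBar (h : Tst D ζ) (v : Fin n → ℂ) : Tst D (fun x => wderBar ζ v x) :=
  ⟨contDiff_iff_contDiffAt.mpr (fun _ => cd_wderBar h.smooth.contDiffAt v), h.cpt.wderBar v,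
    (tsupport_wderBar ζ v).trans h.sub⟩

lemma Tst.conj (h : Tst D ζ) : Tst D (fun x => conj (ζ x)) := by
  have hs : tsupport (fun x => (starRingEnd ℂ) (ζ x)) ⊆ tsupport ζ := by
    apply closure_mono; intro x hx hz; exact hx (by simp [hz])
  exact ⟨contDiff_iff_contDiffAt.mpr (fun _ => cd_conj h.smooth.contDiffAt),
    h.cpt.mono' (subset_trans (subset_tsupport _) hs), hs.trans h.sub⟩

lemma Tst.add (h : Tst D ζ) (h' : Tst D ξ) : Tst D (fun x => ζ x + ξ x) :=
  ⟨h.smooth.add h'.smooth, h.cpt.add h'.cpt,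
    (tsupport_add ζ ξ).trans (union_subset h.sub h'.sub)⟩

lemma Tst.zero : Tst D (fun _ => (0:ℂ)) := by
  have : (fun _ : Fin n → ℂ => (0:ℂ)) = 0 := rfl
  refine ⟨contDiff_const, ?_, ?_⟩
  · rw [this]; exact HasCompactSupport.zero
  · simp [tsupport, Function.support]

lemma Tst.neg (h : Tst D ζ) : Tst D (fun x => - ζ x) := by
  simpa using h.gmul (SmAt.const (-1))

lemma Tst.sub' (h : Tst D ζ) (h' : Tst D ξ) : Tst D (fun x => ζ x - ξ x) := by
  simpa [sub_eq_add_neg] using h.add h'.neg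

lemma Tst.sum {ι : Type*} (s : Finset ι) {f : ι → (Fin n → ℂ) → ℂ}
    (h : ∀ i ∈ s, Tst D (f i)) : Tst D (fun x => ∑ i ∈ s, f i x) := by
  classical
  induction s using Finset.induction_on with
  | empty => simpa using Tst.zero
  | insert a s ha ih =>
    simp only [Finset.sum_insert ha]
    exact (h a (by simp)).add (ih (fun i hi => h i (by simp [hi])))

lemma Tst.cont (h : Tst D ζ) : Continuous ζ := h.smooth.continuous

lemma Tst.integrable (h : Tst D ζ) : Integrable ζ := h.cont.integrable_of_hasCompactSupport h.cpt

lemma Tst.int_fderiv (h : Tst D ζ) (v : Fin n → ℂ) : ∫ x, fderiv ℝ ζ x v = 0 := by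
  have hc : Continuous (fun x => fderiv ℝ ζ x v) :=
    (h.smooth.continuous_fderiv (by simp)).clm_apply continuous_const
  have hs : HasCompactSupport (fun x => fderiv ℝ ζ x v) := h.cpt.fderiv_apply (𝕜 := ℝ) v
  have := integral_smul_fderiv_eq_neg_fderiv_smul_of_integrable (μ := volume) (𝕜 := ℝ)
    (f := fun _ : Fin n → ℂ => (1:ℝ)) (g := ζ) (v := v) (by simp)
    (by simpa using hc.integrable_of_hasCompactSupport hs) (by simpa using h.integrable)
    (fun x _ => differentiableAt_const _) (fun x _ => h.dd x)
  simpa using this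

lemma Tst.fint (h : Tst D ζ) (v : Fin n → ℂ) : Integrable (fun x => fderiv ℝ ζ x v) :=
  ((h.smooth.continuous_fderiv (by simp)).clm_apply
    continuous_const).integrable_of_hasCompactSupport (h.cpt.fderiv_apply (𝕜 := ℝ) v)

lemma Tst.int_wder (h : Tst D ζ) (v : Fin n → ℂ) : ∫ x, _root_.wder ζ v x = 0 := by
  unfold _root_.wder
  rw [integral_const_mul, integral_sub (h.fint _) ((h.fint _).const_mul _), integral_const_mul,
    h.int_fderiv, h.int_fderiv]
  simp

lemma Tst.int_wderBar (h : Tst D ζ) (v : Fin n → ℂ) : ∫ x, _root_.wderBar ζ v x = 0 := by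
  unfold _root_.wderBar
  rw [integral_const_mul, integral_add (h.fint _) ((h.fint _).const_mul _), integral_const_mul,
    h.int_fderiv, h.int_fderiv]
  simp

lemma ibp_wder (hG : SmAt D G) (h : Tst D ζ) (v : Fin n → ℂ) :
    ∫ x, G x * wder ζ v x = - ∫ x, wder G v x * ζ x := by
  have e : ∀ x, wder (fun x => G x * ζ x) v x = wder G v x * ζ x + G x * wder ζ v x := by
    intro x
    by_cases hx : x ∈ tsupport ζ
    · exact wder_mul (hG.d (h.sub hx)) (h.dd x) v
    · have : (fun x => G x * ζ x) =ᶠ[𝓝 x] fun _ => 0 := by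
        filter_upwards [notMem_tsupport_iff_eventuallyEq.mp hx] with y hy
        simp [hy]
      rw [wder_congr this, wder_const, wder_eq_zero_of_notMem hx,
        image_eq_zero_of_notMem_tsupport hx]; simp
  have h0 := (h.gmul hG).int_wder v
  simp only [e] at h0
  rw [integral_add (h.gmul (hG.wder v)).integrable ((h.wder v).gmul hG).integrable] at h0
  linear_combination h0

lemma ibp_wderBar (hG : SmAt D G) (h : Tst D ζ) (v : Fin n → ℂ) :
    ∫ x, G x * wderBar ζ v x = - ∫ x, wderBar G v x * ζ x := by
  have e : ∀ x, wderBar (fun x => G x * ζ x) v x = wderBar G v x * ζ x + G x * wderBar ζ v x := by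
    intro x
    by_cases hx : x ∈ tsupport ζ
    · exact wderBar_mul (hG.d (h.sub hx)) (h.dd x) v
    · have : (fun x => G x * ζ x) =ᶠ[𝓝 x] fun _ => 0 := by
        filter_upwards [notMem_tsupport_iff_eventuallyEq.mp hx] with y hy
        simp [hy]
      rw [wderBar_congr this, wderBar_const, wderBar_eq_zero_of_notMem hx,
        image_eq_zero_of_notMem_tsupport hx]; simp
  have h0 := (h.gmul hG).int_wderBar v
  simp only [e] at h0
  rw [integral_add (h.gmul (hG.wderBar v)).integrable ((h.wderBar v).gmul hG).integrable] at h0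
  linear_combination h0

lemma wder_dir_sum (f : (Fin n → ℂ) → ℂ) (v x : Fin n → ℂ) :
    wder f v x = ∑ j, v j * wder f (ee j) x := by
  let L : (Fin n → ℂ) →ₗ[ℂ] ℂ :=
    { toFun := fun v => wder f v x
      map_add' := fun a b => wder_add_dir f a b x
      map_smul' := fun c a => wder_smul f c a x }
  have := L.pi_apply_eq_sum_univ v
  simp only [smul_eq_mul] at this
  have e : ∀ j : Fin n, (fun i => if j = i then (1:ℂ) else 0) = ee j := by
    intro j; ext i; simp [ee, Pi.single_apply, eq_comm]
  simp only [e] at this; exact this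

lemma wderBar_dir_sum (f : (Fin n → ℂ) → ℂ) (v x : Fin n → ℂ) :
    wderBar f v x = ∑ j, conj (v j) * wderBar f (ee j) x := by
  let L : (Fin n → ℂ) →ₗ[ℂ] ℂ :=
    { toFun := fun v => conj (wderBar f v x)
      map_add' := fun a b => by rw [wderBar_add_dir]; simp
      map_smul' := fun c a => by rw [wderBar_smul]; simp }
  have := L.pi_apply_eq_sum_univ v
  have h2 := congrArg (starRingEnd ℂ) this
  simp only [smul_eq_mul, map_sum, map_mul, L, LinearMap.coe_mk, AddHom.coe_mk,
    Complex.conj_conj] at h2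
  convert h2 using 4 with j
  · ext i; simp [ee, Pi.single_apply, eq_comm]

/-- Levi form -/
def levi {E : Type*} [NormedAddCommGroup E] [NormedSpace ℂ E] (p : E → ℝ) (v x : E) : ℂ :=
  wder (fun y => wderBar (fun q => (p q : ℂ)) v y) v x

lemma levi_expand (hp : SmR D p) {x : Fin n → ℂ} (hx : x ∈ D) (v : Fin n → ℂ) :
    levi p v x = ∑ j, ∑ k, v j * conj (v k) *
      wder (fun y => wderBar (fun q => (p q : ℂ)) (ee k) y) (ee j) x := by
  unfold levi
  rw [wder_dir_sum]
  apply Finset.sum_congr rfl; intro j _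
  simp only [wderBar_dir_sum _ v]
  rw [wder_sum _ (fun i _ => (((hp.toC).wderBar (ee i)).d hx).const_mul _), Finset.mul_sum]
  apply Finset.sum_congr rfl; intro k _
  rw [wder_const_mul (((hp.toC).wderBar (ee k)).d hx)]; ring

end TestFn

section Bochner
variable {n : ℕ} {D : Set (Fin n → ℂ)} {ζ ξ G H : (Fin n → ℂ) → ℂ} {p r : (Fin n → ℂ) → ℝ}

/-- formal adjoint of `∂̄_j` for the weight `p` -/
def dlj (p : (Fin n → ℂ) → ℝ) (b : (Fin n → ℂ) → ℂ) (j : Fin n) (x : Fin n → ℂ) : ℂ :=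
  - wder b (ee j) x + wder (fun y => (p y : ℂ)) (ee j) x * b x

/-- the weight as complex function -/
def ew (p : (Fin n → ℂ) → ℝ) (x : Fin n → ℂ) : ℂ := ((Real.exp (-(p x)) : ℝ) : ℂ)

lemma ew_sm (hp : SmR D p) : SmAt D (ew p) := (hp.neg.exp).toC

lemma ew_conj (x : Fin n → ℂ) : conj (ew p x) = ew p x := Complex.conj_ofReal _

lemma wder_ew (hp : SmR D p) {x : Fin n → ℂ} (hx : x ∈ D) (v : Fin n → ℂ) :
    wder (ew p) v x = - ew p x * wder (fun y => (p y : ℂ)) v x := by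
  have h := wder_chain (h := fun s => Real.exp (-s)) (h' := - Real.exp (-(p x))) (hp.d hx)
    (by simpa using ((hasDerivAt_id (p x)).neg).exp) v
  unfold ew
  rw [h]; push_cast; ring

lemma wderBar_ew (hp : SmR D p) {x : Fin n → ℂ} (hx : x ∈ D) (v : Fin n → ℂ) :
    wderBar (ew p) v x = - ew p x * wderBar (fun y => (p y : ℂ)) v x := by
  have h := wderBar_chain (h := fun s => Real.exp (-s)) (h' := - Real.exp (-(p x))) (hp.d hx)
    (by simpa using ((hasDerivAt_id (p x)).neg).exp) v
  unfold ew
  rw [h]; push_cast; ring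

lemma Tst.dlj (h : Tst D ζ) (hp : SmR D p) (j : Fin n) : Tst D (fun x => dlj p ζ j x) :=
  (h.wder _).neg.add (h.gmul (hp.toC.wder _))

/-- adjointness of `dlj`. -/
lemma dlj_adj (hp : SmR D p) (h : Tst D ζ) (hG : SmAt D G) (j : Fin n) :
    ∫ x, G x * dlj p ζ j x * ew p x = ∫ x, wder G (ee j) x * ζ x * ew p x := by
  have e1 : ∀ x, G x * dlj p ζ j x * ew p x = - (G x * wder (fun y => ew p y * ζ y) (ee j) x) := by
    intro x
    by_cases hx : x ∈ D
    · rw [wder_mul ((ew_sm hp).d hx) (h.dd x), wder_ew hp hx, _root_.dlj]; ring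
    · have hx' : x ∉ tsupport ζ := fun hh => hx (h.sub hh)
      have h2 := (h.gmul (ew_sm hp)).wder (ee j)
      rw [h2.zero_off hx, (h.dlj hp j).zero_off hx]; simp
  simp only [e1]
  rw [integral_neg, ibp_wder hG (h.gmul (ew_sm hp)), neg_neg]
  congr 1; ext x; ring

lemma bochner_jk (hD : IsOpen D) (hp : SmR D p) (h : Tst D ξ) (j k : Fin n) :
    ∫ x, dlj p (fun y => wderBar ξ (ee j) y) j x * conj (dlj p (fun y => wderBar ξ (ee k) y) k x)
        * ew p x
      = (∫ x, wder (fun y => wderBar (fun q => (p q : ℂ)) (ee k) y) (ee j) x * wderBar ξ (ee j) x *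
          conj (wderBar ξ (ee k) x) * ew p x)
        + ∫ x, wderBar (fun y => wderBar ξ (ee j) y) (ee k) x *
            conj (wderBar (fun y => wderBar ξ (ee j) y) (ee k) x) * ew p x := by
  set bj := fun y => wderBar ξ (ee j) y with hbj
  set bk := fun y => wderBar ξ (ee k) y with hbk
  have tj : Tst D bj := h.wderBar _
  have tk : Tst D bk := h.wderBar _
  have td : Tst D (fun x => dlj p bk k x) := tk.dlj hp k
  have s1 : ∫ x, dlj p bj j x * conj (dlj p bk k x) * ew p x
      = ∫ x, conj (wderBar (fun y => dlj p bk k y) (ee j) x) * bj x * ew p x := by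
    have := dlj_adj hp tj td.conj.sm j
    simp only [wder_conj (td.dd _)] at this
    rw [← this]; congr 1; ext x; ring
  have s2 : ∀ x ∈ D, wderBar (fun y => dlj p bk k y) (ee j) x
      = dlj p (fun y => wderBar bk (ee j) y) k x
        + wderBar (fun y => wder (fun q => (p q : ℂ)) (ee k) y) (ee j) x * bk x := by
    intro x hx
    have hd : DifferentiableAt ℝ (fun y => wder bk (ee k) y) x := (tk.wder _).dd x
    have hd2 : DifferentiableAt ℝ (fun y => wder (fun q => (p q : ℂ)) (ee k) y) x :=
      (hp.toC.wder _).d hx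
    unfold _root_.dlj
    rw [wderBar_add hd.fun_neg (hd2.fun_mul (tk.dd x)), wderBar_neg, wderBar_mul hd2 (tk.dd x),
      ← wder_wderBar_comm tk.smooth.contDiffAt]
    ring
  have s3 : ∀ x, conj (wderBar (fun y => dlj p bk k y) (ee j) x) * bj x * ew p x
      = conj (conj (bj x) * dlj p (fun y => wderBar bk (ee j) y) k x * ew p x)
        + wder (fun y => wderBar (fun q => (p q : ℂ)) (ee k) y) (ee j) x * bj x *
          conj (bk x) * ew p x := by
    intro x
    by_cases hx : x ∈ D
    · rw [s2 x hx, wder_wderBar_comm (hp.toC x hx)]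
      have : conj (wderBar (fun y => wder (fun q => (p q : ℂ)) (ee k) y) (ee j) x)
          = wderBar (fun y => wder (fun q => (p q : ℂ)) (ee j) y) (ee k) x := by
        rw [← wder_wderBar_comm (hp.toC x hx) (ee k) (ee j), ← wder_conj ((hp.toC.wder _).d hx)]
        apply wder_congr
        filter_upwards [hD.mem_nhds hx] with y hy
        rw [wderBar_ofReal (hp.d hy)]
      simp only [map_add, map_mul, this, ew_conj, Complex.conj_conj]
      ring
    · rw [tj.zero_off hx]; simp
  rw [s1]
  simp only [s3]
  have t1 : Tst D (fun x => conj (bj x) * dlj p (fun y => wderBar bk (ee j) y) k x * ew p x) := by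
    have := ((tk.wderBar (ee j)).dlj hp k).gmul (tj.conj.sm.mul (ew_sm hp))
    convert this using 2; ring
  have t2 : Tst D (fun x => wder (fun y => wderBar (fun q => (p q : ℂ)) (ee k) y) (ee j) x * bj x *
          conj (bk x) * ew p x) := by
    have := tj.gmul (((hp.toC.wderBar (ee k)).wder (ee j)).mul (tk.conj.sm.mul (ew_sm hp)))
    convert this using 2; ring
  rw [integral_add t1.conj.integrable t2.integrable, add_comm, integral_conj,
    dlj_adj hp (tk.wderBar (ee j)) tj.conj.sm k, ← integral_conj]
  congr 2
  ext x
  rw [wder_conj (tj.dd x)]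
  have : wderBar bk (ee j) x = wderBar bj (ee k) x := wderBar_comm h.smooth.contDiffAt _ _
  rw [this]
  simp only [map_mul, ew_conj, Complex.conj_conj]

/-- `δ_p ∂̄ξ` -/
def dl (p : (Fin n → ℂ) → ℝ) (ξ : (Fin n → ℂ) → ℂ) (x : Fin n → ℂ) : ℂ :=
  ∑ j, dlj p (fun y => wderBar ξ (ee j) y) j x

/-- the vector `(∂̄_j ξ)_j` -/
def bet (ξ : (Fin n → ℂ) → ℂ) (x : Fin n → ℂ) : Fin n → ℂ := fun j => wderBar ξ (ee j) x

lemma Tst.dl (h : Tst D ξ) (hp : SmR D p) : Tst D (fun x => dl p ξ x) :=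
  Tst.sum _ (fun j _ => (h.wderBar _).dlj hp j)

lemma tst_levi (h : Tst D ξ) (hp : SmR D p) : Tst D (fun x => levi p (bet ξ x) x) := by
  have : ∀ x, levi p (bet ξ x) x = ∑ j, ∑ k, (conj (wderBar ξ (ee k) x) *
      _root_.wder (fun y => _root_.wderBar (fun q => (p q : ℂ)) (ee k) y) (ee j) x) *
        wderBar ξ (ee j) x := by
    intro x
    by_cases hx : x ∈ D
    · rw [levi_expand hp hx]
      refine Finset.sum_congr rfl fun j _ => Finset.sum_congr rfl fun k _ => ?_
      simp only [bet]; ring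
    · have : bet ξ x = 0 := by ext j; exact (h.wderBar (ee j)).zero_off hx
      rw [this]
      have e0 : ∀ j, wderBar ξ (ee j) x = 0 := fun j => (h.wderBar (ee j)).zero_off hx
      simp [_root_.levi, _root_.wder, e0]
  simp only [this]
  exact Tst.sum _ fun j _ => Tst.sum _ fun k _ =>
    (h.wderBar _).gmul ((h.wderBar _).conj.sm.mul ((hp.toC.wderBar _).wder _))

lemma re_ge (a : ℂ) (p : (Fin n → ℂ) → ℝ) (x : Fin n → ℂ) :
    (a * conj a * ew p x).re = ‖a‖ ^ 2 * Real.exp (-(p x)) := by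
  rw [Complex.mul_conj, ew, ← Complex.ofReal_mul, Complex.ofReal_re, Complex.normSq_eq_norm_sq]

/-- The Bochner inequality for `∂̄`-exact test forms. -/
lemma bochner (hD : IsOpen D) (hp : SmR D p) (h : Tst D ξ) :
    ∫ x, (levi p (bet ξ x) x).re * Real.exp (-(p x))
      ≤ ∫ x, ‖dl p ξ x‖ ^ 2 * Real.exp (-(p x)) := by
  have T1 : ∀ j k, Tst D (fun x => dlj p (fun y => wderBar ξ (ee j) y) j x *
      conj (dlj p (fun y => wderBar ξ (ee k) y) k x) * ew p x) := by
    intro j k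
    have := ((h.wderBar (ee j)).dlj hp j).gmul
      ((((h.wderBar (ee k)).dlj hp k).conj).sm.mul (ew_sm hp))
    convert this using 2; ring
  have T2 : ∀ j k, Tst D (fun x => wder (fun y => wderBar (fun q => (p q : ℂ)) (ee k) y) (ee j) x *
      wderBar ξ (ee j) x * conj (wderBar ξ (ee k) x) * ew p x) := by
    intro j k
    have := (h.wderBar (ee j)).gmul (((hp.toC.wderBar (ee k)).wder (ee j)).mul
      ((h.wderBar (ee k)).conj.sm.mul (ew_sm hp)))
    convert this using 2; ring
  have T3 : ∀ j k, Tst D (fun x => wderBar (fun y => wderBar ξ (ee j) y) (ee k) x *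
            conj (wderBar (fun y => wderBar ξ (ee j) y) (ee k) x) * ew p x) := by
    intro j k
    have := ((h.wderBar (ee j)).wderBar (ee k)).gmul
      ((((h.wderBar (ee j)).wderBar (ee k)).conj).sm.mul (ew_sm hp))
    convert this using 2; ring
  have key : ∫ x, dl p ξ x * conj (dl p ξ x) * ew p x
      = (∫ x, levi p (bet ξ x) x * ew p x) + ∑ j, ∑ k,
        ∫ x, wderBar (fun y => wderBar ξ (ee j) y) (ee k) x *
            conj (wderBar (fun y => wderBar ξ (ee j) y) (ee k) x) * ew p x := by
    have e1 : ∀ x, dl p ξ x * conj (dl p ξ x) * ew p x = ∑ j, ∑ k,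
      dlj p (fun y => wderBar ξ (ee j) y) j x *
      conj (dlj p (fun y => wderBar ξ (ee k) y) k x) * ew p x := by
      intro x
      simp only [_root_.dl, map_sum, Finset.sum_mul, Finset.mul_sum]
      rw [Finset.sum_comm]
    have e2 : ∀ x, levi p (bet ξ x) x * ew p x = ∑ j, ∑ k,
        wder (fun y => wderBar (fun q => (p q : ℂ)) (ee k) y) (ee j) x *
      wderBar ξ (ee j) x * conj (wderBar ξ (ee k) x) * ew p x := by
      intro x
      by_cases hx : x ∈ D
      · rw [levi_expand hp hx]
        simp only [Finset.sum_mul]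
        refine Finset.sum_congr rfl fun j _ => Finset.sum_congr rfl fun k _ => ?_
        simp only [bet]; ring
      · rw [(tst_levi h hp).zero_off hx]
        have e0 : ∀ j, wderBar ξ (ee j) x = 0 := fun j => (h.wderBar (ee j)).zero_off hx
        simp [e0]
    simp only [e1, e2]
    rw [integral_finsetSum _ fun j _ => integrable_finsetSum _ fun k _ => (T1 j k).integrable,
      integral_finsetSum _ fun j _ => integrable_finsetSum _ fun k _ => (T2 j k).integrable,
      ← Finset.sum_add_distrib]
    refine Finset.sum_congr rfl fun j _ => ?_
    rw [integral_finsetSum _ fun k _ => (T1 j k).integrable,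
      integral_finsetSum _ fun k _ => (T2 j k).integrable, ← Finset.sum_add_distrib]
    exact Finset.sum_congr rfl fun k _ => bochner_jk hD hp h j k
  have TA : Tst D (fun x => dl p ξ x * conj (dl p ξ x) * ew p x) := by
    have := (h.dl hp).gmul ((h.dl hp).conj.sm.mul (ew_sm hp))
    convert this using 2; ring
  have TB : Tst D (fun x => levi p (bet ξ x) x * ew p x) := by
    have := (tst_levi h hp).gmul (ew_sm hp)
    convert this using 2; ring
  have key2 := congrArg Complex.re key
  have reint : ∀ {f : (Fin n → ℂ) → ℂ}, Tst D f → (∫ x, f x).re = ∫ x, (f x).re := by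
    intro f hf
    exact (integral_re hf.integrable).symm
  rw [Complex.add_re, reint TA, reint TB, Complex.re_sum] at key2
  simp only [Complex.re_sum, reint (T3 _ _), re_ge] at key2
  have e3 : ∀ x, (levi p (bet ξ x) x * ew p x).re
      = (levi p (bet ξ x) x).re * Real.exp (-(p x)) := by
    intro x; rw [ew, Complex.re_mul_ofReal]
  simp only [e3] at key2
  rw [key2]
  have : 0 ≤ ∑ j, ∑ k, ∫ x, ‖wderBar (fun y => wderBar ξ (ee j) y) (ee k) x‖ ^ 2
      * Real.exp (-(p x)) :=
    Finset.sum_nonneg fun j _ => Finset.sum_nonneg fun k _ =>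
      integral_nonneg fun x => by positivity
  linarith

end Bochner

section Moll
variable {n : ℕ}

/-- Euclidean norm square -/
def nsq (x : Fin n → ℂ) : ℝ := ∑ j, Complex.normSq (x j)

/-- unnormalised circular bump -/
def rb (ε : ℝ) (x : Fin n → ℂ) : ℝ := Real.smoothTransition (ε ^ 2 - nsq x)

/-- normalised circular bump -/
def rho (ε : ℝ) (x : Fin n → ℂ) : ℝ := (∫ y : Fin n → ℂ, rb ε y)⁻¹ * rb ε x

lemma nsq_smooth : ContDiff ℝ ∞ (nsq : (Fin n → ℂ) → ℝ) := by
  unfold nsq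
  apply ContDiff.sum; intro j _
  simp only [Complex.normSq_apply]
  have h : ContDiff ℝ ∞ (fun x : Fin n → ℂ => x j) := contDiff_apply ℝ ℂ j
  have h1 : ContDiff ℝ ∞ (fun x : Fin n → ℂ => (x j).re) := Complex.reCLM.contDiff.comp h
  have h2 : ContDiff ℝ ∞ (fun x : Fin n → ℂ => (x j).im) := Complex.imCLM.contDiff.comp h
  exact (h1.mul h1).add (h2.mul h2)

lemma nsq_nonneg (x : Fin n → ℂ) : 0 ≤ nsq x := Finset.sum_nonneg fun _ _ => Complex.normSq_nonneg _

lemma rb_smooth (ε : ℝ) : ContDiff ℝ ∞ (rb ε : (Fin n → ℂ) → ℝ) :=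
  Real.smoothTransition.contDiff.comp (contDiff_const.sub nsq_smooth)

lemma rb_nonneg (ε : ℝ) (x : Fin n → ℂ) : 0 ≤ rb ε x := Real.smoothTransition.nonneg _

lemma norm_lt_of_nsq {ε : ℝ} (hε : 0 < ε) {x : Fin n → ℂ} (h : nsq x < ε ^ 2) : ‖x‖ < ε := by
  rw [pi_norm_lt_iff hε]
  intro j
  have : Complex.normSq (x j) ≤ nsq x :=
    Finset.single_le_sum (f := fun j => Complex.normSq (x j)) (fun _ _ => Complex.normSq_nonneg _)
      (Finset.mem_univ j)
  rw [Complex.normSq_eq_norm_sq] at this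
  exact lt_of_pow_lt_pow_left₀ 2 hε.le (this.trans_lt h)

lemma rb_supp {ε : ℝ} (hε : 0 < ε) :
    Function.support (rb ε : (Fin n → ℂ) → ℝ) ⊆ Metric.ball 0 ε := by
  intro x hx
  rw [mem_ball_zero_iff]
  apply norm_lt_of_nsq hε
  by_contra h
  exact hx (Real.smoothTransition.zero_of_nonpos (by linarith))

lemma rb_cpt {ε : ℝ} (hε : 0 < ε) : HasCompactSupport (rb ε : (Fin n → ℂ) → ℝ) :=
  HasCompactSupport.of_support_subset_isCompact (isCompact_closedBall 0 ε)
    ((rb_supp hε).trans Metric.ball_subset_closedBall)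

lemma rb_int_pos {ε : ℝ} (hε : 0 < ε) : 0 < ∫ y : Fin n → ℂ, rb ε y := by
  apply (rb_smooth ε).continuous.integral_pos_of_hasCompactSupport_nonneg_nonzero (rb_cpt hε)
    (rb_nonneg ε) (x := 0)
  refine (Real.smoothTransition.pos_of_pos ?_).ne'
  simp [nsq]; positivity

lemma rho_smooth (ε : ℝ) : ContDiff ℝ ∞ (rho ε : (Fin n → ℂ) → ℝ) :=
  contDiff_const.mul (rb_smooth ε)

lemma rho_nonneg {ε : ℝ} (hε : 0 < ε) (x : Fin n → ℂ) : 0 ≤ rho ε x :=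
  mul_nonneg (inv_nonneg.mpr (rb_int_pos hε).le) (rb_nonneg ε x)

lemma rho_int {ε : ℝ} (hε : 0 < ε) : ∫ y : Fin n → ℂ, rho ε y = 1 := by
  unfold rho; rw [integral_const_mul]; exact inv_mul_cancel₀ (rb_int_pos hε).ne'

lemma rho_supp {ε : ℝ} (hε : 0 < ε) :
    Function.support (rho ε : (Fin n → ℂ) → ℝ) ⊆ Metric.ball 0 ε := by
  intro x hx; apply rb_supp hε; intro h; exact hx (by simp [rho, h])

lemma rho_cpt {ε : ℝ} (hε : 0 < ε) : HasCompactSupport (rho ε : (Fin n → ℂ) → ℝ) :=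
  HasCompactSupport.of_support_subset_isCompact (isCompact_closedBall 0 ε)
    ((rho_supp hε).trans Metric.ball_subset_closedBall)

lemma rho_zero {ε : ℝ} (hε : 0 < ε) {x : Fin n → ℂ} (hx : ε ≤ ‖x‖) : rho ε x = 0 := by
  by_contra h
  have := rho_supp hε h
  rw [mem_ball_zero_iff] at this; linarith

lemma rho_circ (ε : ℝ) {c : ℂ} (hc : ‖c‖ = 1) (x : Fin n → ℂ) : rho ε (c • x) = rho ε x := by
  simp [rho, rb, nsq, Complex.normSq_eq_norm_sq, hc]

lemma rho_even (ε : ℝ) (x : Fin n → ℂ) : rho ε (-x) = rho ε x := by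
  have := rho_circ ε (c := -1) (by simp) x
  simpa using this

lemma rho_sub (ε : ℝ) (x y : Fin n → ℂ) : rho ε (x - y) = rho ε (y - x) := by
  rw [← rho_even, neg_sub]

/-- complex version of rho -/
def rhoC (ε : ℝ) (x : Fin n → ℂ) : ℂ := (rho ε x : ℂ)

lemma rhoC_tst {ε : ℝ} (hε : 0 < ε) : Tst (Metric.closedBall 0 ε) (rhoC ε : (Fin n → ℂ) → ℂ) := by
  have hs : Function.support (rhoC ε : (Fin n → ℂ) → ℂ) ⊆ Metric.closedBall 0 ε := by
    intro x hx
    apply Metric.ball_subset_closedBall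
    apply rho_supp hε; intro h; exact hx (by simp [rhoC, h])
  refine ⟨?_, HasCompactSupport.of_support_subset_isCompact (isCompact_closedBall 0 ε) hs,
    closure_minimal hs Metric.isClosed_closedBall⟩
  exact contDiff_iff_contDiffAt.mpr fun x => ((rho_smooth ε).contDiffAt).toC

/-- mollification / convolution -/
def mol (g k : (Fin n → ℂ) → ℂ) (x : Fin n → ℂ) : ℂ := ∫ t, g t * k (x - t)

lemma mol_eq (g k : (Fin n → ℂ) → ℂ) :
    mol g k = convolution g k (ContinuousLinearMap.mul ℝ ℂ) volume := by
  ext x; simp [mol, convolution]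

variable {g k G : (Fin n → ℂ) → ℂ} {D : Set (Fin n → ℂ)}

lemma mol_smooth (hg : LocallyIntegrable g) (hk : Tst D k) : ContDiff ℝ ∞ (mol g k) := by
  rw [mol_eq]
  exact hk.cpt.contDiff_convolution_right _ hg hk.smooth

lemma mol_fderiv (hg : LocallyIntegrable g) (hk : Tst D k) (v x : Fin n → ℂ) :
    fderiv ℝ (mol g k) x v = mol g (fun y => fderiv ℝ k y v) x := by
  have h1 := hk.cpt.hasFDerivAt_convolution_right (ContinuousLinearMap.mul ℝ ℂ) hg
    (hk.smooth.of_le (by simp)) x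
  rw [mol_eq, h1.fderiv, convolution_precompR_apply _ hg (hk.cpt.fderiv ℝ)
    (hk.smooth.continuous_fderiv (by simp)), mol_eq]

lemma mol_integrand (hg : LocallyIntegrable g) (hk : Continuous k) (hc : HasCompactSupport k)
    (x : Fin n → ℂ) : Integrable (fun t => g t * k (x - t)) := by
  have := hc.convolutionExists_right (ContinuousLinearMap.mul ℝ ℂ) hg hk x
  simpa [ConvolutionExistsAt] using this

lemma mol_wderBar (hg : LocallyIntegrable g) (hk : Tst D k) (v x : Fin n → ℂ) :
    wderBar (mol g k) v x = mol g (fun y => wderBar k v y) x := by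
  have hf : ∀ v, Integrable (fun t => g t * fderiv ℝ k (x - t) v) := fun v =>
    mol_integrand (k := fun y => fderiv ℝ k y v) hg
      ((hk.smooth.continuous_fderiv (by simp)).clm_apply continuous_const)
      (hk.cpt.fderiv_apply (𝕜 := ℝ) v) x
  unfold wderBar
  rw [mol_fderiv hg hk, mol_fderiv hg hk]
  unfold mol
  rw [← integral_const_mul, ← integral_add (hf v) ((hf (Complex.I • v)).const_mul _),
    ← integral_const_mul]
  congr 1; ext t; ring

lemma mol_wder (hg : LocallyIntegrable g) (hk : Tst D k) (v x : Fin n → ℂ) :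
    wder (mol g k) v x = mol g (fun y => wder k v y) x := by
  have hf : ∀ v, Integrable (fun t => g t * fderiv ℝ k (x - t) v) := fun v =>
    mol_integrand (k := fun y => fderiv ℝ k y v) hg
      ((hk.smooth.continuous_fderiv (by simp)).clm_apply continuous_const)
      (hk.cpt.fderiv_apply (𝕜 := ℝ) v) x
  unfold wder
  rw [mol_fderiv hg hk, mol_fderiv hg hk]
  unfold mol
  rw [← integral_const_mul, ← integral_sub (hf v) ((hf (Complex.I • v)).const_mul _),
    ← integral_const_mul]
  congr 1; ext t; ring

lemma mol_comm (g k : (Fin n → ℂ) → ℂ) : mol g k = mol k g := by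
  ext x
  unfold mol
  rw [← integral_sub_left_eq_self _ volume x]
  congr 1; ext t; rw [sub_sub_cancel, mul_comm]

/-- moving a mollifier. -/
lemma mol_pair {ε : ℝ} (hε : 0 < ε) (hg : Integrable g) (hG : Integrable G) :
    ∫ x, mol g (rhoC ε) x * G x = ∫ t, g t * mol G (rhoC ε) t := by
  obtain ⟨C, hC⟩ := (rhoC_tst (n := n) hε).cont.bounded_above_of_compact_support (rhoC_tst hε).cpt
  have hI : Integrable (Function.uncurry fun (x t : Fin n → ℂ) => g t * rhoC ε (x - t) * G x)
      (volume.prod volume) := by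
    refine Integrable.mono' ((hG.norm.mul_prod hg.norm).const_mul C) ?_ ?_
    · refine ((hg.1.comp_snd).mul ?_).mul hG.1.comp_fst
      exact ((rhoC_tst hε).cont.comp (continuous_fst.sub continuous_snd)).aestronglyMeasurable
    · refine Eventually.of_forall fun ⟨x, t⟩ => ?_
      simp only [Function.uncurry, norm_mul]
      have := hC (x - t)
      have : ‖g t‖ * ‖G x‖ * ‖rhoC ε (x - t)‖ ≤ ‖g t‖ * ‖G x‖ * C := by gcongr
      linarith
  have := integral_integral_swap hI
  unfold mol
  simp only [← integral_mul_const, ← integral_const_mul]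
  rw [this]
  congr 1; ext t; congr 1; ext x
  rw [rhoC, rhoC, rho_sub]; ring

lemma rho_translate_int {ε : ℝ} (hε : 0 < ε) (x : Fin n → ℂ) :
    ∫ t, rho ε (x - t) = 1 := by
  rw [integral_sub_left_eq_self (fun t => rho ε t) volume x, rho_int hε]

lemma jensen {μ : Measure (Fin n → ℂ)} {r f : (Fin n → ℂ) → ℝ} (hr : ∀ x, 0 ≤ r x)
    (h1 : ∫ x, r x ∂μ = 1) (hi1 : Integrable (fun x => r x * f x) μ)
    (hi2 : Integrable (fun x => r x * f x ^ 2) μ) :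
    (∫ x, r x * f x ∂μ) ^ 2 ≤ ∫ x, r x * f x ^ 2 ∂μ := by
  have hi0 : Integrable r μ := by
    by_contra h; rw [integral_undef h] at h1; norm_num at h1
  set m := ∫ x, r x * f x ∂μ with hm
  have : 0 ≤ ∫ x, r x * (f x - m) ^ 2 ∂μ :=
    integral_nonneg fun x => mul_nonneg (hr x) (sq_nonneg _)
  have e : ∀ x, r x * (f x - m) ^ 2 = r x * f x ^ 2 - (2 * m) * (r x * f x) + m ^ 2 * r x := by
    intro x; ring
  simp only [e] at this
  have e1 : ∫ x, (r x * f x ^ 2 - (2 * m) * (r x * f x) + m ^ 2 * r x) ∂μ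
      = (∫ x, r x * f x ^ 2 ∂μ) - 2 * m * m + m ^ 2 := by
    have hi3 : Integrable (fun x => r x * f x ^ 2 - (2 * m) * (r x * f x)) μ :=
      hi2.sub (hi1.const_mul _)
    rw [integral_add hi3 (hi0.const_mul _),
      integral_sub hi2 (hi1.const_mul _), integral_const_mul, integral_const_mul, h1, ← hm]
    ring
  rw [e1] at this
  nlinarith

/-- The map `x ↦ c x`, `|c| = 1`, preserves volume. -/
lemma mp_circ {c : ℂ} (hc : ‖c‖ = 1) :
    MeasurePreserving (fun x : Fin n → ℂ => c • x) volume volume := by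
  have h1 : MeasurePreserving (fun z : ℂ => c * z) volume volume := by
    have hc' : c ∈ Submonoid.unitSphere ℂ := by simp [Submonoid.unitSphere, hc]
    have := (rotation ⟨c, hc'⟩).measurePreserving
    exact this
  exact volume_preserving_pi (fun _ : Fin n => h1)

end Moll

section Holo
variable {n : ℕ} {D : Set (Fin n → ℂ)} {f h : (Fin n → ℂ) → ℂ}

lemma circle_mean {x y : Fin n → ℂ} {ε : ℝ} (hD : IsOpen D) (hf : DifferentiableOn ℂ f D)
    (hx : Metric.closedBall x ε ⊆ D) (hy : ‖y‖ ≤ ε) :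
    ∫ θ in (0:ℝ)..(2 * Real.pi), f (x - circleMap 0 1 θ • y) = (2 * Real.pi) • f x := by
  have hmem : ∀ c : ℂ, ‖c‖ ≤ 1 → x - c • y ∈ D := by
    intro c hc
    apply hx
    rw [Metric.mem_closedBall, dist_eq_norm]
    have : ‖x - c • y - x‖ = ‖c‖ * ‖y‖ := by rw [sub_sub_cancel_left, norm_neg, norm_smul]
    rw [this]; nlinarith [norm_nonneg y, norm_nonneg c]
  have hda : ∀ c : ℂ, ‖c‖ ≤ 1 → DifferentiableAt ℂ (fun c : ℂ => f (x - c • y)) c := by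
    intro c hc
    have h1 : DifferentiableAt ℂ f (x - c • y) :=
      hf.differentiableAt (hD.mem_nhds (hmem c hc))
    exact DifferentiableAt.comp c h1 (by fun_prop)
  have := circleAverage_of_differentiable_on_off_countable (f := fun c : ℂ => f (x - c • y))
    (R := 1) (c := 0) (s := ∅) (by simp)
    (fun c hc => (hda c (by simpa using hc)).continuousAt.continuousWithinAt)
    (fun c hc => hda c (by have h1 := hc.1; simp at h1; exact h1.le))
  rw [Real.circleAverage_def] at this
  simp only [zero_smul, sub_zero] at this
  rw [← this, smul_smul, mul_inv_cancel₀ (by positivity), one_smul]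

lemma mean_value {x : Fin n → ℂ} {ε : ℝ} (hε : 0 < ε) (hD : IsOpen D) (hf : DifferentiableOn ℂ f D)
    (hx : Metric.closedBall x ε ⊆ D) : mol f (rhoC ε) x = f x := by
  rw [mol_comm]
  set F : ℝ → (Fin n → ℂ) → ℂ := fun θ t => rhoC ε t * f (x - circleMap 0 1 θ • t) with hF
  have hcm : ∀ θ, ‖circleMap 0 1 θ‖ = 1 := by intro θ; simp
  have hz : ∀ t : Fin n → ℂ, ε < ‖t‖ → rhoC ε t = 0 := by
    intro t ht; simp [rhoC, rho_zero hε ht.le]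
  have hcont : Continuous (Function.uncurry F) := by
    rw [continuous_iff_continuousAt]
    rintro ⟨θ, t⟩
    by_cases ht : ‖t‖ ≤ ε
    · have hmem : x - circleMap 0 1 θ • t ∈ D := by
        apply hx
        rw [Metric.mem_closedBall, dist_eq_norm, sub_sub_cancel_left, norm_neg, norm_smul, hcm]
        linarith
      have h1 : ContinuousAt f (x - circleMap 0 1 θ • t) :=
        (hf.differentiableAt (hD.mem_nhds hmem)).continuousAt
      have h2 : ContinuousAt (fun p : ℝ × (Fin n → ℂ) => x - circleMap 0 1 p.1 • p.2) (θ, t) := by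
        have := continuous_circleMap 0 1
        fun_prop
      have h3 : ContinuousAt (fun p : ℝ × (Fin n → ℂ) => rhoC ε p.2) (θ, t) :=
        ((rhoC_tst hε).cont.comp continuous_snd).continuousAt
      exact h3.mul (ContinuousAt.comp (f := fun p : ℝ × (Fin n → ℂ) => x - circleMap 0 1 p.1 • p.2)
        (x := (θ, t)) (g := f) h1 h2)
    · push Not at ht
      have : Function.uncurry F =ᶠ[𝓝 (θ, t)] fun _ => 0 := by
        have : ∀ᶠ p : ℝ × (Fin n → ℂ) in 𝓝 (θ, t), ε < ‖p.2‖ :=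
          (continuous_snd.norm).continuousAt.eventually (lt_mem_nhds ht)
        filter_upwards [this] with p hp
        simp [Function.uncurry, F, hz p.2 hp]
      exact continuousAt_const.congr this.symm
  have hintg : Integrable (Function.uncurry F)
      ((volume.restrict (Set.uIoc 0 (2 * Real.pi))).prod volume) := by
    have : ((volume : Measure ℝ).restrict (Set.uIoc 0 (2 * Real.pi))).prod
        (volume : Measure (Fin n → ℂ))
        = (volume.prod volume).restrict (Set.uIoc 0 (2 * Real.pi) ×ˢ univ) := by
      rw [← Measure.prod_restrict, Measure.restrict_univ]
    rw [this]
    have hK : IntegrableOn (Function.uncurry F) (Set.Icc 0 (2 * Real.pi) ×ˢ Metric.closedBall 0 ε)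
        (volume.prod volume) :=
      hcont.continuousOn.integrableOn_compact (isCompact_Icc.prod (isCompact_closedBall 0 ε))
    refine IntegrableOn.of_forall_sdiff_eq_zero hK
      (measurableSet_uIoc.prod MeasurableSet.univ) ?_
    rintro ⟨θ, t⟩ ⟨⟨h1, -⟩, h2⟩
    have ht : ε < ‖t‖ := by
      by_contra hcon
      apply h2
      rw [uIoc_of_le (by positivity)] at h1
      exact ⟨⟨h1.1.le, h1.2⟩, by simpa using hcon⟩
    simp [Function.uncurry, F, hz t ht]
  have hsw := intervalIntegral_integral_swap hintg
  have hconst : ∀ θ, ∫ t, F θ t = mol (rhoC ε) f x := by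
    intro θ
    have mp := mp_circ (n := n) (hcm θ)
    have hemb : MeasurableEmbedding (fun t : Fin n → ℂ => circleMap 0 1 θ • t) := by
      have h0 : circleMap 0 1 θ ≠ 0 := by
        intro h; have := hcm θ; rw [h] at this; simp at this
      exact (Homeomorph.smulOfNeZero _ h0).measurableEmbedding
    have := mp.integral_comp hemb (fun t => rhoC ε t * f (x - t))
    rw [mol, ← this]
    congr 1; ext t
    simp only [F, rhoC, rho_circ ε (hcm θ)]
  simp only [hconst] at hsw
  have hr : ∀ t, ∫ θ in (0:ℝ)..(2 * Real.pi), F θ t = ((2 * Real.pi : ℝ) * f x) * rhoC ε t := by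
    intro t
    simp only [F]
    rw [intervalIntegral.integral_const_mul]
    by_cases ht : ‖t‖ ≤ ε
    · rw [circle_mean hD hf hx ht]; simp; ring
    · rw [hz t (by linarith)]; simp
  simp only [hr] at hsw
  rw [integral_const_mul] at hsw
  have h1 : ∫ t : Fin n → ℂ, rhoC ε t = 1 := by
    unfold rhoC; rw [integral_complex_ofReal, rho_int hε]; simp
  rw [h1] at hsw
  simp only [intervalIntegral.integral_const, sub_zero, mul_one] at hsw
  have h2 : ((2 * Real.pi : ℝ) : ℂ) ≠ 0 := by
    norm_cast; positivity
  rw [Complex.real_smul] at hsw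
  exact mul_left_cancel₀ h2 hsw

lemma mol_unif {G : (Fin n → ℂ) → ℂ} (hG : UniformContinuous G) {η : ℝ} (hη : 0 < η) :
    ∃ b0 > 0, ∀ b, 0 < b → b < b0 → ∀ x, ‖mol G (rhoC b) x - G x‖ ≤ η := by
  obtain ⟨b0, hb0, h⟩ := Metric.uniformContinuous_iff.mp hG η hη
  refine ⟨b0, hb0, fun b hb hbb x => ?_⟩
  have hli : LocallyIntegrable G := hG.continuous.locallyIntegrable
  have h1 := mol_integrand hli (rhoC_tst hb).cont (rhoC_tst hb).cpt x
  have hli2 : LocallyIntegrable (fun _ : Fin n → ℂ => G x) := continuous_const.locallyIntegrable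
  have h2 := mol_integrand hli2 (rhoC_tst hb).cont (rhoC_tst hb).cpt x
  have e1 : G x = ∫ t, G x * rhoC b (x - t) := by
    unfold rhoC
    rw [integral_const_mul, integral_complex_ofReal, rho_translate_int hb]; simp
  have hri : Integrable (fun t => rho b (x - t)) := by
    by_contra hcon
    have := rho_translate_int hb x
    rw [integral_undef hcon] at this; norm_num at this
  have e2 : mol G (rhoC b) x - G x = ∫ t, (G t * rhoC b (x - t) - G x * rhoC b (x - t)) := by
    rw [integral_sub h1 h2, ← e1, mol]
  rw [e2]
  calc ‖∫ t, (G t * rhoC b (x - t) - G x * rhoC b (x - t))‖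
      ≤ ∫ t, η * rho b (x - t) := by
        apply norm_integral_le_of_norm_le (hri.const_mul _)
        refine Eventually.of_forall fun t => ?_
        rw [← sub_mul, norm_mul, rhoC, Complex.norm_real, Real.norm_eq_abs,
          abs_of_nonneg (rho_nonneg hb _)]
        by_cases ht : ‖x - t‖ < b
        · have hd : dist t x < b0 := by rw [dist_comm, dist_eq_norm]; linarith
          have := (h hd).le
          rw [dist_eq_norm] at this
          exact mul_le_mul_of_nonneg_right this (rho_nonneg hb _)
        · rw [rho_zero hb (by linarith)]; simp
    _ = η := by rw [integral_const_mul, rho_translate_int hb, mul_one]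

/-- Weakly holomorphic. -/
structure WH (D : Set (Fin n → ℂ)) (h : (Fin n → ℂ) → ℂ) : Prop where
  li : LocallyIntegrableOn h D
  weak : ∀ ζ, Tst D ζ → ∀ j, ∫ x, h x * wderBar ζ (ee j) x = 0

lemma holo_of_wderBar {x : Fin n → ℂ} (hf : DifferentiableAt ℝ f x)
    (h0 : ∀ j, wderBar f (ee j) x = 0) : DifferentiableAt ℂ f x := by
  have hv : ∀ v, wderBar f v x = 0 := by
    intro v; rw [wderBar_dir_sum]; simp [h0]
  have hI : ∀ v, fderiv ℝ f x (Complex.I • v) = Complex.I * fderiv ℝ f x v := by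
    intro v
    have := hv v
    unfold wderBar at this
    have h2 : fderiv ℝ f x v + Complex.I * fderiv ℝ f x (Complex.I • v) = 0 := by
      simpa using this
    linear_combination (-Complex.I) * h2 + fderiv ℝ f x (Complex.I • v) * Complex.I_mul_I
  rw [differentiableAt_iff_restrictScalars ℝ hf]
  let L : (Fin n → ℂ) →ₗ[ℂ] ℂ :=
    { toFun := fun v => fderiv ℝ f x v
      map_add' := fun a b => map_add _ a b
      map_smul' := fun c v => by
        simp only [RingHom.id_apply]
        conv_lhs => rw [← Complex.re_add_im c, add_smul, mul_smul, map_add]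
        have e1 : ((c.re : ℂ) • v) = c.re • v := by simp
        have e2 : ((c.im : ℂ) • (Complex.I • v)) = c.im • (Complex.I • v) :=
          (Complex.coe_smul c.im (Complex.I • v))
        rw [e1, e2, map_smul, map_smul, hI]
        conv_rhs => rw [← Complex.re_add_im c]
        simp only [Complex.real_smul, smul_eq_mul]; ring }
  refine ⟨⟨L, (fderiv ℝ f x).continuous⟩, ?_⟩
  ext v; rfl

lemma wderBar_refl {k : (Fin n → ℂ) → ℂ} (hk : ContDiff ℝ ∞ k) (x v t : Fin n → ℂ) :
    wderBar (fun s => k (x - s)) v t = - wderBar k v (x - t) := by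
  have h1 : HasFDerivAt (fun s => k (x - s)) ((fderiv ℝ k (x - t)).comp
      (-(ContinuousLinearMap.id ℝ (Fin n → ℂ)))) t := by
    have := (hk.contDiffAt (x := x - t)).dR.hasFDerivAt
    exact HasFDerivAt.comp t this ((hasFDerivAt_id t).const_sub x)
  simp only [wderBar, h1.fderiv]
  simp; ring

lemma tst_refl {k : (Fin n → ℂ) → ℂ} {a : ℝ} (hk : Tst (Metric.closedBall 0 a) k) (x : Fin n → ℂ) :
    Tst (Metric.closedBall x a) (fun t => k (x - t)) := by
  have hs : Function.support (fun t => k (x - t)) ⊆ Metric.closedBall x a := by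
    intro t ht
    have := hk.sub (subset_tsupport _ ht)
    rw [mem_closedBall_zero_iff] at this
    rwa [Metric.mem_closedBall, dist_comm, dist_eq_norm]
  refine ⟨hk.smooth.comp (contDiff_const.sub contDiff_id),
    HasCompactSupport.of_support_subset_isCompact (isCompact_closedBall x a) hs,
    closure_minimal hs Metric.isClosed_closedBall⟩

lemma WH.ind (hh : WH D h) {K : Set (Fin n → ℂ)} (hK : IsCompact K) (hKD : K ⊆ D) :
    Integrable (K.indicator h) := by
  rw [integrable_indicator_iff hK.measurableSet]
  exact hh.li.integrableOn_compact_subset hKD hK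

lemma mol_cut {K : Set (Fin n → ℂ)} {k : (Fin n → ℂ) → ℂ} {a : ℝ} {x : Fin n → ℂ}
    (hk : Tst (Metric.closedBall 0 a) k)
    (hx : Metric.closedBall x a ⊆ K) : mol (K.indicator h) k x = mol h k x := by
  unfold mol
  congr 1; ext t
  by_cases ht : t ∈ K
  · rw [indicator_of_mem ht]
  · have : k (x - t) = 0 := (tst_refl hk x).zero_off (fun h => ht (hx h))
    rw [this]; simp

lemma WH.mol_holo (hh : WH D h) {K : Set (Fin n → ℂ)} (hK : IsCompact K) (hKD : K ⊆ D)
    {a : ℝ} (ha : 0 < a) {x : Fin n → ℂ} (hx : Metric.closedBall x a ⊆ K) :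
    DifferentiableAt ℂ (mol (K.indicator h) (rhoC a)) x := by
  have hi := (hh.ind hK hKD).locallyIntegrable
  apply holo_of_wderBar (mol_smooth hi (rhoC_tst ha)).contDiffAt.dR
  intro j
  rw [mol_wderBar hi (rhoC_tst ha), mol_cut ((rhoC_tst ha).wderBar (ee j)) hx]
  have := hh.weak _ ((tst_refl (rhoC_tst ha) x).mono (hx.trans hKD)) j
  simp only [wderBar_refl (rhoC_tst ha).smooth] at this
  unfold mol
  simpa [integral_neg] using this

lemma mol_mol {g : (Fin n → ℂ) → ℂ} (hg : Integrable g) {a b : ℝ} (ha : 0 < a) (hb : 0 < b)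
    (x : Fin n → ℂ) : mol (mol g (rhoC a)) (rhoC b) x = mol (mol g (rhoC b)) (rhoC a) x := by
  have e : ∀ {a b : ℝ}, 0 < a → 0 < b → mol (mol g (rhoC a)) (rhoC b) x
      = ∫ t, g t * mol (fun s => rhoC b (x - s)) (rhoC a) t := by
    intro a b ha hb
    rw [mol, mol_pair ha hg (tst_refl (rhoC_tst hb) x).integrable]
  rw [e ha hb, e hb ha]
  congr 1; ext t; congr 1
  unfold mol
  rw [← integral_sub_left_eq_self _ volume (x + t)]
  congr 1; ext s
  have e1 : x - (x + t - s) = -(t - s) := by abel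
  have e2 : t - (x + t - s) = -(x - s) := by abel
  simp only [e1, e2, rhoC, rho_even]; ring

lemma WH.indep (hh : WH D h) {x : Fin n → ℂ} {R a b : ℝ} (hR : Metric.closedBall x R ⊆ D)
    (ha : 0 < a) (hb : 0 < b) (hab : a + b < R) : mol h (rhoC a) x = mol h (rhoC b) x := by
  set K := Metric.closedBall x R
  have hK : IsCompact K := isCompact_closedBall x R
  have key : ∀ {a b : ℝ}, 0 < a → 0 < b → a + b < R →
      mol (mol (K.indicator h) (rhoC a)) (rhoC b) x = mol h (rhoC a) x := by
    intro a b ha hb hab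
    rw [mean_value hb (D := Metric.ball x (R - a)) Metric.isOpen_ball,
      mol_cut (rhoC_tst ha) (Metric.closedBall_subset_closedBall (by linarith))]
    · intro y hy
      refine (hh.mol_holo hK hR ha ?_).differentiableWithinAt
      apply Metric.closedBall_subset_closedBall'
      rw [Metric.mem_ball] at hy; linarith
    · apply Metric.closedBall_subset_ball; linarith
  rw [← key ha hb hab, ← key hb ha (by linarith), mol_mol (hh.ind hK hR) ha hb]

/-- Weyl lemma for `∂̄`. -/
lemma WH.holo (hD : IsOpen D) (hh : WH D h) :
    ∃ f, DifferentiableOn ℂ f D ∧ ∀ᵐ x, x ∈ D → h x = f x := by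
  have hR : ∀ x : Fin n → ℂ, ∃ R : ℝ, 0 < R ∧ (x ∈ D → Metric.closedBall x R ⊆ D) := by
    intro x
    by_cases hx : x ∈ D
    · obtain ⟨R, hR, h⟩ := Metric.nhds_basis_closedBall.mem_iff.mp (hD.mem_nhds hx)
      exact ⟨R, hR, fun _ => h⟩
    · exact ⟨1, one_pos, fun h => absurd h hx⟩
  choose R hR0 hRD using hR
  set f : (Fin n → ℂ) → ℂ := fun x => mol h (rhoC (R x / 2)) x with hf
  have hfa : ∀ x ∈ D, ∀ R' a, 0 < a → a < R' → Metric.closedBall x R' ⊆ D →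
      f x = mol h (rhoC a) x := by
    intro x hx R' a ha haR hR'
    set c := min ((R' - a) / 2) (R x / 4)
    have hc : 0 < c := by have := hR0 x; apply lt_min <;> linarith
    have hc1 : c ≤ (R' - a) / 2 := min_le_left _ _
    have hc2 : c ≤ R x / 4 := min_le_right _ _
    rw [hh.indep hR' ha hc (by linarith)]
    exact hh.indep (hRD x hx) (by have := hR0 x; linarith) hc (by have := hR0 x; linarith)
  have hdf : DifferentiableOn ℂ f D := by
    intro x0 hx0
    have hr := hR0 x0
    set r := R x0
    have hev : f =ᶠ[𝓝 x0] mol ((Metric.closedBall x0 r).indicator h) (rhoC (r / 3)) := by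
      filter_upwards [Metric.ball_mem_nhds x0 (show (0:ℝ) < r / 3 by linarith)] with x hx
      rw [Metric.mem_ball] at hx
      have hsub : Metric.closedBall x (r / 2) ⊆ Metric.closedBall x0 r :=
        Metric.closedBall_subset_closedBall' (by linarith)
      have hxD : x ∈ D := hRD x0 hx0 (Metric.mem_closedBall.mpr (by linarith))
      rw [hfa x hxD (r / 2) (r / 3) (by linarith) (by linarith) (hsub.trans (hRD x0 hx0)),
        mol_cut (rhoC_tst (by linarith))
          ((Metric.closedBall_subset_closedBall (by linarith)).trans hsub)]
    have := hh.mol_holo (isCompact_closedBall x0 r) (hRD x0 hx0) (show 0 < r / 3 by linarith)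
      (x := x0) (Metric.closedBall_subset_closedBall (by linarith))
    exact (this.congr_of_eventuallyEq hev).differentiableWithinAt
  refine ⟨f, hdf, ?_⟩
  have hfli : LocallyIntegrableOn f D :=
    hdf.continuousOn.locallyIntegrableOn hD.measurableSet
  have := hD.ae_eq_zero_of_integral_contDiff_smul_eq_zero (μ := volume) (f := fun x => h x - f x)
    (hh.li.sub hfli) ?_
  · filter_upwards [this] with x hx hxD
    exact sub_eq_zero.mp (hx hxD)
  intro g hg hgc hgD
  set G : (Fin n → ℂ) → ℂ := fun x => (g x : ℂ) with hGdef
  have hGT : Tst D G := by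
    have hs : tsupport G ⊆ tsupport g := by
      apply closure_mono; intro x hx hz; exact hx (by simp [G, hz])
    exact ⟨contDiff_iff_contDiffAt.mpr fun x => (hg.contDiffAt).toC,
      hgc.mono' ((subset_tsupport _).trans hs), hs.trans hgD⟩
  obtain ⟨δ, hδ, hδD⟩ := hGT.cpt.isCompact.exists_cthickening_subset_open hD hGT.sub
  set K := Metric.cthickening δ (tsupport G) with hKdef
  have hK : IsCompact K := hGT.cpt.isCompact.cthickening
  have hind := hh.ind hK hδD
  have hb : ∀ b, 0 < b → b < δ → ∫ x, f x * G x = ∫ t, K.indicator h t * mol G (rhoC b) t := by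
    intro b hb0 hb
    rw [← mol_pair hb0 hind hGT.integrable]
    congr 1; ext x
    by_cases hx : x ∈ tsupport G
    · have hsub : Metric.closedBall x δ ⊆ K := Metric.closedBall_subset_cthickening hx δ
      rw [hfa x (hGT.sub hx) δ b hb0 hb (hsub.trans hδD),
        mol_cut (rhoC_tst hb0) ((Metric.closedBall_subset_closedBall hb.le).trans hsub)]
    · rw [image_eq_zero_of_notMem_tsupport hx]; simp
  have hhG : ∫ x, h x * G x = ∫ x, K.indicator h x * G x := by
    congr 1; ext x
    by_cases hx : x ∈ K
    · rw [indicator_of_mem hx]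
    · have : x ∉ tsupport G := fun hh => hx (Metric.self_subset_cthickening _ hh)
      rw [image_eq_zero_of_notMem_tsupport this]; simp
  have hIG : Integrable (fun x => K.indicator h x * G x) := by
    obtain ⟨C, hC⟩ := hGT.cont.bounded_above_of_compact_support hGT.cpt
    exact hind.mul_bdd (c := C) hGT.cont.aestronglyMeasurable (Eventually.of_forall hC)
  have hEq : ∫ x, h x * G x = ∫ x, f x * G x := by
    rw [hhG, ← sub_eq_zero, ← norm_le_zero_iff]
    apply le_of_forall_pos_le_add
    intro η hη
    rw [zero_add]
    set N := ∫ x, ‖K.indicator h x‖ with hN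
    have hN0 : 0 ≤ N := integral_nonneg fun x => norm_nonneg _
    obtain ⟨b0, hb0, hbb⟩ := mol_unif (hGT.cpt.uniformContinuous_of_continuous hGT.cont)
      (show 0 < η / (N + 1) by positivity)
    set b := min b0 δ / 2
    have hbp : 0 < b := by have := lt_min hb0 hδ; simp only [b]; linarith
    have hb1 : b < b0 := by
      have := min_le_left b0 δ; simp only [b] at hbp ⊢; linarith
    have hb2 : b < δ := by
      have := min_le_right b0 δ; simp only [b] at hbp ⊢; linarith
    have hmolG : Integrable (fun t => K.indicator h t * mol G (rhoC b) t) := by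
      obtain ⟨C, hC⟩ := hGT.cont.bounded_above_of_compact_support hGT.cpt
      have hms := mol_smooth (hGT.integrable.locallyIntegrable) (rhoC_tst (n := n) hbp)
      refine hind.mul_bdd (c := C + η / (N + 1)) hms.continuous.aestronglyMeasurable
        (Eventually.of_forall fun x => ?_)
      calc ‖mol G (rhoC b) x‖ = ‖G x + (mol G (rhoC b) x - G x)‖ := by congr 1; ring
        _ ≤ _ := (norm_add_le _ _).trans (add_le_add (hC x) (hbb b hbp hb1 x))
    rw [hb b hbp hb2, ← integral_sub hIG hmolG]
    calc ‖∫ x, (K.indicator h x * G x - K.indicator h x * mol G (rhoC b) x)‖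
        ≤ ∫ x, ‖K.indicator h x‖ * (η / (N + 1)) := by
          apply norm_integral_le_of_norm_le (hind.norm.mul_const _)
          refine Eventually.of_forall fun x => ?_
          rw [← mul_sub, norm_mul, norm_sub_rev]
          exact mul_le_mul_of_nonneg_left (hbb b hbp hb1 x) (norm_nonneg _)
      _ = N * (η / (N + 1)) := by rw [integral_mul_const]
      _ ≤ η := by
          rw [mul_div_assoc', div_le_iff₀ (by positivity)]; nlinarith
  have hfG : Integrable (fun x => f x * G x) := by
    have hc : Continuous (fun x => f x * G x) := by
      rw [continuous_iff_continuousAt]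
      intro x
      by_cases hx : x ∈ tsupport G
      · exact ((hdf.differentiableAt (hD.mem_nhds (hGT.sub hx))).continuousAt).mul
          hGT.cont.continuousAt
      · have : (fun x => f x * G x) =ᶠ[𝓝 x] fun _ => 0 := by
          filter_upwards [notMem_tsupport_iff_eventuallyEq.mp hx] with y hy
          simp [hy]
        exact continuousAt_const.congr this.symm
    exact hc.integrable_of_hasCompactSupport hGT.cpt.mul_left
  have hhG' : Integrable (fun x => h x * G x) := by
    refine hIG.congr (Eventually.of_forall fun x => ?_)
    by_cases hx : x ∈ K
    · simp only [indicator_of_mem hx]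
    · have : x ∉ tsupport G := fun hh => hx (Metric.self_subset_cthickening _ hh)
      simp only [image_eq_zero_of_notMem_tsupport this]; simp
  have : ∀ x, g x • (h x - f x) = h x * G x - f x * G x := by
    intro x; simp [G]; ring
  simp only [this]
  rw [integral_sub hhG' hfG, hEq, sub_self]

end Holo

section L2tools
variable {n : ℕ} {D : Set (Fin n → ℂ)}

lemma cs_norm {α : Type*} [MeasurableSpace α] {μ : Measure α} {f g : α → ℂ}
    (hf : MemLp f 2 μ) (hg : MemLp g 2 μ) :
    ∫ x, ‖f x‖ * ‖g x‖ ∂μ ≤ Real.sqrt (∫ x, ‖f x‖ ^ 2 ∂μ) * Real.sqrt (∫ x, ‖g x‖ ^ 2 ∂μ) := by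
  have := integral_mul_norm_le_Lp_mul_Lq (μ := μ) (f := f) (g := g) Real.HolderConjugate.two_two
    (by simpa using hf) (by simpa using hg)
  simpa [Real.sqrt_eq_rpow] using this

lemma cs_int {α : Type*} [MeasurableSpace α] {μ : Measure α} {f g : α → ℂ}
    (hf : MemLp f 2 μ) (hg : MemLp g 2 μ) : Integrable (fun x => ‖f x‖ * ‖g x‖) μ :=
  hf.norm.integrable_mul hg.norm

lemma cs_mul {α : Type*} [MeasurableSpace α] {μ : Measure α} {f g : α → ℂ}
    (hf : MemLp f 2 μ) (hg : MemLp g 2 μ) :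
    ‖∫ x, f x * g x ∂μ‖ ≤ Real.sqrt (∫ x, ‖f x‖ ^ 2 ∂μ) * Real.sqrt (∫ x, ‖g x‖ ^ 2 ∂μ) := by
  refine le_trans ?_ (cs_norm hf hg)
  refine (norm_integral_le_integral_norm _).trans (le_of_eq ?_)
  simp [norm_mul]

lemma sq_int {α : Type*} [MeasurableSpace α] {μ : Measure α} {f : α → ℂ}
    (hf : MemLp f 2 μ) : Integrable (fun x => ‖f x‖ ^ 2) μ :=
  (memLp_two_iff_integrable_sq_norm hf.1).mp hf

lemma Tst.memLp {ζ : (Fin n → ℂ) → ℂ} (h : Tst D ζ) : MemLp ζ 2 :=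
  h.cont.memLp_of_hasCompactSupport h.cpt

/-- real mollification -/
def molR (ε : ℝ) (f : (Fin n → ℂ) → ℝ) (x : Fin n → ℂ) : ℝ := ∫ t, f t * rho ε (x - t)

lemma molR_cast (ε : ℝ) (f : (Fin n → ℂ) → ℝ) (x : Fin n → ℂ) :
    mol (fun t => (f t : ℂ)) (rhoC ε) x = (molR ε f x : ℂ) := by
  unfold mol molR rhoC
  rw [← integral_complex_ofReal]
  congr 1; ext t; push_cast; rfl

variable {ε : ℝ}

lemma molR_integrand (hε : 0 < ε) {f : (Fin n → ℂ) → ℝ} (hf : LocallyIntegrable f)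
    (x : Fin n → ℂ) : Integrable (fun t => f t * rho ε (x - t)) := by
  have h := (rho_cpt (n := n) hε).convolutionExists_right (ContinuousLinearMap.mul ℝ ℝ) hf
    (rho_smooth ε).continuous x
  simpa [ConvolutionExistsAt] using h

lemma molR_nonneg (hε : 0 < ε) {f : (Fin n → ℂ) → ℝ} (hf : ∀ x, 0 ≤ f x) (x : Fin n → ℂ) :
    0 ≤ molR ε f x := integral_nonneg fun t => mul_nonneg (hf t) (rho_nonneg hε _)

lemma molR_eq (f : (Fin n → ℂ) → ℝ) :
    molR ε f = convolution f (rho ε) (ContinuousLinearMap.mul ℝ ℝ) volume := by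
  ext x; simp [molR, convolution]

lemma rho_integrable (hε : 0 < ε) : Integrable (rho ε : (Fin n → ℂ) → ℝ) :=
  (rho_smooth ε).continuous.integrable_of_hasCompactSupport (rho_cpt hε)

lemma molR_integrable (hε : 0 < ε) {f : (Fin n → ℂ) → ℝ} (hf : Integrable f) :
    Integrable (molR ε f) := by
  rw [molR_eq]; exact hf.integrable_convolution _ (rho_integrable hε)

lemma molR_int (hε : 0 < ε) {f : (Fin n → ℂ) → ℝ} (hf : Integrable f) :
    ∫ x, molR ε f x = ∫ x, f x := by
  rw [molR_eq, integral_convolution _ hf (rho_integrable hε), rho_int hε]; simp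

lemma molR_pair (hε : 0 < ε) {f b : (Fin n → ℂ) → ℝ} (hf : Integrable f) (hb : Integrable b) :
    ∫ x, molR ε f x * b x = ∫ x, f x * molR ε b x := by
  have := mol_pair hε hf.ofReal (G := fun x => (b x : ℂ)) hb.ofReal
  have e1 : ∀ f : (Fin n → ℂ) → ℝ, ∀ x,
    mol (fun t => ((RCLike.ofReal (f t) : ℂ))) (rhoC ε) x = (molR ε f x : ℂ) := molR_cast ε
  simp only [e1, molR_cast] at this
  have e2 : ∀ x : Fin n → ℂ, ((RCLike.ofReal (f x) : ℂ)) = (f x : ℂ) := fun x => rfl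
  simp only [e2] at this
  simp only [← Complex.ofReal_mul, integral_complex_ofReal] at this
  exact_mod_cast this

lemma molR_unif {b : (Fin n → ℂ) → ℝ} (hb : UniformContinuous b) {η : ℝ} (hη : 0 < η) :
    ∃ b0 > 0, ∀ ε, 0 < ε → ε < b0 → ∀ x, |molR ε b x - b x| ≤ η := by
  obtain ⟨b0, hb0, h⟩ := mol_unif (G := fun x => (b x : ℂ))
    (Complex.isometry_ofReal.uniformContinuous.comp hb) hη
  refine ⟨b0, hb0, fun ε h1 h2 x => ?_⟩
  have := h ε h1 h2 x
  rw [molR_cast, ← Complex.ofReal_sub, Complex.norm_real] at this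
  exact this

lemma mol_norm_le (hε : 0 < ε) (g : (Fin n → ℂ) → ℂ) (x : Fin n → ℂ) :
    ‖mol g (rhoC ε) x‖ ≤ molR ε (fun t => ‖g t‖) x := by
  unfold mol molR
  refine (norm_integral_le_integral_norm _).trans (le_of_eq ?_)
  congr 1; ext t
  rw [norm_mul, rhoC, Complex.norm_real, Real.norm_eq_abs, abs_of_nonneg (rho_nonneg hε _)]

lemma molR_sq (hε : 0 < ε) {f : (Fin n → ℂ) → ℝ} (hf : LocallyIntegrable f)
    (hf2 : LocallyIntegrable (fun x => f x ^ 2)) (x : Fin n → ℂ) :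
    (molR ε f x) ^ 2 ≤ molR ε (fun t => f t ^ 2) x := by
  have h1 := molR_integrand hε hf x
  have h2 := molR_integrand hε hf2 x
  simp only [mul_comm (f _)] at h1
  simp only [mul_comm (f _ ^ 2)] at h2
  have := jensen (fun t => rho_nonneg hε (x - t)) (rho_translate_int hε x) h1 h2
  simpa only [molR, mul_comm (rho ε _)] using this

lemma mol_sq (hε : 0 < ε) {g : (Fin n → ℂ) → ℂ} (hg : LocallyIntegrable g)
    (hg2 : LocallyIntegrable (fun x => ‖g x‖ ^ 2)) (x : Fin n → ℂ) :
    ‖mol g (rhoC ε) x‖ ^ 2 ≤ molR ε (fun t => ‖g t‖ ^ 2) x :=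
  (pow_le_pow_left₀ (norm_nonneg _) (mol_norm_le hε g x) 2).trans
    (molR_sq hε (fun y => (hg y).norm) hg2 x)

lemma mol_memLp (hε : 0 < ε) {g : (Fin n → ℂ) → ℂ} (hg : Integrable g) (hg2 : MemLp g 2) :
    MemLp (mol g (rhoC ε)) 2 := by
  have hs := mol_smooth hg.locallyIntegrable (rhoC_tst (n := n) hε)
  rw [memLp_two_iff_integrable_sq_norm hs.continuous.aestronglyMeasurable]
  refine (molR_integrable hε (sq_int hg2)).mono' (hs.continuous.norm.pow 2).aestronglyMeasurable
    (Eventually.of_forall fun x => ?_)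
  rw [Real.norm_eq_abs, abs_of_nonneg (by positivity)]
  exact mol_sq hε hg.locallyIntegrable (sq_int hg2).locallyIntegrable x

lemma mol_contr (hε : 0 < ε) {g : (Fin n → ℂ) → ℂ} (hg : Integrable g) (hg2 : MemLp g 2) :
    ∫ x, ‖mol g (rhoC ε) x‖ ^ 2 ≤ ∫ x, ‖g x‖ ^ 2 := by
  rw [← molR_int hε (sq_int hg2)]
  exact integral_mono (sq_int (mol_memLp hε hg hg2)) (molR_integrable hε (sq_int hg2))
    fun x => mol_sq hε hg.locallyIntegrable (sq_int hg2).locallyIntegrable x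

lemma molR_memLp (hε : 0 < ε) {g : (Fin n → ℂ) → ℂ} (hg : Integrable g) (hg2 : MemLp g 2) :
    MemLp (fun x => (molR ε (fun t => ‖g t‖) x : ℂ)) 2 ∧
    ∫ x, ‖(molR ε (fun t => ‖g t‖) x : ℂ)‖ ^ 2 ≤ ∫ x, ‖g x‖ ^ 2 := by
  have h1 : Integrable (fun t => (‖g t‖ : ℂ)) := hg.norm.ofReal
  have h2 : MemLp (fun t => (‖g t‖ : ℂ)) 2 := hg2.norm.ofReal
  have a := mol_memLp hε h1 h2
  have b := mol_contr hε h1 h2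
  have e : mol (fun t => (‖g t‖ : ℂ)) (rhoC ε) = fun x => (molR ε (fun t => ‖g t‖) x : ℂ) := by
    ext x; exact molR_cast _ _ _
  rw [e] at a b
  refine ⟨a, b.trans (le_of_eq ?_)⟩
  simp

/-- weighted contraction -/
lemma mol_contr_w (hε : 0 < ε) {g : (Fin n → ℂ) → ℂ} (hg : Integrable g) (hg2 : MemLp g 2)
    {b : (Fin n → ℂ) → ℝ} (hb : ∀ x, 0 ≤ b x) (hbc : Continuous b) (hbs : HasCompactSupport b) :
    ∫ x, ‖mol g (rhoC ε) x‖ ^ 2 * b x ≤ ∫ x, ‖g x‖ ^ 2 * molR ε b x := by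
  have hbi := hbc.integrable_of_hasCompactSupport hbs (μ := volume)
  obtain ⟨C, hC⟩ := hbc.bounded_above_of_compact_support hbs
  rw [← molR_pair hε (sq_int hg2) hbi]
  refine integral_mono ((sq_int (mol_memLp hε hg hg2)).mul_bdd (c := C)
    hbc.aestronglyMeasurable (Eventually.of_forall hC))
    ((molR_integrable hε (sq_int hg2)).mul_bdd (c := C)
    hbc.aestronglyMeasurable (Eventually.of_forall hC)) fun x => ?_
  exact mul_le_mul_of_nonneg_right
    (mol_sq hε hg.locallyIntegrable (sq_int hg2).locallyIntegrable x) (hb x)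

/-- commutator estimate -/
lemma mol_commut {c : (Fin n → ℂ) → ℂ} (hc : UniformContinuous c) {η : ℝ} (hη : 0 < η) :
    ∃ b0 > 0, ∀ ε, 0 < ε → ε < b0 → ∀ G : (Fin n → ℂ) → ℂ, Continuous G → ∀ x,
      ‖c x * mol G (rhoC ε) x - mol (fun t => c t * G t) (rhoC ε) x‖
        ≤ η * molR ε (fun t => ‖G t‖) x := by
  obtain ⟨b0, hb0, h⟩ := Metric.uniformContinuous_iff.mp hc η hη
  refine ⟨b0, hb0, fun ε hε hlt G hG x => ?_⟩
  have h1 := mol_integrand hG.locallyIntegrable (rhoC_tst hε).cont (rhoC_tst hε).cpt x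
  have h2 := mol_integrand (g := fun t => c t * G t) (hc.continuous.mul hG).locallyIntegrable
    (rhoC_tst hε).cont (rhoC_tst hε).cpt x
  have h3 := molR_integrand hε (f := fun t => ‖G t‖) hG.norm.locallyIntegrable x
  unfold mol molR
  rw [← integral_const_mul, ← integral_sub (h1.const_mul _) h2, ← integral_const_mul]
  apply norm_integral_le_of_norm_le (h3.const_mul _)
  refine Eventually.of_forall fun t => ?_
  have e : c x * (G t * rhoC ε (x - t)) - c t * G t * rhoC ε (x - t)
      = (c x - c t) * (G t * rhoC ε (x - t)) := by ring
  rw [e, norm_mul, norm_mul, rhoC, Complex.norm_real, Real.norm_eq_abs,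
    abs_of_nonneg (rho_nonneg hε _)]
  by_cases ht : ‖x - t‖ < ε
  · have hd : dist x t < b0 := by rw [dist_eq_norm]; linarith
    have := (h hd).le
    rw [dist_eq_norm] at this
    exact mul_le_mul_of_nonneg_right this (mul_nonneg (norm_nonneg _) (rho_nonneg hε _))
  · rw [rho_zero hε (by linarith)]; simp
end L2tools

section Regul
variable {n : ℕ} {D : Set (Fin n → ℂ)} {ζ ξ h : (Fin n → ℂ) → ℂ} {p : (Fin n → ℂ) → ℝ}

/-- `∂_j ζ + c_j ζ` -/
def twd (c : Fin n → (Fin n → ℂ) → ℂ) (ζ : (Fin n → ℂ) → ℂ) (j : Fin n) (x : Fin n → ℂ) : ℂ :=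
  wder ζ (ee j) x + c j x * ζ x

/-- the `∂_j p` -/
def pj (p : (Fin n → ℂ) → ℝ) (j : Fin n) (x : Fin n → ℂ) : ℂ := wder (fun y => (p y : ℂ)) (ee j) x

lemma Tst.twd {c : Fin n → (Fin n → ℂ) → ℂ} (hc : ∀ j, SmAt D (c j)) (h : Tst D ζ) (j : Fin n) :
    Tst D (fun x => twd c ζ j x) := (h.wder _).add (h.gmul (hc j))

lemma weak_form (hD : IsOpen D) (hp : SmR D p) (hζ : Tst D ζ) :
    ∃ ξ, Tst D ξ ∧ ∀ x, conj (dl p ξ x) * ew p x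
      = - ∑ j, wderBar (fun y => twd (pj p) ζ j y) (ee j) x := by
  have hpn := hp.neg
  set ξ : (Fin n → ℂ) → ℂ := fun x => ew (fun y => - p y) x * conj (ζ x) with hξ
  have hT : Tst D ξ := hζ.conj.gmul (ew_sm hpn)
  have hpj : ∀ j, SmAt D (pj p j) := fun j => hp.toC.wder _
  refine ⟨ξ, hT, fun x => ?_⟩
  by_cases hx : x ∈ D
  swap
  · have : ∀ j, wderBar (fun y => twd (pj p) ζ j y) (ee j) x = 0 := fun j =>
      ((hζ.twd hpj j).wderBar (ee j)).zero_off hx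
    simp only [this]
    rw [(hT.dl hp).zero_off hx]; simp
  have e1 : ∀ y ∈ D, ∀ j, ew p y * wderBar ξ (ee j) y = conj (twd (pj p) ζ j y) := by
    intro y hy j
    rw [hξ, wderBar_mul ((ew_sm hpn).d hy) (hζ.conj.dd y), wderBar_ew hpn hy,
      wderBar_conj (hζ.dd y)]
    have e2 : wderBar (fun y => ((-p y : ℝ) : ℂ)) (ee j) y = - conj (pj p j y) := by
      rw [wderBar_ofReal (hpn.d hy)]
      simp only [Complex.ofReal_neg]
      rw [wder_neg, map_neg]; rfl
    rw [e2]
    have e3 : ew p y * ew (fun y => - p y) y = 1 := by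
      simp only [ew]; rw [← Complex.ofReal_mul, ← Real.exp_add]; simp
    simp only [twd, map_add, map_mul]
    linear_combination (conj (pj p j y) * conj (ζ y) + conj (wder ζ (ee j) y)) * e3
  have e2 : ∀ j, dlj p (fun y => wderBar ξ (ee j) y) j x * ew p x
      = - conj (wderBar (fun y => twd (pj p) ζ j y) (ee j) x) := by
    intro j
    have : wder (fun y => ew p y * wderBar ξ (ee j) y) (ee j) x
        = conj (wderBar (fun y => twd (pj p) ζ j y) (ee j) x) := by
      rw [← wder_conj ((hζ.twd hpj j).dd x)]
      apply wder_congr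
      filter_upwards [hD.mem_nhds hx] with y hy using e1 y hy j
    rw [← this, wder_mul ((ew_sm hp).d hx) ((hT.wderBar _).dd x), wder_ew hp hx, dlj]; ring
  have e3 : conj (dl p ξ x) * ew p x = conj (dl p ξ x * ew p x) := by rw [map_mul, ew_conj]
  rw [e3, dl, Finset.sum_mul]
  simp only [e2]
  simp

lemma mol_wderBar' {ε : ℝ} (hε : 0 < ε) {G : (Fin n → ℂ) → ℂ} (hG : Tst D G) (v x : Fin n → ℂ) :
    wderBar (mol G (rhoC ε)) v x = mol (fun y => wderBar G v y) (rhoC ε) x := by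
  rw [mol_comm, mol_wderBar (rhoC_tst hε).integrable.locallyIntegrable hG, mol_comm]

lemma mol_wder' {ε : ℝ} (hε : 0 < ε) {G : (Fin n → ℂ) → ℂ} (hG : Tst D G) (v x : Fin n → ℂ) :
    wder (mol G (rhoC ε)) v x = mol (fun y => wder G v y) (rhoC ε) x := by
  rw [mol_comm, mol_wder (rhoC_tst hε).integrable.locallyIntegrable hG, mol_comm]

lemma mol_add {ε : ℝ} (hε : 0 < ε) {G H : (Fin n → ℂ) → ℂ} (hG : Continuous G) (hH : Continuous H)
    (x : Fin n → ℂ) : mol (fun y => G y + H y) (rhoC ε) x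
      = mol G (rhoC ε) x + mol H (rhoC ε) x := by
  unfold mol
  rw [← integral_add (mol_integrand hG.locallyIntegrable (rhoC_tst hε).cont (rhoC_tst hε).cpt x)
    (mol_integrand hH.locallyIntegrable (rhoC_tst hε).cont (rhoC_tst hε).cpt x)]
  congr 1; ext t; ring

lemma mol_tst {ε : ℝ} (hε : 0 < ε) {G : (Fin n → ℂ) → ℂ} {K : Set (Fin n → ℂ)} (hG : Tst D G)
    (hK : Metric.cthickening ε (tsupport G) ⊆ K) : Tst K (mol G (rhoC ε)) := by
  have hs : Function.support (mol G (rhoC ε)) ⊆ Metric.cthickening ε (tsupport G) := by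
    intro x hx
    by_contra hcon
    apply hx
    unfold mol
    rw [← integral_zero (Fin n → ℂ) ℂ (μ := volume)]
    congr 1; ext t
    by_cases ht : t ∈ tsupport G
    · have : ε < ‖x - t‖ := by
        by_contra h2
        exact hcon (Metric.mem_cthickening_of_dist_le x t ε _ ht
          (by rw [dist_eq_norm]; linarith))
      simp [rhoC, rho_zero hε this.le]
    · rw [image_eq_zero_of_notMem_tsupport ht]; simp
  have hc : IsCompact (Metric.cthickening ε (tsupport G)) := hG.cpt.isCompact.cthickening
  refine ⟨mol_smooth hG.integrable.locallyIntegrable (rhoC_tst hε),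
    HasCompactSupport.of_support_subset_isCompact hc hs, ?_⟩
  exact (closure_minimal hs hc.isClosed).trans hK

/-- approximate equation for the mollification -/
lemma approx_eq {g : (Fin n → ℂ) → ℂ} (hg : Integrable g) (hg2 : MemLp g 2)
    {c : Fin n → (Fin n → ℂ) → ℂ} (hc : ∀ j, Tst univ (c j)) {K : Set (Fin n → ℂ)}
    (hw : ∀ ζ, Tst K ζ → ∑ j, ∫ x, g x * wderBar (fun y => twd c ζ j y) (ee j) x = 0)
    {η : ℝ} (hη : 0 < η) :
    ∃ b0 > 0, ∀ ε, 0 < ε → ε < b0 → ∀ G, Tst univ G → Metric.cthickening ε (tsupport G) ⊆ K →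
      ‖∑ j, ∫ x, mol g (rhoC ε) x * wderBar (fun y => twd c G j y) (ee j) x‖ ≤
        η * Real.sqrt (∫ x, ‖g x‖ ^ 2) *
          ∑ j, (Real.sqrt (∫ x, ‖G x‖ ^ 2) + Real.sqrt (∫ x, ‖wderBar G (ee j) x‖ ^ 2)) := by
  have h1 : ∀ j, ∃ b0 > 0, ∀ ε, 0 < ε → ε < b0 → ∀ G : (Fin n → ℂ) → ℂ, Continuous G → ∀ x,
      ‖c j x * mol G (rhoC ε) x - mol (fun t => c j t * G t) (rhoC ε) x‖
        ≤ η * molR ε (fun t => ‖G t‖) x := fun j =>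
    mol_commut ((hc j).cpt.uniformContinuous_of_continuous (hc j).cont) hη
  have h2 : ∀ j, ∃ b0 > 0, ∀ ε, 0 < ε → ε < b0 → ∀ G : (Fin n → ℂ) → ℂ, Continuous G → ∀ x,
      ‖wderBar (c j) (ee j) x * mol G (rhoC ε) x
        - mol (fun t => wderBar (c j) (ee j) t * G t) (rhoC ε) x‖
        ≤ η * molR ε (fun t => ‖G t‖) x := fun j =>
    mol_commut (((hc j).wderBar _).cpt.uniformContinuous_of_continuous ((hc j).wderBar _).cont) hη
  choose b1 hb1 h1 using h1
  choose b2 hb2 h2 using h2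
  obtain ⟨b0, hb0, hle⟩ : ∃ b0 > 0, ∀ j, b0 ≤ b1 j ∧ b0 ≤ b2 j := by
    rcases isEmpty_or_nonempty (Fin n) with he | he
    · exact ⟨1, one_pos, fun j => he.elim j⟩
    · refine ⟨Finset.univ.inf' Finset.univ_nonempty (fun j => min (b1 j) (b2 j)), ?_, fun j => ?_⟩
      · rw [gt_iff_lt, Finset.lt_inf'_iff]; exact fun j _ => lt_min (hb1 j) (hb2 j)
      · have := Finset.inf'_le (fun j => min (b1 j) (b2 j)) (Finset.mem_univ j)
        exact ⟨this.trans (min_le_left _ _), this.trans (min_le_right _ _)⟩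
  refine ⟨b0, hb0, fun ε hε hlt G hG hK => ?_⟩
  have hG' := fun j => hG.wderBar (ee j)
  have hcS := fun j => (hc j).sm
  have hζ : Tst K (mol G (rhoC ε)) := mol_tst hε hG hK
  have hζu : Tst univ (mol G (rhoC ε)) := hζ.mono (subset_univ _)
  have key := hw _ hζ
  -- the derivative of twd
  have ex : ∀ (G : (Fin n → ℂ) → ℂ), Tst univ G → ∀ j x, wderBar (fun y => twd c G j y) (ee j) x
      = wderBar (fun y => wder G (ee j) y) (ee j) x + (wderBar (c j) (ee j) x * G x
        + c j x * wderBar G (ee j) x) := by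
    intro G hG j x
    unfold twd
    rw [wderBar_add ((hG.wder _).dd x) ((hG.gmul (hcS j)).dd x), wderBar_mul ((hc j).dd x) (hG.dd x)]
  have e1 : ∀ j, ∫ x, mol g (rhoC ε) x * wderBar (fun y => twd c G j y) (ee j) x
      = ∫ x, g x * mol (fun x => wderBar (fun y => twd c G j y) (ee j) x) (rhoC ε) x := fun j =>
    mol_pair hε hg ((hG.twd hcS j).wderBar _).integrable
  -- pointwise error
  have e2 : ∀ j x, ‖wderBar (fun y => twd c (mol G (rhoC ε)) j y) (ee j) x
      - mol (fun x => wderBar (fun y => twd c G j y) (ee j) x) (rhoC ε) x‖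
      ≤ η * molR ε (fun t => ‖G t‖) x + η * molR ε (fun t => ‖wderBar G (ee j) t‖) x := by
    intro j x
    have a1 : wderBar (fun y => wder (mol G (rhoC ε)) (ee j) y) (ee j) x
        = mol (fun y => wderBar (fun y => wder G (ee j) y) (ee j) y) (rhoC ε) x := by
      have : (fun y => wder (mol G (rhoC ε)) (ee j) y) = mol (fun y => wder G (ee j) y) (rhoC ε) := by
        ext y; exact mol_wder' hε hG _ _
      rw [this, mol_wderBar' hε (hG.wder (ee j))]
    rw [ex _ hζu]
    simp only [ex G hG]
    have k1 : Continuous (fun x => wderBar (c j) (ee j) x * G x) :=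
      ((hc j).wderBar _).cont.mul hG.cont
    have k2 : Continuous (fun x => c j x * wderBar G (ee j) x) := (hc j).cont.mul (hG' j).cont
    have k3 : Continuous (fun x => wderBar (c j) (ee j) x * G x + c j x * wderBar G (ee j) x) :=
      k1.add k2
    rw [mol_add hε ((hG.wder _).wderBar _).cont k3, mol_add hε k1 k2, a1, mol_wderBar' hε hG]
    have b1' := h1 j ε hε (hlt.trans_le (hle j).1) _ (hG' j).cont x
    have b2' := h2 j ε hε (hlt.trans_le (hle j).2) _ hG.cont x
    calc _ = ‖(wderBar (c j) (ee j) x * mol G (rhoC ε) x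
        - mol (fun t => wderBar (c j) (ee j) t * G t) (rhoC ε) x)
        + (c j x * mol (fun y => wderBar G (ee j) y) (rhoC ε) x
          - mol (fun t => c j t * wderBar G (ee j) t) (rhoC ε) x)‖ := by congr 1; ring
      _ ≤ _ := (norm_add_le _ _).trans (add_le_add b2' b1')
  have i1 : ∀ j, Integrable (fun x => g x *
      wderBar (fun y => twd c (mol G (rhoC ε)) j y) (ee j) x) := fun j =>
    hg2.integrable_mul ((hζu.twd hcS j).wderBar _).memLp
  have i2 : ∀ j, Integrable (fun x => g x *
      mol (fun x => wderBar (fun y => twd c G j y) (ee j) x) (rhoC ε) x) := fun j =>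
    hg2.integrable_mul (mol_memLp hε ((hG.twd hcS j).wderBar _).integrable
      ((hG.twd hcS j).wderBar _).memLp)
  have m1 := molR_memLp hε hG.integrable hG.memLp
  have m2 := fun j => molR_memLp hε (hG' j).integrable (hG' j).memLp
  have e3 : ∀ j, ‖(∫ x, mol g (rhoC ε) x * wderBar (fun y => twd c G j y) (ee j) x)
      - ∫ x, g x * wderBar (fun y => twd c (mol G (rhoC ε)) j y) (ee j) x‖
      ≤ η * Real.sqrt (∫ x, ‖g x‖ ^ 2) *
        (Real.sqrt (∫ x, ‖G x‖ ^ 2) + Real.sqrt (∫ x, ‖wderBar G (ee j) x‖ ^ 2)) := by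
    intro j
    have ra : ∀ (F : (Fin n → ℂ) → ℂ) x, ‖(molR ε (fun t => ‖F t‖) x : ℂ)‖
        = molR ε (fun t => ‖F t‖) x := fun F x => by
      rw [Complex.norm_real, Real.norm_eq_abs, abs_of_nonneg (molR_nonneg hε (fun _ => norm_nonneg _) _)]
    have q1 := cs_int hg2 m1.1
    have q2 := cs_int hg2 (m2 j).1
    have r1 := cs_norm hg2 m1.1
    have r2 := cs_norm hg2 (m2 j).1
    rw [e1, ← integral_sub (i2 j) (i1 j)]
    calc ‖∫ x, _‖ ≤ ∫ x, (η * (‖g x‖ * ‖(molR ε (fun t => ‖G t‖) x : ℂ)‖)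
          + η * (‖g x‖ * ‖(molR ε (fun t => ‖wderBar G (ee j) t‖) x : ℂ)‖)) := by
          apply norm_integral_le_of_norm_le ((q1.const_mul _).add (q2.const_mul _))
          refine Eventually.of_forall fun x => ?_
          simp only [Pi.add_apply]
          rw [← mul_sub, norm_mul, norm_sub_rev, ra, ra]
          have := mul_le_mul_of_nonneg_left (e2 j x) (norm_nonneg (g x))
          refine this.trans (le_of_eq ?_); ring
      _ = η * (∫ x, (‖g x‖ * ‖(molR ε (fun t => ‖G t‖) x : ℂ)‖))
          + η * ∫ x, (‖g x‖ * ‖(molR ε (fun t => ‖wderBar G (ee j) t‖) x : ℂ)‖) := by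
          rw [integral_add (q1.const_mul _) (q2.const_mul _), integral_const_mul,
            integral_const_mul]
      _ ≤ _ := by
          rw [mul_add, mul_assoc, mul_assoc]
          gcongr
          · refine r1.trans ?_
            exact mul_le_mul_of_nonneg_left (Real.sqrt_le_sqrt m1.2) (Real.sqrt_nonneg _)
          · refine r2.trans ?_
            exact mul_le_mul_of_nonneg_left (Real.sqrt_le_sqrt (m2 j).2) (Real.sqrt_nonneg _)
  have e4 : ∑ j, ∫ x, mol g (rhoC ε) x * wderBar (fun y => twd c G j y) (ee j) x
      = ∑ j, ((∫ x, mol g (rhoC ε) x * wderBar (fun y => twd c G j y) (ee j) x)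
      - ∫ x, g x * wderBar (fun y => twd c (mol G (rhoC ε)) j y) (ee j) x) := by
    rw [Finset.sum_sub_distrib, key, sub_zero]
  rw [e4, Finset.mul_sum]
  exact (norm_sum_le _ _).trans (Finset.sum_le_sum fun j _ => e3 j)
end Regul

section Caccio
variable {n : ℕ} {D : Set (Fin n → ℂ)} {ζ ξ h : (Fin n → ℂ) → ℂ} {p r : (Fin n → ℂ) → ℝ}

/-- energy density -/
def enX (p r : (Fin n → ℂ) → ℝ) (H : (Fin n → ℂ) → ℂ) (x : Fin n → ℂ) : ℝ :=
  ∑ j, r x ^ 2 * Real.exp (-(p x)) * ‖wderBar H (ee j) x‖ ^ 2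

/-- gradient of the cutoff -/
def gradW (p r : (Fin n → ℂ) → ℝ) (x : Fin n → ℂ) : ℝ :=
  ∑ j, Real.exp (-(p x)) * ‖wder (fun y => (r y : ℂ)) (ee j) x‖ ^ 2

/-- test function for Caccioppoli -/
def cacG (p r : (Fin n → ℂ) → ℝ) (H : (Fin n → ℂ) → ℂ) (x : Fin n → ℂ) : ℂ :=
  (ew p x * conj (H x) * (r x : ℂ)) * (r x : ℂ)

lemma Tst.shrink (h : Tst D ζ) : Tst (tsupport ζ) ζ := ⟨h.smooth, h.cpt, subset_rfl⟩

lemma ew_norm (x : Fin n → ℂ) : ‖ew p x‖ = Real.exp (-(p x)) := by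
  rw [ew, Complex.norm_real, Real.norm_eq_abs, abs_of_pos (Real.exp_pos _)]

lemma int_bar_eq {G : (Fin n → ℂ) → ℂ} (hG : Tst univ G) (v : Fin n → ℂ) :
    ∫ x, ‖wderBar G v x‖ ^ 2 = ∫ x, ‖wder G v x‖ ^ 2 := by
  have e1 : ∫ x, wderBar G v x * conj (wderBar G v x) = ∫ x, wder G v x * conj (wder G v x) := by
    have a1 : ∀ x, conj (wderBar G v x) = wder (fun y => conj (G y)) v x := fun x =>
      (wder_conj (hG.dd x) v).symm
    have a2 : ∀ x, conj (wder G v x) = wderBar (fun y => conj (G y)) v x := fun x =>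
      (wderBar_conj (hG.dd x) v).symm
    simp only [a1, a2]
    rw [ibp_wder (hG.wderBar v).sm hG.conj, ibp_wderBar (hG.wder v).sm hG.conj]
    congr 2; ext x
    rw [wder_wderBar_comm hG.smooth.contDiffAt]
  simp only [Complex.mul_conj, Complex.normSq_eq_norm_sq] at e1
  rw [integral_complex_ofReal, integral_complex_ofReal] at e1
  exact_mod_cast e1

lemma cacG_tst (hp : SmR D p) (hr : Tst D (fun x => (r x : ℂ)))
    {H : (Fin n → ℂ) → ℂ} (hH : ContDiff ℝ ∞ H) :
    Tst (tsupport (fun x => (r x : ℂ))) (cacG p r H) := by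
  have hT := hr.shrink
  have hS : SmAt (tsupport (fun x => (r x : ℂ))) (fun x => ew p x * conj (H x) * (r x : ℂ)) :=
    fun x hx => ((ew_sm hp x (hr.sub hx)).mul (cd_conj hH.contDiffAt)).mul hr.smooth.contDiffAt
  exact hT.gmul hS

lemma cacG_twd (hp : SmR D p) (hr : Tst D (fun x => (r x : ℂ)))
    {c : Fin n → (Fin n → ℂ) → ℂ}
    (hc : ∀ j, ∀ x ∈ tsupport (fun x => (r x : ℂ)), c j x = pj p j x)
    {H : (Fin n → ℂ) → ℂ} (hH : ContDiff ℝ ∞ H) (j : Fin n) (x : Fin n → ℂ) :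
    twd c (cacG p r H) j x = ew p x * (2 * (r x : ℂ) * wder (fun x => (r x : ℂ)) (ee j) x * conj (H x)
      + (r x : ℂ) ^ 2 * conj (wderBar H (ee j) x)) := by
  by_cases hx : x ∈ tsupport (fun x => (r x : ℂ))
  · have hxD := hr.sub hx
    have hHd : DifferentiableAt ℝ (fun y => conj (H y)) x := (cd_conj hH.contDiffAt).dR
    have h1 := (ew_sm hp).d hxD
    have h2 := hr.dd x
    have e : wder (cacG p r H) (ee j) x = wder (fun y => (ew p y * conj (H y) * (r y : ℂ)) * (r y : ℂ)) (ee j) x := rfl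
    rw [twd, e, wder_mul ((h1.fun_mul hHd).fun_mul h2) h2, wder_mul (h1.fun_mul hHd) h2,
      wder_mul h1 hHd, wder_ew hp hxD, wder_conj hH.contDiffAt.dR, hc j x hx, cacG, pj]
    ring
  · have h0 : (r x : ℂ) = 0 := hr.shrink.zero_off hx
    have := wder_eq_zero_of_notMem (f := cacG p r H) (fun h => hx ((cacG_tst hp hr hH).sub h)) (ee j)
    rw [twd, this, cacG, h0]; simp

lemma caccio_main (hp : SmR D p) (hr : Tst D (fun x => (r x : ℂ)))
    {c : Fin n → (Fin n → ℂ) → ℂ} (hcT : ∀ j, Tst univ (c j))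
    (hc : ∀ j, ∀ x ∈ tsupport (fun x => (r x : ℂ)), c j x = pj p j x)
    {H : (Fin n → ℂ) → ℂ} (hH : ContDiff ℝ ∞ H) :
    ∫ x, enX p r H x ≤ 2 * ‖∑ j, ∫ x, H x * wderBar (fun y => twd c (cacG p r H) j y) (ee j) x‖
      + 4 * ∫ x, ‖H x‖ ^ 2 * gradW p r x := by
  set K := tsupport (fun x => (r x : ℂ))
  have hT : Tst univ (cacG p r H) := (cacG_tst hp hr hH).mono (subset_univ _)
  have hHs : SmAt (univ : Set (Fin n → ℂ)) H := fun x _ => hH.contDiffAt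
  have hHD : SmAt D H := fun x _ => hH.contDiffAt
  have htw := fun j => hT.twd (fun j => (hcT j).sm) j
  set s : (Fin n → ℂ) → ℂ := fun x => ∑ j, wderBar H (ee j) x * twd c (cacG p r H) j x with hs
  have hsT : Tst univ s := Tst.sum _ fun j _ => (htw j).gmul (hHs.wderBar (ee j))
  have hS : ∑ j, ∫ x, H x * wderBar (fun y => twd c (cacG p r H) j y) (ee j) x = - ∫ x, s x := by
    simp only [hs]
    rw [integral_finsetSum _ fun j _ => ((htw j).gmul (hHs.wderBar (ee j))).integrable,
      ← Finset.sum_neg_distrib]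
    refine Finset.sum_congr rfl fun j _ => ?_
    rw [ibp_wderBar hHs (htw j)]
  -- integrability
  have hXT : Integrable (enX p r H) := by
    unfold enX
    apply integrable_finsetSum; intro j _
    have T1 : Tst D (fun x => (ew p x * (r x:ℂ) * wderBar H (ee j) x * conj (wderBar H (ee j) x)) * (r x : ℂ)) :=
      hr.gmul ((((ew_sm hp).mul hr.sm).mul (hHD.wderBar _)).mul (hHD.wderBar _).conj)
    refine T1.integrable.norm.congr (Eventually.of_forall fun x => ?_)
    simp only [norm_mul, ew_norm, RCLike.norm_conj, Complex.norm_real, Real.norm_eq_abs]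
    rw [← sq_abs (r x)]; ring
  have hMT : Integrable (fun x => ‖H x‖ ^ 2 * gradW p r x) := by
    unfold gradW
    simp only [Finset.mul_sum]
    apply integrable_finsetSum; intro j _
    have T1 : Tst D (fun x => (ew p x * H x * H x * wder (fun y => (r y : ℂ)) (ee j) x)
        * wder (fun y => (r y : ℂ)) (ee j) x) :=
      (hr.wder _).gmul ((((ew_sm hp).mul hHD).mul hHD).mul (hr.wder _).sm)
    refine T1.integrable.norm.congr (Eventually.of_forall fun x => ?_)
    simp only [norm_mul, ew_norm]; ring
  have pw : ∀ x, enX p r H x ≤ (s x).re + (1/2) * enX p r H x + 2 * (‖H x‖ ^ 2 * gradW p r x) := by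
    intro x
    have : ∀ j, r x ^ 2 * Real.exp (-(p x)) * ‖wderBar H (ee j) x‖ ^ 2 ≤
        (wderBar H (ee j) x * twd c (cacG p r H) j x).re
        + (1/2) * (r x ^ 2 * Real.exp (-(p x)) * ‖wderBar H (ee j) x‖ ^ 2)
        + 2 * (‖H x‖ ^ 2 * (Real.exp (-(p x)) * ‖wder (fun y => (r y : ℂ)) (ee j) x‖ ^ 2)) := by
      intro j
      rw [cacG_twd hp hr hc hH]
      set A := wderBar H (ee j) x
      set d := wder (fun y => (r y : ℂ)) (ee j) x
      have e1 : A * (ew p x * (2 * (r x : ℂ) * d * conj (H x) + (r x : ℂ) ^ 2 * conj A))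
          = ((r x ^ 2 * Real.exp (-(p x)) * ‖A‖ ^ 2 : ℝ) : ℂ)
            + ((2 * Real.exp (-(p x)) * r x : ℝ) : ℂ) * (A * d * conj (H x)) := by
        have : A * conj A = ((‖A‖ ^ 2 : ℝ) : ℂ) := by
          rw [Complex.mul_conj, Complex.normSq_eq_norm_sq]
        push_cast at this ⊢
        rw [ew]; push_cast
        linear_combination (Complex.exp (-(p x : ℂ)) * (r x : ℂ) ^ 2) * this
      rw [e1, Complex.add_re, Complex.ofReal_re, Complex.re_ofReal_mul]
      have h2 : |(A * d * conj (H x)).re| ≤ ‖A‖ * ‖d‖ * ‖H x‖ := by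
        refine (Complex.abs_re_le_norm _).trans (le_of_eq ?_)
        simp [norm_mul]
      have h3 := Real.exp_pos (-(p x))
      have h4 : -(|r x| * (‖A‖ * ‖d‖ * ‖H x‖)) ≤ r x * (A * d * conj (H x)).re := by
        have := neg_abs_le (r x * (A * d * conj (H x)).re)
        rw [abs_mul] at this
        have h5 := mul_le_mul_of_nonneg_left h2 (abs_nonneg (r x))
        linarith
      have h6 : 0 ≤ (|r x| * ‖A‖ - 2 * (‖d‖ * ‖H x‖)) ^ 2 := sq_nonneg _
      have h7 : |r x| ^ 2 = r x ^ 2 := sq_abs _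
      have h8 : 0 ≤ 2 * (r x * (A * d * conj (H x)).re) + (1/2) * (r x ^ 2 * ‖A‖ ^ 2)
          + 2 * (‖H x‖ ^ 2 * ‖d‖ ^ 2) := by
        rw [← h7]; nlinarith
      nlinarith [mul_nonneg h3.le h8]
    calc enX p r H x ≤ ∑ j, _ := Finset.sum_le_sum fun j _ => this j
      _ = _ := by
        rw [Finset.sum_add_distrib, Finset.sum_add_distrib, hs, Complex.re_sum, enX,
          gradW, Finset.mul_sum, Finset.mul_sum, Finset.mul_sum]
  have hsre : Integrable (fun x => (s x).re) := hsT.integrable.re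
  have i1 := integral_mono hXT ((hsre.add (hXT.const_mul (1/2))).add (hMT.const_mul 2)) pw
  rw [integral_add' (hsre.add (hXT.const_mul (1/2))) (hMT.const_mul 2),
    integral_add' hsre (hXT.const_mul (1/2)), integral_const_mul, integral_const_mul] at i1
  have i2 : ∫ x, (s x).re = (∫ x, s x).re := integral_re hsT.integrable
  have i3 : (∫ x, s x).re ≤ ‖∫ x, s x‖ := Complex.re_le_norm _
  rw [hS, norm_neg]
  rw [i2] at i1
  linarith

lemma caccio_bd (hp : SmR D p) (hr : Tst D (fun x => (r x : ℂ)))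
    {c : Fin n → (Fin n → ℂ) → ℂ} (hcT : ∀ j, Tst univ (c j))
    (hc : ∀ j, ∀ x ∈ tsupport (fun x => (r x : ℂ)), c j x = pj p j x) :
    ∃ C : ℝ, 0 ≤ C ∧ ∀ H : (Fin n → ℂ) → ℂ, ContDiff ℝ ∞ H → MemLp H 2 →
      (∫ x, ‖cacG p r H x‖ ^ 2 ≤ C * ∫ x, ‖H x‖ ^ 2) ∧
      ∀ j, ∫ x, ‖wderBar (cacG p r H) (ee j) x‖ ^ 2
        ≤ C * ((∫ x, ‖H x‖ ^ 2) + ∫ x, enX p r H x) := by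
  have bd : ∀ {D : Set (Fin n → ℂ)} {f : (Fin n → ℂ) → ℂ}, Tst D f → ∃ C, ∀ x, ‖f x‖ ≤ C :=
    fun h => h.cont.bounded_above_of_compact_support h.cpt
  obtain ⟨C1, h1⟩ := bd (hr.gmul (ew_sm hp))
  obtain ⟨C2, h2⟩ := bd hr
  choose C3 h3 using fun j => bd (hr.wder (ee j))
  choose C4 h4 using fun j => bd (hcT j)
  set C := 1 + |C1| + |C2| + ∑ j, |C3 j| + ∑ j, |C4 j| with hC
  have s3 : 0 ≤ ∑ j, |C3 j| := Finset.sum_nonneg fun _ _ => abs_nonneg _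
  have s4 : 0 ≤ ∑ j, |C4 j| := Finset.sum_nonneg fun _ _ => abs_nonneg _
  have hC1 : 1 ≤ C := by rw [hC]; linarith [abs_nonneg C1, abs_nonneg C2]
  have b1 : ∀ x, ‖ew p x * (r x : ℂ)‖ ≤ C := fun x => (h1 x).trans (by
    rw [hC]; linarith [abs_nonneg C1, abs_nonneg C2, le_abs_self C1])
  have b2 : ∀ x, ‖(r x : ℂ)‖ ≤ C := fun x => (h2 x).trans (by
    rw [hC]; linarith [abs_nonneg C1, abs_nonneg C2, le_abs_self C2])
  have b3 : ∀ j x, ‖wder (fun y => (r y : ℂ)) (ee j) x‖ ≤ C := fun j x => (h3 j x).trans (by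
    have := Finset.single_le_sum (f := fun j => |C3 j|) (fun _ _ => abs_nonneg _) (Finset.mem_univ j)
    rw [hC]; linarith [abs_nonneg C1, abs_nonneg C2, le_abs_self (C3 j)])
  have b4 : ∀ j x, ‖c j x‖ ≤ C := fun j x => (h4 j x).trans (by
    have := Finset.single_le_sum (f := fun j => |C4 j|) (fun _ _ => abs_nonneg _) (Finset.mem_univ j)
    rw [hC]; linarith [abs_nonneg C1, abs_nonneg C2, le_abs_self (C4 j)])
  have hC0 : 0 ≤ C := by linarith
  refine ⟨15 * C ^ 6, by positivity, fun H hH hH2 => ?_⟩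
  have hHD : SmAt D H := fun x _ => hH.contDiffAt
  have hT : Tst univ (cacG p r H) := (cacG_tst hp hr hH).mono (subset_univ _)
  have hXT : Integrable (enX p r H) := by
    unfold enX
    apply integrable_finsetSum; intro j _
    have T1 : Tst D (fun x => (ew p x * (r x:ℂ) * wderBar H (ee j) x * conj (wderBar H (ee j) x)) * (r x : ℂ)) :=
      hr.gmul ((((ew_sm hp).mul hr.sm).mul (hHD.wderBar _)).mul (hHD.wderBar _).conj)
    refine T1.integrable.norm.congr (Eventually.of_forall fun x => ?_)
    simp only [norm_mul, ew_norm, RCLike.norm_conj, Complex.norm_real, Real.norm_eq_abs]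
    rw [← sq_abs (r x)]; ring
  have gb : ∀ x, ‖cacG p r H x‖ ≤ C ^ 2 * ‖H x‖ := by
    intro x
    have : ‖cacG p r H x‖ = ‖ew p x * (r x : ℂ)‖ * ‖(r x : ℂ)‖ * ‖H x‖ := by
      simp only [cacG, norm_mul, RCLike.norm_conj]; ring
    rw [this]
    have := mul_le_mul (b1 x) (b2 x) (norm_nonneg _) hC0
    have := mul_le_mul_of_nonneg_right this (norm_nonneg (H x))
    linarith [this]
  have hX0 : ∀ x j, r x ^ 2 * Real.exp (-(p x)) * ‖wderBar H (ee j) x‖ ^ 2 ≤ enX p r H x :=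
    fun x j => Finset.single_le_sum
      (f := fun j => r x ^ 2 * Real.exp (-(p x)) * ‖wderBar H (ee j) x‖ ^ 2)
      (fun j _ => by have := Real.exp_pos (-(p x)); positivity) (Finset.mem_univ j)
  constructor
  · rw [← integral_const_mul]
    refine integral_mono (sq_int hT.memLp) ((sq_int hH2).const_mul _) fun x => ?_
    have := pow_le_pow_left₀ (norm_nonneg _) (gb x) 2
    refine this.trans ?_
    rw [mul_pow]
    apply mul_le_mul_of_nonneg_right _ (by positivity)
    have : C ^ 4 ≤ C ^ 6 := pow_le_pow_right₀ hC1 (by norm_num)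
    have h4 : (C ^ 2) ^ 2 = C ^ 4 := by ring
    have : 0 ≤ C ^ 6 := by positivity
    linarith
  · intro j
    rw [int_bar_eq hT, ← integral_add (sq_int hH2) hXT, ← integral_const_mul]
    refine integral_mono (sq_int (hT.wder _).memLp) (((sq_int hH2).add hXT).const_mul _) fun x => ?_
    have e := cacG_twd hp hr hc hH j x
    rw [twd] at e
    set d := wder (fun y => (r y : ℂ)) (ee j) x
    set A := wderBar H (ee j) x
    have e2 : wder (cacG p r H) (ee j) x = 2 * ((ew p x * (r x : ℂ)) * d * conj (H x))
        + (ew p x * (r x : ℂ) ^ 2 * conj A) - c j x * cacG p r H x := by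
      linear_combination e
    have n1 : ‖2 * ((ew p x * (r x : ℂ)) * d * conj (H x))‖ ≤ 2 * (C ^ 2 * ‖H x‖) := by
      rw [norm_mul, norm_mul, norm_mul _ d, RCLike.norm_conj]
      have := mul_le_mul (b1 x) (b3 j x) (norm_nonneg _) hC0
      have := mul_le_mul_of_nonneg_right this (norm_nonneg (H x))
      simp only [Complex.norm_ofNat]
      nlinarith
    have n2 : ‖ew p x * (r x : ℂ) ^ 2 * conj A‖ ^ 2 ≤ C ^ 2 * enX p r H x := by
      have a1 : ‖ew p x * (r x : ℂ) ^ 2 * conj A‖ ^ 2 = (‖ew p x * (r x : ℂ)‖ * ‖(r x : ℂ)‖)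
          * (r x ^ 2 * Real.exp (-(p x)) * ‖A‖ ^ 2) := by
        simp only [norm_mul, RCLike.norm_conj, norm_pow, ew_norm, Complex.norm_real,
          Real.norm_eq_abs]
        rw [← sq_abs (r x)]; ring
      rw [a1]
      have := mul_le_mul (b1 x) (b2 x) (norm_nonneg _) hC0
      have hp0 := Real.exp_pos (-(p x))
      have := mul_le_mul this (hX0 x j) (by positivity) (by positivity)
      linarith [this]
    have n3 : ‖c j x * cacG p r H x‖ ≤ C ^ 3 * ‖H x‖ := by
      rw [norm_mul]
      have := mul_le_mul (b4 j x) (gb x) (norm_nonneg _) hC0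
      linarith [this]
    have n4 : ‖wder (cacG p r H) (ee j) x‖ ^ 2 ≤ 3 * (‖2 * ((ew p x * (r x : ℂ)) * d * conj (H x))‖ ^ 2
        + ‖ew p x * (r x : ℂ) ^ 2 * conj A‖ ^ 2 + ‖c j x * cacG p r H x‖ ^ 2) := by
      rw [e2]
      have t := (norm_sub_le (2 * ((ew p x * (r x : ℂ)) * d * conj (H x))
        + (ew p x * (r x : ℂ) ^ 2 * conj A)) (c j x * cacG p r H x)).trans
        (add_le_add_left (norm_add_le _ _) _)
      refine (pow_le_pow_left₀ (norm_nonneg _) t 2).trans ?_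
      nlinarith [sq_nonneg (‖2 * ((ew p x * (r x : ℂ)) * d * conj (H x))‖ - ‖ew p x * (r x : ℂ) ^ 2 * conj A‖),
        sq_nonneg (‖2 * ((ew p x * (r x : ℂ)) * d * conj (H x))‖ - ‖c j x * cacG p r H x‖),
        sq_nonneg (‖c j x * cacG p r H x‖ - ‖ew p x * (r x : ℂ) ^ 2 * conj A‖)]
    have m1 := pow_le_pow_left₀ (norm_nonneg _) n1 2
    have m3 := pow_le_pow_left₀ (norm_nonneg _) n3 2
    have c46 : C ^ 4 ≤ C ^ 6 := pow_le_pow_right₀ hC1 (by norm_num)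
    have c26 : C ^ 2 ≤ C ^ 6 := pow_le_pow_right₀ hC1 (by norm_num)
    have hx0 : 0 ≤ enX p r H x := Finset.sum_nonneg fun j _ => by
      have := Real.exp_pos (-(p x)); positivity
    have k1 := mul_le_mul_of_nonneg_right c46 (sq_nonneg ‖H x‖)
    have k2 := mul_le_mul_of_nonneg_right c26 hx0
    have k3 : 0 ≤ C ^ 6 * enX p r H x := by positivity
    have k4 : (2 * (C ^ 2 * ‖H x‖)) ^ 2 = 4 * (C ^ 4 * ‖H x‖ ^ 2) := by ring
    have k5 : (C ^ 3 * ‖H x‖) ^ 2 = C ^ 6 * ‖H x‖ ^ 2 := by ring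
    rw [k4] at m1; rw [k5] at m3
    have k6 : 15 * C ^ 6 * (‖H x‖ ^ 2 + enX p r H x) = 15 * (C ^ 6 * ‖H x‖ ^ 2) + 15 * (C ^ 6 * enX p r H x) := by ring
    simp only
    rw [k6]
    linarith
end Caccio

section Energy
variable {n : ℕ} {D : Set (Fin n → ℂ)} {ζ ξ h : (Fin n → ℂ) → ℂ} {p r : (Fin n → ℂ) → ℝ}

lemma exists_cutoff (hD : IsOpen D) {K : Set (Fin n → ℂ)} (hK : IsCompact K) (hKD : K ⊆ D) :
    ∃ θ : (Fin n → ℂ) → ℝ, Tst D (fun x => (θ x : ℂ)) ∧ (∀ x ∈ K, θ x = 1) ∧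
      ∀ x, 0 ≤ θ x ∧ θ x ≤ 1 := by
  obtain ⟨d, hd, hdD⟩ := hK.exists_cthickening_subset_open hD hKD
  obtain ⟨f, f1, f2, f3, f4⟩ := exists_contMDiff_support_eq_eq_one_iff (n := (⊤ : ℕ∞))
    (modelWithCornersSelf ℝ (Fin n → ℂ)) (s := Metric.thickening d K) (t := K)
    Metric.isOpen_thickening hK.isClosed (Metric.self_subset_thickening hd K)
  have hts : tsupport (fun x => (f x : ℂ)) ⊆ Metric.cthickening d K := by
    have : Function.support (fun x => (f x : ℂ)) = Metric.thickening d K := by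
      rw [← f3]; ext x; simp
    rw [tsupport, this]
    exact Metric.closure_thickening_subset_cthickening d K
  refine ⟨f, ⟨?_, ?_, hts.trans hdD⟩, fun x hx => (f4 x).1 hx, fun x => f2 (mem_range_self x)⟩
  · exact Complex.ofRealCLM.contDiff.comp (contMDiff_iff_contDiff.1 f1)
  · exact (hK.cthickening).of_isClosed_subset (isClosed_tsupport _) hts

lemma enX_int (hp : SmR D p) (hr : Tst D (fun x => (r x : ℂ))) {H : (Fin n → ℂ) → ℂ}
    (hH : ContDiff ℝ ∞ H) : Integrable (enX p r H) := by
  have hHD : SmAt D H := fun x _ => hH.contDiffAt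
  unfold enX
  apply integrable_finsetSum; intro j _
  have T1 : Tst D (fun x => (ew p x * (r x:ℂ) * wderBar H (ee j) x * conj (wderBar H (ee j) x)) * (r x : ℂ)) :=
    hr.gmul ((((ew_sm hp).mul hr.sm).mul (hHD.wderBar _)).mul (hHD.wderBar _).conj)
  refine T1.integrable.norm.congr (Eventually.of_forall fun x => ?_)
  simp only [norm_mul, ew_norm, RCLike.norm_conj, Complex.norm_real, Real.norm_eq_abs]
  rw [← sq_abs (r x)]; ring

lemma enX_nonneg (H : (Fin n → ℂ) → ℂ) (x : Fin n → ℂ) : 0 ≤ enX p r H x := by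
  unfold enX; positivity

lemma gradW_nonneg (x : Fin n → ℂ) : 0 ≤ gradW p r x := by
  unfold gradW; positivity

lemma gradW_tst (hp : SmR D p) (hr : Tst D (fun x => (r x : ℂ))) :
    Tst D (fun x => (gradW p r x : ℂ)) := by
  have : Tst D (fun x => ∑ j : Fin n, (ew p x * conj (wder (fun y => (r y : ℂ)) (ee j) x)) *
      wder (fun y => (r y : ℂ)) (ee j) x) :=
    Tst.sum _ fun j _ => (hr.wder _).gmul ((ew_sm hp).mul (hr.sm.wder _).conj)
  convert this using 2 with x
  simp only [gradW, Complex.ofReal_sum]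
  refine Finset.sum_congr rfl fun j _ => ?_
  rw [mul_assoc, Complex.conj_mul']
  simp [ew]

lemma gradW_cont (hp : SmR D p) (hr : Tst D (fun x => (r x : ℂ))) :
    Continuous (gradW p r) ∧ HasCompactSupport (gradW p r) := by
  have := gradW_tst hp hr
  constructor
  · have h := Complex.continuous_re.comp this.cont
    exact h
  · exact this.cpt.comp_left (g := Complex.re) Complex.zero_re

lemma gradW_off {x : Fin n → ℂ} (hx : x ∉ tsupport (fun x => (r x : ℂ))) : gradW p r x = 0 := by
  unfold gradW
  refine Finset.sum_eq_zero fun j _ => ?_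
  rw [wder_eq_zero_of_notMem hx]; simp

lemma energy_bound (hD : IsOpen D) (hp : SmR D p)
    (hL : ∀ K, IsCompact K → K ⊆ D → MemLp (K.indicator h) 2)
    (hweak : ∀ ξ, Tst D ξ → ∫ x, h x * (conj (dl p ξ x) * ew p x) = 0)
    (hr : Tst D (fun x => (r x : ℂ))) :
    ∃ K, IsCompact K ∧ K ⊆ D ∧ tsupport (fun x => (r x : ℂ)) ⊆ K ∧ Integrable (K.indicator h) ∧
      ∀ η > 0, ∃ b0 > 0, ∀ ε, 0 < ε → ε < b0 →
        ∫ x, enX p r (mol (K.indicator h) (rhoC ε)) x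
          ≤ 8 * (∫ x, ‖h x‖ ^ 2 * gradW p r x) + η := by
  set K0 := tsupport (fun x => (r x : ℂ)) with hK0
  have hK0c : IsCompact K0 := hr.cpt
  obtain ⟨d, hd, hdD⟩ := hK0c.exists_cthickening_subset_open hD hr.sub
  set K := Metric.cthickening d K0 with hK
  have hKc : IsCompact K := hK0c.cthickening
  obtain ⟨θ, hθ, hθ1, -⟩ := exists_cutoff hD hKc hdD
  set g := K.indicator h with hg
  have hg2 : MemLp g 2 := hL K hKc hdD
  have hgK : MemLp g 2 (volume.restrict K) := hg2.restrict K
  have hgi : Integrable g := by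
    have : IntegrableOn g K := by
      have : IsFiniteMeasure (volume.restrict K) := ⟨by simpa using hKc.measure_lt_top⟩
      exact hgK.integrable one_le_two
    exact this.integrable_of_forall_notMem_eq_zero fun x hx => by simp [hg, hx]
  refine ⟨K, hKc, hdD, Metric.self_subset_cthickening K0, hgi, ?_⟩
  set c : Fin n → (Fin n → ℂ) → ℂ := fun j x => pj p j x * θ x with hcdef
  have hpj : ∀ j, SmAt D (pj p j) := fun j => hp.toC.wder _
  have hcT : ∀ j, Tst univ (c j) := fun j => (hθ.gmul (hpj j)).mono (subset_univ _)
  have hc : ∀ j, ∀ x ∈ K0, c j x = pj p j x := fun j x hx => by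
    simp [hcdef, hθ1 x (Metric.self_subset_cthickening K0 hx)]
  have hw : ∀ ζ, Tst K ζ → ∑ j, ∫ x, g x * wderBar (fun y => twd c ζ j y) (ee j) x = 0 := by
    intro ζ hζ
    have e1 : ∀ j, (fun y => twd c ζ j y) = fun y => twd (pj p) ζ j y := by
      intro j; ext y
      simp only [twd, hcdef]
      by_cases hy : y ∈ K
      · rw [hθ1 y hy]; simp
      · rw [hζ.zero_off hy]; simp
    have hζD := hζ.mono hdD
    obtain ⟨ξ, hξ, hξe⟩ := weak_form hD hp hζD
    have hT : ∀ j, Tst K (fun x => wderBar (fun y => twd (pj p) ζ j y) (ee j) x) := fun j => by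
      have : Tst K (fun y => twd (pj p) ζ j y) :=
        Tst.twd (fun j x hx => hpj j x (hdD hx)) hζ j
      exact this.wderBar _
    rw [← integral_finsetSum]
    · have := hweak ξ hξ
      rw [← neg_eq_zero, ← integral_neg, ← this]
      congr 1; ext x
      rw [hξe x, mul_neg, neg_inj, Finset.mul_sum]
      refine Finset.sum_congr rfl fun j _ => ?_
      rw [e1]
      by_cases hx : x ∈ K
      · simp [hg, hx]
      · rw [(hT j).zero_off hx]; simp
    · intro j _
      rw [e1]
      exact (hg2.integrable_mul (hT j).memLp)
  obtain ⟨C, hC0, hC⟩ := caccio_bd hp hr hcT hc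
  set N2 := ∫ x, ‖g x‖ ^ 2 with hN2
  have hN20 : 0 ≤ N2 := integral_nonneg fun x => by positivity
  set M0 := ∫ x, ‖h x‖ ^ 2 * gradW p r x with hM0
  have hM0' : M0 = ∫ x, ‖g x‖ ^ 2 * gradW p r x := by
    rw [hM0]; congr 1; ext x
    by_cases hx : x ∈ K
    · simp [hg, hx]
    · rw [gradW_off fun hx' => hx (Metric.self_subset_cthickening K0 hx')]; simp
  obtain ⟨gc, gs⟩ := gradW_cont hp hr
  intro η hη
  set B2 := Real.sqrt N2 * (n * C) with hB2
  set B1 := Real.sqrt N2 * (n * (2 + 2 * C * N2)) with hB1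
  have hB20 : 0 ≤ B2 := by positivity
  have hB10 : 0 ≤ B1 := by positivity
  set η1 := min (1 / (4 * (B2 + 1))) (η / (8 * (B1 + 1))) with hη1
  have hη10 : 0 < η1 := by rw [hη1]; positivity
  have hη1a : η1 * B2 ≤ 1 / 4 := by
    have : η1 ≤ 1 / (4 * (B2 + 1)) := min_le_left _ _
    have h2 : η1 * (4 * (B2 + 1)) ≤ 1 := by
      rwa [le_div_iff₀ (by positivity)] at this
    nlinarith
  have hη1b : η1 * B1 ≤ η / 8 := by
    have : η1 ≤ η / (8 * (B1 + 1)) := min_le_right _ _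
    have h2 : η1 * (8 * (B1 + 1)) ≤ η := by
      rwa [le_div_iff₀ (by positivity)] at this
    nlinarith
  set η2 := η / (16 * (N2 + 1)) with hη2
  have hη20 : 0 < η2 := by positivity
  have hη2a : η2 * N2 ≤ η / 16 := by
    have : η2 * (16 * (N2 + 1)) = η := by rw [hη2]; field_simp
    nlinarith
  obtain ⟨a0, ha0, ha⟩ := approx_eq hgi hg2 hcT hw hη10
  obtain ⟨b0, hb0, hb⟩ := molR_unif (gs.uniformContinuous_of_continuous gc) hη20
  refine ⟨min (min a0 b0) d, by positivity, fun ε hε hεb => ?_⟩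
  have hεa : ε < a0 := hεb.trans_le ((min_le_left _ _).trans (min_le_left _ _))
  have hεb' : ε < b0 := hεb.trans_le ((min_le_left _ _).trans (min_le_right _ _))
  have hεd : ε ≤ d := (hεb.trans_le (min_le_right _ _)).le
  set H := mol g (rhoC ε) with hH
  have hHs : ContDiff ℝ ∞ H := mol_smooth hgi.locallyIntegrable (rhoC_tst hε)
  have hH2 : MemLp H 2 := mol_memLp hε hgi hg2
  have hHN : ∫ x, ‖H x‖ ^ 2 ≤ N2 := mol_contr hε hgi hg2
  obtain ⟨c1, c2⟩ := hC H hHs hH2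
  have hm := caccio_main hp hr hcT hc hHs
  set X := ∫ x, enX p r H x with hX
  have hX0 : 0 ≤ X := integral_nonneg fun x => enX_nonneg H x
  have hGT := cacG_tst hp hr hHs
  have hae := ha ε hε hεa (cacG p r H) (hGT.mono (subset_univ _))
    ((Metric.cthickening_subset_of_subset ε hGT.sub).trans (Metric.cthickening_mono hεd _))
  have sq1 : ∀ t : ℝ, 0 ≤ t → Real.sqrt t ≤ 1 + t := fun t ht => by
    rw [Real.sqrt_le_left (by positivity)]; nlinarith
  have hsum : ∑ j : Fin n, (Real.sqrt (∫ x, ‖cacG p r H x‖ ^ 2) +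
      Real.sqrt (∫ x, ‖wderBar (cacG p r H) (ee j) x‖ ^ 2)) ≤ n * (2 + 2 * C * N2 + C * X) := by
    have : ∀ j ∈ (Finset.univ : Finset (Fin n)), (Real.sqrt (∫ x, ‖cacG p r H x‖ ^ 2) +
      Real.sqrt (∫ x, ‖wderBar (cacG p r H) (ee j) x‖ ^ 2)) ≤ (2 + 2 * C * N2 + C * X) := by
      intro j _
      have s1 := sq1 (∫ x, ‖cacG p r H x‖ ^ 2) (integral_nonneg fun x => by positivity)
      have s2 := sq1 (∫ x, ‖wderBar (cacG p r H) (ee j) x‖ ^ 2) (integral_nonneg fun x => by positivity)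
      have s3 := c2 j
      have s4 := mul_le_mul_of_nonneg_left hHN hC0
      linarith
    refine (Finset.sum_le_card_nsmul _ _ _ this).trans (le_of_eq ?_)
    rw [Finset.card_univ, Fintype.card_fin, nsmul_eq_mul]
  have hS : ‖∑ j, ∫ x, H x * wderBar (fun y => twd c (cacG p r H) j y) (ee j) x‖ ≤ η1 * (B1 + B2 * X) := by
    refine hae.trans ?_
    have := mul_le_mul_of_nonneg_left hsum (by positivity : 0 ≤ η1 * Real.sqrt N2)
    refine this.trans (le_of_eq ?_)
    rw [hB1, hB2]; ring
  have hM : ∫ x, ‖H x‖ ^ 2 * gradW p r x ≤ M0 + η2 * N2 := by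
    refine (mol_contr_w hε hgi hg2 (fun x => gradW_nonneg x) gc gs).trans ?_
    have hg2i := sq_int hg2
    have gb : ∃ C, ∀ x, ‖gradW p r x‖ ≤ C := gs.exists_bound_of_continuous gc
    obtain ⟨Cg, hCg⟩ := gb
    have i1 : Integrable (fun x => ‖g x‖ ^ 2 * gradW p r x) :=
      hg2i.mul_bdd (c := Cg) gc.aestronglyMeasurable (Eventually.of_forall hCg)
    rw [hM0', hN2, ← integral_const_mul, ← integral_add i1 (hg2i.const_mul _)]
    refine integral_mono_of_nonneg (Eventually.of_forall fun x => ?_) (i1.add (hg2i.const_mul _))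
      (Eventually.of_forall fun x => ?_)
    · exact mul_nonneg (by positivity) (molR_nonneg hε (fun x => gradW_nonneg x) x)
    · have := (abs_le.1 (hb ε hε hεb' x)).2
      have := mul_le_mul_of_nonneg_left this (by positivity : 0 ≤ ‖g x‖ ^ 2)
      simp only
      linarith
  have key : X ≤ 2 * (η1 * B1 + η1 * B2 * X) + 4 * (M0 + η2 * N2) := by
    have := hS
    linarith [this]
  have : η1 * B2 * X ≤ 1 / 4 * X := mul_le_mul_of_nonneg_right hη1a hX0
  linarith

lemma pair_bound (hD : IsOpen D) (hp : SmR D p)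
    (hL : ∀ K, IsCompact K → K ⊆ D → MemLp (K.indicator h) 2)
    (hweak : ∀ ξ, Tst D ξ → ∫ x, h x * (conj (dl p ξ x) * ew p x) = 0)
    (hr : Tst D (fun x => (r x : ℂ))) (hζ : Tst D ζ)
    (hr1 : ∀ x ∈ tsupport ζ, r x = 1) (j : Fin n) {l : ℝ} (hl : 0 < l) :
    ‖∫ x, h x * wderBar ζ (ee j) x‖ ≤ 8 * l * (∫ x, ‖h x‖ ^ 2 * gradW p r x)
      + (∫ x, ‖ζ x‖ ^ 2 * Real.exp (p x)) / l := by
  obtain ⟨K, hKc, hKD, hrK, hgi, hE⟩ := energy_bound hD hp hL hweak hr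
  set g := K.indicator h with hg
  set M0 := ∫ x, ‖h x‖ ^ 2 * gradW p r x with hM0
  have hTd := hζ.wderBar (ee j)
  have hζr : tsupport ζ ⊆ tsupport (fun x => (r x : ℂ)) := fun x hx =>
    subset_tsupport _ (by simp [hr1 x hx])
  have e0 : ∫ x, h x * wderBar ζ (ee j) x = ∫ x, g x * wderBar ζ (ee j) x := by
    congr 1; ext x
    by_cases hx : x ∈ K
    · simp [hg, hx]
    · rw [(hζ.shrink.wderBar (ee j)).zero_off fun hx' => hx (hrK (hζr hx'))]; simp
  rw [e0]
  have iζ : Integrable (fun x => ‖ζ x‖ ^ 2 * Real.exp (p x)) := by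
    have T1 : Tst D (fun x => (ew (fun y => - p y) x * conj (ζ x)) * ζ x) :=
      hζ.gmul ((ew_sm hp.neg).mul hζ.sm.conj)
    refine T1.integrable.norm.congr (Eventually.of_forall fun x => ?_)
    simp only [norm_mul, ew_norm, RCLike.norm_conj, neg_neg]; ring
  set N1 := ∫ x, ‖g x‖ with hN1
  have hN10 : 0 ≤ N1 := integral_nonneg fun x => norm_nonneg _
  have main : ∀ η > 0, ‖∫ x, g x * wderBar ζ (ee j) x‖ ≤ 8 * l * M0
      + (∫ x, ‖ζ x‖ ^ 2 * Real.exp (p x)) / l + (l + N1) * η := by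
    intro η hη
    obtain ⟨a0, ha0, ha⟩ := hE η hη
    obtain ⟨b0, hb0, hb⟩ := mol_unif (hTd.cpt.uniformContinuous_of_continuous hTd.cont) hη
    set ε := min a0 b0 / 2 with hε'
    have hm : 0 < min a0 b0 := lt_min ha0 hb0
    have hε : 0 < ε := by positivity
    have hεa : ε < a0 := by linarith [min_le_left a0 b0]
    have hεb : ε < b0 := by linarith [min_le_right a0 b0]
    specialize ha ε hε hεa
    set H := mol g (rhoC ε) with hH
    have hHs : ContDiff ℝ ∞ H := mol_smooth hgi.locallyIntegrable (rhoC_tst hε)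
    have hHD : SmAt D H := fun x _ => hHs.contDiffAt
    have hX := enX_int hp hr hHs
    have p1 : ∫ x, H x * wderBar ζ (ee j) x
        = ∫ t, g t * mol (fun x => wderBar ζ (ee j) x) (rhoC ε) t := mol_pair hε hgi hTd.integrable
    have p2 := ibp_wderBar hHD hζ (ee j)
    obtain ⟨Cb, hCb⟩ := hTd.cpt.exists_bound_of_continuous hTd.cont
    have mc : Continuous (mol (fun x => wderBar ζ (ee j) x) (rhoC ε)) :=
      (mol_smooth hTd.integrable.locallyIntegrable (rhoC_tst hε)).continuous
    have i1 : Integrable (fun x => g x * wderBar ζ (ee j) x) :=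
      hgi.mul_bdd (c := Cb) hTd.cont.aestronglyMeasurable (Eventually.of_forall hCb)
    have i2 : Integrable (fun x => g x * mol (fun x => wderBar ζ (ee j) x) (rhoC ε) x) :=
      hgi.mul_bdd (c := η + Cb) mc.aestronglyMeasurable (Eventually.of_forall fun x => by
        have := norm_sub_norm_le (mol (fun x => wderBar ζ (ee j) x) (rhoC ε) x) (wderBar ζ (ee j) x)
        linarith [hb ε hε hεb x, hCb x])
    have d1 : ‖(∫ x, g x * wderBar ζ (ee j) x) - ∫ x, H x * wderBar ζ (ee j) x‖ ≤ N1 * η := by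
      rw [p1, ← integral_sub i1 i2, hN1, ← integral_mul_const]
      refine norm_integral_le_of_norm_le (hgi.norm.mul_const _) (Eventually.of_forall fun x => ?_)
      rw [← mul_sub, norm_mul]
      refine mul_le_mul_of_nonneg_left ?_ (norm_nonneg _)
      rw [norm_sub_rev]; exact hb ε hε hεb x
    have d2 : ‖∫ x, H x * wderBar ζ (ee j) x‖ ≤ l * (∫ x, enX p r H x)
        + (∫ x, ‖ζ x‖ ^ 2 * Real.exp (p x)) / l := by
      rw [p2, norm_neg, div_eq_mul_inv, ← integral_const_mul, ← integral_mul_const,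
        ← integral_add (hX.const_mul _) (iζ.mul_const _)]
      refine norm_integral_le_of_norm_le ((hX.const_mul _).add (iζ.mul_const _))
        (Eventually.of_forall fun x => ?_)
      rw [norm_mul]
      have hnn : 0 ≤ l * enX p r H x := mul_nonneg hl.le (enX_nonneg H x)
      by_cases hx : x ∈ tsupport ζ
      · have q1 : Real.exp (-(p x)) * ‖wderBar H (ee j) x‖ ^ 2 ≤ enX p r H x := by
          have := Finset.single_le_sum (f := fun j => r x ^ 2 * Real.exp (-(p x)) * ‖wderBar H (ee j) x‖ ^ 2)
            (fun _ _ => by positivity) (Finset.mem_univ j)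
          rw [hr1 x hx] at this
          unfold enX; rw [hr1 x hx]; simpa using this
        have q2 : Real.exp (-(p x)) * Real.exp (p x) = 1 := by rw [← Real.exp_add]; simp
        have q3 := mul_le_mul_of_nonneg_left q1 hl.le
        set A := ‖wderBar H (ee j) x‖
        set B := ‖ζ x‖
        have s1 : Real.sqrt (Real.exp (-(p x))) ^ 2 = Real.exp (-(p x)) := Real.sq_sqrt (Real.exp_pos _).le
        have s2 : Real.sqrt (Real.exp (p x)) ^ 2 = Real.exp (p x) := Real.sq_sqrt (Real.exp_pos _).le
        have s3 : Real.sqrt (Real.exp (-(p x))) * Real.sqrt (Real.exp (p x)) = 1 := by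
          rw [← Real.sqrt_mul (Real.exp_pos _).le, q2, Real.sqrt_one]
        have s4 : Real.sqrt l ^ 2 = l := Real.sq_sqrt hl.le
        have s5 : Real.sqrt l⁻¹ ^ 2 = l⁻¹ := Real.sq_sqrt (by positivity)
        have s6 : Real.sqrt l * Real.sqrt l⁻¹ = 1 := by
          rw [← Real.sqrt_mul hl.le, mul_inv_cancel₀ hl.ne', Real.sqrt_one]
        set a := Real.sqrt l * Real.sqrt (Real.exp (-(p x))) * A with ha'
        set b := Real.sqrt l⁻¹ * Real.sqrt (Real.exp (p x)) * B with hb'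
        have ha2 : a ^ 2 = l * (Real.exp (-(p x)) * A ^ 2) := by rw [ha', mul_pow, mul_pow, s1, s4]; ring
        have hb2 : b ^ 2 = B ^ 2 * Real.exp (p x) * l⁻¹ := by rw [hb', mul_pow, mul_pow, s2, s5]; ring
        have hab : a * b = A * B := by
          calc a * b = (Real.sqrt l * Real.sqrt l⁻¹) * (Real.sqrt (Real.exp (-(p x))) * Real.sqrt (Real.exp (p x))) * (A * B) := by
                rw [ha', hb']; ring
            _ = A * B := by rw [s6, s3]; ring
        have : 0 ≤ A * B := mul_nonneg (norm_nonneg _) (norm_nonneg _)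
        nlinarith [sq_nonneg (a - b)]
      · rw [image_eq_zero_of_notMem_tsupport hx]
        simp only [norm_zero, mul_zero]
        have : 0 ≤ ‖(0:ℂ)‖ ^ 2 * Real.exp (p x) * l⁻¹ := by positivity
        simpa using hnn
    have := norm_sub_norm_le (∫ x, g x * wderBar ζ (ee j) x) (∫ x, H x * wderBar ζ (ee j) x)
    have := mul_le_mul_of_nonneg_left ha hl.le
    linarith
  refine le_of_forall_pos_le_add fun e he => ?_
  have := main (e / (l + N1)) (by positivity)
  have q : (l + N1) * (e / (l + N1)) = e := by field_simp
  rw [q] at this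
  linarith

end Energy

/-- Smooth psh exhaustion. -/
structure Exh {n : ℕ} (Ω : Set (Fin n → ℂ)) (u : (Fin n → ℂ) → ℝ) : Prop where
  op : IsOpen Ω
  sm : SmR Ω u
  psh : ∀ x ∈ Ω, ∀ v, 0 ≤ (levi u v x).re
  cpt : ∀ c : ℝ, IsCompact {z | z ∈ Ω ∧ u z ≤ c}

/-- sublevel sets -/
def sbl {n : ℕ} (Ω : Set (Fin n → ℂ)) (u : (Fin n → ℂ) → ℝ) (c : ℝ) : Set (Fin n → ℂ) :=
  {z | z ∈ Ω ∧ u z < c}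

section Exhaust
variable {n : ℕ} {Ω : Set (Fin n → ℂ)} {u q q' : (Fin n → ℂ) → ℝ} {c : ℝ} {h : (Fin n → ℂ) → ℂ}

lemma SmR.contOn {D : Set (Fin n → ℂ)} {p : (Fin n → ℂ) → ℝ} (hp : SmR D p) : ContinuousOn p D :=
  fun x hx => (hp x hx).continuousAt.continuousWithinAt

lemma SmAt.contOn {D : Set (Fin n → ℂ)} {p : (Fin n → ℂ) → ℂ} (hp : SmAt D p) : ContinuousOn p D :=
  fun x hx => (hp x hx).continuousAt.continuousWithinAt

lemma Exh.open_sbl (E : Exh Ω u) (c : ℝ) : IsOpen (sbl Ω u c) :=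
  E.sm.contOn.isOpen_inter_preimage E.op isOpen_Iio

lemma sbl_sub : sbl Ω u c ⊆ Ω := fun _ h => h.1

lemma trans_deriv_bd : ∃ M : ℝ, 0 ≤ M ∧ ∀ v, |deriv Real.smoothTransition v| ≤ M ∧
    ((v < 0 ∨ 1 < v) → deriv Real.smoothTransition v = 0) := by
  have hc : Continuous (deriv Real.smoothTransition) :=
    (Real.smoothTransition.contDiff (n := 1)).continuous_deriv le_rfl
  have h0 : ∀ v : ℝ, (v < 0 ∨ 1 < v) → deriv Real.smoothTransition v = 0 := by
    rintro v (hv | hv)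
    · have : Real.smoothTransition =ᶠ[𝓝 v] fun _ => 0 := by
        filter_upwards [Iio_mem_nhds hv] with y hy
        exact Real.smoothTransition.zero_of_nonpos (le_of_lt hy)
      rw [this.deriv_eq]; simp
    · have : Real.smoothTransition =ᶠ[𝓝 v] fun _ => 1 := by
        filter_upwards [Ioi_mem_nhds hv] with y hy
        exact Real.smoothTransition.one_of_one_le (le_of_lt hy)
      rw [this.deriv_eq]; simp
  obtain ⟨M, hM⟩ := isCompact_Icc.exists_bound_of_continuousOn (s := Icc (0:ℝ) 1) hc.continuousOn
  refine ⟨|M|, abs_nonneg _, fun v => ⟨?_, h0 v⟩⟩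
  by_cases hv : v ∈ Icc (0:ℝ) 1
  · exact (hM v hv).trans (le_abs_self _)
  · rw [h0 v, abs_zero]; exact abs_nonneg _
    simp only [mem_Icc, not_and_or, not_le] at hv; exact hv

open Classical in
/-- exhaustion cutoffs -/
def cutk (Ω : Set (Fin n → ℂ)) (u : (Fin n → ℂ) → ℝ) (c : ℝ) (k : ℕ) (x : Fin n → ℂ) : ℝ :=
  if x ∈ Ω then Real.smoothTransition ((k + 1) * (c - u x) - 1) else 0

lemma cutk_supp (E : Exh Ω u) (k : ℕ) :
    tsupport (fun x => (cutk Ω u c k x : ℂ)) ⊆ {z | z ∈ Ω ∧ u z ≤ c - 1 / (k + 1)} := by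
  refine closure_minimal (fun x hx => ?_) (E.cpt _).isClosed
  have hk : (0:ℝ) < k + 1 := by positivity
  by_contra hn
  apply hx
  simp only [cutk]
  split_ifs with h1
  · rw [Real.smoothTransition.zero_of_nonpos]; simp
    simp only [mem_setOf_eq, not_and, not_le] at hn
    have := hn h1
    have h2 : (k + 1 : ℝ) * (c - u x) ≤ (k + 1) * (1 / (k + 1)) :=
      mul_le_mul_of_nonneg_left (by linarith) hk.le
    rw [mul_one_div_cancel hk.ne'] at h2
    linarith
  · simp

lemma cutk_tst (E : Exh Ω u) (k : ℕ) : Tst (sbl Ω u c) (fun x => (cutk Ω u c k x : ℂ)) := by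
  have hs := cutk_supp (c := c) E k
  refine ⟨?_, (E.cpt _).of_isClosed_subset (isClosed_tsupport _) hs, hs.trans ?_⟩
  · rw [contDiff_iff_contDiffAt]
    intro x
    by_cases hx : x ∈ Ω
    · have e : (fun x => (cutk Ω u c k x : ℂ)) =ᶠ[𝓝 x]
          fun x => ((Real.smoothTransition ((k + 1) * (c - u x) - 1) : ℝ) : ℂ) := by
        filter_upwards [E.op.mem_nhds hx] with y hy
        simp [cutk, hy]
      refine ContDiffAt.congr_of_eventuallyEq ?_ e
      have h1 : ContDiffAt ℝ ∞ (fun x => (k + 1) * (c - u x) - 1) x :=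
        (contDiffAt_const.mul (contDiffAt_const.sub (E.sm x hx))).sub contDiffAt_const
      have h2 : ContDiffAt ℝ ∞ (fun x => Real.smoothTransition ((k + 1) * (c - u x) - 1)) x :=
        (Real.smoothTransition.contDiff (n := ⊤)).contDiffAt.comp x h1
      exact h2.toC
    · have hx' : x ∉ tsupport (fun x => (cutk Ω u c k x : ℂ)) := fun h => hx (hs h).1
      have := notMem_tsupport_iff_eventuallyEq.mp hx'
      exact contDiffAt_const.congr_of_eventuallyEq this
  · rintro x ⟨h1, h2⟩
    have : (0:ℝ) < 1 / (k + 1) := by positivity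
    exact ⟨h1, by linarith⟩

lemma cutk_one (E : Exh Ω u) {K : Set (Fin n → ℂ)} (hK : IsCompact K) (hKD : K ⊆ sbl Ω u c) :
    ∃ k0, ∀ k ≥ k0, ∀ x ∈ K, cutk Ω u c k x = 1 := by
  rcases K.eq_empty_or_nonempty with rfl | hne
  · exact ⟨0, by simp⟩
  obtain ⟨x0, hx0, hm⟩ := hK.exists_isMaxOn hne (E.sm.contOn.mono (hKD.trans sbl_sub))
  have hpos : 0 < c - u x0 := by have := (hKD hx0).2; linarith
  obtain ⟨k0, hk0⟩ := exists_nat_gt (2 / (c - u x0))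
  refine ⟨k0, fun k hk x hx => ?_⟩
  rw [cutk, if_pos (hKD hx).1, Real.smoothTransition.one_of_one_le]
  have h1 : u x ≤ u x0 := hm hx
  have h2 : 2 < k0 * (c - u x0) := by rwa [div_lt_iff₀ hpos] at hk0
  have h3 : (k0:ℝ) ≤ k := by exact_mod_cast hk
  have h4 : (k0:ℝ) * (c - u x0) ≤ (k+1) * (c - u x) := by
    apply mul_le_mul (by linarith) (by linarith) hpos.le (by positivity)
  linarith

/-- gradient bound on cutoffs -/
lemma cutk_grad (E : Exh Ω u) : ∃ L : ℝ, 0 ≤ L ∧ ∀ k j, ∀ x ∈ sbl Ω u c,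
    ‖wder (fun y => (cutk Ω u c k y : ℂ)) (ee j) x‖ * (c - u x) ≤ L ∧
    (2 / (k + 1 : ℝ) < c - u x → wder (fun y => (cutk Ω u c k y : ℂ)) (ee j) x = 0) := by
  obtain ⟨M, hM, hMb⟩ := trans_deriv_bd
  have : ∀ j : Fin n, ∃ L, ∀ x ∈ {z | z ∈ Ω ∧ u z ≤ c}, ‖wder (fun y => (u y : ℂ)) (ee j) x‖ ≤ L :=
    fun j => (E.cpt c).exists_bound_of_continuousOn
      ((E.sm.toC.wder (ee j)).contOn.mono fun x hx => hx.1)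
  choose L hL using this
  have hLs : ∀ j, L j ≤ ∑ j, |L j| := fun j =>
    (le_abs_self _).trans (Finset.single_le_sum (f := fun j => |L j|) (fun _ _ => abs_nonneg _) (Finset.mem_univ j))
  refine ⟨2 * M * ∑ j, |L j|, by positivity, fun k j x hx => ?_⟩
  have hk : (0:ℝ) < k + 1 := by positivity
  have hs : 0 < c - u x := by have := hx.2; linarith
  have hdu : DifferentiableAt ℝ u x := E.sm.d hx.1
  set v := (k + 1 : ℝ) * (c - u x) - 1 with hv
  have e : (fun x => (cutk Ω u c k x : ℂ)) =ᶠ[𝓝 x]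
      fun x => ((Real.smoothTransition ((k + 1) * (c - u x) - 1) : ℝ) : ℂ) := by
    filter_upwards [E.op.mem_nhds hx.1] with y hy
    simp [cutk, hy]
  have hd : HasDerivAt (fun s : ℝ => Real.smoothTransition ((k + 1) * (c - s) - 1))
      (deriv Real.smoothTransition v * (-(k+1))) (u x) := by
    have h1 : HasDerivAt (fun s : ℝ => (k + 1) * (c - s) - 1) (-(k+1) : ℝ) (u x) := by
      have := (((hasDerivAt_id (u x)).const_sub c).const_mul (k + 1 : ℝ)).sub_const 1
      simpa using this
    have h2 : HasDerivAt Real.smoothTransition (deriv Real.smoothTransition v) v :=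
      ((Real.smoothTransition.contDiff (n := 1)).differentiable (by norm_num) v).hasDerivAt
    exact h2.comp (u x) h1
  have ew : wder (fun y => (cutk Ω u c k y : ℂ)) (ee j) x =
      ((deriv Real.smoothTransition v * (-(k+1)) : ℝ) : ℂ) * wder (fun y => (u y : ℂ)) (ee j) x := by
    rw [wder_congr e, wder_chain hdu hd]
  have hz : 2 / (k + 1 : ℝ) < c - u x → deriv Real.smoothTransition v = 0 := by
    intro h2
    refine (hMb v).2 (Or.inr ?_)
    rw [div_lt_iff₀ hk] at h2
    rw [hv]; linarith
  constructor
  · by_cases h2 : 2 / (k + 1 : ℝ) < c - u x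
    · rw [ew, hz h2]; simp; positivity
    · push Not at h2
      rw [ew, norm_mul, Complex.norm_real, Real.norm_eq_abs, abs_mul, abs_neg, abs_of_pos hk]
      have h3 : (k + 1 : ℝ) * (c - u x) ≤ 2 := by rw [le_div_iff₀ hk] at h2; linarith
      have h4 := (hL j x ⟨hx.1, hx.2.le⟩).trans (hLs j)
      calc |deriv Real.smoothTransition v| * (k + 1) * ‖wder (fun y => (u y : ℂ)) (ee j) x‖ * (c - u x)
          = |deriv Real.smoothTransition v| * ((k + 1) * (c - u x)) * ‖wder (fun y => (u y : ℂ)) (ee j) x‖ := by ring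
        _ ≤ (M * 2) * ∑ j, |L j| := by
            apply mul_le_mul _ h4 (norm_nonneg _) (by positivity)
            exact mul_le_mul (hMb v).1 h3 (by positivity) hM
        _ = _ := by ring
  · intro h2; rw [ew, hz h2]; simp

lemma regularity (E : Exh Ω u) (hq : SmR (sbl Ω u c) q) (hq' : SmR (sbl Ω u c) q')
    {C : ℝ} (hC : ∀ x ∈ sbl Ω u c, Real.exp (-(q' x)) ≤ C * (c - u x) ^ 2 * Real.exp (-(q x)))
    (hm : AEStronglyMeasurable h (volume.restrict (sbl Ω u c)))
    (hintg : IntegrableOn (fun x => ‖h x‖ ^ 2 * Real.exp (-(q x))) (sbl Ω u c))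
    (hweak : ∀ ξ, Tst (sbl Ω u c) ξ → ∫ x, h x * (conj (dl q' ξ x) * ew q' x) = 0) :
    ∃ f, DifferentiableOn ℂ f (sbl Ω u c) ∧ ∀ᵐ x, x ∈ sbl Ω u c → h x = f x := by
  set D := sbl Ω u c with hDdef
  have hD : IsOpen D := E.open_sbl c
  have hL : ∀ K, IsCompact K → K ⊆ D → MemLp (K.indicator h) 2 := by
    intro K hK hKD
    have hmK : AEStronglyMeasurable (K.indicator h) := by
      rw [aestronglyMeasurable_indicator_iff hK.measurableSet]
      exact hm.mono_measure (Measure.restrict_mono hKD le_rfl)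
    rw [memLp_two_iff_integrable_sq_norm hmK]
    obtain ⟨B, hB⟩ := hK.exists_bound_of_continuousOn (f := fun x => Real.exp (q x))
      (hq.contOn.mono hKD).rexp
    have i1 : Integrable (K.indicator (fun x => ‖h x‖ ^ 2 * Real.exp (-(q x)))) :=
      (hintg.mono_set hKD).integrable_indicator hK.measurableSet
    refine (i1.const_mul B).mono' (hmK.norm.pow 2) (Eventually.of_forall fun x => ?_)
    by_cases hx : x ∈ K
    · simp only [hx, indicator_of_mem, norm_pow, norm_norm]
      have e1 : Real.exp (q x) * Real.exp (-(q x)) = 1 := by rw [← Real.exp_add]; simp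
      have e2 : Real.exp (q x) ≤ B := by simpa using hB x hx
      calc ‖h x‖ ^ 2 = Real.exp (q x) * (‖h x‖ ^ 2 * Real.exp (-(q x))) := by
            rw [mul_left_comm, e1, mul_one]
        _ ≤ _ := mul_le_mul_of_nonneg_right e2 (by positivity)
    · simp [hx]
  refine WH.holo hD ⟨?_, fun ζ hζ j => ?_⟩
  · rw [locallyIntegrableOn_iff hD.isLocallyClosed]
    intro K hKD hK
    have : MemLp (K.indicator h) 2 (volume.restrict K) := (hL K hK hKD).restrict K
    have fm : IsFiniteMeasure (volume.restrict K) := ⟨by simpa using hK.measure_lt_top⟩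
    have := this.integrable one_le_two
    have h2 : IntegrableOn (K.indicator h) K := this
    rwa [integrableOn_congr_fun (g := h) (fun x hx => by simp [hx]) hK.measurableSet] at h2
  obtain ⟨k0, hk0⟩ := cutk_one E hζ.cpt hζ.sub
  obtain ⟨L, hL0, hLb⟩ := cutk_grad (c := c) E
  have hlim : Tendsto (fun k : ℕ => ∫ x, ‖h x‖ ^ 2 * gradW q' (cutk Ω u c k) x) atTop (𝓝 0) := by
    have h0 : ∀ k x, ‖h x‖ ^ 2 * gradW q' (cutk Ω u c k) x =
        D.indicator (fun x => ‖h x‖ ^ 2 * gradW q' (cutk Ω u c k) x) x := by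
      intro k x
      by_cases hx : x ∈ D
      · simp [hx]
      · rw [gradW_off fun hx' => hx ((cutk_tst E k).sub hx')]; simp [hx]
    rw [show (fun k : ℕ => ∫ x, ‖h x‖ ^ 2 * gradW q' (cutk Ω u c k) x) = fun k : ℕ => ∫ x,
      D.indicator (fun x => ‖h x‖ ^ 2 * gradW q' (cutk Ω u c k) x) x from
      funext fun k => integral_congr_ae (Eventually.of_forall (h0 k))]
    have : (0:ℝ) = ∫ x : Fin n → ℂ, (0:ℝ) := by simp
    rw [this]
    refine tendsto_integral_of_dominated_convergence
      (D.indicator (fun x => (n * (L ^ 2 * C)) * (‖h x‖ ^ 2 * Real.exp (-(q x))))) ?_ ?_ ?_ ?_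
    · intro k
      rw [aestronglyMeasurable_indicator_iff hD.measurableSet]
      exact (hm.norm.pow 2).mul (gradW_cont hq' (cutk_tst E k)).1.aestronglyMeasurable
    · exact (integrable_indicator_iff hD.measurableSet).2 (hintg.const_mul _)
    · intro k
      refine Eventually.of_forall fun x => ?_
      by_cases hx : x ∈ D
      · simp only [hx, indicator_of_mem]
        rw [Real.norm_of_nonneg (mul_nonneg (by positivity) (gradW_nonneg _))]
        have hg : gradW q' (cutk Ω u c k) x ≤ n * (L ^ 2 * C * Real.exp (-(q x))) := by
          unfold gradW
          have : ∀ j ∈ (Finset.univ : Finset (Fin n)), Real.exp (-(q' x)) *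
              ‖wder (fun y => (cutk Ω u c k y : ℂ)) (ee j) x‖ ^ 2 ≤ L ^ 2 * C * Real.exp (-(q x)) := by
            intro j _
            have a1 := (hLb k j x hx).1
            have a2 := hC x hx
            have hs : 0 < c - u x := by have := hx.2; linarith
            have hC0 : 0 ≤ C * Real.exp (-(q x)) := by
              have : 0 < C * (c - u x) ^ 2 * Real.exp (-(q x)) := (Real.exp_pos _).trans_le a2
              have : 0 < (C * Real.exp (-(q x))) * (c - u x) ^ 2 := by linarith
              exact (pos_of_mul_pos_left this (by positivity)).le
            set W := ‖wder (fun y => (cutk Ω u c k y : ℂ)) (ee j) x‖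
            have a3 : (W * (c - u x)) ^ 2 ≤ L ^ 2 := by
              have : 0 ≤ W * (c - u x) := mul_nonneg (norm_nonneg _) hs.le
              gcongr
            calc Real.exp (-(q' x)) * W ^ 2 ≤ (C * (c - u x) ^ 2 * Real.exp (-(q x))) * W ^ 2 :=
                  mul_le_mul_of_nonneg_right a2 (by positivity)
              _ = (W * (c - u x)) ^ 2 * (C * Real.exp (-(q x))) := by ring
              _ ≤ L ^ 2 * (C * Real.exp (-(q x))) := mul_le_mul_of_nonneg_right a3 hC0
              _ = _ := by ring
          refine (Finset.sum_le_card_nsmul _ _ _ this).trans (le_of_eq ?_)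
          rw [Finset.card_univ, Fintype.card_fin, nsmul_eq_mul]
        calc _ ≤ ‖h x‖ ^ 2 * (n * (L ^ 2 * C * Real.exp (-(q x)))) :=
              mul_le_mul_of_nonneg_left hg (by positivity)
          _ = _ := by ring
      · simp [hx]
    · refine Eventually.of_forall fun x => ?_
      by_cases hx : x ∈ D
      · simp only [hx, indicator_of_mem]
        have hs : 0 < c - u x := by have := hx.2; linarith
        obtain ⟨k1, hk1⟩ := exists_nat_gt (2 / (c - u x))
        refine tendsto_const_nhds.congr' ?_
        filter_upwards [eventually_ge_atTop k1] with k hk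
        have h2 : 2 / (k + 1 : ℝ) < c - u x := by
          rw [div_lt_iff₀ (by positivity)]
          rw [div_lt_iff₀ hs] at hk1
          have h3 : (k1:ℝ) ≤ k := by exact_mod_cast hk
          nlinarith
        have : gradW q' (cutk Ω u c k) x = 0 := by
          unfold gradW
          refine Finset.sum_eq_zero fun j _ => ?_
          rw [(hLb k j x hx).2 h2]; simp
        rw [this]; simp
      · simp [hx]
  have hb : ∀ l : ℝ, 0 < l → ‖∫ x, h x * wderBar ζ (ee j) x‖ ≤
      (∫ x, ‖ζ x‖ ^ 2 * Real.exp (q' x)) / l := by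
    intro l hl
    have ht := (hlim.const_mul (8 * l)).add_const ((∫ x, ‖ζ x‖ ^ 2 * Real.exp (q' x)) / l)
    rw [mul_zero, zero_add] at ht
    refine ge_of_tendsto ht ?_
    filter_upwards [eventually_ge_atTop k0] with k hk
    exact pair_bound hD hq' hL hweak (cutk_tst E k) hζ (hk0 k hk) j hl
  have ht : Tendsto (fun l : ℝ => (∫ x, ‖ζ x‖ ^ 2 * Real.exp (q' x)) / l) atTop (𝓝 0) :=
    tendsto_const_nhds.div_atTop tendsto_id
  have : ‖∫ x, h x * wderBar ζ (ee j) x‖ ≤ 0 :=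
    ge_of_tendsto ht (by filter_upwards [eventually_gt_atTop 0] with l hl using hb l hl)
  exact norm_le_zero_iff.1 this

end Exhaust

section HoloX
variable {n : ℕ} {D : Set (Fin n → ℂ)} {f : (Fin n → ℂ) → ℂ}

lemma cpt_ind {B : Set (Fin n → ℂ)} (hB : IsCompact B) (hf : ContinuousOn f B) :
    Integrable (B.indicator f) :=
  (hf.integrableOn_compact hB).integrable_indicator hB.measurableSet

lemma hol_repr (hD : IsOpen D) (hf : DifferentiableOn ℂ f D) {x : Fin n → ℂ} {ε : ℝ} (hε : 0 < ε)
    (hx : Metric.closedBall x (2 * ε) ⊆ D) {y : Fin n → ℂ} (hy : y ∈ Metric.ball x ε) :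
    f y = mol ((Metric.closedBall x (2 * ε)).indicator f) (rhoC ε) y := by
  have hyB : Metric.closedBall y ε ⊆ Metric.closedBall x (2 * ε) := by
    refine Metric.closedBall_subset_closedBall' ?_
    have := Metric.mem_ball.1 hy
    linarith
  rw [mol_cut (rhoC_tst hε) hyB, mean_value hε hD hf (hyB.trans hx)]

lemma hol_smooth (hD : IsOpen D) (hf : DifferentiableOn ℂ f D) : SmAt D f := by
  intro x hx
  obtain ⟨e, he, hed⟩ := Metric.nhds_basis_closedBall.mem_iff.1 (hD.mem_nhds hx)
  have hε : 0 < e / 2 := by positivity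
  have h2 : 2 * (e / 2) = e := by ring
  have hB : IsCompact (Metric.closedBall x (2 * (e / 2))) := isCompact_closedBall _ _
  have hx2 : Metric.closedBall x (2 * (e / 2)) ⊆ D := by rw [h2]; exact hed
  have hs := mol_smooth (cpt_ind hB (hf.continuousOn.mono hx2)).locallyIntegrable (rhoC_tst hε)
  refine hs.contDiffAt.congr_of_eventuallyEq ?_
  filter_upwards [Metric.ball_mem_nhds x hε] with y hy
  exact hol_repr hD hf hε hx2 hy

lemma ker_ineq {Φ : (Fin n → ℂ) → ℝ} {B : Set (Fin n → ℂ)} (hB : IsCompact B)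
    (hΦ : ContinuousOn Φ B) : ∃ C : ℝ, 0 ≤ C ∧ ∀ f : (Fin n → ℂ) → ℂ, ContinuousOn f B →
      ∀ (k : (Fin n → ℂ) → ℂ) (η : ℝ), (∀ t, ‖k t‖ ≤ η) →
      ENNReal.ofReal (‖∫ t, B.indicator f t * k t‖ ^ 2) ≤
        ENNReal.ofReal (C * η ^ 2) * bergNormSq B Φ volume f := by
  obtain ⟨M, hM⟩ := hB.exists_bound_of_continuousOn (f := fun x => Real.exp (Φ x)) hΦ.rexp
  have fm : IsFiniteMeasure (volume.restrict B) := ⟨by simpa using hB.measure_lt_top⟩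
  refine ⟨|M| * volume.real B, by positivity, fun f hf k η hk => ?_⟩
  have hη : 0 ≤ η := (norm_nonneg _).trans (hk 0)
  have hfi : IntegrableOn (fun x => ‖f x‖) B := hf.norm.integrableOn_compact hB
  have hf2 : IntegrableOn (fun x => ‖f x‖ ^ 2) B := (hf.norm.pow 2).integrableOn_compact hB
  have hfw : IntegrableOn (fun x => ‖f x‖ ^ 2 * Real.exp (-(Φ x))) B :=
    ((hf.norm.pow 2).mul hΦ.neg.rexp).integrableOn_compact hB
  have hN : bergNormSq B Φ volume f = ENNReal.ofReal (∫ x in B, ‖f x‖ ^ 2 * Real.exp (-(Φ x))) := by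
    rw [bergNormSq, ofReal_integral_eq_lintegral_ofReal hfw]
    exact Eventually.of_forall fun x => by positivity
  have b1 : ‖∫ t, B.indicator f t * k t‖ ≤ η * ∫ x in B, ‖f x‖ := by
    rw [← integral_const_mul, ← integral_indicator hB.measurableSet]
    refine norm_integral_le_of_norm_le ((integrable_indicator_iff hB.measurableSet).2 (hfi.const_mul _))
      (Eventually.of_forall fun x => ?_)
    by_cases hx : x ∈ B
    · simp only [hx, indicator_of_mem, norm_mul]
      rw [mul_comm]
      exact mul_le_mul_of_nonneg_right (hk x) (norm_nonneg _)
    · simp [hx]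
  have b2 : ∫ x in B, ‖f x‖ ≤ Real.sqrt (∫ x in B, ‖f x‖ ^ 2) * Real.sqrt (volume.real B) := by
    have m1 : MemLp f 2 (volume.restrict B) := by
      rw [memLp_two_iff_integrable_sq_norm (hf.aestronglyMeasurable hB.measurableSet)]
      exact hf2
    have m2 : MemLp (fun _ : Fin n → ℂ => (1:ℂ)) 2 (volume.restrict B) := memLp_const 1
    have := cs_norm m1 m2
    simpa using this
  have b3 : ∫ x in B, ‖f x‖ ^ 2 ≤ |M| * ∫ x in B, ‖f x‖ ^ 2 * Real.exp (-(Φ x)) := by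
    rw [← integral_const_mul]
    refine setIntegral_mono_on hf2 (hfw.const_mul _) hB.measurableSet fun x hx => ?_
    have e1 : Real.exp (Φ x) * Real.exp (-(Φ x)) = 1 := by rw [← Real.exp_add]; simp
    have e2 : Real.exp (Φ x) ≤ |M| := by
      have := hM x hx
      rw [Real.norm_of_nonneg (Real.exp_pos _).le] at this
      exact this.trans (le_abs_self _)
    calc ‖f x‖ ^ 2 = Real.exp (Φ x) * (‖f x‖ ^ 2 * Real.exp (-(Φ x))) := by
          rw [mul_left_comm, e1, mul_one]
      _ ≤ _ := mul_le_mul_of_nonneg_right e2 (by positivity)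
  rw [hN, ← ENNReal.ofReal_mul (by positivity)]
  refine ENNReal.ofReal_le_ofReal ?_
  have i0 : 0 ≤ ∫ x in B, ‖f x‖ ^ 2 := integral_nonneg fun x => by positivity
  have i1 : 0 ≤ ∫ x in B, ‖f x‖ := integral_nonneg fun x => by positivity
  calc ‖∫ t, B.indicator f t * k t‖ ^ 2 ≤ (η * ∫ x in B, ‖f x‖) ^ 2 := by gcongr
    _ = η ^ 2 * (∫ x in B, ‖f x‖) ^ 2 := by ring
    _ ≤ η ^ 2 * (Real.sqrt (∫ x in B, ‖f x‖ ^ 2) * Real.sqrt (volume.real B)) ^ 2 := by gcongr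
    _ = η ^ 2 * ((∫ x in B, ‖f x‖ ^ 2) * volume.real B) := by
        rw [mul_pow, Real.sq_sqrt i0, Real.sq_sqrt measureReal_nonneg]
    _ ≤ η ^ 2 * ((|M| * ∫ x in B, ‖f x‖ ^ 2 * Real.exp (-(Φ x))) * volume.real B) := by gcongr
    _ = _ := by ring

lemma norm_mono_set {A B : Set (Fin n → ℂ)} (h : A ⊆ B) (Φ : (Fin n → ℂ) → ℝ) (f : (Fin n → ℂ) → ℂ) :
    bergNormSq A Φ volume f ≤ bergNormSq B Φ volume f := lintegral_mono_set h

/-- local sup bound -/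
lemma hol_sup (hD : IsOpen D) {Φ : (Fin n → ℂ) → ℝ} (hΦ : ContinuousOn Φ D) {x : Fin n → ℂ}
    (hx : x ∈ D) : ∃ ε > 0, ∃ C : ℝ, 0 ≤ C ∧ Metric.ball x ε ⊆ D ∧
      ∀ f, DifferentiableOn ℂ f D → ∀ y ∈ Metric.ball x ε,
        ENNReal.ofReal (‖f y‖ ^ 2) ≤ ENNReal.ofReal C * bergNormSq D Φ volume f := by
  obtain ⟨e, he, hed⟩ := Metric.nhds_basis_closedBall.mem_iff.1 (hD.mem_nhds hx)
  have hε : 0 < e / 2 := by positivity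
  have h2 : 2 * (e / 2) = e := by ring
  have hB : IsCompact (Metric.closedBall x (2 * (e / 2))) := isCompact_closedBall _ _
  have hx2 : Metric.closedBall x (2 * (e / 2)) ⊆ D := by rw [h2]; exact hed
  obtain ⟨C, hC0, hC⟩ := ker_ineq hB (hΦ.mono hx2)
  have hT := rhoC_tst (n := n) hε
  obtain ⟨R, hR⟩ := hT.cpt.exists_bound_of_continuous hT.cont
  refine ⟨e / 2, hε, C * R ^ 2, by positivity, ?_, fun f hf y hy => ?_⟩
  · exact (Metric.ball_subset_closedBall.trans (Metric.closedBall_subset_closedBall (by linarith))).trans hed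
  · rw [hol_repr hD hf hε hx2 hy, mol]
    refine (hC f (hf.continuousOn.mono hx2) (fun t => rhoC (e / 2) (y - t)) R fun t => hR _).trans ?_
    gcongr
    exact norm_mono_set hx2 _ _

/-- equicontinuity -/
lemma hol_equi (hD : IsOpen D) {Φ : (Fin n → ℂ) → ℝ} (hΦ : ContinuousOn Φ D) {x : Fin n → ℂ}
    (hx : x ∈ D) {e0 : ℝ} (he0 : 0 < e0) : ∃ ε > 0, Metric.ball x ε ⊆ D ∧
      ∀ f, DifferentiableOn ℂ f D → ∀ y ∈ Metric.ball x ε,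
        ENNReal.ofReal (‖f y - f x‖ ^ 2) ≤ ENNReal.ofReal e0 * bergNormSq D Φ volume f := by
  obtain ⟨e, he, hed⟩ := Metric.nhds_basis_closedBall.mem_iff.1 (hD.mem_nhds hx)
  have hε : 0 < e / 2 := by positivity
  have h2 : 2 * (e / 2) = e := by ring
  have hB : IsCompact (Metric.closedBall x (2 * (e / 2))) := isCompact_closedBall _ _
  have hx2 : Metric.closedBall x (2 * (e / 2)) ⊆ D := by rw [h2]; exact hed
  obtain ⟨C, hC0, hC⟩ := ker_ineq hB (hΦ.mono hx2)
  have hT := rhoC_tst (n := n) hε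
  have hu := hT.cpt.uniformContinuous_of_continuous hT.cont
  set η := Real.sqrt (e0 / (C + 1)) with hη
  have hη0 : 0 < η := Real.sqrt_pos.2 (by positivity)
  have hη2 : C * η ^ 2 ≤ e0 := by
    rw [hη, Real.sq_sqrt (by positivity)]
    have : e0 / (C + 1) * (C + 1) = e0 := by field_simp
    have h3 : 0 < e0 / (C + 1) := by positivity
    nlinarith
  obtain ⟨d, hd, hdu⟩ := Metric.uniformContinuous_iff.1 hu η hη0
  refine ⟨min (e / 2) d, by positivity, ?_, fun f hf y hy => ?_⟩
  · exact ((Metric.ball_subset_ball (min_le_left _ _)).trans (Metric.ball_subset_closedBall.trans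
      (Metric.closedBall_subset_closedBall (by linarith)))).trans hed
  · have hy1 : y ∈ Metric.ball x (e / 2) := Metric.ball_subset_ball (min_le_left _ _) hy
    have hy2 : dist y x < d := (Metric.mem_ball.1 hy).trans_le (min_le_right _ _)
    have hi := (cpt_ind hB (hf.continuousOn.mono hx2)).locallyIntegrable
    rw [hol_repr hD hf hε hx2 hy1, hol_repr hD hf hε hx2 (Metric.mem_ball_self hε), mol, mol,
      ← integral_sub (mol_integrand hi hT.cont hT.cpt _) (mol_integrand hi hT.cont hT.cpt _)]
    simp_rw [← mul_sub]
    refine (hC f (hf.continuousOn.mono hx2)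
      (fun t => rhoC (e / 2) (y - t) - rhoC (e / 2) (x - t)) η fun t => ?_).trans ?_
    · rw [← dist_eq_norm]
      exact (hdu (by simpa using hy2)).le
    · gcongr
      exact norm_mono_set hx2 _ _

lemma hol_WH (hD : IsOpen D) (hf : DifferentiableOn ℂ f D) {ζ : (Fin n → ℂ) → ℂ} (hζ : Tst D ζ)
    (j : Fin n) : ∫ x, f x * wderBar ζ (ee j) x = 0 := by
  rw [ibp_wderBar (hol_smooth hD hf) hζ, neg_eq_zero]
  refine integral_eq_zero_of_ae (Eventually.of_forall fun x => ?_)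
  show wderBar f (ee j) x * ζ x = 0
  by_cases hx : x ∈ D
  · rw [wderBar_holo ((hf x hx).differentiableAt (hD.mem_nhds hx))]; simp
  · rw [hζ.zero_off hx]; simp

lemma hol_limit (hD : IsOpen D) {g : ℕ → (Fin n → ℂ) → ℂ}
    (hloc : ∀ x ∈ D, ∃ V, IsOpen V ∧ x ∈ V ∧ (∀ᶠ j in atTop, DifferentiableOn ℂ (g j) V) ∧
      TendstoUniformlyOn g f atTop V) : DifferentiableOn ℂ f D := by
  intro x hx
  obtain ⟨V, hV, hxV, hg, hu⟩ := hloc x hx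
  have hfc : ContinuousOn f V :=
    hu.continuousOn (hg.mono fun j hj => hj.continuousOn).frequently
  have hW : WH V f := by
    refine ⟨hfc.locallyIntegrableOn hV.measurableSet, fun ζ hζ j => ?_⟩
    have hTd := hζ.wderBar (ee j)
    have hn : ∀ e > 0, ‖∫ x, f x * wderBar ζ (ee j) x‖ ≤ e * ∫ x, ‖wderBar ζ (ee j) x‖ := by
      intro e he
      obtain ⟨i, hi1, hi2⟩ := ((Metric.tendstoUniformlyOn_iff.1 hu e he).and hg).exists
      have z0 := hol_WH hV hi2 hζ j
      have iG : ∀ G : (Fin n → ℂ) → ℂ, ContinuousOn G V → Integrable (fun x => G x * wderBar ζ (ee j) x) := by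
        intro G hG
        have hc : Continuous (fun x => wderBar ζ (ee j) x * G x) := by
          refine continuous_iff_continuousAt.2 fun x => ?_
          by_cases hx : x ∈ tsupport (fun x => wderBar ζ (ee j) x)
          · exact hTd.cont.continuousAt.mul (hG.continuousAt (hV.mem_nhds (hTd.sub hx)))
          · have : (fun x => wderBar ζ (ee j) x * G x) =ᶠ[𝓝 x] fun _ => 0 := by
              filter_upwards [notMem_tsupport_iff_eventuallyEq.mp hx] with y hy
              rw [hy]; simp
            exact continuousAt_const.congr this.symm
        have := hc.integrable_of_hasCompactSupport (μ := volume) (hTd.cpt.mul_right)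
        simpa [mul_comm] using this
      have : ∫ x, f x * wderBar ζ (ee j) x = ∫ x, (f x - g i x) * wderBar ζ (ee j) x := by
        simp_rw [sub_mul]
        rw [integral_sub (iG f hfc) (iG _ hi2.continuousOn), z0, sub_zero]
      rw [this, ← integral_const_mul]
      refine norm_integral_le_of_norm_le (hTd.integrable.norm.const_mul _) (Eventually.of_forall fun x => ?_)
      rw [norm_mul]
      by_cases hx : x ∈ V
      · refine mul_le_mul_of_nonneg_right ?_ (norm_nonneg _)
        rw [← dist_eq_norm]; exact (hi1 x hx).le
      · rw [hTd.zero_off hx]; simp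
    set I := ∫ x, ‖wderBar ζ (ee j) x‖ with hI
    have hI0 : 0 ≤ I := integral_nonneg fun _ => norm_nonneg _
    refine norm_le_zero_iff.1 (le_of_forall_pos_le_add fun e he => ?_)
    have := hn (e / (I + 1)) (by positivity)
    have q : e / (I + 1) * (I + 1) = e := by field_simp
    have q' : 0 < e / (I + 1) := by positivity
    nlinarith
  obtain ⟨f', hf', hae⟩ := hW.holo hV
  have he : EqOn f f' V := by
    refine Measure.eqOn_open_of_ae_eq (μ := volume) ?_ hV hfc hf'.continuousOn
    rw [Filter.EventuallyEq, ae_restrict_iff' hV.measurableSet]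
    exact hae
  have : DifferentiableAt ℂ f x := by
    refine ((hf' x hxV).differentiableAt (hV.mem_nhds hxV)).congr_of_eventuallyEq ?_
    filter_upwards [hV.mem_nhds hxV] with y hy using he hy
  exact this.differentiableWithinAt

end HoloX

section Levi
variable {n : ℕ} {D Ω : Set (Fin n → ℂ)} {p r u η P : (Fin n → ℂ) → ℝ} {ξ : (Fin n → ℂ) → ℂ} {c τ τ' : ℝ}

lemma levi_add (hD : IsOpen D) (hp : SmR D p) (hr : SmR D r) {x : Fin n → ℂ} (hx : x ∈ D)
    (v : Fin n → ℂ) : levi (fun y => p y + r y) v x = levi p v x + levi r v x := by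
  unfold levi
  rw [← wder_add ((hp.toC.wderBar v).d hx) ((hr.toC.wderBar v).d hx)]
  refine wder_congr ?_ v
  filter_upwards [hD.mem_nhds hx] with y hy
  rw [← wderBar_add (hp.toC.d hy) (hr.toC.d hy)]
  simp only [Complex.ofReal_add]

lemma levi_const_mul (hD : IsOpen D) (hp : SmR D p) (a : ℝ) {x : Fin n → ℂ} (hx : x ∈ D)
    (v : Fin n → ℂ) : levi (fun y => a * p y) v x = a * levi p v x := by
  unfold levi
  rw [← wder_const_mul ((hp.toC.wderBar v).d hx)]
  refine wder_congr ?_ v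
  filter_upwards [hD.mem_nhds hx] with y hy
  rw [← wderBar_const_mul (hp.toC.d hy)]
  simp only [Complex.ofReal_mul]

lemma levi_chain (hD : IsOpen D) (hr : SmR D r) {h h' h'' : ℝ → ℝ} {x : Fin n → ℂ} (hx : x ∈ D)
    (h1 : ∀ y ∈ D, HasDerivAt h (h' (r y)) (r y)) (h2 : HasDerivAt h' (h'' (r x)) (r x))
    (v : Fin n → ℂ) : (levi (fun y => h (r y)) v x).re =
      h'' (r x) * ‖wder (fun y => (r y : ℂ)) v x‖ ^ 2 + h' (r x) * (levi r v x).re := by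
  have : levi (fun y => h (r y)) v x =
      (h'' (r x) : ℂ) * (wder (fun y => (r y : ℂ)) v x * conj (wder (fun y => (r y : ℂ)) v x))
        + (h' (r x) : ℂ) * levi r v x := by
    have e : levi (fun y => h (r y)) v x =
        wder (fun y => ((h' (r y) : ℝ) : ℂ) * wderBar (fun q => (r q : ℂ)) v y) v x := by
      unfold levi
      refine wder_congr ?_ v
      filter_upwards [hD.mem_nhds hx] with y hy
      exact wderBar_chain (hr.d hy) (h1 y hy) v
    have hd : DifferentiableAt ℝ (fun y => ((h' (r y) : ℝ) : ℂ)) x :=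
      diff_ofReal (h2.differentiableAt.comp x (hr.d hx))
    rw [e, wder_mul hd ((hr.toC.wderBar v).d hx), wder_chain (hr.d hx) h2,
      wderBar_ofReal (hr.d hx)]
    unfold levi; ring
  rw [this, Complex.mul_conj, Complex.add_re, Complex.re_ofReal_mul, Complex.re_ofReal_mul,
    Complex.ofReal_re, Complex.normSq_eq_norm_sq]

/-- `1/(c-u)` -/
def psi (u : (Fin n → ℂ) → ℝ) (c : ℝ) (x : Fin n → ℂ) : ℝ := (c - u x)⁻¹

lemma psi_sm (E : Exh Ω u) : SmR (sbl Ω u c) (psi u c) := by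
  intro x hx
  have : c - u x ≠ 0 := by have := hx.2; linarith
  exact (contDiffAt_const.sub (E.sm x hx.1)).inv this

lemma SmR.mono {D' : Set (Fin n → ℂ)} (h : SmR D p) (hs : D' ⊆ D) : SmR D' p := fun x hx => h x (hs hx)
lemma SmAt.mono {D' : Set (Fin n → ℂ)} {G : (Fin n → ℂ) → ℂ} (h : SmAt D G) (hs : D' ⊆ D) : SmAt D' G :=
  fun x hx => h x (hs hx)

lemma psi_levi (E : Exh Ω u) {x : Fin n → ℂ} (hx : x ∈ sbl Ω u c) (v : Fin n → ℂ) :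
    0 ≤ (levi (psi u c) v x).re := by
  have hpos : ∀ y ∈ sbl Ω u c, 0 < c - u y := fun y hy => by have := hy.2; linarith
  have := levi_chain (E.open_sbl c) (E.sm.mono (sbl_sub (c := c))) (h := fun s => (c - s)⁻¹)
    (h' := fun s => ((c - s)^2)⁻¹) (h'' := fun s => 2 * ((c - s)^3)⁻¹) hx ?_ ?_ v
  · have e : (levi (psi u c) v x) = levi (fun y => (fun s => (c - s)⁻¹) (u y)) v x := rfl
    rw [e, this]
    have := hpos x hx
    have := E.psh x hx.1 v
    positivity
  · intro y hy
    have h0 := hpos y hy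
    have := HasDerivAt.congr_deriv (((hasDerivAt_id (u y)).const_sub c).inv (by simpa using h0.ne'))
      (g' := ((c - u y)^2)⁻¹) (by simp [div_eq_mul_inv])
    exact this
  · have h0 := hpos x hx
    have := HasDerivAt.congr_deriv ((((hasDerivAt_id (u x)).const_sub c).pow 2).inv
      (by simpa using h0.ne')) (g' := 2 * ((c - u x)^3)⁻¹) (by
        simp only [id, Pi.pow_apply]; push_cast; field_simp)
    exact this

lemma psisq_levi (E : Exh Ω u) {x : Fin n → ℂ} (hx : x ∈ sbl Ω u c) (v : Fin n → ℂ) :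
    2 * ‖wder (fun y => (psi u c y : ℂ)) v x‖ ^ 2 ≤ (levi (fun y => psi u c y ^ 2) v x).re := by
  have := levi_chain (E.open_sbl c) (psi_sm E) (h := fun s => s ^ 2)
    (h' := fun s => 2 * s) (h'' := fun s => 2) hx ?_ ?_ v
  · rw [this]
    have h1 := psi_levi E hx v
    have h0 : 0 < psi u c x := by have := hx.2; unfold psi; rw [inv_pos]; linarith
    have := mul_nonneg h0.le h1
    nlinarith
  · intro y hy
    simpa using hasDerivAt_pow 2 (psi u c y)
  · simpa using (hasDerivAt_id (psi u c x)).const_mul 2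

lemma dl_shift (hp : SmR D p) (hr : SmR D r) (h : Tst D ξ) (a : ℝ) (x : Fin n → ℂ) :
    dl (fun y => p y + a * r y) ξ x = dl p ξ x + a * wder (fun y => (r y : ℂ)) (bet ξ x) x := by
  by_cases hx : x ∈ D
  · rw [wder_dir_sum]
    unfold dl
    rw [Finset.mul_sum, ← Finset.sum_add_distrib]
    refine Finset.sum_congr rfl fun j _ => ?_
    unfold dlj
    have : wder (fun y => ((p y + a * r y : ℝ) : ℂ)) (ee j) x =
        wder (fun y => (p y : ℂ)) (ee j) x + a * wder (fun y => (r y : ℂ)) (ee j) x := by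
      rw [← wder_const_mul (hr.toC.d hx), ← wder_add (hp.toC.d hx) ((hr.toC.d hx).const_mul _)]
      simp only [Complex.ofReal_add, Complex.ofReal_mul]
    rw [this]; simp only [bet]; ring
  · have : bet ξ x = 0 := by ext j; exact (h.wderBar (ee j)).zero_off hx
    rw [(h.dl hp).zero_off hx, this]
    have := (h.dl (hp.add ((SmR.const a).mul hr))).zero_off hx
    rw [this]; simp [wder]

/-- basic a priori estimate -/
lemma apriori (E : Exh Ω u) (hP : SmR Ω P) (hη : SmR Ω η) (hτ : 0 < τ) (hτ' : 0 < τ')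
    (hττ : (1 + 1 / τ') * τ ^ 2 ≤ 2) (h : Tst (sbl Ω u c) ξ) :
    ∫ x, ((levi P (bet ξ x) x).re + 2 * (levi η (bet ξ x) x).re) *
        Real.exp (-(P x + psi u c x ^ 2 + 2 * η x + τ * psi u c x + τ * psi u c x)) ≤
      (1 + τ') * ∫ x, ‖dl (fun y => P y + psi u c y ^ 2 + 2 * η y + τ * psi u c y) ξ x‖ ^ 2 *
        Real.exp (-(P x + psi u c x ^ 2 + 2 * η x + τ * psi u c x + τ * psi u c x)) := by
  set D := sbl Ω u c with hDdef
  have hD : IsOpen D := E.open_sbl c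
  have hψ : SmR D (psi u c) := psi_sm E
  have hψ2 : SmR D (fun y => psi u c y ^ 2) := fun x hx => (hψ x hx).pow 2
  have hP' : SmR D P := hP.mono sbl_sub
  have hη' : SmR D η := hη.mono sbl_sub
  have h1 : SmR D (fun y => P y + psi u c y ^ 2) := hP'.add hψ2
  have h2η : SmR D (fun y => 2 * η y) := (SmR.const 2).mul hη'
  have hτψ : SmR D (fun y => τ * psi u c y) := (SmR.const τ).mul hψ
  have h2 : SmR D (fun y => P y + psi u c y ^ 2 + 2 * η y) := h1.add h2η
  have hq : SmR D (fun y => P y + psi u c y ^ 2 + 2 * η y + τ * psi u c y) := h2.add hτψ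
  have hp : SmR D (fun y => P y + psi u c y ^ 2 + 2 * η y + τ * psi u c y + τ * psi u c y) :=
    hq.add hτψ
  have hb := bochner hD hp h
  set p := (fun y => P y + psi u c y ^ 2 + 2 * η y + τ * psi u c y + τ * psi u c y) with hpdef
  set q' := (fun y => P y + psi u c y ^ 2 + 2 * η y + τ * psi u c y) with hqdef
  have hpe : ∀ x, P x + psi u c x ^ 2 + 2 * η x + τ * psi u c x + τ * psi u c x = p x := fun _ => rfl
  simp only [hpe]
  have hwψ : Tst D (fun x => wder (fun y => (psi u c y : ℂ)) (bet ξ x) x) := by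
    have : (fun x => wder (fun y => (psi u c y : ℂ)) (bet ξ x) x) = fun x =>
        ∑ j, wder (fun y => (psi u c y : ℂ)) (ee j) x * wderBar ξ (ee j) x := by
      ext x; rw [wder_dir_sum]; refine Finset.sum_congr rfl fun j _ => ?_
      simp only [bet]; ring
    rw [this]
    exact Tst.sum _ fun j _ => (h.wderBar _).gmul (hψ.toC.wder _)
  have hI : ∀ {G : (Fin n → ℂ) → ℂ}, Tst D G → Integrable (fun x => (G x).re * Real.exp (-(p x))) := by
    intro G hG
    refine ((hG.gmul (ew_sm hp)).integrable.re).congr (Eventually.of_forall fun x => ?_)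
    simp only [ew]
    change (_ * _ : ℂ).re = _
    rw [Complex.re_ofReal_mul]; ring
  have hI2 : ∀ {G : (Fin n → ℂ) → ℂ}, Tst D G → Integrable (fun x => ‖G x‖ ^ 2 * Real.exp (-(p x))) := by
    intro G hG
    refine (hI (hG.gmul hG.conj.sm)).congr (Eventually.of_forall fun x => ?_)
    simp only
    rw [mul_comm (conj _), Complex.mul_conj, Complex.ofReal_re, Complex.normSq_eq_norm_sq]
  have hdl : ∀ x, dl p ξ x = dl q' ξ x + τ * wder (fun y => (psi u c y : ℂ)) (bet ξ x) x :=
    fun x => dl_shift hq hψ h τ x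
  have key1 : ∫ x, ‖dl p ξ x‖ ^ 2 * Real.exp (-(p x)) ≤
      ∫ x, ((1 + τ') * (‖dl q' ξ x‖ ^ 2 * Real.exp (-(p x))) +
        2 * (‖wder (fun y => (psi u c y : ℂ)) (bet ξ x) x‖ ^ 2 * Real.exp (-(p x)))) := by
    refine integral_mono (hI2 (h.dl hp)) (((hI2 (h.dl hq)).const_mul _).add ((hI2 hwψ).const_mul _))
      fun x => ?_
    simp only
    rw [← mul_assoc, ← mul_assoc, ← add_mul]
    refine mul_le_mul_of_nonneg_right ?_ (Real.exp_pos _).le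
    rw [hdl]
    set a := ‖dl q' ξ x‖
    set b := ‖wder (fun y => (psi u c y : ℂ)) (bet ξ x) x‖
    have hn : ‖dl q' ξ x + τ * wder (fun y => (psi u c y : ℂ)) (bet ξ x) x‖ ≤ a + τ * b := by
      refine (norm_add_le _ _).trans ?_
      rw [norm_mul, Complex.norm_real, Real.norm_of_nonneg hτ.le]
    have h0 : 0 ≤ ‖dl q' ξ x + τ * wder (fun y => (psi u c y : ℂ)) (bet ξ x) x‖ := norm_nonneg _
    have h3 : (a + τ * b) ^ 2 ≤ (1 + τ') * a ^ 2 + (1 + 1 / τ') * τ ^ 2 * b ^ 2 := by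
      have : (1 + τ') * a ^ 2 + (1 + 1 / τ') * τ ^ 2 * b ^ 2 - (a + τ * b) ^ 2
        = (τ' * a - τ * b) ^ 2 / τ' := by field_simp; ring
      have h5 : 0 ≤ (τ' * a - τ * b) ^ 2 / τ' := by positivity
      linarith
    have h4 : (1 + 1 / τ') * τ ^ 2 * b ^ 2 ≤ 2 * b ^ 2 := mul_le_mul_of_nonneg_right hττ (sq_nonneg _)
    have h5 := pow_le_pow_left₀ h0 hn 2
    linarith
  have key2 : ∫ x, (((levi P (bet ξ x) x).re + 2 * (levi η (bet ξ x) x).re) * Real.exp (-(p x)) +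
        2 * (‖wder (fun y => (psi u c y : ℂ)) (bet ξ x) x‖ ^ 2 * Real.exp (-(p x)))) ≤
      ∫ x, (levi p (bet ξ x) x).re * Real.exp (-(p x)) := by
    refine integral_mono (Integrable.add ?_ ((hI2 hwψ).const_mul _)) (hI (tst_levi h hp)) fun x => ?_
    · refine ((hI (tst_levi h hP')).add ((hI (tst_levi h hη')).const_mul 2)).congr
        (Eventually.of_forall fun x => ?_)
      simp only [Pi.add_apply]; ring
    simp only
    rw [← mul_assoc, ← add_mul]
    refine mul_le_mul_of_nonneg_right ?_ (Real.exp_pos _).le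
    by_cases hx : x ∈ D
    · set v := bet ξ x
      have e : (levi p v x).re = (levi P v x).re + (levi (fun y => psi u c y ^ 2) v x).re +
          2 * (levi η v x).re + τ * (levi (psi u c) v x).re + τ * (levi (psi u c) v x).re := by
        rw [hpdef, levi_add hD hq hτψ hx, levi_add hD h2 hτψ hx, levi_add hD h1 h2η hx,
          levi_add hD hP' hψ2 hx, levi_const_mul hD hψ _ hx, levi_const_mul hD hη' _ hx]
        simp
      rw [e]
      have := psisq_levi E hx v
      have := mul_nonneg hτ.le (psi_levi E hx v)
      linarith
    · have : bet ξ x = 0 := by ext j; exact (h.wderBar (ee j)).zero_off hx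
      rw [this]
      have z : ∀ p : (Fin n → ℂ) → ℝ, levi p 0 x = 0 := fun p => by simp [levi, wder]
      simp [z, wder]
  rw [integral_add] at key1 key2
  · rw [integral_const_mul, integral_const_mul] at key1
    rw [integral_const_mul] at key2
    linarith
  · refine ((hI (tst_levi h hP')).add ((hI (tst_levi h hη')).const_mul 2)).congr
        (Eventually.of_forall fun x => ?_)
    simp only [Pi.add_apply]; ring
  · exact (hI2 hwψ).const_mul _
  · exact (hI2 (h.dl hq)).const_mul _
  · exact (hI2 hwψ).const_mul _

end Levi

section Proj
variable {n : ℕ} {D : Set (Fin n → ℂ)} {p q q' : (Fin n → ℂ) → ℝ} {v ξ ζ : (Fin n → ℂ) → ℂ}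

lemma dl_add' (h : Tst D ξ) (h' : Tst D ζ) (p : (Fin n → ℂ) → ℝ) (x : Fin n → ℂ) :
    dl p (fun y => ξ y + ζ y) x = dl p ξ x + dl p ζ x := by
  unfold dl
  rw [← Finset.sum_add_distrib]
  refine Finset.sum_congr rfl fun j _ => ?_
  unfold dlj
  have : (fun y => wderBar (fun y => ξ y + ζ y) (ee j) y) =
      fun y => wderBar ξ (ee j) y + wderBar ζ (ee j) y := by
    ext y; exact wderBar_add (h.dd y) (h'.dd y) _
  rw [this, wder_add ((h.wderBar _).dd x) ((h'.wderBar _).dd x)]; ring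

lemma dl_smul' (h : Tst D ξ) (a : ℂ) (p : (Fin n → ℂ) → ℝ) (x : Fin n → ℂ) :
    dl p (fun y => a * ξ y) x = a * dl p ξ x := by
  unfold dl
  rw [Finset.mul_sum]
  refine Finset.sum_congr rfl fun j _ => ?_
  unfold dlj
  have : (fun y => wderBar (fun y => a * ξ y) (ee j) y) =
      fun y => a * wderBar ξ (ee j) y := by
    ext y; exact wderBar_const_mul (h.dd y) _ _
  rw [this, wder_const_mul ((h.wderBar _).dd x)]; ring

/-- range of hats -/
def Rng (D : Set (Fin n → ℂ)) (q q' : (Fin n → ℂ) → ℝ) : Submodule ℂ (Lp ℂ 2 (volume.restrict D)) where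
  carrier := {F | ∃ ξ, Tst D ξ ∧ F =ᵐ[volume.restrict D]
    fun x => dl q' ξ x * ((Real.exp (q x / 2 - q' x) : ℝ) : ℂ)}
  zero_mem' := by
    refine ⟨fun _ => 0, Tst.zero, ?_⟩
    filter_upwards [Lp.coeFn_zero ℂ 2 (volume.restrict D)] with x hx
    rw [hx]
    have := dl_smul' (D := D) Tst.zero (ξ := fun _ => 0) 0 q' x
    simp only [zero_mul] at this
    simp [this]
  add_mem' := by
    rintro F G ⟨ξ, h1, h2⟩ ⟨ζ, h3, h4⟩
    refine ⟨_, h1.add h3, ?_⟩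
    filter_upwards [Lp.coeFn_add F G, h2, h4] with x hx hx2 hx4
    rw [hx, Pi.add_apply, hx2, hx4, dl_add' h1 h3]; ring
  smul_mem' := by
    rintro a F ⟨ξ, h1, h2⟩
    refine ⟨fun y => a * ξ y, h1.gmul (SmAt.const a), ?_⟩
    filter_upwards [Lp.coeFn_smul a F, h2] with x hx hx2
    rw [hx, Pi.smul_apply, hx2, dl_smul' h1, smul_eq_mul]; ring

lemma l2_norm_sq {μ : Measure (Fin n → ℂ)} (F : Lp ℂ 2 μ) : ∫ x, ‖F x‖ ^ 2 ∂μ = ‖F‖ ^ 2 := by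
  have h := L2.inner_def (𝕜 := ℂ) F F
  rw [inner_self_eq_norm_sq_to_K] at h
  have h2 : ∀ x, inner ℂ (F x) (F x) = (((‖F x‖ ^ 2 : ℝ)) : ℂ) := fun x => by
    rw [inner_self_eq_norm_sq_to_K]; norm_cast
  simp only [h2] at h
  have e := integral_ofReal (𝕜 := ℂ) (μ := μ) (f := fun x => ‖F x‖ ^ 2)
  have h3 := h.trans e
  exact (by exact_mod_cast h3.symm)

lemma proj_lemma (hD : IsOpen D) (hq : SmR D q) (hq' : SmR D q')
    (hv : AEStronglyMeasurable v (volume.restrict D))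
    (hvi : IntegrableOn (fun x => ‖v x‖ ^ 2 * Real.exp (-(q x))) D) :
    ∃ g : (Fin n → ℂ) → ℂ, AEStronglyMeasurable g (volume.restrict D) ∧
      IntegrableOn (fun x => ‖g x‖ ^ 2 * Real.exp (-(q x))) D ∧
      (∀ ξ, Tst D ξ → ∫ x, g x * (conj (dl q' ξ x) * ew q' x) = 0) ∧
      ∀ ε : ℝ, 0 < ε → ∃ ξ, Tst D ξ ∧
        IntegrableOn (fun x => ‖v x - g x - ((Real.exp (q x - q' x) : ℝ) : ℂ) * dl q' ξ x‖ ^ 2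
          * Real.exp (-(q x))) D ∧
        ∫ x in D, ‖v x - g x - ((Real.exp (q x - q' x) : ℝ) : ℂ) * dl q' ξ x‖ ^ 2
          * Real.exp (-(q x)) ≤ ε := by
  set μ := (volume : Measure (Fin n → ℂ)).restrict D with hμ
  have hqm : AEStronglyMeasurable q μ := hq.contOn.aestronglyMeasurable hD.measurableSet
  have hexm : ∀ a : ℝ, AEStronglyMeasurable (fun x => ((Real.exp (a * q x) : ℝ) : ℂ)) μ := fun a =>
    Complex.continuous_ofReal.comp_aestronglyMeasurable
      (Real.continuous_exp.comp_aestronglyMeasurable (hqm.const_mul a))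
  have hnsq : ∀ a : ℂ, ∀ x, ‖a * ((Real.exp (-(1/2) * q x) : ℝ) : ℂ)‖ ^ 2 = ‖a‖ ^ 2 * Real.exp (-(q x)) := by
    intro a x
    rw [norm_mul, mul_pow, Complex.norm_real, Real.norm_of_nonneg (Real.exp_pos _).le, ← Real.exp_nat_mul]
    congr 2; push_cast; ring
  have hvL : MemLp (fun x => v x * ((Real.exp (-(1/2) * q x) : ℝ) : ℂ)) 2 μ := by
    refine (memLp_two_iff_integrable_sq_norm (hv.mul (hexm (-(1/2))))).2 ?_
    refine hvi.congr (Eventually.of_forall fun x => ?_)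
    exact (hnsq _ _).symm
  set R := (Rng D q q').topologicalClosure with hR
  obtain ⟨uh, huR, gh, hgR, hsum⟩ := R.exists_add_mem_mem_orthogonal (hvL.toLp _)
  have hback : ∀ a : ℂ, ∀ x, (a * ((Real.exp (1/2 * q x) : ℝ) : ℂ)) * ((Real.exp (-(1/2) * q x) : ℝ) : ℂ) = a := by
    intro a x
    rw [mul_assoc, ← Complex.ofReal_mul, ← Real.exp_add]
    rw [show 1 / 2 * q x + -(1 / 2) * q x = 0 by ring]; simp
  have hgm : AEStronglyMeasurable gh μ := Lp.aestronglyMeasurable gh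
  refine ⟨fun x => gh x * ((Real.exp (1/2 * q x) : ℝ) : ℂ), hgm.mul (hexm _), ?_, ?_, ?_⟩
  · have := (memLp_two_iff_integrable_sq_norm hgm).1 (Lp.memLp gh)
    refine this.congr (Eventually.of_forall fun x => ?_)
    simp only
    rw [← hnsq, hback]
  · intro ξ hξ
    have hs : SmAt D (fun x => ((Real.exp (q x / 2 - q' x) : ℝ) : ℂ)) :=
      fun x hx => ((Real.contDiff_exp.contDiffAt).comp x (((hq x hx).div_const 2).sub (hq' x hx))).toC
    have hT := (hξ.dl hq').gmul hs
    have hL : MemLp (fun x => dl q' ξ x * ((Real.exp (q x / 2 - q' x) : ℝ) : ℂ)) 2 μ := by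
      have : MemLp _ 2 volume := hT.memLp
      refine (this.restrict D).congr_norm ?_ (Eventually.of_forall fun x => ?_)
      · refine (hT.cont.congr fun x => ?_).aestronglyMeasurable
        ring
      · simp only [mul_comm]
    have hin := hgR (hL.toLp _) (Submodule.le_topologicalClosure _ ⟨ξ, hξ, hL.coeFn_toLp⟩)
    rw [L2.inner_def] at hin
    have hset : ∫ x in D, gh x * ((Real.exp (1/2 * q x) : ℝ) : ℂ) * (conj (dl q' ξ x) * ew q' x) =
      ∫ x, gh x * ((Real.exp (1/2 * q x) : ℝ) : ℂ) * (conj (dl q' ξ x) * ew q' x) := by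
      apply setIntegral_eq_integral_of_forall_compl_eq_zero
      intro x hx
      rw [(hξ.dl hq').zero_off hx]; simp
    rw [← hset, ← hin]
    refine integral_congr_ae ?_
    filter_upwards [hL.coeFn_toLp] with x hx
    rw [hx]
    simp only [RCLike.inner_apply, map_mul, Complex.conj_ofReal, ew]
    have : Real.exp (q x / 2 - q' x) = Real.exp (1/2 * q x) * Real.exp (-(q' x)) := by
      rw [← Real.exp_add]; congr 1; ring
    rw [this]; push_cast; ring
  · intro ε hε
    obtain ⟨F, hF, hFd⟩ := Metric.mem_closure_iff.1 huR (Real.sqrt ε) (Real.sqrt_pos.2 hε)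
    obtain ⟨ξ, hξ, hFe⟩ := hF
    have hae : (fun x => ‖(uh - F) x‖ ^ 2) =ᵐ[μ] fun x =>
        ‖v x - gh x * ((Real.exp (1/2 * q x) : ℝ) : ℂ) - ((Real.exp (q x - q' x) : ℝ) : ℂ) * dl q' ξ x‖ ^ 2
          * Real.exp (-(q x)) := by
      have hu : uh = hvL.toLp _ - gh := by rw [hsum]; simp
      filter_upwards [hFe, Lp.coeFn_sub uh F, Lp.coeFn_sub (hvL.toLp _) gh, hvL.coeFn_toLp] with x h1 h2 h3 h4
      rw [← hu] at h3
      rw [← hnsq, h2, Pi.sub_apply, h3, Pi.sub_apply, h4, h1, sub_mul, sub_mul, hback]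
      congr 3
      have : Real.exp (q x / 2 - q' x) = Real.exp (q x - q' x) * Real.exp (-(1/2) * q x) := by
        rw [← Real.exp_add]; congr 1; ring
      rw [this]; push_cast; ring
    have hi := (memLp_two_iff_integrable_sq_norm (Lp.aestronglyMeasurable (uh - F))).1 (Lp.memLp _)
    refine ⟨ξ, hξ, hi.congr hae, ?_⟩
    rw [← integral_congr_ae hae, l2_norm_sq]
    rw [dist_eq_norm] at hFd
    have := pow_le_pow_left₀ (norm_nonneg _) hFd.le 2
    rwa [Real.sq_sqrt hε.le] at this
end Proj

section Tw
variable {n : ℕ} {D : Set (Fin n → ℂ)} {p q q' Φ : (Fin n → ℂ) → ℝ} {v ξ ζ H : (Fin n → ℂ) → ℂ}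

lemma dl_pair (hp : SmR D p) (h : Tst D ξ) (hH : SmAt D H) :
    ∫ x, H x * conj (dl p ξ x) * ew p x = ∫ x, wderBar H (bet ξ x) x * ew p x := by
  have e1 : ∫ x, conj (H x) * dl p ξ x * ew p x = ∫ x, wder (fun y => conj (H y)) (bet ξ x) x * ew p x := by
    have a1 : ∀ x, conj (H x) * dl p ξ x * ew p x =
        ∑ j, conj (H x) * dlj p (fun y => wderBar ξ (ee j) y) j x * ew p x := by
      intro x; unfold dl; rw [Finset.mul_sum, Finset.sum_mul]
    have a2 : ∀ x, wder (fun y => conj (H y)) (bet ξ x) x * ew p x =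
        ∑ j, wder (fun y => conj (H y)) (ee j) x * wderBar ξ (ee j) x * ew p x := by
      intro x; rw [wder_dir_sum, Finset.sum_mul]
      refine Finset.sum_congr rfl fun j _ => ?_
      simp only [bet]; ring
    simp only [a1, a2]
    rw [integral_finsetSum, integral_finsetSum]
    · exact Finset.sum_congr rfl fun j _ => dlj_adj hp (h.wderBar _) hH.conj j
    · intro j _
      refine ((((h.wderBar (ee j)).gmul (hH.conj.wder (ee j))).gmul (ew_sm hp)).integrable).congr
        (Eventually.of_forall fun x => ?_)
      simp only; ring
    · intro j _
      refine (((((h.wderBar (ee j)).dlj hp j).gmul hH.conj).gmul (ew_sm hp)).integrable).congr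
        (Eventually.of_forall fun x => ?_)
      simp only; ring
  have e2 := congrArg conj e1
  rw [← integral_conj, ← integral_conj] at e2
  simp only [map_mul, ew_conj, Complex.conj_conj] at e2
  rw [e2]
  congr 1; ext x
  by_cases hx : x ∈ D
  · rw [wder_conj (hH.d hx), Complex.conj_conj]
  · have : bet ξ x = 0 := by ext j; exact (h.wderBar (ee j)).zero_off hx
    rw [this]; simp [wder, wderBar]

lemma intOn_le {F : (Fin n → ℂ) → ℝ} {E : Type*} [NormedAddCommGroup E] {G : (Fin n → ℂ) → E} {K : ℝ}
    (hD : IsOpen D) (hF : IntegrableOn F D)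
    (hG : AEStronglyMeasurable G (volume.restrict D)) (h : ∀ x ∈ D, ‖G x‖ ≤ K * F x) :
    IntegrableOn G D := by
  refine Integrable.mono' (hF.const_mul K) hG ?_
  exact (ae_restrict_iff' hD.measurableSet).2 (Eventually.of_forall h)

lemma hilb_final {H : Type*} [NormedAddCommGroup H] [InnerProductSpace ℂ H] (U : H) (K : ℝ) (hK : 0 ≤ K)
    (h : ∀ ε : ℝ, 0 < ε → ∃ W : H, ‖U - W‖ ≤ ε ∧ ‖inner ℂ U W‖ ≤ K * ‖W‖) : ‖U‖ ≤ K := by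
  have key : ∀ ε : ℝ, 0 < ε → ‖U‖ ^ 2 ≤ K * ‖U‖ + ε * (K + ‖U‖) := by
    intro ε hε
    obtain ⟨W, h1, h2⟩ := h ε hε
    have h3 : ‖W‖ ≤ ‖U‖ + ε := by
      have := norm_sub_le U (U - W)
      rw [sub_sub_cancel] at this; linarith
    have h4 : ‖inner ℂ U U‖ ≤ ‖inner ℂ U W‖ + ‖inner ℂ U (U - W)‖ := by
      have : inner ℂ U U = inner ℂ U W + inner ℂ U (U - W) := by rw [← inner_add_right]; simp
      rw [this]; exact norm_add_le _ _
    rw [inner_self_eq_norm_sq_to_K] at h4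
    have h5 : ‖inner ℂ U (U - W)‖ ≤ ‖U‖ * ε :=
      (norm_inner_le_norm _ _).trans (mul_le_mul_of_nonneg_left h1 (norm_nonneg _))
    have h6 := mul_le_mul_of_nonneg_left h3 hK
    have h7 : ‖((‖U‖ : ℂ)) ^ 2‖ = ‖U‖ ^ 2 := by simp
    have h8 : ‖U‖ ^ 2 ≤ ‖inner ℂ U W‖ + ‖inner ℂ U (U - W)‖ := by rw [← h7]; exact h4
    nlinarith
  have : ‖U‖ ^ 2 ≤ K * ‖U‖ := by
    refine le_of_forall_pos_le_add fun ε hε => ?_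
    have hp : 0 < K + ‖U‖ + 1 := by positivity
    have := key (ε / (K + ‖U‖ + 1)) (by positivity)
    have h2 : ε / (K + ‖U‖ + 1) * (K + ‖U‖) ≤ ε := by
      rw [div_mul_eq_mul_div, div_le_iff₀ hp]; nlinarith
    linarith
  rcases (norm_nonneg U).eq_or_lt with h0 | h0
  · rw [← h0]; exact hK
  · nlinarith

/-- `a e^{-Φ/2}` -/
def hat (Φ : (Fin n → ℂ) → ℝ) (a : (Fin n → ℂ) → ℂ) (x : Fin n → ℂ) : ℂ :=
  a x * ((Real.exp (-(1/2) * Φ x) : ℝ) : ℂ)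

lemma hat_sq (Φ : (Fin n → ℂ) → ℝ) (a : (Fin n → ℂ) → ℂ) (x : Fin n → ℂ) :
    ‖hat Φ a x‖ ^ 2 = ‖a x‖ ^ 2 * Real.exp (-(Φ x)) := by
  unfold hat
  rw [norm_mul, mul_pow, Complex.norm_real, Real.norm_of_nonneg (Real.exp_pos _).le, ← Real.exp_nat_mul]
  congr 2; push_cast; ring

lemma hat_memLp (hD : IsOpen D) (hΦ : ContinuousOn Φ D) (hv : ContinuousOn v D)
    (hi : IntegrableOn (fun x => ‖v x‖ ^ 2 * Real.exp (-(Φ x))) D) :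
    MemLp (hat Φ v) 2 (volume.restrict D) := by
  have hm : AEStronglyMeasurable (hat Φ v) (volume.restrict D) := by
    refine ContinuousOn.aestronglyMeasurable ?_ hD.measurableSet
    unfold hat
    exact hv.mul (Complex.continuous_ofReal.comp_continuousOn
      (Real.continuous_exp.comp_continuousOn (hΦ.const_mul _)))
  rw [memLp_two_iff_integrable_sq_norm hm]
  simp only [hat_sq]; exact hi

lemma toLp_norm_sq {μ : Measure (Fin n → ℂ)} (hv : MemLp v 2 μ) : ‖hv.toLp v‖ ^ 2 = ∫ x, ‖v x‖ ^ 2 ∂μ := by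
  rw [← l2_norm_sq]
  refine integral_congr_ae ?_
  filter_upwards [hv.coeFn_toLp] with x hx
  rw [hx]

lemma toLp_inner {μ : Measure (Fin n → ℂ)} (hv : MemLp v 2 μ) (hH : MemLp H 2 μ) :
    inner ℂ (hv.toLp v) (hH.toLp H) = ∫ x, H x * conj (v x) ∂μ := by
  rw [L2.inner_def]
  refine integral_congr_ae ?_
  filter_upwards [hv.coeFn_toLp, hH.coeFn_toLp] with x hx hx2
  rw [hx, hx2, RCLike.inner_apply]

end Tw

section Core
variable {n : ℕ} {Ω : Set (Fin n → ℂ)} {u P η A : (Fin n → ℂ) → ℝ} {V f : (Fin n → ℂ) → ℂ} {c δ τ τ' : ℝ}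

lemma sbl_bdd (E : Exh Ω u) {G : Type*} [NormedAddCommGroup G] {a : (Fin n → ℂ) → G}
    (ha : ContinuousOn a Ω) (c : ℝ) : ∃ M : ℝ, 0 ≤ M ∧ ∀ x ∈ sbl Ω u c, ‖a x‖ ≤ M := by
  obtain ⟨M, hM⟩ := (E.cpt c).exists_bound_of_continuousOn (ha.mono fun x hx => hx.1)
  exact ⟨|M|, abs_nonneg _, fun x hx => (hM x ⟨hx.1, hx.2.le⟩).trans (le_abs_self _)⟩

lemma exp_psi_bd {s : ℝ} (hs : 0 < s) (hτ : 0 < τ) : Real.exp (-(τ * s⁻¹)) ≤ 2 / τ ^ 2 * s ^ 2 := by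
  have h := Real.quadratic_le_exp_of_nonneg (x := τ * s⁻¹) (by positivity)
  rw [Real.exp_neg]
  have h2 : (τ * s⁻¹) ^ 2 / 2 ≤ Real.exp (τ * s⁻¹) := by
    have : 0 ≤ τ * s⁻¹ := by positivity
    linarith
  have h3 : 0 < (τ * s⁻¹) ^ 2 / 2 := by positivity
  refine (inv_anti₀ h3 h2).trans (le_of_eq ?_)
  field_simp

lemma twisted_core (E : Exh Ω u) (hP : SmR Ω P) (hη : SmR Ω η) (hV : SmAt Ω V)
    (hA : ContinuousOn A Ω) (hA0 : ∀ x ∈ Ω, 0 ≤ A x) (hδ : 0 < δ)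
    (hXi : ∀ x ∈ Ω, ∀ β : Fin n → ℂ, ∀ a b : ℂ,
      ‖a * wderBar V β x + b * wderBar (fun y => (η y : ℂ)) β x‖ ^ 2 ≤
        (‖a‖ ^ 2 * A x * (δ / (1 + δ)) + ‖b‖ ^ 2 * (1 / (1 + δ))) *
          ((levi P β x).re + 2 * (levi η β x).re))
    (hf : DifferentiableOn ℂ f (sbl Ω u c))
    (hfi : IntegrableOn (fun x => ‖f x‖ ^ 2 * Real.exp (-(P x + psi u c x ^ 2))) (sbl Ω u c))
    (hτ : 0 < τ) (hτ' : 0 < τ') (hττ : (1 + 1 / τ') * τ ^ 2 ≤ 2) :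
    ∃ g, DifferentiableOn ℂ g (sbl Ω u c) ∧
      IntegrableOn (fun x => ‖g x‖ ^ 2 * Real.exp (-(P x + psi u c x ^ 2))) (sbl Ω u c) ∧
      IntegrableOn (fun x => ‖f x * V x - g x‖ ^ 2 * Real.exp (-(P x + psi u c x ^ 2))) (sbl Ω u c) ∧
      (1 + δ) * (∫ x in sbl Ω u c, ‖f x * V x - g x‖ ^ 2 * Real.exp (-(P x + psi u c x ^ 2))) ≤
      (1 + τ') * (δ * (∫ x in sbl Ω u c, ‖f x‖ ^ 2 * A x * Real.exp (-(P x + psi u c x ^ 2))) +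
        ∫ x in sbl Ω u c, ‖f x * V x - g x‖ ^ 2 * Real.exp (-(P x + psi u c x ^ 2))) := by
  set D := sbl Ω u c with hDdef
  have hD : IsOpen D := E.open_sbl c
  have hψ : SmR D (psi u c) := psi_sm E
  have hψ2 : SmR D (fun y => psi u c y ^ 2) := fun x hx => (hψ x hx).pow 2
  have hP' : SmR D P := hP.mono sbl_sub
  have hη' : SmR D η := hη.mono sbl_sub
  have hV' : SmAt D V := hV.mono sbl_sub
  have hA' : ContinuousOn A D := hA.mono sbl_sub
  set Φ := (fun y => P y + psi u c y ^ 2) with hΦdef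
  have hΦ : SmR D Φ := hP'.add hψ2
  have hΦe : ∀ x, P x + psi u c x ^ 2 = Φ x := fun _ => rfl
  simp only [hΦe] at hfi ⊢
  set q := (fun y => Φ y + η y) with hqdef
  set q' := (fun y => P y + psi u c y ^ 2 + 2 * η y + τ * psi u c y) with hq'def
  have hq : SmR D q := hΦ.add hη'
  have hq' : SmR D q' := (hΦ.add ((SmR.const 2).mul hη')).add ((SmR.const τ).mul hψ)
  obtain ⟨M, hM0, hM⟩ := sbl_bdd E hη.contOn c
  obtain ⟨MV, hMV0, hMV⟩ := sbl_bdd E hV.contOn c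
  obtain ⟨MA, hMA0, hMA⟩ := sbl_bdd E hA c
  rw [← hDdef] at hM hMV hMA
  have hfs : SmAt D f := hol_smooth hD hf
  have hfV : SmAt D (fun x => f x * V x) := hfs.mul hV'
  have mexp : ∀ {r : (Fin n → ℂ) → ℝ}, ContinuousOn r D → ContinuousOn (fun x => Real.exp (-(r x))) D :=
    fun hr => Real.continuous_exp.comp_continuousOn hr.neg
  have mwt : ∀ {a : (Fin n → ℂ) → ℂ} {r : (Fin n → ℂ) → ℝ}, ContinuousOn a D → ContinuousOn r D →
      AEStronglyMeasurable (fun x => ‖a x‖ ^ 2 * Real.exp (-(r x))) (volume.restrict D) :=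
    fun ha hr => ((ha.norm.pow 2).mul (mexp hr)).aestronglyMeasurable hD.measurableSet
  have hηle : ∀ x ∈ D, -M ≤ η x ∧ η x ≤ M := fun x hx => abs_le.1 (hM x hx)
  have hqle : ∀ x ∈ D, Real.exp (-(q x)) ≤ Real.exp M * Real.exp (-(Φ x)) := by
    intro x hx
    rw [← Real.exp_add]; refine Real.exp_le_exp.2 ?_
    simp only [hqdef]; have := (hηle x hx).1; linarith
  have hΦle : ∀ x ∈ D, Real.exp (-(Φ x)) ≤ Real.exp M * Real.exp (-(q x)) := by
    intro x hx
    rw [← Real.exp_add]; refine Real.exp_le_exp.2 ?_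
    simp only [hqdef]; have := (hηle x hx).2; linarith
  have hfVi : IntegrableOn (fun x => ‖f x * V x‖ ^ 2 * Real.exp (-(Φ x))) D := by
    refine intOn_le (K := MV ^ 2) hD hfi (mwt hfV.contOn hΦ.contOn) fun x hx => ?_
    rw [Real.norm_of_nonneg (by positivity), norm_mul, mul_pow]
    have : ‖V x‖ ^ 2 ≤ MV ^ 2 := pow_le_pow_left₀ (norm_nonneg _) (hMV x hx) 2
    have h2 : 0 ≤ ‖f x‖ ^ 2 * Real.exp (-(Φ x)) := by positivity
    nlinarith
  have hvi : IntegrableOn (fun x => ‖f x * V x‖ ^ 2 * Real.exp (-(q x))) D := by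
    refine intOn_le (K := Real.exp M) hD hfVi (mwt hfV.contOn hq.contOn) fun x hx => ?_
    rw [Real.norm_of_nonneg (by positivity)]
    have := mul_le_mul_of_nonneg_left (hqle x hx) (sq_nonneg ‖f x * V x‖)
    linarith
  obtain ⟨g0, hg0m, hg0i, hg0w, hg0a⟩ := proj_lemma hD hq hq'
    (hfV.contOn.aestronglyMeasurable hD.measurableSet) hvi
  obtain ⟨g, hg, hgae⟩ := regularity E hq hq' (C := Real.exp M * (2 / τ ^ 2)) (by
    intro x hx
    have hs : 0 < c - u x := by have := hx.2; linarith
    have h1 := exp_psi_bd hs hτ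
    have e : Real.exp (-(q' x)) = Real.exp (-(q x)) * Real.exp (-η x) * Real.exp (-(τ * (c - u x)⁻¹)) := by
      rw [← Real.exp_add, ← Real.exp_add]; congr 1; simp only [hq'def, hqdef, hΦdef, psi]; ring
    rw [e]
    have h2 : Real.exp (-η x) ≤ Real.exp M := Real.exp_le_exp.2 (by have := (hηle x hx).1; linarith)
    calc _ ≤ Real.exp (-(q x)) * Real.exp M * (2 / τ ^ 2 * (c - u x) ^ 2) := by gcongr
      _ = _ := by ring) hg0m hg0i hg0w
  have hgae' : ∀ᵐ x ∂(volume.restrict D), g0 x = g x := (ae_restrict_iff' hD.measurableSet).2 hgae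
  have hgs : SmAt D g := hol_smooth hD hg
  have hgi : IntegrableOn (fun x => ‖g x‖ ^ 2 * Real.exp (-(Φ x))) D := by
    have h1 : IntegrableOn (fun x => ‖g x‖ ^ 2 * Real.exp (-(q x))) D := by
      refine Integrable.congr hg0i ?_
      filter_upwards [hgae'] with x hx
      rw [hx]
    refine intOn_le (K := Real.exp M) hD h1 (mwt hgs.contOn hΦ.contOn) fun x hx => ?_
    rw [Real.norm_of_nonneg (by positivity)]
    have := mul_le_mul_of_nonneg_left (hΦle x hx) (sq_nonneg ‖g x‖)
    linarith
  set U := (fun x => f x * V x - g x) with hUdef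
  have hUs : SmAt D U := hfV.sub hgs
  have hUi : IntegrableOn (fun x => ‖U x‖ ^ 2 * Real.exp (-(Φ x))) D := by
    refine intOn_le (K := 2) hD (hfVi.add hgi) (mwt hUs.contOn hΦ.contOn) fun x hx => ?_
    rw [Real.norm_of_nonneg (by positivity)]
    simp only [Pi.add_apply]
    rw [← add_mul, ← mul_assoc]
    refine mul_le_mul_of_nonneg_right ?_ (Real.exp_pos _).le
    have h1 := norm_sub_le (f x * V x) (g x)
    have h2 := pow_le_pow_left₀ (norm_nonneg _) h1 2
    have h3 : ‖U x‖ = ‖f x * V x - g x‖ := rfl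
    rw [h3]
    nlinarith [sq_nonneg (‖f x * V x‖ - ‖g x‖)]
  have hAi : IntegrableOn (fun x => ‖f x‖ ^ 2 * A x * Real.exp (-(Φ x))) D := by
    refine intOn_le (K := MA) hD hfi
      ((((hfs.contOn.norm.pow 2).mul hA').mul (mexp hΦ.contOn)).aestronglyMeasurable hD.measurableSet)
      fun x hx => ?_
    have h0 := hA0 x hx.1
    rw [Real.norm_of_nonneg (by positivity)]
    have h1 := hMA x hx
    rw [Real.norm_of_nonneg h0] at h1
    have h2 : 0 ≤ ‖f x‖ ^ 2 * Real.exp (-(Φ x)) := by positivity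
    nlinarith
  refine ⟨g, hg, hgi, hUi, ?_⟩
  have hUe : ∀ x, f x * V x - g x = U x := fun _ => rfl
  simp only [hUe]
  set X := ∫ x in D, ‖U x‖ ^ 2 * Real.exp (-(Φ x)) with hX
  set C0 := ∫ x in D, ‖f x‖ ^ 2 * A x * Real.exp (-(Φ x)) with hC0
  have hX0 : 0 ≤ X := integral_nonneg fun x => by positivity
  have hC00 : 0 ≤ C0 := setIntegral_nonneg hD.measurableSet fun x hx => by
    have := hA0 x hx.1; positivity
  set B := (fun x => ‖f x‖ ^ 2 * A x * (δ / (1 + δ)) + ‖U x‖ ^ 2 * (1 / (1 + δ))) with hB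
  have hB0 : ∀ x ∈ D, 0 ≤ B x := fun x hx => by
    have := hA0 x hx.1; simp only [hB]; positivity
  have hBi : IntegrableOn (fun x => B x * Real.exp (-(Φ x))) D := by
    refine ((hAi.const_mul (δ / (1 + δ))).add (hUi.const_mul (1 / (1 + δ)))).congr
      (Eventually.of_forall fun x => ?_)
    simp only [Pi.add_apply, hB]; ring
  have hBv : ∫ x in D, B x * Real.exp (-(Φ x)) = (δ * C0 + X) / (1 + δ) := by
    have : ∀ x, B x * Real.exp (-(Φ x)) = δ / (1 + δ) * (‖f x‖ ^ 2 * A x * Real.exp (-(Φ x))) +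
        1 / (1 + δ) * (‖U x‖ ^ 2 * Real.exp (-(Φ x))) := fun x => by simp only [hB]; ring
    simp only [this]
    rw [integral_add (hAi.const_mul _) (hUi.const_mul _), integral_const_mul, integral_const_mul]
    ring
  have hUL : MemLp (hat Φ U) 2 (volume.restrict D) := hat_memLp hD hΦ.contOn hUs.contOn hUi
  have hXn : ‖hUL.toLp _‖ ^ 2 = X := by rw [toLp_norm_sq]; simp only [hat_sq]; rfl
  have hK := hilb_final (hUL.toLp _) (Real.sqrt ((δ * C0 + X) / (1 + δ) * (1 + τ'))) (Real.sqrt_nonneg _) ?_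
  · have h1 := pow_le_pow_left₀ (norm_nonneg _) hK 2
    rw [hXn, Real.sq_sqrt (by positivity), div_mul_eq_mul_div, le_div_iff₀ (by positivity)] at h1
    linarith
  intro ε hε
  obtain ⟨ξ, hξ, hdi, hdle⟩ := hg0a (ε ^ 2 * Real.exp (-M)) (by positivity)
  have eqs : SmAt D (fun x => ((Real.exp (q x - q' x) : ℝ) : ℂ)) := fun x hx =>
    ((Real.contDiff_exp.contDiffAt).comp x ((hq x hx).sub (hq' x hx))).toC
  set om := (fun x => ((Real.exp (q x - q' x) : ℝ) : ℂ) * dl q' ξ x) with hom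
  have homT : Tst D om := (hξ.dl hq').gmul eqs
  have hp : SmR D (fun y => P y + psi u c y ^ 2 + 2 * η y + τ * psi u c y + τ * psi u c y) :=
    hq'.add ((SmR.const τ).mul hψ)
  have hap := apriori E hP hη hτ hτ' hττ hξ
  set p := (fun y => P y + psi u c y ^ 2 + 2 * η y + τ * psi u c y + τ * psi u c y) with hpdef
  have hpe : ∀ x, P x + psi u c x ^ 2 + 2 * η x + τ * psi u c x + τ * psi u c x = p x := fun _ => rfl
  simp only [hpe] at hap
  have homΦ : ∀ x, ‖om x‖ ^ 2 * Real.exp (-(Φ x)) = ‖dl q' ξ x‖ ^ 2 * Real.exp (-(p x)) := by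
    intro x
    simp only [hom]
    rw [norm_mul, mul_pow, Complex.norm_real, Real.norm_of_nonneg (Real.exp_pos _).le, ← Real.exp_nat_mul]
    rw [mul_right_comm, ← Real.exp_add, mul_comm]
    congr 2; simp only [hqdef, hq'def, hpdef, hΦdef]; push_cast; ring
  have homi : IntegrableOn (fun x => ‖om x‖ ^ 2 * Real.exp (-(Φ x))) D := by
    have := (((homT.gmul homT.conj.sm).gmul (ew_sm hΦ)).integrable.norm).integrableOn (s := D)
    refine this.congr (Eventually.of_forall fun x => ?_)
    simp only [norm_mul, ew_norm, RCLike.norm_conj]; ring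
  have homL : MemLp (hat Φ om) 2 (volume.restrict D) := hat_memLp hD hΦ.contOn homT.cont.continuousOn homi
  have homn : ‖homL.toLp _‖ ^ 2 = ∫ x, ‖dl q' ξ x‖ ^ 2 * Real.exp (-(p x)) := by
    rw [toLp_norm_sq]; simp only [hat_sq, homΦ]
    apply setIntegral_eq_integral_of_forall_compl_eq_zero
    intro x hx
    rw [(hξ.dl hq').zero_off hx]; simp
  refine ⟨homL.toLp _, ?_, ?_⟩
  · have h1 : ‖hUL.toLp _ - homL.toLp _‖ ^ 2 ≤ ε ^ 2 := by
      rw [← MemLp.toLp_sub, toLp_norm_sq]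
      calc ∫ x in D, ‖(hat Φ U - hat Φ om) x‖ ^ 2
          ≤ ∫ x in D, Real.exp M * (‖f x * V x - g0 x - ((Real.exp (q x - q' x) : ℝ) : ℂ) * dl q' ξ x‖ ^ 2
              * Real.exp (-(q x))) := by
            refine integral_mono_ae (sq_int (hUL.sub homL)) (hdi.const_mul _) ?_
            filter_upwards [hgae', ae_restrict_mem hD.measurableSet] with x hx hxD
            have e : (hat Φ U - hat Φ om) x = hat Φ (fun y => U y - om y) x := by
              simp only [hat, Pi.sub_apply]; ring
            rw [e, hat_sq, hx]
            have := mul_le_mul_of_nonneg_left (hΦle x hxD) (sq_nonneg ‖U x - om x‖)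
            simp only [hUdef, hom] at this ⊢
            linarith
        _ ≤ Real.exp M * (ε ^ 2 * Real.exp (-M)) := by
            rw [integral_const_mul]
            exact mul_le_mul_of_nonneg_left hdle (Real.exp_pos _).le
        _ = ε ^ 2 := by rw [Real.exp_neg]; field_simp
    exact (pow_le_pow_iff_left₀ (norm_nonneg _) hε.le two_ne_zero).1 h1
  · -- the main pairing estimate
    rw [← inner_conj_symm, RCLike.norm_conj, toLp_inner]
    set S := (fun x => (levi P (bet ξ x) x).re + 2 * (levi η (bet ξ x) x).re) with hS
    have hS0 : ∀ x ∈ D, 0 ≤ S x := by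
      intro x hx
      have := hXi x hx.1 (bet ξ x) 0 1
      simp only [norm_zero, norm_one] at this
      have h2 : 0 ≤ (1 / (1 + δ)) * S x := by
        refine le_trans (sq_nonneg _) (this.trans (le_of_eq ?_))
        simp only [hS]; ring
      exact nonneg_of_mul_nonneg_right h2 (by positivity)
    have hSi : IntegrableOn (fun x => S x * Real.exp (-(p x))) D := by
      have hT := (tst_levi hξ hP').add ((tst_levi hξ hη').gmul (SmAt.const 2))
      have := ((hT.gmul (ew_sm hp)).integrable.re).integrableOn (s := D)
      refine this.congr (Eventually.of_forall fun x => ?_)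
      change (_ * _ : ℂ).re = _
      rw [ew, Complex.re_ofReal_mul]
      simp [hS]; ring
    have hScont : ContinuousOn S D := by
      have hT := (tst_levi hξ hP').add ((tst_levi hξ hη').gmul (SmAt.const 2))
      have : S = fun x => (levi P (bet ξ x) x + 2 * levi η (bet ξ x) x).re := by
        ext x; simp [hS]
      rw [this]
      exact (Complex.continuous_re.comp hT.cont).continuousOn
    have hBcont : ContinuousOn B D := by
      have h1 := hfs.contOn.norm
      have h2 := hUs.contOn.norm
      exact (((h1.pow 2).mul hA').mul_const _).add ((h2.pow 2).mul_const _)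
    set H := (fun x => U x * ((Real.exp (η x) : ℝ) : ℂ)) with hH
    have hHs : SmAt D H := hUs.mul hη'.exp.toC
    have hI : ∫ x in D, hat Φ U x * conj (hat Φ om x) = ∫ x in D, wderBar H (bet ξ x) x * ew q' x := by
      have e1 : ∫ x in D, wderBar H (bet ξ x) x * ew q' x = ∫ x, wderBar H (bet ξ x) x * ew q' x := by
        apply setIntegral_eq_integral_of_forall_compl_eq_zero
        intro x hx
        have : bet ξ x = 0 := by ext j; exact (hξ.wderBar (ee j)).zero_off hx
        rw [this]; simp [wderBar]
      rw [e1, ← dl_pair hq' hξ hHs]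
      have e2 : ∫ x in D, H x * conj (dl q' ξ x) * ew q' x = ∫ x, H x * conj (dl q' ξ x) * ew q' x := by
        apply setIntegral_eq_integral_of_forall_compl_eq_zero
        intro x hx
        rw [(hξ.dl hq').zero_off hx]; simp
      rw [← e2]
      · congr 1; ext x
        simp only [hat, hom, map_mul, Complex.conj_ofReal, hH, ew]
        have e : Real.exp (-(1/2) * Φ x) * Real.exp (-(1/2) * Φ x) * Real.exp (q x - q' x) =
            Real.exp (η x) * Real.exp (-(q' x)) := by
          rw [← Real.exp_add, ← Real.exp_add, ← Real.exp_add]; congr 1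
          simp only [hqdef]; ring
        have e' := congrArg (fun r : ℝ => (r : ℂ)) e
        simp only [Complex.ofReal_mul] at e'
        linear_combination (U x * conj (dl q' ξ x)) * e'
    rw [hI]
    set b1 := (fun x => ((Real.sqrt (B x * Real.exp (-(Φ x))) : ℝ) : ℂ)) with hb1
    set b2 := (fun x => ((Real.sqrt (S x * Real.exp (-(p x))) : ℝ) : ℂ)) with hb2
    have b1n : ∀ x ∈ D, ‖b1 x‖ ^ 2 = B x * Real.exp (-(Φ x)) := fun x hx => by
      have := hB0 x hx
      simp only [hb1]
      rw [Complex.norm_real, Real.norm_of_nonneg (Real.sqrt_nonneg _), Real.sq_sqrt (by positivity)]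
    have b2n : ∀ x ∈ D, ‖b2 x‖ ^ 2 = S x * Real.exp (-(p x)) := fun x hx => by
      have := hS0 x hx
      simp only [hb2]
      rw [Complex.norm_real, Real.norm_of_nonneg (Real.sqrt_nonneg _), Real.sq_sqrt (by positivity)]
    have b1L : MemLp b1 2 (volume.restrict D) := by
      refine (memLp_two_iff_integrable_sq_norm ?_).2 ?_
      · refine ContinuousOn.aestronglyMeasurable ?_ hD.measurableSet
        exact Complex.continuous_ofReal.comp_continuousOn
          (Real.continuous_sqrt.comp_continuousOn (hBcont.mul (mexp hΦ.contOn)))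
      · refine Integrable.congr hBi ?_
        filter_upwards [ae_restrict_mem hD.measurableSet] with x hx using (b1n x hx).symm
    have b2L : MemLp b2 2 (volume.restrict D) := by
      refine (memLp_two_iff_integrable_sq_norm ?_).2 ?_
      · refine ContinuousOn.aestronglyMeasurable ?_ hD.measurableSet
        exact Complex.continuous_ofReal.comp_continuousOn
          (Real.continuous_sqrt.comp_continuousOn (hScont.mul (mexp hp.contOn)))
      · refine Integrable.congr hSi ?_
        filter_upwards [ae_restrict_mem hD.measurableSet] with x hx using (b2n x hx).symm
    have hpt : ∀ x ∈ D, ‖wderBar H (bet ξ x) x * ew q' x‖ ≤ ‖b1 x‖ * ‖b2 x‖ := by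
      intro x hx
      have e1 : wderBar H (bet ξ x) x = ((Real.exp (η x) : ℝ) : ℂ) *
          (f x * wderBar V (bet ξ x) x + U x * wderBar (fun y => (η y : ℂ)) (bet ξ x) x) := by
        have hgd : DifferentiableAt ℂ g x := hg.differentiableAt (hD.mem_nhds hx)
        have hfd : DifferentiableAt ℂ f x := hf.differentiableAt (hD.mem_nhds hx)
        have e2 : wderBar U (bet ξ x) x = f x * wderBar V (bet ξ x) x := by
          simp only [hUdef]
          rw [wderBar_sub (hfV.d hx) (hgs.d hx), wderBar_mul (hfs.d hx) (hV'.d hx),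
            wderBar_holo hgd, wderBar_holo hfd]; ring
        simp only [hH]
        rw [wderBar_mul (hUs.d hx) (hη'.exp.toC.d hx), e2,
          wderBar_chain (hη'.d hx) (Real.hasDerivAt_exp _)]
        ring
      rw [← pow_le_pow_iff_left₀ (norm_nonneg _) (by positivity) two_ne_zero, mul_pow, b1n x hx, b2n x hx,
        e1, norm_mul, norm_mul, ew_norm, mul_pow, mul_pow, Complex.norm_real,
        Real.norm_of_nonneg (Real.exp_pos _).le]
      have := hXi x hx.1 (bet ξ x) (f x) (U x)
      have e3 : Real.exp (η x) ^ 2 * Real.exp (-(q' x)) ^ 2 = Real.exp (-(Φ x)) * Real.exp (-(p x)) := by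
        rw [← Real.exp_nat_mul, ← Real.exp_nat_mul, ← Real.exp_add, ← Real.exp_add]; congr 1
        simp only [hq'def, hpdef, hΦdef]; push_cast; ring
      calc _ = (Real.exp (η x) ^ 2 * Real.exp (-(q' x)) ^ 2) * _ := by rw [mul_right_comm]
        _ ≤ (Real.exp (η x) ^ 2 * Real.exp (-(q' x)) ^ 2) * (B x * S x) :=
            mul_le_mul_of_nonneg_left this (by positivity)
        _ = _ := by rw [e3]; ring
    have hcs := cs_norm b1L b2L
    have hle : ‖∫ x in D, wderBar H (bet ξ x) x * ew q' x‖ ≤ ∫ x in D, ‖b1 x‖ * ‖b2 x‖ := by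
      refine norm_integral_le_of_norm_le (cs_int b1L b2L) ?_
      filter_upwards [ae_restrict_mem hD.measurableSet] with x hx using hpt x hx
    refine hle.trans (hcs.trans ?_)
    rw [setIntegral_congr_fun hD.measurableSet (fun x hx => b1n x hx),
      setIntegral_congr_fun hD.measurableSet (fun x hx => b2n x hx), hBv]
    have hSe : ∫ x in D, S x * Real.exp (-(p x)) = ∫ x, S x * Real.exp (-(p x)) := by
      apply setIntegral_eq_integral_of_forall_compl_eq_zero
      intro x hx
      have : bet ξ x = 0 := by ext j; exact (hξ.wderBar (ee j)).zero_off hx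
      have z : ∀ p : (Fin n → ℂ) → ℝ, levi p 0 x = 0 := fun p => by simp [levi, wder]
      simp [hS, this, z]
    rw [hSe]
    have h3 : Real.sqrt (∫ x, S x * Real.exp (-(p x))) ≤ Real.sqrt (1 + τ') * ‖homL.toLp _‖ := by
      rw [← Real.sqrt_sq (norm_nonneg (homL.toLp _)), ← Real.sqrt_mul (by positivity), homn]
      exact Real.sqrt_le_sqrt hap
    rw [Real.sqrt_mul (by positivity), mul_assoc]
    exact mul_le_mul_of_nonneg_left h3 (Real.sqrt_nonneg _)

end Core

section Core2
variable {n : ℕ} {Ω : Set (Fin n → ℂ)} {u P η A : (Fin n → ℂ) → ℝ} {V f : (Fin n → ℂ) → ℂ} {c δ τ τ' : ℝ}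

lemma twisted (E : Exh Ω u) (hP : SmR Ω P) (hη : SmR Ω η) (hV : SmAt Ω V)
    (hA : ContinuousOn A Ω) (hA0 : ∀ x ∈ Ω, 0 ≤ A x) (hδ : 0 < δ)
    (hXi : ∀ x ∈ Ω, ∀ β : Fin n → ℂ, ∀ a b : ℂ,
      ‖a * wderBar V β x + b * wderBar (fun y => (η y : ℂ)) β x‖ ^ 2 ≤
        (‖a‖ ^ 2 * A x * (δ / (1 + δ)) + ‖b‖ ^ 2 * (1 / (1 + δ))) *
          ((levi P β x).re + 2 * (levi η β x).re))
    (hf : DifferentiableOn ℂ f (sbl Ω u c))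
    (hfi : IntegrableOn (fun x => ‖f x‖ ^ 2 * Real.exp (-(P x + psi u c x ^ 2))) (sbl Ω u c))
    {ε : ℝ} (hε : 0 < ε) :
    ∃ g, DifferentiableOn ℂ g (sbl Ω u c) ∧
      IntegrableOn (fun x => ‖g x‖ ^ 2 * Real.exp (-(P x + psi u c x ^ 2))) (sbl Ω u c) ∧
      IntegrableOn (fun x => ‖f x * V x - g x‖ ^ 2 * Real.exp (-(P x + psi u c x ^ 2))) (sbl Ω u c) ∧
      (∫ x in sbl Ω u c, ‖f x * V x - g x‖ ^ 2 * Real.exp (-(P x + psi u c x ^ 2))) ≤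
      (∫ x in sbl Ω u c, ‖f x‖ ^ 2 * A x * Real.exp (-(P x + psi u c x ^ 2))) + ε := by
  set C0 := ∫ x in sbl Ω u c, ‖f x‖ ^ 2 * A x * Real.exp (-(P x + psi u c x ^ 2)) with hC0
  have hC00 : 0 ≤ C0 := setIntegral_nonneg (E.open_sbl c).measurableSet fun x hx => by
    have := hA0 x hx.1; positivity
  set t := min (δ / 2) (ε * δ / (2 * (1 + δ) * (C0 + 1))) with ht
  have ht0 : 0 < t := lt_min (by positivity) (by positivity)
  have ht1 : t ≤ δ / 2 := min_le_left _ _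
  have ht2 : t ≤ ε * δ / (2 * (1 + δ) * (C0 + 1)) := min_le_right _ _
  obtain ⟨g, h1, h2, h3, h4⟩ := twisted_core E hP hη hV hA hA0 hδ hXi hf hfi
    (τ := Real.sqrt (2 / (1 + 1 / t))) (τ' := t) (by positivity) ht0 (by
      rw [Real.sq_sqrt (by positivity)]; field_simp; exact le_rfl)
  refine ⟨g, h1, h2, h3, ?_⟩
  set X := ∫ x in sbl Ω u c, ‖f x * V x - g x‖ ^ 2 * Real.exp (-(P x + psi u c x ^ 2))
  rw [le_div_iff₀ (by positivity)] at ht2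
  have h5 : (δ - t) * X ≤ (1 + t) * δ * C0 := by linarith
  have h6 : (1 + t) * δ * C0 ≤ (δ - t) * (C0 + ε) := by
    have a1 : t * (1 + δ) * C0 ≤ ε * δ / 2 := by nlinarith [mul_pos ht0 (by linarith : 0 < 1 + δ)]
    have a2 : ε * δ / 2 ≤ (δ - t) * ε := by nlinarith
    nlinarith
  exact le_of_mul_le_mul_left (h5.trans h6) (by linarith)

end Core2

section Xi
variable {m n : ℕ} {U : Set (Fin m → ℂ)} {Ω : Set (Fin n → ℂ)}
  {φ : (Fin m → ℂ) × (Fin n → ℂ) → ℝ} {η : (Fin n → ℂ) → ℝ} {δ : ℝ}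

/-- smoothness on the product -/
def SmP (U : Set (Fin m → ℂ)) (Ω : Set (Fin n → ℂ)) (φ : (Fin m → ℂ) × (Fin n → ℂ) → ℝ) : Prop :=
  ∀ p ∈ U ×ˢ Ω, ContDiffAt ℝ ∞ φ p

lemma slice_cd {F : Type*} [NormedAddCommGroup F] [NormedSpace ℝ F]
    {G : (Fin m → ℂ) × (Fin n → ℂ) → F} {t : Fin m → ℂ} {z : Fin n → ℂ}
    (h : ContDiffAt ℝ ∞ G (t, z)) : ContDiffAt ℝ ∞ (fun y => G (t, y)) z :=
  ContDiffAt.comp z (g := G) (f := fun y : Fin n → ℂ => (t, y)) h (contDiffAt_const.prodMk contDiffAt_id)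

lemma SmP.slice (h : SmP U Ω φ) {t : Fin m → ℂ} (ht : t ∈ U) : SmR Ω (fun z => φ (t, z)) :=
  fun z hz => slice_cd (h (t, z) ⟨ht, hz⟩)

/-- the mixed potential -/
def Vv (φ : (Fin m → ℂ) × (Fin n → ℂ) → ℝ) (w t : Fin m → ℂ) (z : Fin n → ℂ) : ℂ :=
  wder (fun q => (φ q : ℂ)) ((w, 0) : (Fin m → ℂ) × (Fin n → ℂ)) (t, z)

/-- the base Levi form -/
def Aa (φ : (Fin m → ℂ) × (Fin n → ℂ) → ℝ) (w t : Fin m → ℂ) (z : Fin n → ℂ) : ℝ :=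
  (levi φ ((w, 0) : (Fin m → ℂ) × (Fin n → ℂ)) (t, z)).re

lemma Vv_sm (h : SmP U Ω φ) {t : Fin m → ℂ} (ht : t ∈ U) (w : Fin m → ℂ) : SmAt Ω (Vv φ w t) :=
  fun z hz => slice_cd (cd_wder (h (t, z) ⟨ht, hz⟩).toC _)

lemma Aa_cont (h : SmP U Ω φ) {t : Fin m → ℂ} (ht : t ∈ U) (w : Fin m → ℂ) :
    ContinuousOn (Aa φ w t) Ω := fun z hz =>
  (Complex.continuous_re.continuousAt.comp
    (slice_cd (cd_wder (cd_wderBar (h (t, z) ⟨ht, hz⟩).toC _) _)).continuousAt).continuousWithinAt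

lemma xi_mixed (h : SmP U Ω φ) (hU : IsOpen U) (hΩ : IsOpen Ω) {t : Fin m → ℂ} (ht : t ∈ U)
    {z : Fin n → ℂ} (hz : z ∈ Ω) (w : Fin m → ℂ) (β : Fin n → ℂ) (s : ℂ) :
    wder (fun y => wderBar (fun q => (φ q : ℂ)) (((0 : Fin m → ℂ), β)) y) ((s • w, 0)) (t, z)
      = s * wderBar (Vv φ w t) β z ∧
    wder (fun y => wderBar (fun q => (φ q : ℂ)) ((s • w, 0)) y) (((0 : Fin m → ℂ), β)) (t, z)
      = conj (s * wderBar (Vv φ w t) β z) ∧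
    wder (fun y => wderBar (fun q => (φ q : ℂ)) ((s • w, (0 : Fin n → ℂ))) y) ((s • w, 0)) (t, z)
      = (‖s‖ ^ 2 : ℝ) * levi φ ((w, 0) : (Fin m → ℂ) × (Fin n → ℂ)) (t, z) := by
  have hp := h (t, z) ⟨ht, hz⟩
  have hs : ((s • w, 0) : (Fin m → ℂ) × (Fin n → ℂ)) = s • (w, 0) := by simp
  have e1 : wderBar (Vv φ w t) β z =
      wderBar (fun y => wder (fun q => (φ q : ℂ)) ((w, 0) : (Fin m → ℂ) × (Fin n → ℂ)) y) (0, β) (t, z) :=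
    wderBar_slice (cd_wder hp.toC _).dR β
  have hev : ∀ᶠ y in 𝓝 (t, z), y ∈ U ×ˢ Ω := (hU.prod hΩ).mem_nhds ⟨ht, hz⟩
  refine ⟨?_, ?_, ?_⟩
  · rw [hs, wder_smul, e1]
    congr 1
    exact wder_wderBar_comm hp.toC _ _
  · have : wder (fun y => wderBar (fun q => (φ q : ℂ)) ((s • w, (0 : Fin n → ℂ))) y) (((0 : Fin m → ℂ), β)) (t, z)
        = wder (fun y => conj (s * wder (fun q => (φ q : ℂ)) ((w, (0 : Fin n → ℂ))) y)) (((0 : Fin m → ℂ), β)) (t, z) := by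
      refine wder_congr ?_ _
      filter_upwards [hev] with y hy
      rw [wderBar_ofReal (h y hy).dR, hs, wder_smul]
    rw [this, wder_conj ((cd_wder hp.toC _).dR.const_mul _), wderBar_const_mul (cd_wder hp.toC _).dR, e1]
  · rw [hs, wder_smul]
    have : wder (fun y => wderBar (fun q => (φ q : ℂ)) (s • ((w, (0 : Fin n → ℂ)))) y) ((w, 0)) (t, z)
        = conj s * levi φ ((w, 0) : (Fin m → ℂ) × (Fin n → ℂ)) (t, z) := by
      unfold levi
      rw [← wder_const_mul (cd_wderBar hp.toC _).dR]
      congr 1; ext y; rw [wderBar_smul]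
    rw [this, ← mul_assoc, Complex.mul_conj, Complex.normSq_eq_norm_sq]

lemma levi_slice (h : SmP U Ω φ) (hU : IsOpen U) (hΩ : IsOpen Ω) {t : Fin m → ℂ} (ht : t ∈ U)
    {z : Fin n → ℂ} (hz : z ∈ Ω) (β : Fin n → ℂ) :
    levi (fun y => φ (t, y)) β z = levi φ ((0, β) : (Fin m → ℂ) × (Fin n → ℂ)) (t, z) := by
  have hp := h (t, z) ⟨ht, hz⟩
  unfold levi
  rw [← wder_slice (cd_wderBar hp.toC _).dR]
  refine wder_congr ?_ _
  filter_upwards [hΩ.mem_nhds hz] with y hy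
  exact wderBar_slice (f := fun q => (φ q : ℂ)) (h (t, y) ⟨ht, hy⟩).toC.dR β

lemma xi_alg {A κ Θ : ℝ} {L : ℂ} (h : ∀ s : ℂ, 0 ≤ ‖s‖ ^ 2 * A + 2 * (s * L).re + κ * Θ) :
    ‖L‖ ^ 2 ≤ A * (κ * Θ) := by
  have hq : ∀ r : ℝ, 0 ≤ (‖L‖ ^ 2 * A) * (r * r) + (-(2 * ‖L‖ ^ 2)) * r + κ * Θ := by
    intro r
    have := h (-(r : ℂ) * conj L)
    have e : (-(r : ℂ) * conj L) * L = ((-(r * ‖L‖ ^ 2) : ℝ) : ℂ) := by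
      rw [mul_assoc, mul_comm (conj L), Complex.mul_conj, Complex.normSq_eq_norm_sq]; push_cast; ring
    rw [e, Complex.ofReal_re, norm_mul, norm_neg, Complex.norm_real, RCLike.norm_conj, mul_pow,
      Real.norm_eq_abs, sq_abs] at this
    nlinarith
  have hd := discrim_le_zero hq
  unfold discrim at hd
  rcases (sq_nonneg ‖L‖).eq_or_lt with h0 | h0
  · rw [← h0]
    have h1 := h 0
    have hA : 0 ≤ A ∨ A < 0 := le_or_gt 0 A
    simp at h1
    rcases hA with hA | hA
    · positivity
    · exfalso
      have hL : L = 0 := by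
        have : ‖L‖ = 0 := by nlinarith [norm_nonneg L]
        simpa using this
      have h2 := h (((κ * Θ + 1) / (-A) + 1 : ℝ) : ℂ)
      rw [hL, mul_zero, Complex.zero_re, Complex.norm_real, Real.norm_eq_abs, sq_abs] at h2
      set y := (κ * Θ + 1) / (-A) with hy
      have hy0 : 0 ≤ y := div_nonneg (by linarith) (by linarith)
      have hy1 : y * (-A) = κ * Θ + 1 := div_mul_cancel₀ _ (by linarith)
      nlinarith [mul_nonneg hy0 (by linarith : 0 ≤ -A), mul_nonneg (mul_nonneg hy0 hy0) (by linarith : 0 ≤ -A)]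
  · have : ‖L‖ ^ 2 * (‖L‖ ^ 2) ≤ ‖L‖ ^ 2 * (A * (κ * Θ)) := by nlinarith
    exact le_of_mul_le_mul_left this h0

lemma xi_alg2 {A δ Θ g l a b : ℝ} (hδ : 0 < δ) (hA : 0 ≤ A) (hΘ : 0 ≤ Θ) (ha : 0 ≤ a)
    (hb : 0 ≤ b) (hg : 0 ≤ g) (hl : 0 ≤ l) (h : l ^ 2 ≤ A * (δ / (1 + δ) * Θ)) :
    (a * l + b * g) ^ 2 ≤ (a ^ 2 * A * (δ / (1 + δ)) + b ^ 2 * (1 / (1 + δ))) * (Θ + (1 + δ) * g ^ 2) := by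
  set x := Real.sqrt (A * (δ / (1 + δ))) with hx
  set y := Real.sqrt Θ with hy
  have hx2 : x ^ 2 = A * (δ / (1 + δ)) := Real.sq_sqrt (by positivity)
  have hy2 : y ^ 2 = Θ := Real.sq_sqrt hΘ
  have hx0 : 0 ≤ x := Real.sqrt_nonneg _
  have hy0 : 0 ≤ y := Real.sqrt_nonneg _
  have hlxy : l ≤ x * y := by
    refine (pow_le_pow_iff_left₀ hl (by positivity) two_ne_zero).1 ?_
    rw [mul_pow, hx2, hy2]; linarith
  have h1 : (a * l + b * g) ^ 2 ≤ (a * (x * y) + b * g) ^ 2 := by gcongr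
  refine h1.trans ?_
  rw [mul_assoc (a ^ 2), ← hx2, ← hy2]
  have e : (a ^ 2 * x ^ 2 + b ^ 2 * (1 / (1 + δ))) * (y ^ 2 + (1 + δ) * g ^ 2) - (a * (x * y) + b * g) ^ 2
    = ((1 + δ) * a * x * g - b * y) ^ 2 / (1 + δ) := by field_simp; ring
  have : 0 ≤ ((1 + δ) * a * x * g - b * y) ^ 2 / (1 + δ) := by positivity
  linarith

lemma xi_all (hφ : SmP U Ω φ) (hη : SmR Ω η) (hU : IsOpen U) (hΩ : IsOpen Ω) (hδ : 0 < δ)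
    (hXi : XiNonneg U Ω φ η δ) {t : Fin m → ℂ} (ht : t ∈ U) (w : Fin m → ℂ) {z : Fin n → ℂ} (hz : z ∈ Ω) :
    0 ≤ Aa φ w t z ∧ ∀ β : Fin n → ℂ, ∀ a b : ℂ,
      ‖a * wderBar (Vv φ w t) β z + b * wderBar (fun y => (η y : ℂ)) β z‖ ^ 2 ≤
        (‖a‖ ^ 2 * Aa φ w t z * (δ / (1 + δ)) + ‖b‖ ^ 2 * (1 / (1 + δ))) *
          ((levi (fun y => φ (t, y)) β z).re + 2 * (levi η β z).re) := by
  have key : ∀ β : Fin n → ℂ, ∀ s : ℂ, 0 ≤ ‖s‖ ^ 2 * Aa φ w t z + 2 * (s * wderBar (Vv φ w t) β z).re +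
      δ / (1 + δ) * ((levi (fun y => φ (t, y)) β z).re + 2 * (levi η β z).re -
        (1 + δ) * ‖wder (fun y => (η y : ℂ)) β z‖ ^ 2) := by
    intro β s
    have := hXi (t, z) ⟨ht, hz⟩ (s • w) β
    obtain ⟨e1, e2, e3⟩ := xi_mixed hφ hU hΩ ht hz w β s
    rw [e1, e2, e3] at this
    have e4 := levi_slice hφ hU hΩ ht hz β
    rw [e4]
    refine this.trans (le_of_eq ?_)
    simp only [Complex.add_re, Complex.re_ofReal_mul, Complex.sub_re, Complex.conj_re, Complex.ofReal_re,
      Aa, levi, Complex.normSq_eq_norm_sq]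
    have : ∀ a : ℂ, (2 * a).re = 2 * a.re := fun a => by simp
    rw [this]; ring
  have hA : 0 ≤ Aa φ w t z := by
    have := key 0 1
    have z1 : ∀ p : (Fin n → ℂ) → ℝ, levi p 0 z = 0 := fun p => by simp [levi, wder]
    simpa [z1, wder, wderBar] using this
  refine ⟨hA, fun β a b => ?_⟩
  set Θ := (levi (fun y => φ (t, y)) β z).re + 2 * (levi η β z).re -
        (1 + δ) * ‖wder (fun y => (η y : ℂ)) β z‖ ^ 2 with hΘ
  have hΘ0 : 0 ≤ Θ := by
    have := key β 0
    simp only [norm_zero, zero_mul, Complex.zero_re] at this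
    have h2 : 0 ≤ δ / (1 + δ) * Θ := by linarith
    exact nonneg_of_mul_nonneg_right h2 (by positivity)
  have h1 := xi_alg (key β)
  have h2 := xi_alg2 hδ hA hΘ0 (norm_nonneg a) (norm_nonneg b)
    (norm_nonneg (wder (fun y => (η y : ℂ)) β z)) (norm_nonneg (wderBar (Vv φ w t) β z)) h1
  have e : (levi (fun y => φ (t, y)) β z).re + 2 * (levi η β z).re =
    Θ + (1 + δ) * ‖wder (fun y => (η y : ℂ)) β z‖ ^ 2 := by rw [hΘ]; ring
  rw [e]
  refine le_trans (pow_le_pow_left₀ (norm_nonneg _) ?_ 2) h2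
  refine (norm_add_le _ _).trans (le_of_eq ?_)
  rw [norm_mul, norm_mul, wderBar_ofReal (hη.d hz), RCLike.norm_conj]

end Xi

section KernelFacts
variable {n : ℕ} {D : Set (Fin n → ℂ)} {Φ : (Fin n → ℂ) → ℝ} {z : Fin n → ℂ}

/-- minimal norm of holomorphic functions with value one at `z` -/
def mm (D : Set (Fin n → ℂ)) (Φ : (Fin n → ℂ) → ℝ) (z : Fin n → ℂ) : ℝ≥0∞ :=
  ⨅ (f : (Fin n → ℂ) → ℂ) (_ : DifferentiableOn ℂ f D) (_ : f z = 1), bergNormSq D Φ volume f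

lemma mm_le {f : (Fin n → ℂ) → ℂ} (hf : DifferentiableOn ℂ f D) (h1 : f z = 1) :
    mm D Φ z ≤ bergNormSq D Φ volume f := iInf_le_of_le f (iInf_le_of_le hf (iInf_le _ h1))

lemma norm_smul_berg (a : ℂ) (f : (Fin n → ℂ) → ℂ) :
    bergNormSq D Φ volume (fun x => a * f x) = ENNReal.ofReal (‖a‖ ^ 2) * bergNormSq D Φ volume f := by
  unfold bergNormSq
  rw [← lintegral_const_mul' _ _ ENNReal.ofReal_ne_top]
  congr 1; ext x
  rw [← ENNReal.ofReal_mul (by positivity)]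
  congr 1; rw [norm_mul]; ring

lemma berg_zero (hD : IsOpen D) (hΦ : ContinuousOn Φ D) (hz : z ∈ D) {f : (Fin n → ℂ) → ℂ}
    (hf : DifferentiableOn ℂ f D) (h0 : bergNormSq D Φ volume f = 0) : f z = 0 := by
  obtain ⟨ε, hε, C, hC, hb, h⟩ := hol_sup hD hΦ hz
  have := h f hf z (Metric.mem_ball_self hε)
  rw [h0, mul_zero, nonpos_iff_eq_zero, ENNReal.ofReal_eq_zero] at this
  have h2 : ‖f z‖ ^ 2 = 0 := le_antisymm this (by positivity)
  simpa using h2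

lemma mm_pos (hD : IsOpen D) (hΦ : ContinuousOn Φ D) (hz : z ∈ D) : mm D Φ z ≠ 0 := by
  obtain ⟨ε, hε, C, hC, hb, h⟩ := hol_sup hD hΦ hz
  intro h0
  have : (ENNReal.ofReal (C + 1))⁻¹ ≤ mm D Φ z := by
    refine le_iInf fun f => le_iInf fun hf => le_iInf fun h1 => ?_
    have := h f hf z (Metric.mem_ball_self hε)
    rw [h1] at this
    simp at this
    rw [ENNReal.inv_le_iff_le_mul]
    · exact this.trans (by gcongr; linarith)
    · intro _; rw [Ne, ENNReal.ofReal_eq_zero]; linarith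
    · intro hh; simp at hh
  rw [h0] at this
  simp at this

lemma ker_eq (hD : IsOpen D) (hΦ : ContinuousOn Φ D) (hz : z ∈ D) :
    bergKernel D Φ volume z = (mm D Φ z)⁻¹ := by
  apply le_antisymm
  · refine iSup_le fun f => iSup_le fun hf => iSup_le fun h0 => iSup_le fun ht => ?_
    by_cases hfz : f z = 0
    · simp [hfz]
    have := mm_le (Φ := Φ) (hf.const_mul (f z)⁻¹) (inv_mul_cancel₀ hfz)
    rw [norm_smul_berg] at this
    rw [ENNReal.le_inv_iff_le_inv]
    refine this.trans (le_of_eq ?_)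
    have hp : (0:ℝ) < ‖f z‖ ^ 2 := by positivity
    rw [norm_inv, inv_pow, ENNReal.ofReal_inv_of_pos hp, ENNReal.inv_div, ENNReal.div_eq_inv_mul]
    · left; exact ht
    · left; exact h0
  · rw [ENNReal.inv_le_iff_inv_le]
    refine le_iInf fun f => le_iInf fun hf => le_iInf fun h1 => ?_
    by_cases ht : bergNormSq D Φ volume f = ⊤
    · rw [ht]; exact le_top
    have h0 : bergNormSq D Φ volume f ≠ 0 := fun h0 => by
      have := berg_zero hD hΦ hz hf h0
      rw [h1] at this; exact one_ne_zero this
    rw [ENNReal.inv_le_iff_inv_le]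
    refine le_trans (le_of_eq ?_) (le_iSup_of_le f (le_iSup_of_le hf (le_iSup_of_le h0 (le_iSup_of_le ht le_rfl))))
    simp [h1]

lemma ker_le (hD : IsOpen D) (hΦ : ContinuousOn Φ D) (hz : z ∈ D) {f : (Fin n → ℂ) → ℂ}
    (hf : DifferentiableOn ℂ f D) (ht : bergNormSq D Φ volume f ≠ ⊤) :
    ENNReal.ofReal (‖f z‖ ^ 2) ≤ bergKernel D Φ volume z * bergNormSq D Φ volume f := by
  by_cases h0 : bergNormSq D Φ volume f = 0
  · simp [berg_zero hD hΦ hz hf h0]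
  rw [← ENNReal.div_le_iff h0 ht]
  exact le_iSup_of_le f (le_iSup_of_le hf (le_iSup_of_le h0 (le_iSup_of_le ht le_rfl)))

lemma ker_fin (hD : IsOpen D) (hΦ : ContinuousOn Φ D) (hz : z ∈ D) :
    bergKernel D Φ volume z ≠ ⊤ := by
  rw [ker_eq hD hΦ hz]; simpa using mm_pos hD hΦ hz

lemma berg_aem (hD : IsOpen D) (hΦ : ContinuousOn Φ D) {f : (Fin n → ℂ) → ℂ}
    (hf : ContinuousOn f D) : AEMeasurable (fun z => ENNReal.ofReal (‖f z‖ ^ 2 * Real.exp (-(Φ z)))) (volume.restrict D) := by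
  have : ContinuousOn (fun z => ‖f z‖ ^ 2 * Real.exp (-(Φ z))) D := by fun_prop
  exact (this.aemeasurable hD.measurableSet).ennreal_ofReal

lemma berg_par (hD : IsOpen D) (hΦ : ContinuousOn Φ D) {f g : (Fin n → ℂ) → ℂ}
    (hf : ContinuousOn f D) (hg : ContinuousOn g D) :
    bergNormSq D Φ volume (fun x => f x - g x) + bergNormSq D Φ volume (fun x => f x + g x) ≤
      2 * bergNormSq D Φ volume f + 2 * bergNormSq D Φ volume g := by
  unfold bergNormSq
  refine (le_lintegral_add _ _).trans ?_
  rw [← lintegral_const_mul' _ _ (by simp), ← lintegral_const_mul' _ _ (by simp),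
    ← lintegral_add_left' ((berg_aem hD hΦ hf).const_mul 2)]
  refine lintegral_mono fun x => ?_
  simp only
  rw [show (2:ℝ≥0∞) = ENNReal.ofReal 2 by simp, ← ENNReal.ofReal_mul (by norm_num), ← ENNReal.ofReal_mul (by norm_num),
    ← ENNReal.ofReal_add (by positivity) (by positivity), ← ENNReal.ofReal_add (by positivity) (by positivity)]
  apply ENNReal.ofReal_le_ofReal
  have := parallelogram_law_with_norm ℂ (f x) (g x)
  have e : ‖f x - g x‖ ^ 2 * Real.exp (-Φ x) + ‖f x + g x‖ ^ 2 * Real.exp (-Φ x) =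
      (‖f x + g x‖ ^ 2 + ‖f x - g x‖ ^ 2) * Real.exp (-Φ x) := by ring
  rw [e, this]
  apply le_of_eq; ring

lemma berg_mono {D' : Set (Fin n → ℂ)} {Φ' : (Fin n → ℂ) → ℝ} (hD : MeasurableSet D) (h : D ⊆ D') (h2 : ∀ x ∈ D, Φ' x ≤ Φ x)
    (f : (Fin n → ℂ) → ℂ) : bergNormSq D Φ volume f ≤ bergNormSq D' Φ' volume f := by
  refine le_trans ?_ (norm_mono_set h Φ' f)
  refine setLIntegral_mono' hD fun x hx => ENNReal.ofReal_le_ofReal ?_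
  have := h2 x hx
  gcongr

lemma mm_mono {D' : Set (Fin n → ℂ)} {Φ' : (Fin n → ℂ) → ℝ} (hD : MeasurableSet D) (h : D ⊆ D') (h2 : ∀ x ∈ D, Φ' x ≤ Φ x) :
    mm D Φ z ≤ mm D' Φ' z :=
  le_iInf fun f => le_iInf fun hf => le_iInf fun h1 => (mm_le (hf.mono h) h1).trans (berg_mono hD h h2 f)

end KernelFacts

section Montel
variable {n : ℕ}

/-- monotone limit of minimal norms -/
lemma montel {D : ℕ → Set (Fin n → ℂ)} {Φ : ℕ → (Fin n → ℂ) → ℝ} {Ω : Set (Fin n → ℂ)}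
    {φ : (Fin n → ℂ) → ℝ} {z : Fin n → ℂ} (hD : ∀ j, IsOpen (D j)) (hm : Monotone D)
    (hΩ : IsOpen Ω)
    (hU : ∀ x ∈ Ω, ∃ j, x ∈ D j) (hsub : ∀ j, D j ⊆ Ω) (hΦ : ∀ j, ContinuousOn (Φ j) (D j))
    (hanti : ∀ j k, j ≤ k → ∀ x ∈ D j, Φ k x ≤ Φ j x)
    (hlim : ∀ x ∈ Ω, Tendsto (fun j => Φ j x) atTop (𝓝 (φ x))) (hz : ∀ j, z ∈ D j)
    {C : ℝ≥0∞} (hCt : C ≠ ⊤) (hC : ∀ j, mm (D j) (Φ j) z ≤ C) :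
    ∃ g, DifferentiableOn ℂ g Ω ∧ g z = 1 ∧ bergNormSq Ω φ volume g ≤ C := by
  set m : ℕ → ℝ≥0∞ := fun j => mm (D j) (Φ j) z with hmdef
  have mt : ∀ j, m j ≠ ⊤ := fun j => ne_top_of_le_ne_top hCt (hC j)
  have hex : ∀ j : ℕ, ∃ g, DifferentiableOn ℂ g (D j) ∧ g z = 1 ∧
      bergNormSq (D j) (Φ j) volume g < m j + ENNReal.ofReal ((1/2) ^ j) := by
    intro j
    have h1 : mm (D j) (Φ j) z < m j + ENNReal.ofReal ((1/2) ^ j) :=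
      ENNReal.lt_add_right (mt j) (by rw [Ne, ENNReal.ofReal_eq_zero, not_le]; positivity)
    unfold mm at h1
    simp only [iInf_lt_iff] at h1
    obtain ⟨g, a, b, c⟩ := h1
    exact ⟨g, a, b, c⟩
  choose g hg hg1 hgN using hex
  set mr : ℕ → ℝ := fun j => (m j).toReal with hmr
  have mmono : Monotone mr := by
    intro j k hjk
    exact ENNReal.toReal_mono (mt k) (mm_mono (hD j).measurableSet (hm hjk) (hanti j k hjk))
  have mbd : BddAbove (range mr) := ⟨C.toReal, by rintro _ ⟨j, rfl⟩; exact ENNReal.toReal_mono hCt (hC j)⟩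
  set L := ⨆ j, mr j with hL
  have mlim : Tendsto mr atTop (𝓝 L) := tendsto_atTop_ciSup mmono mbd
  set e : ℕ → ℝ := fun j => 2 * (L - mr j) + 4 * (1/2) ^ j with he
  have elim : Tendsto e atTop (𝓝 0) := by
    have h2 : Tendsto (fun j : ℕ => ((1:ℝ)/2) ^ j) atTop (𝓝 0) :=
      tendsto_pow_atTop_nhds_zero_of_lt_one (by norm_num) (by norm_num)
    have := ((tendsto_const_nhds (x := L)).sub mlim).const_mul 2 |>.add (h2.const_mul 4)
    simpa [he] using this
  have hsm : ∀ j, ENNReal.ofReal (mr j) = m j := fun j => ENNReal.ofReal_toReal (mt j)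
  have mr0 : ∀ j, 0 ≤ mr j := fun j => ENNReal.toReal_nonneg
  -- Cauchy estimate
  have hcau : ∀ J j k, J ≤ j → j ≤ k →
      bergNormSq (D J) (Φ J) volume (fun x => g j x - g k x) ≤ ENNReal.ofReal (e j) := by
    intro J j k hJ hk
    refine (berg_mono (hD J).measurableSet (hm hJ) (hanti J j hJ) _).trans ?_
    have gk : DifferentiableOn ℂ (g k) (D j) := (hg k).mono (hm hk)
    have h1 := berg_par (hD j) (hΦ j) (hg j).continuousOn gk.continuousOn
    have h2 : ENNReal.ofReal (4 * mr j) ≤ bergNormSq (D j) (Φ j) volume (fun x => g j x + g k x) := by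
      have h3 : mm (D j) (Φ j) z ≤ _ := mm_le (Φ := Φ j) (f := fun x => (1/2 : ℂ) * (g j x + g k x))
        (((hg j).add gk).const_mul _) (by rw [hg1, hg1]; norm_num)
      have h4 : (fun x => g j x + g k x) = fun x => (2:ℂ) * ((1/2 : ℂ) * (g j x + g k x)) := by
        ext x; ring
      rw [h4, norm_smul_berg 2, ENNReal.ofReal_mul (by norm_num), hsm]
      refine mul_le_mul' (le_of_eq (by norm_num)) h3
    have h3 : 2 * bergNormSq (D j) (Φ j) volume (g j) ≤ ENNReal.ofReal (2 * (mr j + (1/2) ^ j)) := by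
      rw [ENNReal.ofReal_mul (by norm_num), ENNReal.ofReal_add (mr0 j) (by positivity), hsm]
      refine mul_le_mul' (by norm_num) (hgN j).le
    have h4 : 2 * bergNormSq (D j) (Φ j) volume (g k) ≤ ENNReal.ofReal (2 * (L + (1/2) ^ j)) := by
      have : bergNormSq (D j) (Φ j) volume (g k) ≤ ENNReal.ofReal (L + (1/2)^j) := by
        refine (berg_mono (hD j).measurableSet (hm hk) (hanti j k hk) _).trans ((hgN k).le.trans ?_)
        rw [← hsm, ← ENNReal.ofReal_add (mr0 k) (by positivity)]
        apply ENNReal.ofReal_le_ofReal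
        refine add_le_add (le_ciSup mbd k) (pow_le_pow_of_le_one (by norm_num) (by norm_num) hk)
      rw [ENNReal.ofReal_mul (by norm_num)]
      exact mul_le_mul' (by norm_num) this
    have h5 := (add_le_add_right h2 (bergNormSq (D j) (Φ j) volume (fun x => g j x - g k x))).trans
      (h1.trans (add_le_add h3 h4))
    have L0 : 0 ≤ L := (mr0 0).trans (le_ciSup mbd 0)
    rw [← ENNReal.ofReal_add (by have := mr0 j; positivity) (by positivity)] at h5
    have h6 := ENNReal.le_sub_of_add_le_right ENNReal.ofReal_ne_top h5
    rw [← ENNReal.ofReal_sub _ (by have := mr0 j; positivity)] at h6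
    refine h6.trans (ENNReal.ofReal_le_ofReal (le_of_eq ?_))
    simp only [he]; ring
  have e0 : ∀ j, 0 ≤ e j := fun j => by
    have : mr j ≤ L := le_ciSup mbd j
    have h2 : (0:ℝ) < (1/2)^j := by positivity
    simp only [he]; linarith
  -- local uniform Cauchy
  have hloc : ∀ x ∈ Ω, ∃ ε > 0, ∃ J, Metric.ball x ε ⊆ D J ∧ UniformCauchySeqOn g atTop (Metric.ball x ε) := by
    intro x hx
    obtain ⟨J, hJ⟩ := hU x hx
    obtain ⟨ε, hε, K, hK, hb, hh⟩ := hol_sup (hD J) (hΦ J) hJ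
    refine ⟨ε, hε, J, hb, ?_⟩
    have key : ∀ j k, J ≤ j → j ≤ k → ∀ y ∈ Metric.ball x ε, ‖g j y - g k y‖ ^ 2 ≤ K * e j := by
      intro j k hj hk y hy
      have h1 := hh (fun x => g j x - g k x) (((hg j).mono (hm hj)).sub ((hg k).mono (hm (hj.trans hk)))) y hy
      have h2 := h1.trans (mul_le_mul_right (hcau J j k hj hk) _)
      rw [← ENNReal.ofReal_mul hK] at h2
      exact (ENNReal.ofReal_le_ofReal_iff (mul_nonneg hK (e0 j))).1 h2
    rw [Metric.uniformCauchySeqOn_iff]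
    intro s hs
    have h3 : ∀ᶠ j in atTop, K * e j < s ^ 2 := by
      have := elim.const_mul K
      rw [mul_zero] at this
      exact this.eventually_lt_const (by positivity)
    obtain ⟨N, hN⟩ := eventually_atTop.1 (h3.and (eventually_ge_atTop J))
    have key2 : ∀ j k, N ≤ j → j ≤ k → ∀ y ∈ Metric.ball x ε, ‖g j y - g k y‖ < s := by
      intro j k hj hk y hy
      have h4 := (key j k (hN j hj).2 hk y hy).trans_lt (hN j hj).1
      exact lt_of_pow_lt_pow_left₀ 2 hs.le h4
    refine ⟨N, fun a ha b hb y hy => ?_⟩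
    rw [dist_eq_norm]
    rcases le_total a b with h | h
    · exact key2 a b ha h y hy
    · rw [norm_sub_rev]; exact key2 b a hb h y hy
  have hpt : ∀ x, ∃ l, x ∈ Ω → Tendsto (fun j => g j x) atTop (𝓝 l) := by
    intro x
    by_cases hx : x ∈ Ω
    · obtain ⟨ε, hε, J, hb, hc⟩ := hloc x hx
      obtain ⟨l, hl⟩ := cauchySeq_tendsto_of_complete (hc.cauchySeq (Metric.mem_ball_self hε))
      exact ⟨l, fun _ => hl⟩
    · exact ⟨0, fun h => absurd h hx⟩
  choose G hG using hpt
  have hunif : ∀ x ∈ Ω, ∃ V, IsOpen V ∧ x ∈ V ∧ (∀ᶠ j in atTop, DifferentiableOn ℂ (g j) V) ∧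
      TendstoUniformlyOn g G atTop V := by
    intro x hx
    obtain ⟨ε, hε, J, hb, hc⟩ := hloc x hx
    refine ⟨Metric.ball x ε, Metric.isOpen_ball, Metric.mem_ball_self hε, ?_, ?_⟩
    · filter_upwards [eventually_ge_atTop J] with j hj
      exact (hg j).mono (hb.trans (hm hj))
    · exact hc.tendstoUniformlyOn_of_tendsto fun y hy => hG y (hsub J (hb hy))
  refine ⟨G, hol_limit hΩ hunif, ?_, ?_⟩
  · have := hG z (hsub 0 (hz 0))
    simp only [hg1] at this
    exact tendsto_nhds_unique this tendsto_const_nhds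
  · set h : ℕ → (Fin n → ℂ) → ℝ≥0∞ := fun j =>
      (D j).indicator (fun z => ENNReal.ofReal (‖g j z‖ ^ 2 * Real.exp (-(Φ j z)))) with hh
    have h1 : ∀ j, ∫⁻ x in Ω, h j x = bergNormSq (D j) (Φ j) volume (g j) := by
      intro j
      rw [hh]; simp only
      rw [setLIntegral_indicator (hD j).measurableSet, inter_eq_left.2 (hsub j)]
      rfl
    have h2 : bergNormSq Ω φ volume G ≤ ∫⁻ x in Ω, liminf (fun j => h j x) atTop := by
      refine setLIntegral_mono' hΩ.measurableSet fun x hx => ?_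
      have ht : Tendsto (fun j => h j x) atTop (𝓝 (ENNReal.ofReal (‖G x‖ ^ 2 * Real.exp (-(φ x))))) := by
        have t1 : Tendsto (fun j => ENNReal.ofReal (‖g j x‖ ^ 2 * Real.exp (-(Φ j x)))) atTop
            (𝓝 (ENNReal.ofReal (‖G x‖ ^ 2 * Real.exp (-(φ x))))) := by
          refine ENNReal.tendsto_ofReal ?_
          exact ((hG x hx).norm.pow 2).mul ((Real.continuous_exp.tendsto _).comp (hlim x hx).neg)
        refine t1.congr' ?_
        obtain ⟨J, hJ⟩ := hU x hx
        filter_upwards [eventually_ge_atTop J] with j hj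
        rw [hh]; simp only
        rw [indicator_of_mem (hm hj hJ)]
      rw [ht.liminf_eq]
    refine h2.trans ((lintegral_liminf_le' fun j => ?_).trans ?_)
    · rw [hh]; simp only
      rw [aemeasurable_indicator_iff (hD j).measurableSet, Measure.restrict_restrict (hD j).measurableSet,
        inter_eq_left.2 (hsub j)]
      exact berg_aem (hD j) (hΦ j) (hg j).continuousOn
    · simp_rw [h1]
      have t2 : Tendsto (fun j : ℕ => C + ENNReal.ofReal ((1/2) ^ j)) atTop (𝓝 C) := by
        have h2 : Tendsto (fun j : ℕ => ((1:ℝ)/2) ^ j) atTop (𝓝 0) :=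
          tendsto_pow_atTop_nhds_zero_of_lt_one (by norm_num) (by norm_num)
        have := (tendsto_const_nhds (x := C)).add (ENNReal.tendsto_ofReal h2)
        simpa using this
      rw [← t2.liminf_eq]
      refine liminf_le_liminf (Eventually.of_forall fun j => (hgN j).le.trans ?_)
      gcongr
      exact hC j

lemma extremal {D : Set (Fin n → ℂ)} {Φ : (Fin n → ℂ) → ℝ} {z : Fin n → ℂ} (hD : IsOpen D)
    (hΦ : ContinuousOn Φ D) (hz : z ∈ D) (hk : bergKernel D Φ volume z ≠ 0) :
    ∃ f, DifferentiableOn ℂ f D ∧ f z = 1 ∧ bergNormSq D Φ volume f ≤ (bergKernel D Φ volume z)⁻¹ := by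
  rw [ker_eq hD hΦ hz] at hk ⊢
  rw [inv_inv]
  exact montel (D := fun _ => D) (Φ := fun _ => Φ) (fun _ => hD) monotone_const hD (fun x hx => ⟨0, hx⟩)
    (fun _ => le_rfl) (fun _ => hΦ) (fun _ _ _ _ _ => le_rfl) (fun _ _ => tendsto_const_nhds) (fun _ => hz)
    (by simpa using hk) (fun _ => le_rfl)
end Montel

section KFam
variable {m n : ℕ} {U : Set (Fin m → ℂ)} {Ω : Set (Fin n → ℂ)} {u : (Fin n → ℂ) → ℝ}
  {φ : (Fin m → ℂ) × (Fin n → ℂ) → ℝ} {c : ℝ} {F : (Fin m → ℂ) → (Fin n → ℂ)} {t t0 : Fin m → ℂ}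

/-- penalized weight -/
def Ph (φ : (Fin m → ℂ) × (Fin n → ℂ) → ℝ) (u : (Fin n → ℂ) → ℝ) (c : ℝ) (t : Fin m → ℂ)
    (z : Fin n → ℂ) : ℝ := φ (t, z) + psi u c z ^ 2

/-- penalized kernels -/
def kk (Ω : Set (Fin n → ℂ)) (u : (Fin n → ℂ) → ℝ) (φ : (Fin m → ℂ) × (Fin n → ℂ) → ℝ)
    (F : (Fin m → ℂ) → (Fin n → ℂ)) (c : ℝ) (t : Fin m → ℂ) : ℝ≥0∞ :=
  bergKernel (sbl Ω u c) (Ph φ u c t) volume (F t)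

lemma Ph_cont (E : Exh Ω u) (hφ : SmP U Ω φ) (ht : t ∈ U) (c : ℝ) :
    ContinuousOn (Ph φ u c t) (sbl Ω u c) :=
  ((hφ.slice ht).mono sbl_sub).contOn.add ((psi_sm E).contOn.pow 2)

lemma psi_anti {c c' : ℝ} (h : c ≤ c') {x : Fin n → ℂ} (hx : u x < c) :
    psi u c' x ^ 2 ≤ psi u c x ^ 2 := by
  unfold psi
  have h1 : 0 < c - u x := by linarith
  have h2 : 0 < c' - u x := by linarith
  gcongr

lemma kk_anti (E : Exh Ω u) (hφ : SmP U Ω φ) (ht : t ∈ U) {c c' : ℝ} (h : c ≤ c') (hF : F t ∈ sbl Ω u c) :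
    kk Ω u φ F c' t ≤ kk Ω u φ F c t := by
  have hs : sbl Ω u c ⊆ sbl Ω u c' := fun x hx => ⟨hx.1, hx.2.trans_le h⟩
  unfold kk
  rw [ker_eq (E.open_sbl c) (Ph_cont E hφ ht c) hF, ker_eq (E.open_sbl c') (Ph_cont E hφ ht c') (hs hF)]
  rw [ENNReal.inv_le_inv]
  refine mm_mono (E.open_sbl c).measurableSet hs fun x hx => ?_
  have := psi_anti h hx.2
  unfold Ph; linarith

lemma kk_ge (E : Exh Ω u) (hφ : SmP U Ω φ) (ht : t ∈ U) (hF : F t ∈ sbl Ω u c) :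
    bergKernel Ω (fun w => φ (t, w)) volume (F t) ≤ kk Ω u φ F c t := by
  unfold kk
  rw [ker_eq (E.open_sbl c) (Ph_cont E hφ ht c) hF, ker_eq E.op (hφ.slice ht).contOn hF.1]
  rw [ENNReal.inv_le_inv]
  refine mm_mono (E.open_sbl c).measurableSet sbl_sub fun x hx => ?_
  have := sq_nonneg (psi u c x)
  unfold Ph; linarith

lemma kk_lim (E : Exh Ω u) (hφ : SmP U Ω φ) (ht : t ∈ U) (hF : F t ∈ Ω) {y : ℝ≥0∞}
    (hy : bergKernel Ω (fun w => φ (t, w)) volume (F t) < y) :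
    ∃ c, F t ∈ sbl Ω u c ∧ kk Ω u φ F c t < y := by
  by_contra hcon
  push Not at hcon
  have hc : ∀ j : ℕ, F t ∈ sbl Ω u (u (F t) + 1 + j) := fun j => ⟨hF, by
    have : (0:ℝ) ≤ j := by positivity
    linarith⟩
  have hy0 : y ≠ 0 := (bot_le.trans_lt hy).ne'
  obtain ⟨g, h1, h2, h3⟩ := montel (D := fun j : ℕ => sbl Ω u (u (F t) + 1 + j))
    (Φ := fun j : ℕ => Ph φ u (u (F t) + 1 + j) t) (φ := fun w => φ (t, w)) (C := y⁻¹) (z := F t)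
    (Ω := Ω) (fun j => E.open_sbl _) (fun j k hjk x hx => ⟨hx.1, hx.2.trans_le (by gcongr)⟩) E.op
    (fun x hx => by
      obtain ⟨j, hj⟩ := exists_nat_gt (u x - (u (F t) + 1))
      exact ⟨j, hx, by linarith⟩)
    (fun j => sbl_sub) (fun j => Ph_cont E hφ ht _)
    (fun j k hjk x hx => by
      have := psi_anti (u := u) (c := u (F t) + 1 + j) (c' := u (F t) + 1 + k) (by gcongr) hx.2
      unfold Ph; linarith)
    (fun x hx => by
      unfold Ph psi
      have h1 : Tendsto (fun j : ℕ => (u (F t) + 1 + (j:ℝ) - u x)) atTop atTop := by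
        have := tendsto_atTop_add_const_left atTop (u (F t) + 1 - u x) (tendsto_natCast_atTop_atTop (R := ℝ))
        refine this.congr fun j => ?_
        ring
      have := (tendsto_const_nhds (x := φ (t, x))).add (h1.inv_tendsto_atTop.pow 2)
      simpa using this)
    hc (by simpa using hy0)
    (fun j => by
      have := hcon _ (hc j)
      unfold kk at this
      rw [ker_eq (E.open_sbl _) (Ph_cont E hφ ht _) (hc j)] at this
      rwa [ENNReal.le_inv_iff_le_inv] at this)
  have h4 : mm Ω (fun w => φ (t, w)) (F t) ≤ y⁻¹ := (mm_le h1 h2).trans h3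
  rw [ker_eq E.op (hφ.slice ht).contOn hF] at hy
  rw [ENNReal.le_inv_iff_le_inv] at h4
  exact absurd hy (not_lt.2 h4)

lemma SmP.cont (hφ : SmP U Ω φ) : ContinuousOn φ (U ×ˢ Ω) := fun p hp => (hφ p hp).continuousAt.continuousWithinAt

/-- uniform closeness of weights -/
lemma unif_close (E : Exh Ω u) (hφ : SmP U Ω φ) (ht : t0 ∈ U) (c : ℝ) {e : ℝ} (he : 0 < e) :
    ∀ᶠ t in 𝓝 t0, ∀ z ∈ sbl Ω u c, |φ (t, z) - φ (t0, z)| < e := by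
  have h1 : ∀ z ∈ {z | z ∈ Ω ∧ u z ≤ c}, ∀ᶠ p : (Fin m → ℂ) × (Fin n → ℂ) in 𝓝 t0 ×ˢ 𝓝 z,
      |φ p - φ (t0, p.2)| < e := by
    intro z hz
    rw [← nhds_prod_eq]
    have c1 : ContinuousAt φ (t0, z) := (hφ (t0, z) ⟨ht, hz.1⟩).continuousAt
    have c2 : ContinuousAt (fun p : (Fin m → ℂ) × (Fin n → ℂ) => φ (t0, p.2)) (t0, z) :=
      ContinuousAt.comp (f := fun p : (Fin m → ℂ) × (Fin n → ℂ) => (t0, p.2)) (g := φ) c1 (by fun_prop)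
    have c3 := (c1.sub c2).abs
    have : ∀ᶠ p in 𝓝 (t0, z), |φ p - φ (t0, p.2)| < e := by
      refine c3.eventually_lt_const ?_
      simpa using he
    exact this
  have h2 := (E.cpt c).eventually_forall_of_forall_eventually (x₀ := t0)
    (P := fun t z => |φ (t, z) - φ (t0, z)| < e) (fun z hz => by
      rw [nhds_prod_eq]; exact h1 z hz)
  filter_upwards [h2] with t h z hz
  exact h z ⟨hz.1, hz.2.le⟩

lemma berg_close {D : Set (Fin n → ℂ)} (hD : MeasurableSet D) {P Q : (Fin n → ℂ) → ℝ} {e : ℝ}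
    (h : ∀ x ∈ D, Q x - e ≤ P x) (f : (Fin n → ℂ) → ℂ) :
    bergNormSq D P volume f ≤ ENNReal.ofReal (Real.exp e) * bergNormSq D Q volume f := by
  unfold bergNormSq
  rw [← lintegral_const_mul' _ _ ENNReal.ofReal_ne_top]
  refine setLIntegral_mono' hD fun x hx => ?_
  rw [← ENNReal.ofReal_mul (by positivity)]
  apply ENNReal.ofReal_le_ofReal
  have : Real.exp (-P x) ≤ Real.exp e * Real.exp (-Q x) := by
    rw [← Real.exp_add]; apply Real.exp_le_exp.2; linarith [h x hx]
  calc _ ≤ ‖f x‖ ^ 2 * (Real.exp e * Real.exp (-Q x)) := by gcongr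
    _ = _ := by ring

lemma sbl_fin (E : Exh Ω u) (c : ℝ) : volume (sbl Ω u c) < ⊤ :=
  (measure_mono fun x hx => ⟨hx.1, hx.2.le⟩ : volume (sbl Ω u c) ≤ volume {z | z ∈ Ω ∧ u z ≤ c}).trans_lt
    (E.cpt c).measure_lt_top

lemma kk_pos (E : Exh Ω u) (hφ : SmP U Ω φ) (ht : t ∈ U) (hF : F t ∈ sbl Ω u c) : kk Ω u φ F c t ≠ 0 := by
  unfold kk
  rw [ker_eq (E.open_sbl c) (Ph_cont E hφ ht c) hF]
  simp only [ne_eq, ENNReal.inv_eq_zero]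
  obtain ⟨M, hM0, hM⟩ := sbl_bdd E (hφ.slice ht).contOn c
  refine ne_top_of_le_ne_top ?_ (mm_le (f := fun _ => 1) (differentiableOn_const _) rfl)
  unfold bergNormSq
  refine ne_top_of_le_ne_top ?_ (setLIntegral_mono' (E.open_sbl c).measurableSet
    (g := fun _ => ENNReal.ofReal (Real.exp M)) fun x hx => ?_)
  · rw [setLIntegral_const]
    exact ENNReal.mul_ne_top ENNReal.ofReal_ne_top (sbl_fin E c).ne
  · apply ENNReal.ofReal_le_ofReal
    simp only [norm_one, one_pow, one_mul]
    apply Real.exp_le_exp.2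
    have := hM x hx
    rw [Real.norm_eq_abs, abs_le] at this
    have h2 := sq_nonneg (psi u c x)
    unfold Ph; linarith

lemma kk_usc (E : Exh Ω u) (hφ : SmP U Ω φ) (hU : IsOpen U) (ht : t0 ∈ U) (hF : F t0 ∈ sbl Ω u c)
    (hFc : ContinuousAt F t0) {Y : ℝ} (hY : kk Ω u φ F c t0 < ENNReal.ofReal Y) :
    ∀ᶠ t in 𝓝 t0, kk Ω u φ F c t ≤ ENNReal.ofReal Y := by
  have hfin : kk Ω u φ F c t0 ≠ ⊤ := hY.ne_top
  set κ := (kk Ω u φ F c t0).toReal with hκ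
  have hκ0 : 0 ≤ κ := ENNReal.toReal_nonneg
  have hke : kk Ω u φ F c t0 = ENNReal.ofReal κ := (ENNReal.ofReal_toReal hfin).symm
  have hκY : κ < Y := by rw [hke] at hY; exact (ENNReal.ofReal_lt_ofReal_iff'.1 hY).1
  set d := Y - κ with hd
  have hd0 : 0 < d := by linarith
  set s := d / (4 * (κ + 1)) with hs
  have hs0 : 0 < s := by positivity
  have hsκ : s * κ ≤ d / 4 := by
    rw [hs, div_mul_eq_mul_div, div_le_div_iff₀ (by positivity) (by norm_num)]; nlinarith
  set e0 := (d / 4) / (1 + 1 / s) with he0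
  have he00 : 0 < e0 := by positivity
  set e := Real.log ((κ + d) / (κ + d / 2)) with he
  have hee : 0 < e := Real.log_pos (by rw [lt_div_iff₀ (by positivity)]; linarith)
  have hexp : Real.exp e * (κ + d / 2) = Y := by
    rw [he, Real.exp_log (by positivity), div_mul_cancel₀ _ (by positivity)]; rw [hd]; ring
  have hΦ0 := Ph_cont E hφ ht c
  obtain ⟨ε, hε, hb, hq⟩ := hol_equi (E.open_sbl c) hΦ0 hF he00
  filter_upwards [unif_close E hφ ht c hee, hU.mem_nhds ht,
    hFc.eventually (Metric.ball_mem_nhds (F t0) hε)] with t h1 h2 h3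
  refine iSup_le fun f => iSup_le fun hf => iSup_le fun hn0 => iSup_le fun hnt => ?_
  rw [ENNReal.div_le_iff hn0 hnt]
  have hcl := berg_close (P := Ph φ u c t0) (Q := Ph φ u c t) (e := e) (E.open_sbl c).measurableSet
    (fun x hx => by
      have := (abs_lt.1 (h1 x hx)).2
      unfold Ph; linarith) f
  have hnt0 : bergNormSq (sbl Ω u c) (Ph φ u c t0) volume f ≠ ⊤ :=
    ne_top_of_le_ne_top (ENNReal.mul_ne_top ENNReal.ofReal_ne_top hnt) hcl
  have ha := hq f hf (F t) h3
  have hb2 := ker_le (E.open_sbl c) hΦ0 hF hf hnt0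
  change _ ≤ kk Ω u φ F c t0 * _ at hb2
  rw [hke] at hb2
  have hyoung : ‖f (F t)‖ ^ 2 ≤ (1 + s) * ‖f (F t0)‖ ^ 2 + (1 + 1 / s) * ‖f (F t) - f (F t0)‖ ^ 2 := by
    have h5 : ‖f (F t)‖ ≤ ‖f (F t0)‖ + ‖f (F t) - f (F t0)‖ := by
      have := norm_add_le (f (F t0)) (f (F t) - f (F t0)); simpa using this
    have h6 : ‖f (F t)‖ ^ 2 ≤ (‖f (F t0)‖ + ‖f (F t) - f (F t0)‖) ^ 2 := by gcongr
    refine h6.trans ?_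
    set a := ‖f (F t0)‖
    set b := ‖f (F t) - f (F t0)‖
    have h7 : (1 + s) * a ^ 2 + (1 + 1 / s) * b ^ 2 - (a + b) ^ 2 = (s * a - b) ^ 2 / s := by
      field_simp; ring
    have h8 : 0 ≤ (s * a - b) ^ 2 / s := by positivity
    linarith
  calc ENNReal.ofReal (‖f (F t)‖ ^ 2)
      ≤ ENNReal.ofReal (1 + s) * ENNReal.ofReal (‖f (F t0)‖ ^ 2) +
          ENNReal.ofReal (1 + 1 / s) * ENNReal.ofReal (‖f (F t) - f (F t0)‖ ^ 2) := by
        rw [← ENNReal.ofReal_mul (by positivity), ← ENNReal.ofReal_mul (by positivity),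
          ← ENNReal.ofReal_add (by positivity) (by positivity)]
        exact ENNReal.ofReal_le_ofReal hyoung
    _ ≤ ENNReal.ofReal (1 + s) * (ENNReal.ofReal κ * bergNormSq (sbl Ω u c) (Ph φ u c t0) volume f) +
          ENNReal.ofReal (1 + 1 / s) * (ENNReal.ofReal e0 * bergNormSq (sbl Ω u c) (Ph φ u c t0) volume f) := by
        gcongr
    _ = ENNReal.ofReal ((1 + s) * κ + (1 + 1 / s) * e0) * bergNormSq (sbl Ω u c) (Ph φ u c t0) volume f := by
        rw [← mul_assoc, ← mul_assoc, ← add_mul, ← ENNReal.ofReal_mul (by positivity),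
          ← ENNReal.ofReal_mul (by positivity), ← ENNReal.ofReal_add (by positivity) (by positivity)]
    _ ≤ ENNReal.ofReal (κ + d / 2) * (ENNReal.ofReal (Real.exp e) * bergNormSq (sbl Ω u c) (Ph φ u c t) volume f) := by
        refine mul_le_mul' (ENNReal.ofReal_le_ofReal ?_) hcl
        have : (1 + 1 / s) * e0 = d / 4 := by rw [he0]; field_simp
        rw [this]; linarith
    _ = _ := by
        rw [← mul_assoc, ← ENNReal.ofReal_mul (by positivity), mul_comm (κ + d / 2), hexp]

end KFam

section Taylor
variable {m n : ℕ} {U : Set (Fin m → ℂ)} {Ω : Set (Fin n → ℂ)}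
  {p φ : (Fin m → ℂ) × (Fin n → ℂ) → ℝ} {t0 : Fin m → ℂ}

lemma unif_close' {K : Set (Fin n → ℂ)} (hK : IsCompact K) 
    (hp : ∀ z ∈ K, ContinuousAt p (t0, z)) {e : ℝ} (he : 0 < e) :
    ∀ᶠ t in 𝓝 t0, ∀ z ∈ K, |p (t, z) - p (t0, z)| < e := by
  refine hK.eventually_forall_of_forall_eventually (x₀ := t0)
    (P := fun t z => |p (t, z) - p (t0, z)| < e) (fun z hz => ?_)
  have c1 : ContinuousAt p (t0, z) := hp z hz
  have c2 : ContinuousAt (fun q : (Fin m → ℂ) × (Fin n → ℂ) => p (t0, q.2)) (t0, z) :=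
    ContinuousAt.comp (f := fun q : (Fin m → ℂ) × (Fin n → ℂ) => (t0, q.2)) (g := p) c1 (by fun_prop)
  have c3 := (c1.sub c2).abs
  refine c3.eventually_lt_const ?_
  simpa using he

lemma one_var {q q1 q2 : ℝ → ℝ} {S κ : ℝ} (h1 : ∀ s, |s| ≤ S → HasDerivAt q (q1 s) s)
    (h2 : ∀ s, |s| ≤ S → HasDerivAt q1 (q2 s) s) (h3 : ∀ s, |s| ≤ S → |q2 s - q2 0| ≤ κ)
    {s : ℝ} (hs : |s| ≤ S) : |q s - (q 0 + s * q1 0 + s ^ 2 / 2 * q2 0)| ≤ κ * s ^ 2 := by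
  have hS : 0 ≤ S := (abs_nonneg s).trans hs
  have hκ : 0 ≤ κ := (abs_nonneg _).trans (h3 0 (by simpa using hS))
  have a1 : ∀ x, |x| ≤ S → |q1 x - (q1 0 + x * q2 0)| ≤ κ * |x| := by
    intro x hx
    have := Convex.norm_image_sub_le_of_norm_hasDerivWithin_le (f := fun x => q1 x - (q1 0 + x * q2 0))
      (f' := fun x => q2 x - q2 0) (s := Icc (-S) S) (C := κ) (x := 0) (y := x)
      (fun y hy => by
        have h := (h2 y (abs_le.2 hy)).sub (((hasDerivAt_id y).mul_const (q2 0)).const_add (q1 0))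
        simp only [one_mul] at h
        exact h.hasDerivWithinAt)
      (fun y hy => h3 y (abs_le.2 hy)) (convex_Icc _ _) ⟨by linarith, hS⟩ (abs_le.1 hx)
    simpa using this
  have := Convex.norm_image_sub_le_of_norm_hasDerivWithin_le (f := fun x => q x - (q 0 + x * q1 0 + x ^ 2 / 2 * q2 0))
      (f' := fun x => q1 x - (q1 0 + x * q2 0)) (s := Icc (-|s|) |s|) (C := κ * |s|) (x := 0) (y := s)
      (fun y hy => by
        have h := (h1 y ((abs_le.2 hy).trans hs)).sub ((((hasDerivAt_id y).mul_const (q1 0)).const_add (q 0)).add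
          ((((hasDerivAt_id y).pow 2).div_const 2).mul_const (q2 0)))
        refine (HasDerivAt.congr_deriv h (g' := q1 y - (q1 0 + y * q2 0)) ?_).hasDerivWithinAt
        simp)
      (fun y hy => (a1 y ((abs_le.2 hy).trans hs)).trans (mul_le_mul_of_nonneg_left (abs_le.2 hy) hκ)) (convex_Icc _ _)
      ⟨by linarith [abs_nonneg s], abs_nonneg s⟩ (abs_le.1 le_rfl)
  simp only [Real.norm_eq_abs, sub_zero] at this
  rw [mul_assoc, abs_mul_abs_self, ← sq] at this
  simpa using this

lemma SmP.cdd (hp : SmP U Ω p) (v : (Fin m → ℂ) × (Fin n → ℂ)) : SmP U Ω (fun q => fderiv ℝ p q v) :=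
  fun q hq => ((hp q hq).fderiv_right (m := ∞) (by simp)).clm_apply contDiffAt_const

/-- uniform second order Taylor expansion in the parameter -/
lemma unif_taylor (hp : SmP U Ω p) (hU : IsOpen U) {K : Set (Fin n → ℂ)} (hK : IsCompact K) (hKΩ : K ⊆ Ω)
    (ht : t0 ∈ U) (v : Fin m → ℂ) {κ : ℝ} (hκ : 0 < κ) :
    ∃ S > 0, ∀ s : ℝ, |s| ≤ S → ∀ z ∈ K, 
      |p (t0 + s • v, z) - (p (t0, z) + s * fderiv ℝ p (t0, z) (v, 0) + s ^ 2 / 2 *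
        fderiv ℝ (fun q => fderiv ℝ p q (v, 0)) (t0, z) (v, 0))| ≤ κ * s ^ 2 := by
  have h1 := (hp.cdd (v, 0))
  have h2 := (h1.cdd (v, 0))
  have h3 := unif_close' hK (fun z hz => (h2 (t0, z) ⟨ht, hKΩ hz⟩).continuousAt) hκ
  have hc : Tendsto (fun s : ℝ => t0 + s • v) (𝓝 0) (𝓝 t0) := by
    have : ContinuousAt (fun s : ℝ => t0 + s • v) 0 := by fun_prop
    simpa [ContinuousAt] using this
  have h4 := hc.eventually (h3.and (hU.mem_nhds ht))
  obtain ⟨S0, hS0, hS⟩ := Metric.eventually_nhds_iff.1 h4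
  refine ⟨S0 / 2, by positivity, fun s hs z hz => ?_⟩
  have hS' : ∀ s : ℝ, |s| ≤ S0 / 2 → _ := fun s hs => hS (y := s) (by
    rw [Real.dist_eq, sub_zero]; linarith)
  have hline : ∀ s : ℝ, HasDerivAt (fun s : ℝ => (t0 + s • v, z)) (v, (0 : Fin n → ℂ)) s := by
    intro s
    have a := ((hasDerivAt_id s).smul_const v).const_add t0
    rw [one_smul] at a
    exact a.prodMk (hasDerivAt_const s z)
  have dd : ∀ {f : (Fin m → ℂ) × (Fin n → ℂ) → ℝ}, SmP U Ω f → ∀ s : ℝ, |s| ≤ S0 / 2 →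
      HasDerivAt (fun s : ℝ => f (t0 + s • v, z)) (fderiv ℝ f (t0 + s • v, z) (v, 0)) s := by
    intro f hf s hs
    have := (hf (t0 + s • v, z) ⟨(hS' s hs).2, hKΩ hz⟩).differentiableAt (by simp)
    exact this.hasFDerivAt.comp_hasDerivAt s (hline s)
  have := one_var (S := S0 / 2) (κ := κ) (dd hp) (dd h1) (fun s hs => by
    have := ((hS' s hs).1 z hz).le
    simpa using this) hs
  simpa using this

/-- ratio of weights -/
def rat (φ : (Fin m → ℂ) × (Fin n → ℂ) → ℝ) (t0 : Fin m → ℂ) (q : (Fin m → ℂ) × (Fin n → ℂ)) : ℝ :=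
  Real.exp (φ (t0, q.2) - φ q)

lemma rat_base_sm (hφ : SmP U Ω φ) (ht : t0 ∈ U) {q : (Fin m → ℂ) × (Fin n → ℂ)} (hq : q ∈ U ×ˢ Ω) :
    ContDiffAt ℝ ∞ (fun q : (Fin m → ℂ) × (Fin n → ℂ) => φ (t0, q.2)) q :=
  (hφ (t0, q.2) ⟨ht, hq.2⟩).comp q (contDiffAt_const.prodMk contDiffAt_snd)

lemma rat_sm (hφ : SmP U Ω φ) (ht : t0 ∈ U) : SmP U Ω (rat φ t0) := fun q hq =>
  ((rat_base_sm hφ ht hq).sub (hφ q hq)).exp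

lemma rat_d1 (hφ : SmP U Ω φ) (ht : t0 ∈ U) {q : (Fin m → ℂ) × (Fin n → ℂ)} (hq : q ∈ U ×ˢ Ω) (v : Fin m → ℂ) :
    fderiv ℝ (rat φ t0) q (v, 0) = rat φ t0 q * (-fderiv ℝ φ q (v, 0)) := by
  have d1 := ((rat_base_sm hφ ht hq).differentiableAt (by simp)).hasFDerivAt
  have d2 := ((hφ q hq).differentiableAt (by simp)).hasFDerivAt
  have d3 : fderiv ℝ (fun q : (Fin m → ℂ) × (Fin n → ℂ) => φ (t0, q.2)) q (v, 0) = 0 := by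
    have e1 : HasFDerivAt (fun q : (Fin m → ℂ) × (Fin n → ℂ) => (t0, q.2)) 
      ((0 : _ →L[ℝ] (Fin m → ℂ)).prod (ContinuousLinearMap.snd ℝ (Fin m → ℂ) (Fin n → ℂ))) q :=
      (hasFDerivAt_const t0 q).prodMk hasFDerivAt_snd
    have e2 := ((hφ (t0, q.2) ⟨ht, hq.2⟩).differentiableAt (by simp)).hasFDerivAt
    have e3 := HasFDerivAt.comp q (g := φ) e2 e1
    have e4 := e3.fderiv
    change fderiv ℝ (fun q : (Fin m → ℂ) × (Fin n → ℂ) => φ (t0, q.2)) q = _ at e4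
    rw [e4]
    have e5 : ((0 : Fin m → ℂ), (0 : Fin n → ℂ)) = 0 := rfl
    simp [e5]
  have := (d1.sub d2).exp.fderiv
  change fderiv ℝ (rat φ t0) q = _ at this
  rw [this]
  simp [d3, rat]

lemma rat_d2 (hφ : SmP U Ω φ) (hU : IsOpen U) (hΩ : IsOpen Ω) (ht : t0 ∈ U) {z : Fin n → ℂ} (hz : z ∈ Ω) (v : Fin m → ℂ) :
    fderiv ℝ (fun q => fderiv ℝ (rat φ t0) q (v, 0)) (t0, z) (v, 0) =
      (fderiv ℝ φ (t0, z) (v, 0)) ^ 2 - fderiv ℝ (fun q => fderiv ℝ φ q (v, 0)) (t0, z) (v, 0) := by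
  have hq : (t0, z) ∈ U ×ˢ Ω := ⟨ht, hz⟩
  have ev : (fun q => fderiv ℝ (rat φ t0) q (v, 0)) =ᶠ[𝓝 (t0, z)] fun q => rat φ t0 q * (-fderiv ℝ φ q (v, 0)) := by
    filter_upwards [(hU.prod hΩ).mem_nhds hq] with q hq'
    exact rat_d1 hφ ht hq' v
  rw [ev.fderiv_eq]
  have d1 := ((rat_sm hφ ht _ hq).differentiableAt (by simp)).hasFDerivAt
  have d2 := (((hφ.cdd (v, 0)) _ hq).differentiableAt (by simp)).hasFDerivAt
  have := (d1.mul d2.neg).fderiv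
  change fderiv ℝ (fun q => rat φ t0 q * (-fderiv ℝ φ q (v, 0))) (t0, z) = _ at this
  rw [this]
  have r1 : rat φ t0 (t0, z) = 1 := by simp [rat]
  simp [rat_d1 hφ ht hq, r1]
  ring

lemma Vv_eq (hφ : SmP U Ω φ) (ht : t0 ∈ U) {z : Fin n → ℂ} (hz : z ∈ Ω) (w : Fin m → ℂ) :
    Vv φ w t0 z = (1 / 2 : ℂ) * ((fderiv ℝ φ (t0, z) (w, 0) : ℂ) - Complex.I * (fderiv ℝ φ (t0, z) (Complex.I • w, 0) : ℂ)) := by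
  unfold Vv wder
  have d := ((hφ (t0, z) ⟨ht, hz⟩).differentiableAt (by simp))
  rw [fderiv_ofReal_apply d, fderiv_ofReal_apply d]
  simp

lemma Aa_eq (hφ : SmP U Ω φ) (hU : IsOpen U) (hΩ : IsOpen Ω) (ht : t0 ∈ U) {z : Fin n → ℂ} (hz : z ∈ Ω) (w : Fin m → ℂ) :
    Aa φ w t0 z = (1 / 4) * (fderiv ℝ (fun q => fderiv ℝ φ q (w, 0)) (t0, z) (w, 0) +
      fderiv ℝ (fun q => fderiv ℝ φ q (Complex.I • w, 0)) (t0, z) (Complex.I • w, 0)) := by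
  have hq : (t0, z) ∈ U ×ˢ Ω := ⟨ht, hz⟩
  unfold Aa levi
  have ev : (fun y => wderBar (fun q => (φ q : ℂ)) ((w, 0) : (Fin m → ℂ) × (Fin n → ℂ)) y) =ᶠ[𝓝 (t0, z)]
      fun q => (1 / 2 : ℂ) * ((fderiv ℝ φ q (w, 0) : ℂ) + Complex.I * (fderiv ℝ φ q (Complex.I • w, 0) : ℂ)) := by
    filter_upwards [(hU.prod hΩ).mem_nhds hq] with q hq'
    have d := ((hφ _ hq').differentiableAt (by simp))
    unfold wderBar
    rw [fderiv_ofReal_apply d, fderiv_ofReal_apply d]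
    simp
  unfold wder
  rw [ev.fderiv_eq]
  have d1 := ((hφ.cdd (w, 0)) _ hq).differentiableAt (by simp)
  have d2 := ((hφ.cdd (Complex.I • w, 0)) _ hq).differentiableAt (by simp)
  have c1 : DifferentiableAt ℝ (fun q => (fderiv ℝ φ q (w, 0) : ℂ)) (t0, z) := diff_ofReal d1
  have c2 : DifferentiableAt ℝ (fun q => (fderiv ℝ φ q (Complex.I • w, 0) : ℂ)) (t0, z) := diff_ofReal d2
  have := ((c1.hasFDerivAt.add (c2.hasFDerivAt.const_mul Complex.I)).const_mul (1 / 2 : ℂ)).fderiv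
  change fderiv ℝ (fun q => (1 / 2 : ℂ) * ((fderiv ℝ φ q (w, 0) : ℂ) + Complex.I * (fderiv ℝ φ q (Complex.I • w, 0) : ℂ))) _ = _ at this
  rw [this]
  simp [fderiv_ofReal_apply d1, fderiv_ofReal_apply d2]
  ring

end Taylor

section LocalAlg

lemma abs_cross (a b c d : ℝ) : |a * b + c * d| ≤ (a ^ 2 + c ^ 2 + (b ^ 2 + d ^ 2)) / 2 := by
  rw [abs_le]; constructor <;>
    nlinarith only [sq_nonneg (a + b), sq_nonneg (c + d), sq_nonneg (a - b), sq_nonneg (c - d)]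

lemma alg4 {f g V : ℂ} {a0 a1 b0 b1 A s κ p1 p2 p3 p4 : ℝ}
    (hV : V = (1 / 2 : ℂ) * ((a0 : ℂ) - Complex.I * (a1 : ℂ))) (hA : A = (1 / 4) * (b0 + b1))
    (hs : 0 ≤ s) (hs1 : s ≤ 1) (hκ : 0 ≤ κ)
    (h1 : |p1 - (1 + s * (-a0) + s ^ 2 / 2 * (a0 ^ 2 - b0))| ≤ κ * s ^ 2)
    (h2 : |p2 - (1 + (-s) * (-a0) + (-s) ^ 2 / 2 * (a0 ^ 2 - b0))| ≤ κ * (-s) ^ 2)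
    (h3 : |p3 - (1 + s * (-a1) + s ^ 2 / 2 * (a1 ^ 2 - b1))| ≤ κ * s ^ 2)
    (h4 : |p4 - (1 + (-s) * (-a1) + (-s) ^ 2 / 2 * (a1 ^ 2 - b1))| ≤ κ * (-s) ^ 2)
    (k1 : p1 ≤ 1 + κ) (k2 : p2 ≤ 1 + κ) (k3 : p3 ≤ 1 + κ) (k4 : p4 ≤ 1 + κ) :
    (‖f + (s : ℂ) * g‖ ^ 2 * p1 + ‖f + (-(s : ℂ)) * g‖ ^ 2 * p2 + ‖f + (Complex.I * s) * g‖ ^ 2 * p3 +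
      ‖f + (-(Complex.I * s)) * g‖ ^ 2 * p4) / 4 ≤
      ‖f‖ ^ 2 + s ^ 2 * (‖f * V - g‖ ^ 2 - ‖f‖ ^ 2 * A) + 2 * κ * s ^ 2 * (‖f‖ ^ 2 + ‖g‖ ^ 2) := by
  subst hV hA
  obtain ⟨f1, f2⟩ := f
  obtain ⟨g1, g2⟩ := g
  simp only [← Complex.normSq_eq_norm_sq, Complex.normSq_apply]
  simp
  generalize hr1 : p1 - (1 + s * (-a0) + s ^ 2 / 2 * (a0 ^ 2 - b0)) = r1 at h1
  generalize hr2 : p2 - (1 + (-s) * (-a0) + (-s) ^ 2 / 2 * (a0 ^ 2 - b0)) = r2 at h2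
  generalize hr3 : p3 - (1 + s * (-a1) + s ^ 2 / 2 * (a1 ^ 2 - b1)) = r3 at h3
  generalize hr4 : p4 - (1 + (-s) * (-a1) + (-s) ^ 2 / 2 * (a1 ^ 2 - b1)) = r4 at h4
  have e1 : p1 = r1 + (1 + s * (-a0) + s ^ 2 / 2 * (a0 ^ 2 - b0)) := by linarith
  have e2 : p2 = r2 + (1 + (-s) * (-a0) + (-s) ^ 2 / 2 * (a0 ^ 2 - b0)) := by linarith
  have e3 : p3 = r3 + (1 + s * (-a1) + s ^ 2 / 2 * (a1 ^ 2 - b1)) := by linarith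
  have e4 : p4 = r4 + (1 + (-s) * (-a1) + (-s) ^ 2 / 2 * (a1 ^ 2 - b1)) := by linarith
  rw [neg_sq] at h2 h4
  rw [abs_le] at h1 h2 h3 h4
  set G := g1 ^ 2 + g2 ^ 2 with hG
  set Q := f1 ^ 2 + f2 ^ 2 with hQ
  set x := f1 * g1 + f2 * g2 with hx
  set y := f1 * g2 - f2 * g1 with hy
  have hG0 : 0 ≤ G := by positivity
  have hQ0 : 0 ≤ Q := by positivity
  have xb : |x| ≤ (Q + G) / 2 := by
    exact abs_cross f1 g1 f2 g2
  have yb : |y| ≤ (Q + G) / 2 := by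
    have := abs_cross f1 g2 (-f2) g1
    rw [hy, hQ, hG]
    calc _ = |f1 * g2 + -f2 * g1| := by congr 1; ring
      _ ≤ _ := this
      _ = _ := by ring
  have t1 : s ^ 2 * G * (p1 + p2 + p3 + p4) ≤ s ^ 2 * G * (4 + 4 * κ) := by
    apply mul_le_mul_of_nonneg_left _ (by positivity); linarith
  have t2 : Q * (r1 + r2 + r3 + r4) ≤ Q * (4 * (κ * s ^ 2)) := by
    apply mul_le_mul_of_nonneg_left _ (by positivity); linarith
  have t3 : 2 * s * (x * (r1 - r2)) ≤ 2 * 1 * ((Q + G) / 2 * (2 * (κ * s ^ 2))) := by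
    have : x * (r1 - r2) ≤ (Q + G) / 2 * (2 * (κ * s ^ 2)) := by
      refine (le_abs_self _).trans ?_
      rw [abs_mul]
      refine mul_le_mul xb ?_ (abs_nonneg _) (by positivity)
      rw [abs_le]; constructor <;> linarith
    refine (mul_le_mul_of_nonneg_left this (by positivity)).trans ?_
    gcongr
  have t4 : 2 * s * (y * (r4 - r3)) ≤ 2 * 1 * ((Q + G) / 2 * (2 * (κ * s ^ 2))) := by
    have : y * (r4 - r3) ≤ (Q + G) / 2 * (2 * (κ * s ^ 2)) := by
      refine (le_abs_self _).trans ?_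
      rw [abs_mul]
      refine mul_le_mul yb ?_ (abs_nonneg _) (by positivity)
      rw [abs_le]; constructor <;> linarith
    refine (mul_le_mul_of_nonneg_left this (by positivity)).trans ?_
    gcongr
  have main : Q * (p1 + p2 + p3 + p4) + 2 * s * (x * (p1 - p2)) + 2 * s * (y * (p4 - p3)) 
     = Q * (4 + s ^ 2 * (a0 ^ 2 - b0 + a1 ^ 2 - b1)) - 4 * s ^ 2 * x * a0 + 4 * s ^ 2 * y * a1 +
       Q * (r1 + r2 + r3 + r4) + 2 * s * (x * (r1 - r2)) + 2 * s * (y * (r4 - r3)) := by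
    rw [e1, e2, e3, e4]; ring
  rw [div_le_iff₀ (by norm_num)]
  have lhs : ∀ L : ℝ, L = Q * (p1 + p2 + p3 + p4) + 2 * s * (x * (p1 - p2)) + 2 * s * (y * (p4 - p3)) + s ^ 2 * G * (p1 + p2 + p3 + p4) →
    ∀ R : ℝ, R = 4 * Q + s ^ 2 * (Q * (a0 ^ 2 + a1 ^ 2) - 4 * x * a0 + 4 * y * a1 + 4 * G - Q * (b0 + b1)) + 8 * κ * s ^ 2 * (Q + G) → L ≤ R := by
    intro L hL R hR
    rw [hL, hR]
    linarith
  refine lhs _ ?_ _ ?_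
  · rw [hx, hy, hG, hQ]; ring
  · rw [hx, hy, hG, hQ]; ring

lemma hol_avg {G : ℂ → ℂ} {ρ κ : ℝ} (hρ : 0 < ρ) (hκ : 0 < κ) (hG : DifferentiableOn ℂ G (Metric.ball 0 ρ)) :
    ∃ S > 0, ∀ s : ℝ, 0 ≤ s → s ≤ S →
      ‖G 0‖ - κ * s ^ 2 ≤ (‖G s‖ + ‖G (-s)‖ + ‖G (Complex.I * s)‖ + ‖G (-(Complex.I * s))‖) / 4 := by
  have hb : Metric.ball (0:ℂ) ρ ∈ 𝓝 (0:ℂ) := Metric.ball_mem_nhds _ hρ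
  set G1 := dslope G 0 with hG1
  have d1 : DifferentiableOn ℂ G1 (Metric.ball 0 ρ) := (Complex.differentiableOn_dslope hb).2 hG
  set G2 := dslope G1 0 with hG2
  have d2 : DifferentiableOn ℂ G2 (Metric.ball 0 ρ) := (Complex.differentiableOn_dslope hb).2 d1
  have ex : ∀ z, G z = G 0 + z * G1 0 + z ^ 2 * G2 z := by
    intro z
    have e1 := sub_smul_dslope G 0 z
    have e2 := sub_smul_dslope G1 0 z
    simp only [sub_zero, smul_eq_mul] at e1 e2
    linear_combination -e1 - z * e2
  have c2 : ContinuousAt G2 0 := (d2.differentiableAt hb).continuousAt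
  obtain ⟨S0, hS0, hS⟩ := Metric.continuousAt_iff.1 c2 κ hκ
  refine ⟨S0 / 2, by positivity, fun s hs hs' => ?_⟩
  have hn : ∀ z : ℂ, ‖z‖ ≤ S0 / 2 → ‖G2 z - G2 0‖ ≤ κ := fun z hz => by
    have := hS (x := z) (by rw [dist_zero_right]; linarith)
    rw [dist_eq_norm] at this; exact this.le
  have key : 4 * G 0 = (G s + G (-s) + G (Complex.I * s) + G (-(Complex.I * s))) -
     s ^ 2 * ((G2 s - G2 0) + (G2 (-s) - G2 0) - (G2 (Complex.I * s) - G2 0) - (G2 (-(Complex.I * s)) - G2 0)) := by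
    rw [ex s, ex (-s), ex (Complex.I * s), ex (-(Complex.I * s))]
    have := Complex.I_sq
    ring_nf
    rw [this]; ring
  have b1 := hn s (by rw [Complex.norm_real, Real.norm_of_nonneg hs]; exact hs')
  have b2 := hn (-s) (by rw [norm_neg, Complex.norm_real, Real.norm_of_nonneg hs]; exact hs')
  have b3 := hn (Complex.I * s) (by rw [norm_mul, Complex.norm_I, one_mul, Complex.norm_real, Real.norm_of_nonneg hs]; exact hs')
  have b4 := hn (-(Complex.I * s)) (by rw [norm_neg, norm_mul, Complex.norm_I, one_mul, Complex.norm_real, Real.norm_of_nonneg hs]; exact hs')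
  have n0 : ‖4 * G 0‖ = 4 * ‖G 0‖ := by simp
  have n1 : ‖(G2 s - G2 0) + (G2 (-s) - G2 0) - (G2 (Complex.I * s) - G2 0) - (G2 (-(Complex.I * s)) - G2 0)‖ ≤ 4 * κ := by
    refine (norm_sub_le _ _).trans ?_
    have a := norm_sub_le ((G2 s - G2 0) + (G2 (-s) - G2 0)) (G2 (Complex.I * s) - G2 0)
    have b := norm_add_le (G2 s - G2 0) (G2 (-s) - G2 0)
    linarith
  have n2 : ‖G s + G (-s) + G (Complex.I * s) + G (-(Complex.I * s))‖ ≤ ‖G s‖ + ‖G (-s)‖ + ‖G (Complex.I * s)‖ + ‖G (-(Complex.I * s))‖ := by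
    refine (norm_add_le _ _).trans ?_
    have a := norm_add_le (G s + G (-s)) (G (Complex.I * s))
    have b := norm_add_le (G s) (G (-s))
    linarith
  rw [key] at n0
  have n3 := norm_sub_le (G s + G (-s) + G (Complex.I * s) + G (-(Complex.I * s))) 
    ((s:ℂ) ^ 2 * ((G2 s - G2 0) + (G2 (-s) - G2 0) - (G2 (Complex.I * s) - G2 0) - (G2 (-(Complex.I * s)) - G2 0)))
  rw [n0, norm_mul, norm_pow, Complex.norm_real, Real.norm_of_nonneg hs] at n3
  have n4 := mul_le_mul_of_nonneg_left n1 (sq_nonneg s)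
  linarith

end LocalAlg

section BergInt
variable {n : ℕ} {D : Set (Fin n → ℂ)} {Φ : (Fin n → ℂ) → ℝ} {f : (Fin n → ℂ) → ℂ}

lemma berg_int (hD : IsOpen D) (hΦ : ContinuousOn Φ D) (hf : ContinuousOn f D)
    (h : bergNormSq D Φ volume f ≠ ⊤) : IntegrableOn (fun x => ‖f x‖ ^ 2 * Real.exp (-(Φ x))) D := by
  have hc : ContinuousOn (fun x => ‖f x‖ ^ 2 * Real.exp (-(Φ x))) D := by fun_prop
  refine ⟨hc.aestronglyMeasurable hD.measurableSet, ?_⟩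
  rw [hasFiniteIntegral_iff_ofReal (Eventually.of_forall fun x => by positivity)]
  exact lt_top_iff_ne_top.2 h

lemma berg_real (h : IntegrableOn (fun x => ‖f x‖ ^ 2 * Real.exp (-(Φ x))) D) :
    bergNormSq D Φ volume f = ENNReal.ofReal (∫ x in D, ‖f x‖ ^ 2 * Real.exp (-(Φ x))) :=
  (ofReal_integral_eq_lintegral_ofReal h (Eventually.of_forall fun x => by positivity)).symm

end BergInt

section Local
variable {m n : ℕ} {U : Set (Fin m → ℂ)} {Ω : Set (Fin n → ℂ)} {u η : (Fin n → ℂ) → ℝ}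
  {φ : (Fin m → ℂ) × (Fin n → ℂ) → ℝ} {c δ : ℝ} {F : (Fin m → ℂ) → (Fin n → ℂ)} {t t0 : Fin m → ℂ}

lemma int4 {α : Type*} [MeasurableSpace α] {μ : Measure α} {a b c d : α → ℝ} (ha : Integrable a μ)
    (hb : Integrable b μ) (hc : Integrable c μ) (hd : Integrable d μ) :
    ∫ x, (a x + b x + c x + d x) / 4 ∂μ = ((∫ x, a x ∂μ) + (∫ x, b x ∂μ) + (∫ x, c x ∂μ) + ∫ x, d x ∂μ) / 4 := by
  have h1 := integral_add ha hb
  have h2 : ∫ x, (a x + b x) + c x ∂μ = (∫ x, (a x + b x) ∂μ) + ∫ x, c x ∂μ := integral_add (ha.add hb) hc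
  have h3 : ∫ x, ((a x + b x) + c x) + d x ∂μ = (∫ x, ((a x + b x) + c x) ∂μ) + ∫ x, d x ∂μ :=
    integral_add ((ha.add hb).add hc) hd
  rw [integral_div, h3, h2, h1]

lemma int5 {α : Type*} [MeasurableSpace α] {μ : Measure α} {a b c d : α → ℝ} (ha : Integrable a μ)
    (hb : Integrable b μ) (hc : Integrable c μ) (hd : Integrable d μ) (p q : ℝ) :
    ∫ x, (a x + p * (b x - c x) + q * (a x + d x)) ∂μ
      = (∫ x, a x ∂μ) + p * ((∫ x, b x ∂μ) - ∫ x, c x ∂μ) + q * ((∫ x, a x ∂μ) + ∫ x, d x ∂μ) := by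
  have h1 := integral_sub hb hc
  have h2 := integral_add ha hd
  have i1 : Integrable (fun x => p * (b x - c x)) μ := (hb.sub hc).const_mul p
  have i2 : Integrable (fun x => q * (a x + d x)) μ := (ha.add hd).const_mul q
  have i3 : Integrable (fun x => a x + p * (b x - c x)) μ := ha.add i1
  have h3 := integral_add ha i1
  have h4 := integral_add i3 i2
  rw [h4, h3, integral_const_mul, integral_const_mul, h1, h2]

lemma final_num {ε κ k0 T If J s : ℝ} (hε : 0 < ε) (hk0 : 0 < k0) (hT : 0 ≤ T) (hs : 0 < s) (hs1 : s ≤ 1)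
    (hκ0 : 0 < κ) (hκ1 : κ ≤ 1 / 8) (hκ2 : κ ≤ ε / 8) (hκ3 : κ ≤ ε / (8 * (k0 * T + 1))) (hIf : If ≤ k0⁻¹)
    (hJ : J ≤ If + s ^ 2 * (ε / (4 * k0)) + 2 * κ * s ^ 2 * T) 
    (h : 1 - κ * s ^ 2 ≤ k0 * Real.exp (-ε * s ^ 2) * J) : False := by
  have e1 : k0 * J ≤ 1 + s ^ 2 * (ε / 2) := by
    have a : k0 * J ≤ k0 * (k0⁻¹ + s ^ 2 * (ε / (4 * k0)) + 2 * κ * s ^ 2 * T) := by gcongr; linarith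
    have b : k0 * (k0⁻¹ + s ^ 2 * (ε / (4 * k0)) + 2 * κ * s ^ 2 * T) = 1 + s ^ 2 * (ε / 4) + s ^ 2 * (2 * (κ * (k0 * T))) := by
      field_simp
    have d : κ * (k0 * T) ≤ ε / 8 := by
      have h0 : 0 ≤ k0 * T := by positivity
      rw [le_div_iff₀ (by positivity)] at hκ3
      nlinarith
    have e : s ^ 2 * (2 * (κ * (k0 * T))) ≤ s ^ 2 * (2 * (ε / 8)) := by gcongr
    rw [b] at a
    linarith
  have e2 : 1 + ε * s ^ 2 ≤ Real.exp (ε * s ^ 2) := by linarith [Real.add_one_le_exp (ε * s ^ 2)]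
  have s2 : 0 < s ^ 2 := by positivity
  have s2' : s ^ 2 ≤ 1 := pow_le_one₀ hs.le hs1
  have e3 : 0 ≤ 1 - κ * s ^ 2 := by nlinarith
  have e4 : (1 - κ * s ^ 2) * (1 + ε * s ^ 2) ≤ k0 * J := by
    calc _ ≤ (1 - κ * s ^ 2) * Real.exp (ε * s ^ 2) := by gcongr
      _ ≤ (k0 * Real.exp (-ε * s ^ 2) * J) * Real.exp (ε * s ^ 2) := by gcongr
      _ = k0 * J * (Real.exp (-ε * s ^ 2) * Real.exp (ε * s ^ 2)) := by ring
      _ = k0 * J := by rw [← Real.exp_add]; simp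
  have e5 : (1 - κ * s ^ 2) * (1 + ε * s ^ 2) ≤ 1 + s ^ 2 * (ε / 2) := e4.trans e1
  have e6 : κ * s ^ 2 * ε ≤ 1 / 8 * 1 * ε := by gcongr
  have e7 : s ^ 2 * (ε - κ - κ * s ^ 2 * ε) ≤ s ^ 2 * (ε / 2) := by nlinarith only [e5]
  have e8 := le_of_mul_le_mul_left e7 s2
  linarith

lemma local_claim (E : Exh Ω u) (hφ : SmP U Ω φ) (hη : SmR Ω η) (hU : IsOpen U) (hδ : 0 < δ)
    (hXi : XiNonneg U Ω φ η δ) (hF : DifferentiableOn ℂ F U) (ht : t0 ∈ U) (hFt : F t0 ∈ sbl Ω u c)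
    (w : Fin m → ℂ) {P : ℂ → ℂ} (hP : Differentiable ℂ P) (hP0 : P 0 = 0) {ε : ℝ} (hε : 0 < ε)
    (hle : ∀ᶠ τ in 𝓝 (0:ℂ), kk Ω u φ F c (t0 + τ • w) ≤
      kk Ω u φ F c t0 * ENNReal.ofReal (Real.exp ((P τ).re - ε * ‖τ‖ ^ 2))) : False := by
  have hD := E.open_sbl c
  set D := sbl Ω u c with hDdef
  have hDΩ : D ⊆ Ω := sbl_sub
  have hΦ0 := Ph_cont E hφ ht c
  have hkt : kk Ω u φ F c t0 ≠ ⊤ := ker_fin hD hΦ0 hFt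
  have hkp : kk Ω u φ F c t0 ≠ 0 := kk_pos E hφ ht hFt
  set k0 := (kk Ω u φ F c t0).toReal with hk0d
  have hk0 : 0 < k0 := ENNReal.toReal_pos hkp hkt
  have hke : kk Ω u φ F c t0 = ENNReal.ofReal k0 := (ENNReal.ofReal_toReal hkt).symm
  obtain ⟨f, hf, hf1, hfN⟩ := extremal hD hΦ0 hFt hkp
  change _ ≤ (kk Ω u φ F c t0)⁻¹ at hfN
  rw [hke, ← ENNReal.ofReal_inv_of_pos hk0] at hfN
  have hfi := berg_int hD hΦ0 hf.continuousOn (ne_top_of_le_ne_top ENNReal.ofReal_ne_top hfN)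
  rw [berg_real hfi, ENNReal.ofReal_le_ofReal_iff (by positivity)] at hfN
  set V := Vv φ w t0 with hV
  set A := Aa φ w t0 with hA
  have hAc : ContinuousOn A Ω := Aa_cont hφ ht w
  obtain ⟨g, hg, hgi, hfgi, hI⟩ := twisted E (hφ.slice ht) hη (Vv_sm hφ ht w) (Aa_cont hφ ht w)
    (fun x hx => (xi_all hφ hη hU E.op hδ hXi ht w hx).1) hδ
    (fun x hx => (xi_all hφ hη hU E.op hδ hXi ht w hx).2) hf hfi (ε := ε / (4 * k0)) (by positivity)
  set W : (Fin n → ℂ) → ℝ := fun x => Real.exp (-(φ (t0, x) + psi u c x ^ 2)) with hW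
  have hWc : ContinuousOn W D := (Real.continuous_exp.comp_continuousOn hΦ0.neg)
  have hW0 : ∀ x, 0 < W x := fun x => Real.exp_pos _
  change IntegrableOn (fun x => ‖f x‖ ^ 2 * W x) D at hfi
  change (∫ x in D, ‖f x‖ ^ 2 * W x) ≤ _ at hfN
  change IntegrableOn (fun x => ‖g x‖ ^ 2 * W x) D at hgi
  change IntegrableOn (fun x => ‖f x * V x - g x‖ ^ 2 * W x) D at hfgi
  change (∫ x in D, ‖f x * V x - g x‖ ^ 2 * W x) ≤ (∫ x in D, ‖f x‖ ^ 2 * A x * W x) + _ at hI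
  have hAi : IntegrableOn (fun x => ‖f x‖ ^ 2 * A x * W x) D := by
    obtain ⟨M, hM0, hM⟩ := sbl_bdd E hAc c
    have hc : ContinuousOn (fun x => ‖f x‖ ^ 2 * A x * W x) D :=
      ((hf.continuousOn.norm.pow 2).mul (hAc.mono hDΩ)).mul hWc
    refine intOn_le (K := M) hD hfi (hc.aestronglyMeasurable hD.measurableSet) fun x hx => ?_
    rw [norm_mul, norm_mul, Real.norm_of_nonneg (hW0 x).le, norm_pow, norm_norm]
    have := hM x hx
    have h2 := (hW0 x).le
    calc _ ≤ ‖f x‖ ^ 2 * M * W x := by gcongr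
      _ = _ := by ring
  set If := ∫ x in D, ‖f x‖ ^ 2 * W x with hIf
  set Ig := ∫ x in D, ‖g x‖ ^ 2 * W x with hIg
  have hIf0 : 0 ≤ If := integral_nonneg fun x => mul_nonneg (by positivity) (hW0 x).le
  have hIg0 : 0 ≤ Ig := integral_nonneg fun x => mul_nonneg (by positivity) (hW0 x).le
  set T := If + Ig with hT
  have hT0 : 0 ≤ T := by positivity
  set κ := min (1 / 8) (min (ε / 8) (ε / (8 * (k0 * T + 1)))) with hκ
  have hκ0 : 0 < κ := by
    rw [hκ]; refine lt_min (by norm_num) (lt_min (by positivity) (by positivity))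
  have hκ1 : κ ≤ 1 / 8 := min_le_left _ _
  have hκ2 : κ ≤ ε / 8 := (min_le_right _ _).trans (min_le_left _ _)
  have hκ3 : κ ≤ ε / (8 * (k0 * T + 1)) := (min_le_right _ _).trans (min_le_right _ _)
  -- neighbourhood
  set K := {z | z ∈ Ω ∧ u z ≤ c} with hK
  have hKc : IsCompact K := E.cpt c
  have hDK : D ⊆ K := fun x hx => ⟨hx.1, hx.2.le⟩
  have hrs := rat_sm hφ ht
  have hr0 : ∀ z, rat φ t0 (t0, z) = 1 := fun z => by simp [rat]
  have hlin : Tendsto (fun τ : ℂ => t0 + τ • w) (𝓝 0) (𝓝 t0) := by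
    have : ContinuousAt (fun τ : ℂ => t0 + τ • w) 0 := by fun_prop
    simpa [ContinuousAt] using this
  have hFc : ContinuousAt F t0 := (hF.differentiableAt (hU.mem_nhds ht)).continuousAt
  have ev1 : ∀ᶠ t in 𝓝 t0, t ∈ U := hU.mem_nhds ht
  have ev2 : ∀ᶠ t in 𝓝 t0, F t ∈ D := hFc.eventually (hD.mem_nhds hFt)
  have hev := (hlin.eventually (ev1.and (ev2.and (unif_close' hKc
    (fun z hz => (hrs (t0, z) ⟨ht, hz.1⟩).continuousAt) hκ0)))).and hle
  obtain ⟨ρ, hρ, hev⟩ := Metric.eventually_nhds_iff.1 hev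
  replace hev : ∀ τ : ℂ, ‖τ‖ < ρ → _ := fun τ hτ => hev (y := τ) (by simpa using hτ)
  -- holomorphic function on the disc
  set G : ℂ → ℂ := fun τ => (f (F (t0 + τ • w)) + τ * g (F (t0 + τ • w))) ^ 2 * Complex.exp (-P τ) with hG
  have hGd : DifferentiableOn ℂ G (Metric.ball 0 ρ) := by
    intro τ hτ
    have hh := hev τ (by simpa using hτ)
    have a1 : DifferentiableAt ℂ (fun τ : ℂ => t0 + τ • w) τ := by fun_prop
    have a2 : DifferentiableAt ℂ (fun τ : ℂ => F (t0 + τ • w)) τ :=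
      DifferentiableAt.comp τ (g := F) (hF.differentiableAt (hU.mem_nhds hh.1.1)) a1
    have a3 : DifferentiableAt ℂ (fun τ : ℂ => f (F (t0 + τ • w))) τ :=
      DifferentiableAt.comp τ (g := f) (hf.differentiableAt (hD.mem_nhds hh.1.2.1)) a2
    have a4 : DifferentiableAt ℂ (fun τ : ℂ => g (F (t0 + τ • w))) τ :=
      DifferentiableAt.comp τ (g := g) (hg.differentiableAt (hD.mem_nhds hh.1.2.1)) a2
    have a5 : DifferentiableAt ℂ P τ := hP τ
    exact (((a3.add (differentiableAt_id.mul a4)).pow 2).mul a5.neg.cexp).differentiableWithinAt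
  have hG0 : ‖G 0‖ = 1 := by simp [hG, hf1, hP0]
  obtain ⟨S0, hS0, havg⟩ := hol_avg hρ hκ0 hGd
  obtain ⟨S1, hS1, hT1⟩ := unif_taylor hrs hU hKc (fun z hz => hz.1) ht w hκ0
  obtain ⟨S2, hS2, hT2⟩ := unif_taylor hrs hU hKc (fun z hz => hz.1) ht (Complex.I • w) hκ0
  -- norms
  set X : ℂ → (Fin n → ℂ) → ℝ := fun τ x => ‖f x + τ * g x‖ ^ 2 * rat φ t0 (t0 + τ • w, x) * W x with hX
  have hXi : ∀ τ : ℂ, ‖τ‖ < ρ → ‖τ‖ ≤ 1 → IntegrableOn (X τ) D := by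
    intro τ hτ hτ1
    have hh := hev τ hτ
    have hrc : ContinuousOn (fun x => rat φ t0 (t0 + τ • w, x)) D := fun x hx =>
      (slice_cd (hrs (t0 + τ • w, x) ⟨hh.1.1, hDΩ hx⟩)).continuousAt.continuousWithinAt
    have hc : ContinuousOn (X τ) D :=
      ((((hf.continuousOn.add (continuousOn_const.mul hg.continuousOn)).norm).pow 2).mul hrc).mul hWc
    refine intOn_le (K := 4) (F := fun x => ‖f x‖ ^ 2 * W x + ‖g x‖ ^ 2 * W x) hD (hfi.add hgi) (hc.aestronglyMeasurable hD.measurableSet) fun x hx => ?_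
    have r2 : rat φ t0 (t0 + τ • w, x) ≤ 2 := by
      have := (abs_lt.1 (hh.1.2.2 x (hDK hx))).2
      rw [hr0] at this; linarith
    have r0 : 0 ≤ rat φ t0 (t0 + τ • w, x) := (Real.exp_pos _).le
    have h2 := (hW0 x).le
    have h3 : ‖f x + τ * g x‖ ^ 2 ≤ 2 * (‖f x‖ ^ 2 + ‖g x‖ ^ 2) := by
      have a : ‖f x + τ * g x‖ ≤ ‖f x‖ + ‖g x‖ := by
        refine (norm_add_le _ _).trans ?_
        rw [norm_mul]
        have := mul_le_mul_of_nonneg_right hτ1 (norm_nonneg (g x))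
        linarith
      have b : ‖f x + τ * g x‖ ^ 2 ≤ (‖f x‖ + ‖g x‖) ^ 2 := by gcongr
      nlinarith [sq_nonneg (‖f x‖ - ‖g x‖)]
    rw [Real.norm_of_nonneg (by positivity)]
    simp only [hX]
    calc _ ≤ (2 * (‖f x‖ ^ 2 + ‖g x‖ ^ 2)) * 2 * W x := by gcongr
      _ = _ := by ring
  have hGb : ∀ τ : ℂ, ‖τ‖ < ρ → ‖τ‖ ≤ 1 → ‖G τ‖ ≤ k0 * Real.exp (-ε * ‖τ‖ ^ 2) * ∫ x in D, X τ x := by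
    intro τ hτ hτ1
    have hh := hev τ hτ
    have hi := hXi τ hτ hτ1
    have hXe : X τ = fun x => ‖f x + τ * g x‖ ^ 2 * Real.exp (-(Ph φ u c (t0 + τ • w) x)) := by
      ext x
      simp only [hX, rat, hW, Ph]
      rw [mul_assoc, ← Real.exp_add]
      congr 2; ring
    rw [hXe] at hi ⊢
    have hb := berg_real (f := fun x => f x + τ * g x) hi
    have hkl := ker_le hD (Ph_cont E hφ hh.1.1 c) hh.1.2.1 (f := fun x => f x + τ * g x)
      (hf.add ((differentiableOn_const τ).mul hg)) (by rw [hb]; exact ENNReal.ofReal_ne_top)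
    have hk2 := hkl.trans (mul_le_mul_left hh.2 _)
    rw [hb, hke, ← ENNReal.ofReal_mul hk0.le, ← ENNReal.ofReal_mul (by positivity)] at hk2
    have hint0 : 0 ≤ ∫ x in D, ‖f x + τ * g x‖ ^ 2 * Real.exp (-(Ph φ u c (t0 + τ • w) x)) :=
      integral_nonneg fun x => by positivity
    rw [ENNReal.ofReal_le_ofReal_iff (by positivity)] at hk2
    have hGn : ‖G τ‖ = ‖f (F (t0 + τ • w)) + τ * g (F (t0 + τ • w))‖ ^ 2 * Real.exp (-(P τ).re) := by
      simp only [hG]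
      rw [norm_mul, norm_pow, Complex.norm_exp, Complex.neg_re]
    rw [hGn]
    calc _ ≤ (k0 * Real.exp ((P τ).re - ε * ‖τ‖ ^ 2) * ∫ x in D, ‖f x + τ * g x‖ ^ 2 * Real.exp (-(Ph φ u c (t0 + τ • w) x))) * Real.exp (-(P τ).re) := by gcongr
      _ = k0 * (Real.exp ((P τ).re - ε * ‖τ‖ ^ 2) * Real.exp (-(P τ).re)) * ∫ x in D, ‖f x + τ * g x‖ ^ 2 * Real.exp (-(Ph φ u c (t0 + τ • w) x)) := by ring
      _ = _ := by rw [← Real.exp_add]; congr 3; ring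
  -- choose s
  obtain ⟨s, hs, hsρ, hs1, hsS0, hsS1, hsS2⟩ : ∃ s : ℝ, 0 < s ∧ s < ρ ∧ s ≤ 1 ∧ s ≤ S0 ∧ s ≤ S1 ∧ s ≤ S2 := by
    refine ⟨min (ρ / 2) (min 1 (min S0 (min S1 S2))), by positivity, ?_, ?_, ?_, ?_, ?_⟩
    · exact (min_le_left _ _).trans_lt (by linarith)
    · exact (min_le_right _ _).trans (min_le_left _ _)
    · exact (min_le_right _ _).trans ((min_le_right _ _).trans (min_le_left _ _))
    · exact (min_le_right _ _).trans ((min_le_right _ _).trans ((min_le_right _ _).trans (min_le_left _ _)))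
    · exact (min_le_right _ _).trans ((min_le_right _ _).trans ((min_le_right _ _).trans (min_le_right _ _)))
  have n1 : ‖(s:ℂ)‖ = s := by rw [Complex.norm_real, Real.norm_of_nonneg hs.le]
  have n2 : ‖-(s:ℂ)‖ = s := by rw [norm_neg, n1]
  have n3 : ‖Complex.I * (s:ℂ)‖ = s := by rw [norm_mul, Complex.norm_I, one_mul, n1]
  have n4 : ‖-(Complex.I * (s:ℂ))‖ = s := by rw [norm_neg, n3]
  have q1 : (s:ℂ) • w = s • w := by ext; simp
  have q2 : (-(s:ℂ)) • w = (-s) • w := by ext; simp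
  have q3 : (Complex.I * (s:ℂ)) • w = s • (Complex.I • w) := by ext; simp; ring
  have q4 : (-(Complex.I * (s:ℂ))) • w = (-s) • (Complex.I • w) := by ext; simp; ring
  have i1 := hXi s (by rwa [n1]) (by rwa [n1])
  have i2 := hXi (-s) (by rwa [n2]) (by rwa [n2])
  have i3 := hXi (Complex.I * s) (by rwa [n3]) (by rwa [n3])
  have i4 := hXi (-(Complex.I * s)) (by rwa [n4]) (by rwa [n4])
  have g1 := hGb s (by rwa [n1]) (by rwa [n1])
  have g2 := hGb (-s) (by rwa [n2]) (by rwa [n2])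
  have g3 := hGb (Complex.I * s) (by rwa [n3]) (by rwa [n3])
  have g4 := hGb (-(Complex.I * s)) (by rwa [n4]) (by rwa [n4])
  rw [n1] at g1
  rw [n2] at g2
  rw [n3] at g3
  rw [n4] at g4
  have e1 := (hev s (by rwa [n1])).1.2.2
  have e2 := (hev (-s) (by rwa [n2])).1.2.2
  have e3 := (hev (Complex.I * s) (by rwa [n3])).1.2.2
  have e4 := (hev (-(Complex.I * s)) (by rwa [n4])).1.2.2
  have hpt : ∀ x ∈ D, (X s x + X (-s) x + X (Complex.I * s) x + X (-(Complex.I * s)) x) / 4 ≤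
      ‖f x‖ ^ 2 * W x + s ^ 2 * (‖f x * V x - g x‖ ^ 2 * W x - ‖f x‖ ^ 2 * A x * W x) +
        2 * κ * s ^ 2 * (‖f x‖ ^ 2 * W x + ‖g x‖ ^ 2 * W x) := by
    intro x hx
    have hx2 := hDΩ hx
    have as1 : |s| ≤ S1 := by rwa [abs_of_pos hs]
    have as2 : |s| ≤ S2 := by rwa [abs_of_pos hs]
    have t1 := hT1 s as1 x (hDK hx)
    have t2 := hT1 (-s) (by rwa [abs_neg]) x (hDK hx)
    have t3 := hT2 s as2 x (hDK hx)
    have t4 := hT2 (-s) (by rwa [abs_neg]) x (hDK hx)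
    have mm : (t0, x) ∈ U ×ˢ Ω := ⟨ht, hx2⟩
    rw [← q1, hr0, rat_d1 hφ ht mm, rat_d2 hφ hU E.op ht hx2, hr0, one_mul] at t1
    rw [← q2, hr0, rat_d1 hφ ht mm, rat_d2 hφ hU E.op ht hx2, hr0, one_mul] at t2
    rw [← q3, hr0, rat_d1 hφ ht mm, rat_d2 hφ hU E.op ht hx2, hr0, one_mul] at t3
    rw [← q4, hr0, rat_d1 hφ ht mm, rat_d2 hφ hU E.op ht hx2, hr0, one_mul] at t4
    have k1 := (abs_lt.1 (e1 x (hDK hx))).2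
    have k2 := (abs_lt.1 (e2 x (hDK hx))).2
    have k3 := (abs_lt.1 (e3 x (hDK hx))).2
    have k4 := (abs_lt.1 (e4 x (hDK hx))).2
    rw [hr0] at k1 k2 k3 k4
    have := alg4 (f := f x) (g := g x) (Vv_eq hφ ht hx2 w) (Aa_eq hφ hU E.op ht hx2 w) hs.le hs1 hκ0.le t1 t2 t3 t4
      (by linarith) (by linarith) (by linarith) (by linarith)
    have := mul_le_mul_of_nonneg_right this (hW0 x).le
    simp only [hX]
    calc _ = _ := ?_
      _ ≤ _ := this
      _ = _ := ?_
    · ring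
    · rw [hV, hA]; ring
  have hiL : IntegrableOn (fun x => (X s x + X (-s) x + X (Complex.I * s) x + X (-(Complex.I * s)) x) / 4) D :=
    (((i1.add i2).add i3).add i4).div_const 4
  have hiR : IntegrableOn (fun x => ‖f x‖ ^ 2 * W x + s ^ 2 * (‖f x * V x - g x‖ ^ 2 * W x - ‖f x‖ ^ 2 * A x * W x) +
        2 * κ * s ^ 2 * (‖f x‖ ^ 2 * W x + ‖g x‖ ^ 2 * W x)) D :=
    (hfi.add ((hfgi.sub hAi).const_mul (s ^ 2))).add ((hfi.add hgi).const_mul (2 * κ * s ^ 2))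
  have hintg := setIntegral_mono_on hiL hiR hD.measurableSet hpt
  have eL : ∫ x in D, (X s x + X (-s) x + X (Complex.I * s) x + X (-(Complex.I * s)) x) / 4 =
      ((∫ x in D, X s x) + (∫ x in D, X (-s) x) + (∫ x in D, X (Complex.I * s) x) + ∫ x in D, X (-(Complex.I * s)) x) / 4 := by
    exact int4 i1 i2 i3 i4
  have eR : ∫ x in D, (‖f x‖ ^ 2 * W x + s ^ 2 * (‖f x * V x - g x‖ ^ 2 * W x - ‖f x‖ ^ 2 * A x * W x) +
        2 * κ * s ^ 2 * (‖f x‖ ^ 2 * W x + ‖g x‖ ^ 2 * W x)) =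
      If + s ^ 2 * ((∫ x in D, ‖f x * V x - g x‖ ^ 2 * W x) - ∫ x in D, ‖f x‖ ^ 2 * A x * W x) + 2 * κ * s ^ 2 * T := by
    exact int5 hfi hfgi hAi hgi _ _
  rw [eL, eR] at hintg
  have hav := havg s hs.le hsS0
  rw [hG0] at hav
  refine final_num (J := ((∫ x in D, X s x) + (∫ x in D, X (-s) x) + (∫ x in D, X (Complex.I * s) x) + ∫ x in D, X (-(Complex.I * s)) x) / 4)
    hε hk0 hT0 hs hs1 hκ0 hκ1 hκ2 hκ3 hfN (hintg.trans ?_) (hav.trans ?_)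
  · have : s ^ 2 * ((∫ x in D, ‖f x * V x - g x‖ ^ 2 * W x) - ∫ x in D, ‖f x‖ ^ 2 * A x * W x) ≤ s ^ 2 * (ε / (4 * k0)) := by
      gcongr; linarith
    linarith
  · linarith

end Local

section MaxPrinciple

lemma max_aux {r : ℝ} (hr : 0 < r) {L : ℂ → ℝ} (hL : UpperSemicontinuousOn L (Metric.closedBall 0 r))
    (hloc : ∀ τ0 : ℂ, ‖τ0‖ < r → ∀ P : ℂ → ℂ, Differentiable ℂ P → P 0 = 0 → ∀ ε : ℝ, 0 < ε →
      ¬ ∀ᶠ s in 𝓝 (0:ℂ), L (τ0 + s) ≤ L τ0 + ((P s).re - ε * ‖s‖ ^ 2))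
    {Q : ℂ → ℂ} (hQ : Differentiable ℂ Q) (hb : ∀ τ : ℂ, ‖τ‖ = r → L τ ≤ (Q τ).re) : L 0 ≤ (Q 0).re := by
  refine le_of_forall_pos_le_add fun e he => ?_
  set ε := e / r ^ 2 with hε
  have hε0 : 0 < ε := by positivity
  have hc : Continuous (fun τ : ℂ => -(Q τ).re + ε * ‖τ‖ ^ 2) := by
    have := hQ.continuous
    fun_prop
  have hW : UpperSemicontinuousOn (fun τ : ℂ => L τ + (-(Q τ).re + ε * ‖τ‖ ^ 2)) (Metric.closedBall 0 r) :=
    hL.add hc.continuousOn.upperSemicontinuousOn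
  obtain ⟨τ1, h1, hmax⟩ := hW.exists_isMaxOn ⟨0, by simp [hr.le]⟩ (isCompact_closedBall 0 r)
  have hmax' : ∀ τ : ℂ, ‖τ‖ ≤ r → L τ + (-(Q τ).re + ε * ‖τ‖ ^ 2) ≤ L τ1 + (-(Q τ1).re + ε * ‖τ1‖ ^ 2) :=
    fun τ hτ => hmax (by simpa using hτ)
  have h1' : ‖τ1‖ ≤ r := by simpa using h1
  rcases h1'.lt_or_eq with h | h
  · exfalso
    refine hloc τ1 h (fun s => Q (τ1 + s) - Q τ1 - 2 * ε * (conj τ1 * s)) ?_ (by simp) ε hε0 ?_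
    · exact ((hQ.comp (by fun_prop)).sub (by fun_prop)).sub (by fun_prop)
    · have hev : ∀ᶠ s in 𝓝 (0:ℂ), ‖τ1 + s‖ < r := by
        have : ContinuousAt (fun s : ℂ => ‖τ1 + s‖) 0 := by fun_prop
        exact this.eventually (Iio_mem_nhds (by simpa using h))
      filter_upwards [hev] with s hs
      have := hmax' (τ1 + s) hs.le
      have e1 : ‖τ1 + s‖ ^ 2 = ‖τ1‖ ^ 2 + 2 * (conj τ1 * s).re + ‖s‖ ^ 2 := by
        rw [← Complex.normSq_eq_norm_sq, ← Complex.normSq_eq_norm_sq, ← Complex.normSq_eq_norm_sq]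
        simp [Complex.normSq_apply]; ring
      rw [e1] at this
      have e2 : (2 * (ε:ℂ) * (conj τ1 * s)).re = 2 * ε * (conj τ1 * s).re := by
        rw [show (2 * (ε:ℂ) * (conj τ1 * s)) = ((2 * ε : ℝ) : ℂ) * (conj τ1 * s) by push_cast; ring, Complex.re_ofReal_mul]
      simp only [Complex.sub_re, e2]
      linarith
  · have h0 := hmax' 0 (by simp [hr.le])
    have h2 := hb τ1 h
    rw [h] at h0
    simp only [norm_zero] at h0
    have : ε * r ^ 2 = e := by rw [hε]; field_simp
    rw [this] at h0
    linarith

lemma trig_poly {r : ℝ} (hr : 0 < r) (p : C(AddCircle (2 * Real.pi), ℂ))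
    (hp : p ∈ Submodule.span ℂ (range <| @fourier (2 * Real.pi))) :
    ∃ Q1 Q2 : ℂ → ℂ, Differentiable ℂ Q1 ∧ Differentiable ℂ Q2 ∧
      ∀ θ : ℝ, p (θ : AddCircle (2 * Real.pi)) = Q1 (r * Complex.exp (θ * Complex.I)) +
        conj (Q2 (r * Complex.exp (θ * Complex.I))) := by
  have hrc : (r:ℂ) ≠ 0 := by exact_mod_cast hr.ne'
  induction hp using Submodule.span_induction with
  | mem x hx =>
    obtain ⟨n, rfl⟩ := hx
    have hf : ∀ θ : ℝ, fourier n (θ : AddCircle (2 * Real.pi)) = Complex.exp (n * (θ * Complex.I)) := by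
      intro θ
      rw [fourier_coe_apply]
      congr 1
      have : (Real.pi : ℂ) ≠ 0 := by exact_mod_cast Real.pi_ne_zero
      push_cast
      field_simp
    obtain ⟨k, rfl | rfl⟩ := n.eq_nat_or_neg
    · refine ⟨fun z => (z / r) ^ k, 0, by fun_prop, differentiable_const 0, fun θ => ?_⟩
      rw [hf]
      simp [mul_div_cancel_left₀ _ hrc, ← Complex.exp_nat_mul]
    · refine ⟨0, fun z => (z / r) ^ k, differentiable_const 0, by fun_prop, fun θ => ?_⟩
      rw [hf]
      simp [mul_div_cancel_left₀ _ hrc, ← Complex.exp_nat_mul, ← Complex.exp_conj]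
  | zero => exact ⟨0, 0, differentiable_const 0, differentiable_const 0, fun θ => by simp⟩
  | add x y _ _ hx hy =>
    obtain ⟨A1, A2, a1, a2, a3⟩ := hx
    obtain ⟨B1, B2, b1, b2, b3⟩ := hy
    refine ⟨A1 + B1, A2 + B2, a1.add b1, a2.add b2, fun θ => ?_⟩
    simp [a3, b3]; ring
  | smul c x _ hx =>
    obtain ⟨A1, A2, a1, a2, a3⟩ := hx
    refine ⟨fun z => c * A1 z, fun z => conj c * A2 z, a1.const_mul c, a2.const_mul _, fun θ => ?_⟩
    simp [a3]; ring

lemma trig_approx {r : ℝ} (hr : 0 < r) {h : ℝ → ℝ} (hc : Continuous h) (hper : h 0 = h (2 * Real.pi))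
    {e : ℝ} (he : 0 < e) : ∃ Q : ℂ → ℂ, Differentiable ℂ Q ∧ ∀ θ ∈ Ico 0 (2 * Real.pi),
      |h θ - (Q (r * Complex.exp (θ * Complex.I))).re| < e := by
  have : Fact (0 < 2 * Real.pi) := ⟨by positivity⟩
  let G : C(AddCircle (2 * Real.pi), ℂ) :=
    ⟨AddCircle.liftIco (2 * Real.pi) 0 (fun θ => (h θ : ℂ)),
      AddCircle.liftIco_continuous (by simp [hper]) (Complex.continuous_ofReal.comp hc).continuousOn⟩
  have hG : G ∈ closure (Submodule.span ℂ (range <| @fourier (2 * Real.pi)) : Set C(AddCircle (2 * Real.pi), ℂ)) := by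
    rw [← Submodule.topologicalClosure_coe, span_fourier_closure_eq_top]; trivial
  obtain ⟨p, hp, hd⟩ := Metric.mem_closure_iff.1 hG e he
  obtain ⟨Q1, Q2, h1, h2, h3⟩ := trig_poly hr p hp
  refine ⟨Q1 + Q2, h1.add h2, fun θ hθ => ?_⟩
  have d1 := (ContinuousMap.dist_apply_le_dist (f := G) (g := p) (θ : AddCircle (2 * Real.pi))).trans_lt hd
  have d2 : G (θ : AddCircle (2 * Real.pi)) = (h θ : ℂ) :=
    AddCircle.liftIco_coe_apply (p := 2 * Real.pi) (a := 0) (f := fun θ : ℝ => (h θ : ℂ)) (x := θ) (by simpa using hθ)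
  rw [d2, h3, dist_eq_norm] at d1
  have := (Complex.abs_re_le_norm _).trans_lt d1
  simpa using this

lemma mean_re {r : ℝ} (hr : 0 < r) {Q : ℂ → ℂ} (hQ : Differentiable ℂ Q) :
    (Q 0).re = 1 / (2 * Real.pi) * ∫ θ in (0:ℝ)..(2 * Real.pi), (Q (r * Complex.exp (θ * Complex.I))).re := by
  have h := (hQ.diffContOnCl (s := Metric.ball (0:ℂ) |r|)).circleAverage
  have hcm : ∀ θ : ℝ, circleMap 0 r θ = r * Complex.exp (θ * Complex.I) := fun θ => by simp [circleMap]
  have hcont : Continuous (fun θ : ℝ => Q (circleMap 0 r θ)) := hQ.continuous.comp (continuous_circleMap 0 r)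
  have hi := hcont.intervalIntegrable (μ := volume) 0 (2 * Real.pi)
  have h2 := Complex.reCLM.intervalIntegral_comp_comm hi
  rw [Real.circleAverage_def] at h
  rw [← h, Complex.smul_re]
  simp only [Complex.reCLM_apply] at h2
  rw [← h2]
  simp [hcm]

lemma patch {g : ℝ → ℝ} (hg : Continuous g) {e : ℝ} (he : 0 < e) : ∃ h : ℝ → ℝ, Continuous h ∧
    h 0 = h (2 * Real.pi) ∧ (∀ θ ∈ Icc 0 (2 * Real.pi), g θ ≤ h θ) ∧
    ∫ θ in (0:ℝ)..(2 * Real.pi), h θ ≤ (∫ θ in (0:ℝ)..(2 * Real.pi), g θ) + e := by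
  have hp : 0 < 2 * Real.pi := by positivity
  generalize 2 * Real.pi = T at hp ⊢
  set d := g 0 - g T with hd
  set A := max d 0 with hA
  set B := max (-d) 0 with hB
  have hA0 : 0 ≤ A := le_max_right _ _
  have hB0 : 0 ≤ B := le_max_right _ _
  have hAB : A - B = d := by
    rcases le_total 0 d with h | h
    · rw [hA, hB, max_eq_left h, max_eq_right (by linarith)]; ring
    · rw [hA, hB, max_eq_right h, max_eq_left (by linarith)]; ring
  obtain ⟨N, hN⟩ := exists_nat_gt ((A + B) * T / e)
  have i1 : ∫ θ in (0:ℝ)..T, (θ / T) ^ (N+1) = T / (N + 2) := by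
    rw [intervalIntegral.integral_comp_div (fun x => x ^ (N+1)) hp.ne', integral_pow]
    simp [hp.ne']
    push_cast; field_simp; ring
  have i2 : ∫ θ in (0:ℝ)..T, (1 - θ / T) ^ (N+1) = T / (N + 2) := by
    rw [intervalIntegral.integral_comp_div (fun x => (1 - x) ^ (N+1)) hp.ne',
      intervalIntegral.integral_comp_sub_left (fun x => x ^ (N+1)), integral_pow]
    simp [hp.ne']
    push_cast; field_simp; ring
  refine ⟨fun θ => g θ + (A * (θ / T) ^ (N+1) + B * (1 - θ / T) ^ (N+1)), by fun_prop, ?_, ?_, ?_⟩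
  · simp [hp.ne']; linarith
  · intro θ hθ
    have a : 0 ≤ θ / T := div_nonneg hθ.1 hp.le
    have b : 0 ≤ 1 - θ / T := by
      have := (div_le_one hp).2 hθ.2
      linarith
    have : 0 ≤ A * (θ / T) ^ (N+1) + B * (1 - θ / T) ^ (N+1) := by positivity
    linarith
  · have c1 : Continuous (fun θ : ℝ => A * (θ / T) ^ (N+1)) := by fun_prop
    have c2 : Continuous (fun θ : ℝ => B * (1 - θ / T) ^ (N+1)) := by fun_prop
    have c3 : Continuous (fun θ : ℝ => A * (θ / T) ^ (N+1) + B * (1 - θ / T) ^ (N+1)) := by fun_prop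
    simp only []
    rw [intervalIntegral.integral_add (hg.intervalIntegrable _ _) (c3.intervalIntegrable _ _),
      intervalIntegral.integral_add (c1.intervalIntegrable _ _) (c2.intervalIntegrable _ _),
      intervalIntegral.integral_const_mul, intervalIntegral.integral_const_mul, i1, i2]
    have : A * (T / (N + 2)) + B * (T / (N + 2)) ≤ e := by
      rw [← add_mul, ← mul_div_assoc, div_le_iff₀ (by positivity)]
      rw [div_lt_iff₀ he] at hN
      nlinarith
    linarith

lemma sub_mean {r : ℝ} (hr : 0 < r) {L : ℂ → ℝ} (hL : UpperSemicontinuousOn L (Metric.closedBall 0 r))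
    (hloc : ∀ τ0 : ℂ, ‖τ0‖ < r → ∀ P : ℂ → ℂ, Differentiable ℂ P → P 0 = 0 → ∀ ε : ℝ, 0 < ε →
      ¬ ∀ᶠ s in 𝓝 (0:ℂ), L (τ0 + s) ≤ L τ0 + ((P s).re - ε * ‖s‖ ^ 2))
    {h : ℝ → ℝ} (hc : Continuous h) (hper : h 0 = h (2 * Real.pi))
    (hb : ∀ θ ∈ Ico 0 (2 * Real.pi), L (r * Complex.exp (θ * Complex.I)) ≤ h θ) :
    L 0 ≤ 1 / (2 * Real.pi) * ∫ θ in (0:ℝ)..(2 * Real.pi), h θ := by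
  refine le_of_forall_pos_le_add fun e he => ?_
  obtain ⟨Q, hQ, hQh⟩ := trig_approx hr hc hper (half_pos he)
  have hp : 0 < 2 * Real.pi := by positivity
  have h1 := max_aux hr hL hloc (Q := fun z => Q z + ((e / 2 : ℝ) : ℂ)) (hQ.add_const _) (by
    intro τ hτ
    obtain ⟨θ, hθ, rfl⟩ : ∃ θ ∈ Ico 0 (2 * Real.pi), τ = r * Complex.exp (θ * Complex.I) := by
      refine ⟨toIcoMod hp 0 τ.arg, by simpa using toIcoMod_mem_Ico hp 0 τ.arg, ?_⟩
      rw [← hτ, toIcoMod]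
      conv_lhs => rw [← Complex.norm_mul_exp_arg_mul_I τ]
      congr 1
      rw [Complex.exp_eq_exp_iff_exists_int]
      refine ⟨toIcoDiv hp 0 τ.arg, ?_⟩
      push_cast
      simp
      ring
    have a := hb θ hθ
    have b := (abs_lt.1 (hQh θ hθ)).2
    simp only [Complex.add_re, Complex.ofReal_re]
    linarith)
  simp only [Complex.add_re, Complex.ofReal_re] at h1
  rw [mean_re hr hQ] at h1
  have hcQ : Continuous (fun θ : ℝ => (Q (r * Complex.exp (θ * Complex.I))).re) := by
    have := hQ.continuous
    fun_prop
  have h2 : ∫ θ in (0:ℝ)..(2 * Real.pi), (Q (r * Complex.exp (θ * Complex.I))).re ≤ ∫ θ in (0:ℝ)..(2 * Real.pi), (h θ + e / 2) := by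
    refine intervalIntegral.integral_mono_on_of_le_Ioo hp.le (hcQ.intervalIntegrable _ _) ((hc.add continuous_const).intervalIntegrable _ _) ?_
    intro θ hθ
    have b := (abs_lt.1 (hQh θ ⟨hθ.1.le, hθ.2⟩)).1
    linarith
  rw [intervalIntegral.integral_add (hc.intervalIntegrable _ _) (continuous_const.intervalIntegrable _ _),
    intervalIntegral.integral_const, smul_eq_mul, sub_zero] at h2
  have h3 := mul_le_mul_of_nonneg_left h2 (by positivity : 0 ≤ 1 / (2 * Real.pi))
  have h4 : 1 / (2 * Real.pi) * ((∫ θ in (0:ℝ)..(2 * Real.pi), h θ) + 2 * Real.pi * (e / 2)) =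
    1 / (2 * Real.pi) * (∫ θ in (0:ℝ)..(2 * Real.pi), h θ) + e / 2 := by
    rw [mul_add]; congr 1; field_simp
  linarith

end MaxPrinciple

section Assembly
variable {m n : ℕ} {U : Set (Fin m → ℂ)} {Ω : Set (Fin n → ℂ)} {u η : (Fin n → ℂ) → ℝ}
  {φ : (Fin m → ℂ) × (Fin n → ℂ) → ℝ} {c δ : ℝ} {F : (Fin m → ℂ) → (Fin n → ℂ)}

lemma elog_le_iff {x : ℝ≥0∞} {b : ℝ} : elog x ≤ (b : EReal) ↔ x ≤ ENNReal.ofReal (Real.exp b) := by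
  unfold elog
  split_ifs with h0 h1
  · simp [h0]
  · simp [h1]
  · have : 0 < x.toReal := ENNReal.toReal_pos h0 h1
    rw [EReal.coe_le_coe_iff, Real.log_le_iff_le_exp this, ENNReal.le_ofReal_iff_toReal_le h1 (Real.exp_pos _).le]

lemma elog_lt_iff {x : ℝ≥0∞} {b : ℝ} : elog x < (b : EReal) ↔ x < ENNReal.ofReal (Real.exp b) := by
  unfold elog
  split_ifs with h0 h1
  · simp [h0, Real.exp_pos]
  · simp [h1]
  · have : 0 < x.toReal := ENNReal.toReal_pos h0 h1
    rw [EReal.coe_lt_coe_iff, Real.log_lt_iff_lt_exp this, ENNReal.lt_ofReal_iff_toReal_lt h1]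

lemma K_usc (E : Exh Ω u) (hφ : SmP U Ω φ) (hU : IsOpen U) (hF : DifferentiableOn ℂ F U)
    (hFΩ : ∀ t ∈ U, F t ∈ Ω) :
    UpperSemicontinuousOn (fun t => elog (bergKernel Ω (fun w => φ (t, w)) volume (F t))) U := by
  intro t0 ht y hy
  obtain ⟨b, hb1, hb2⟩ := EReal.lt_iff_exists_real_btwn.1 hy
  obtain ⟨c, hc, hk⟩ := kk_lim E hφ ht (hFΩ t0 ht) (elog_lt_iff.1 hb1)
  have hFc : ContinuousAt F t0 := (hF.differentiableAt (hU.mem_nhds ht)).continuousAt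
  have h1 := kk_usc E hφ hU ht hc hFc hk
  have hsb : ∀ᶠ t in 𝓝 t0, F t ∈ sbl Ω u c := hFc.eventually ((E.open_sbl c).mem_nhds hc)
  have hU' : ∀ᶠ t in 𝓝 t0, t ∈ U := hU.mem_nhds ht
  refine Filter.Eventually.filter_mono nhdsWithin_le_nhds ?_
  filter_upwards [h1, hsb, hU'] with t h1 h2 h3
  exact (elog_le_iff.2 ((kk_ge E hφ h3 h2).trans h1)).trans_lt hb2

lemma circle_choice (E : Exh Ω u) (hφ : SmP U Ω φ) (hU : IsOpen U) (hF : DifferentiableOn ℂ F U)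
    (hFΩ : ∀ t ∈ U, F t ∈ Ω) {a w : Fin m → ℂ} {r : ℝ} (hr : 0 < r)
    (hd : ∀ τ : ℂ, ‖τ‖ ≤ r → a + τ • w ∈ U) {h : ℝ → ℝ} (hc : Continuous h)
    (hb : ∀ θ ∈ Icc 0 (2 * Real.pi), bergKernel Ω (fun z => φ (a + ((r : ℂ) * Complex.exp (θ * Complex.I)) • w, z)) volume
      (F (a + ((r : ℂ) * Complex.exp (θ * Complex.I)) • w)) ≤ ENNReal.ofReal (Real.exp (h θ))) {e : ℝ} (he : 0 < e) :
    ∃ c, (∀ τ : ℂ, ‖τ‖ ≤ r → F (a + τ • w) ∈ sbl Ω u c) ∧ ∀ θ ∈ Icc 0 (2 * Real.pi),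
      kk Ω u φ F c (a + ((r : ℂ) * Complex.exp (θ * Complex.I)) • w) ≤ ENNReal.ofReal (Real.exp (h θ + e)) := by
  set ζ : ℝ → Fin m → ℂ := fun θ => a + ((r : ℂ) * Complex.exp (θ * Complex.I)) • w with hζ
  have hζc : Continuous ζ := by fun_prop
  have hζn : ∀ θ : ℝ, ‖(r : ℂ) * Complex.exp (θ * Complex.I)‖ ≤ r := fun θ => by
    rw [norm_mul, Complex.norm_exp_ofReal_mul_I, Complex.norm_real, Real.norm_of_nonneg hr.le, mul_one]
  have hζU : ∀ θ, ζ θ ∈ U := fun θ => hd _ (hζn θ)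
  obtain ⟨c0, hc0⟩ : ∃ c0, ∀ τ : ℂ, ‖τ‖ ≤ r → F (a + τ • w) ∈ sbl Ω u c0 := by
    have hcont : ContinuousOn (fun τ : ℂ => u (F (a + τ • w))) (Metric.closedBall 0 r) := by
      intro τ hτ
      have hτU := hd τ (by simpa using hτ)
      have a1 : ContinuousAt (fun τ : ℂ => a + τ • w) τ := by fun_prop
      have a2 : ContinuousAt (fun τ : ℂ => F (a + τ • w)) τ :=
        ContinuousAt.comp (f := fun τ : ℂ => a + τ • w) (g := F) (hF.differentiableAt (hU.mem_nhds hτU)).continuousAt a1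
      exact (ContinuousAt.comp (f := fun τ : ℂ => F (a + τ • w)) (g := u)
        (E.sm _ (hFΩ _ hτU)).continuousAt a2).continuousWithinAt
    obtain ⟨M, hM⟩ := (isCompact_closedBall (0:ℂ) r).exists_bound_of_continuousOn hcont
    refine ⟨M + 1, fun τ hτ => ⟨hFΩ _ (hd τ hτ), ?_⟩⟩
    have := (abs_le.1 (hM τ (by simpa using hτ))).2
    linarith
  have key : ∃ c, c0 ≤ c ∧ ∀ c', c ≤ c' → ∀ θ ∈ Icc 0 (2 * Real.pi), kk Ω u φ F c' (ζ θ) ≤ ENNReal.ofReal (Real.exp (h θ + e)) := by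
    refine isCompact_Icc.induction_on (p := fun s => ∃ c, c0 ≤ c ∧ ∀ c', c ≤ c' → ∀ θ ∈ s, kk Ω u φ F c' (ζ θ) ≤ ENNReal.ofReal (Real.exp (h θ + e))) ?_ ?_ ?_ ?_
    · exact ⟨c0, le_rfl, fun _ _ _ hx => absurd hx (by simp)⟩
    · rintro s t hst ⟨c, h1, h2⟩
      exact ⟨c, h1, fun c' hc' θ hθ => h2 c' hc' θ (hst hθ)⟩
    · rintro s t ⟨c, h1, h2⟩ ⟨c', h1', h2'⟩
      refine ⟨max c c', h1.trans (le_max_left _ _), fun c2 hc2 θ hθ => ?_⟩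
      rcases hθ with hθ | hθ
      · exact h2 c2 ((le_max_left _ _).trans hc2) θ hθ
      · exact h2' c2 ((le_max_right _ _).trans hc2) θ hθ
    · intro θ hθ
      have hlt : bergKernel Ω (fun z => φ (ζ θ, z)) volume (F (ζ θ)) < ENNReal.ofReal (Real.exp (h θ + e / 2)) :=
        (hb θ hθ).trans_lt ((ENNReal.ofReal_lt_ofReal_iff (Real.exp_pos _)).2 (Real.exp_lt_exp.2 (by linarith)))
      obtain ⟨c1, hc1, hk⟩ := kk_lim E hφ (hζU θ) (hFΩ _ (hζU θ)) hlt
      have hFc : ContinuousAt F (ζ θ) := (hF.differentiableAt (hU.mem_nhds (hζU θ))).continuousAt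
      have hk2 : kk Ω u φ F (max c0 c1) (ζ θ) < ENNReal.ofReal (Real.exp (h θ + e / 2)) :=
        (kk_anti E hφ (hζU θ) (le_max_right _ _) hc1).trans_lt hk
      have hm : ∀ θ, F (ζ θ) ∈ sbl Ω u (max c0 c1) := fun θ =>
        ⟨(hc0 _ (hζn θ)).1, (hc0 _ (hζn θ)).2.trans_le (le_max_left _ _)⟩
      have h1 := hζc.continuousAt.eventually (kk_usc E hφ hU (hζU θ) (hm θ) hFc hk2)
      have h2 : ∀ᶠ θ' in 𝓝 θ, h θ - e / 2 < h θ' := hc.continuousAt.eventually (Ioi_mem_nhds (by linarith))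
      refine ⟨_, mem_nhdsWithin_of_mem_nhds (h1.and h2), max c0 c1, le_max_left _ _, fun c' hc' θ' hθ' => ?_⟩
      refine (kk_anti E hφ (hζU θ') hc' (hm θ')).trans (hθ'.1.trans ?_)
      refine ENNReal.ofReal_le_ofReal (Real.exp_le_exp.2 ?_)
      have := hθ'.2
      linarith
  obtain ⟨c, hcc, hk⟩ := key
  exact ⟨c, fun τ hτ => ⟨(hc0 τ hτ).1, (hc0 τ hτ).2.trans_le hcc⟩, hk c le_rfl⟩

lemma K_mean (E : Exh Ω u) (hφ : SmP U Ω φ) (hη : SmR Ω η) (hU : IsOpen U) (hδ : 0 < δ)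
    (hXi : XiNonneg U Ω φ η δ) (hF : DifferentiableOn ℂ F U)
    (hFΩ : ∀ t ∈ U, F t ∈ Ω) {a w : Fin m → ℂ} {r : ℝ} (hr : 0 < r)
    (hd : ∀ τ : ℂ, ‖τ‖ ≤ r → a + τ • w ∈ U) {g : ℝ → ℝ} (hg : Continuous g)
    (hb : ∀ θ : ℝ, bergKernel Ω (fun z => φ (a + ((r : ℂ) * Complex.exp (θ * Complex.I)) • w, z)) volume
      (F (a + ((r : ℂ) * Complex.exp (θ * Complex.I)) • w)) ≤ ENNReal.ofReal (Real.exp (g θ))) :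
    bergKernel Ω (fun z => φ (a, z)) volume (F a) ≤
      ENNReal.ofReal (Real.exp (1 / (2 * Real.pi) * ∫ θ in (0:ℝ)..(2 * Real.pi), g θ)) := by
  have haU : a ∈ U := by simpa using hd 0 (by simpa using hr.le)
  have hp : 0 < 2 * Real.pi := by positivity
  suffices H : ∀ e : ℝ, 0 < e → bergKernel Ω (fun z => φ (a, z)) volume (F a) ≤
      ENNReal.ofReal (Real.exp ((1 / (2 * Real.pi) * ∫ θ in (0:ℝ)..(2 * Real.pi), g θ) + e)) by
    have hcont : Tendsto (fun e : ℝ => ENNReal.ofReal (Real.exp ((1 / (2 * Real.pi) * ∫ θ in (0:ℝ)..(2 * Real.pi), g θ) + e)))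
        (𝓝[>] 0) (𝓝 (ENNReal.ofReal (Real.exp ((1 / (2 * Real.pi) * ∫ θ in (0:ℝ)..(2 * Real.pi), g θ) + 0)))) := by
      refine Tendsto.mono_left ?_ nhdsWithin_le_nhds
      exact (ENNReal.continuous_ofReal.comp (Real.continuous_exp.comp (continuous_const.add continuous_id))).tendsto _
    rw [add_zero] at hcont
    refine ge_of_tendsto hcont ?_
    filter_upwards [self_mem_nhdsWithin] with e he using H e he
  intro e he
  obtain ⟨h, hhc, hper, hgh, hintg⟩ := patch hg (e := e / 2 * (2 * Real.pi)) (by positivity)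
  obtain ⟨c, hsb, hk⟩ := circle_choice E hφ hU hF hFΩ hr hd hhc (fun θ hθ => (hb θ).trans
    (ENNReal.ofReal_le_ofReal (Real.exp_le_exp.2 (hgh θ hθ)))) (half_pos he)
  set L : ℂ → ℝ := fun τ => Real.log (kk Ω u φ F c (a + τ • w)).toReal with hLdef
  have hL : ∀ τ : ℂ, ‖τ‖ ≤ r → kk Ω u φ F c (a + τ • w) = ENNReal.ofReal (Real.exp (L τ)) := by
    intro τ hτ
    have h0 := kk_pos E hφ (hd τ hτ) (hsb τ hτ)
    have h1 : kk Ω u φ F c (a + τ • w) ≠ ⊤ := ker_fin (E.open_sbl c) (Ph_cont E hφ (hd τ hτ) c) (hsb τ hτ)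
    rw [hLdef]
    simp only []
    rw [Real.exp_log (ENNReal.toReal_pos h0 h1), ENNReal.ofReal_toReal h1]
  have hle : ∀ τ : ℂ, ‖τ‖ ≤ r → ∀ y : ℝ, kk Ω u φ F c (a + τ • w) ≤ ENNReal.ofReal (Real.exp y) → L τ ≤ y := by
    intro τ hτ y hy
    rw [hL τ hτ, ENNReal.ofReal_le_ofReal_iff (Real.exp_pos _).le, Real.exp_le_exp] at hy
    exact hy
  have hLusc : UpperSemicontinuousOn L (Metric.closedBall 0 r) := by
    intro τ0 hτ0 y hy
    have hτ0' : ‖τ0‖ ≤ r := by simpa using hτ0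
    obtain ⟨b, hb1, hb2⟩ := exists_between hy
    have hFc : ContinuousAt F (a + τ0 • w) := (hF.differentiableAt (hU.mem_nhds (hd _ hτ0'))).continuousAt
    have h1 := kk_usc E hφ hU (hd _ hτ0') (hsb _ hτ0') hFc (Y := Real.exp b) (by
      rw [hL _ hτ0', ENNReal.ofReal_lt_ofReal_iff (Real.exp_pos _)]
      exact Real.exp_lt_exp.2 hb1)
    have a1 : ContinuousAt (fun τ : ℂ => a + τ • w) τ0 := by fun_prop
    have h2 := a1.eventually h1
    filter_upwards [self_mem_nhdsWithin, mem_nhdsWithin_of_mem_nhds h2] with τ hτ h3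
    exact (hle τ (by simpa using hτ) b h3).trans_lt hb2
  have hloc : ∀ τ0 : ℂ, ‖τ0‖ < r → ∀ P : ℂ → ℂ, Differentiable ℂ P → P 0 = 0 → ∀ ε : ℝ, 0 < ε →
      ¬ ∀ᶠ s in 𝓝 (0:ℂ), L (τ0 + s) ≤ L τ0 + ((P s).re - ε * ‖s‖ ^ 2) := by
    intro τ0 hτ0 P hP hP0 ε hε hev
    refine local_claim E hφ hη hU hδ hXi hF (hd _ hτ0.le) (hsb _ hτ0.le) w hP hP0 hε ?_
    have hev2 : ∀ᶠ s in 𝓝 (0:ℂ), ‖τ0 + s‖ < r := by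
      have : ContinuousAt (fun s : ℂ => ‖τ0 + s‖) 0 := by fun_prop
      exact this.eventually (Iio_mem_nhds (by simpa using hτ0))
    filter_upwards [hev, hev2] with s h1 h2
    rw [hL τ0 hτ0.le, show a + τ0 • w + s • w = a + (τ0 + s) • w by rw [add_smul, add_assoc], hL _ h2.le,
      ← ENNReal.ofReal_mul (Real.exp_pos _).le, ← Real.exp_add]
    exact ENNReal.ofReal_le_ofReal (Real.exp_le_exp.2 h1)
  have hζn : ∀ θ : ℝ, ‖(r : ℂ) * Complex.exp (θ * Complex.I)‖ ≤ r := fun θ => by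
    rw [norm_mul, Complex.norm_exp_ofReal_mul_I, Complex.norm_real, Real.norm_of_nonneg hr.le, mul_one]
  have hfin := sub_mean hr hLusc hloc (h := fun θ => h θ + e / 2) (hhc.add continuous_const) (by simp only [hper])
    (fun θ hθ => hle _ (hζn θ) _ (hk θ ⟨hθ.1, hθ.2.le⟩))
  rw [intervalIntegral.integral_add (hhc.intervalIntegrable _ _) (continuous_const.intervalIntegrable _ _),
    intervalIntegral.integral_const, smul_eq_mul, sub_zero] at hfin
  have h0r : ‖(0:ℂ)‖ ≤ r := by simpa using hr.le
  have hK := kk_ge E hφ haU (c := c) (by simpa using hsb 0 h0r)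
  have hL0 := hL 0 h0r
  rw [zero_smul, add_zero] at hL0
  rw [hL0] at hK
  refine hK.trans (ENNReal.ofReal_le_ofReal (Real.exp_le_exp.2 (hfin.trans ?_)))
  calc _ ≤ 1 / (2 * Real.pi) * (((∫ θ in (0:ℝ)..(2 * Real.pi), g θ) + e / 2 * (2 * Real.pi)) + 2 * Real.pi * (e / 2)) := by gcongr
    _ = _ := by field_simp; ring

end Assembly

/-- **Twisted log-plurisubharmonic variation of the Bergman kernel along a holomorphic
section**: if `Ξ_{δ,η}(e^{−φ}) ≥ 0` on `U × Ω` and `F : U → Ω` is holomorphic, then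
`t ↦ log K_t(F(t))` is plurisubharmonic or identically `−∞`. -/
theorem bergKernel_log_psh_along_section {m n : ℕ}
    (U : Set (Fin m → ℂ)) (hUo : IsOpen U) (hUc : IsConnected U)
    (Ω : Set (Fin n → ℂ)) (hΩ : Pseudoconvex Ω)
    (φ : (Fin m → ℂ) × (Fin n → ℂ) → ℝ) (hφ : ContDiffOn ℝ (⊤ : ℕ∞) φ (U ×ˢ Ω))
    (η : (Fin n → ℂ) → ℝ) (hη : ContDiffOn ℝ (⊤ : ℕ∞) η Ω)
    (δ : ℝ) (hδ : 0 < δ) (hXi : XiNonneg U Ω φ η δ) :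
    ∀ F : (Fin m → ℂ) → (Fin n → ℂ), DifferentiableOn ℂ F U → (∀ t ∈ U, F t ∈ Ω) →
      (∀ t ∈ U, bergKernel Ω (fun w => φ (t, w)) volume (F t) = 0) ∨
      PshOn U (fun t => elog (bergKernel Ω (fun w => φ (t, w)) volume (F t))) := by
  intro F hF hFΩ
  obtain ⟨hΩo, u, hu, hlevi, hcpt⟩ := hΩ
  have E : Exh Ω u := ⟨hΩo, fun x hx => hu.contDiffAt (hΩo.mem_nhds hx), fun x hx v => hlevi x hx v, hcpt⟩
  have hφ' : SmP U Ω φ := fun p hp => hφ.contDiffAt ((hUo.prod hΩo).mem_nhds hp)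
  have hη' : SmR Ω η := fun x hx => hη.contDiffAt (hΩo.mem_nhds hx)
  right
  refine ⟨K_usc E hφ' hUo hF hFΩ, fun a ha w r hr hd g hg hb => ?_⟩
  exact elog_le_iff.2 (K_mean E hφ' hη' hUo hδ hXi hF hFΩ hr hd hg fun θ => elog_le_iff.1 (hb θ))
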